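/- Let 1 ≤ a < b be fixed positive integers with gcd(a,b) = 1. Then for every real T > 10 and every real T₀ with 0 < T₀ ≤ T, one has ∫_T^{T+T₀} Δ_{a,b}(x)² dx = (a^{b/(a+b)} b^{a/(a+b)} / (2π²(a+b))) · G_{a,b} · ∫_T^{T+T₀} x^{1/(a+b)} dx + O( T^{1 + 1/(a+b) − a/(b(a+b)(a+b−1))} (log T)⁴ ), where the implied constant depends only on a and b. -/

import Mathlib

open Real MeasureTheory

/-- The lattice point counting function `D_{a,b}(x) = #{(h,r) ∈ ℤ⁺×ℤ⁺ : h^a r^b ≤ x}`. -/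
noncomputable def latticeCount (a b x : ℝ) : ℝ :=
  (Set.ncard {p : ℕ × ℕ | 0 < p.1 ∧ 0 < p.2 ∧ (p.1 : ℝ) ^ a * (p.2 : ℝ) ^ b ≤ x} : ℝ)

/-- The error term `Δ_{a,b}(x) = D_{a,b}(x) - ζ(b/a) x^{1/a} - ζ(a/b) x^{1/b}`. -/
noncomputable def DeltaErr (a b x : ℝ) : ℝ :=
  latticeCount a b x - (riemannZeta ((b / a : ℝ) : ℂ)).re * x ^ (1 / a)
    - (riemannZeta ((a / b : ℝ) : ℂ)).re * x ^ (1 / b)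

open Classical in
/-- The singular series `G_{a,b}`, summed over quadruples `(h₁, h₂, r₁, r₂)` of positive
integers with `h₁^a r₁^b = h₂^a r₂^b`. -/
noncomputable def Gab (a b : ℝ) : ℝ :=
  ∑' q : ℕ+ × ℕ+ × ℕ+ × ℕ+,
    if (q.1 : ℝ) ^ a * (q.2.2.1 : ℝ) ^ b = (q.2.1 : ℝ) ^ a * (q.2.2.2 : ℝ) ^ b then
      ((q.1 : ℝ) * (q.2.1 : ℝ)) ^ (-(a + 2 * b) / (2 * (a + b))) *
        ((q.2.2.1 : ℝ) * (q.2.2.2 : ℝ)) ^ (-(2 * a + b) / (2 * (a + b)))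
    else 0

namespace MSQ

/-- auxiliary Euler-Maclaurin term -/
noncomputable def zt (n : ℕ) (s : ℂ) : ℂ :=
  (1 - s) * ((n : ℂ) + 1) ^ (-s) - (((n : ℂ) + 2) ^ (1 - s) - ((n : ℂ) + 1) ^ (1 - s))

lemma zt_bound (n : ℕ) (s : ℂ) (hs : 0 < s.re) :
    ‖zt n s‖ ≤ ‖1 - s‖ * ‖s‖ * ((n : ℝ) + 1) ^ (-s.re - 1) := by
  have hn : (0 : ℝ) < (n : ℝ) + 1 := by positivity
  have hs0 : s ≠ 0 := by rintro rfl; simp at hs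
  have key : ∀ x ∈ Set.Icc ((n : ℝ) + 1) (n + 2),
      ‖(((n : ℝ) + 1 : ℝ) : ℂ) ^ (-s) - ((x : ℝ) : ℂ) ^ (-s)‖ ≤ ‖s‖ * ((n : ℝ) + 1) ^ (-s.re - 1) := by
    intro x hx
    have h := Convex.norm_image_sub_le_of_norm_hasDerivWithin_le (𝕜 := ℝ)
      (f := fun y : ℝ => (y : ℂ) ^ (-s)) (f' := fun y : ℝ => -s * (y : ℂ) ^ (-s - 1))
      (s := Set.Icc ((n : ℝ) + 1) (n + 2)) (x := x) (y := (n : ℝ) + 1)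
      (C := ‖s‖ * ((n : ℝ) + 1) ^ (-s.re - 1)) ?_ ?_ (convex_Icc _ _) hx ⟨le_rfl, by linarith⟩
    · refine h.trans ?_
      have : ‖(n : ℝ) + 1 - x‖ ≤ 1 := by
        rw [Real.norm_eq_abs, abs_le]; constructor <;> linarith [hx.1, hx.2]
      calc _ ≤ ‖s‖ * ((n : ℝ) + 1) ^ (-s.re - 1) * 1 := by gcongr
        _ = _ := mul_one _
    · intro y hy
      have hy0 : y ≠ 0 := by linarith [hy.1] |> ne_of_gt
      have h3 := hasDerivAt_ofReal_cpow_const (x := y) hy0 (r := -s) (by simpa using hs0)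
      exact h3.hasDerivWithinAt
    · intro y hy
      have hy0 : 0 < y := by linarith [hy.1]
      rw [norm_mul, norm_neg, Complex.norm_cpow_eq_rpow_re_of_pos hy0]
      gcongr ‖s‖ * ?_
      simp only [Complex.sub_re, Complex.neg_re, Complex.one_re]
      exact rpow_le_rpow_of_nonpos hn hy.1 (by linarith)
  by_cases hs1 : s = 1
  · subst hs1; simp [zt]
  have h := Convex.norm_image_sub_le_of_norm_hasDerivWithin_le (𝕜 := ℝ)
      (f := fun y : ℝ => (1 - s) * (y : ℂ) * (((n : ℝ) + 1 : ℝ) : ℂ) ^ (-s) - (y : ℂ) ^ (1 - s))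
      (f' := fun y : ℝ => (1 - s) * ((((n : ℝ) + 1 : ℝ) : ℂ) ^ (-s) - (y : ℂ) ^ (-s)))
      (s := Set.Icc ((n : ℝ) + 1) (n + 2)) (x := (n : ℝ) + 1) (y := (n : ℝ) + 2)
      (C := ‖1 - s‖ * (‖s‖ * ((n : ℝ) + 1) ^ (-s.re - 1))) ?_ ?_ (convex_Icc _ _)
      ⟨le_rfl, by linarith⟩ ⟨by linarith, le_rfl⟩
  · have e1 : ‖(n : ℝ) + 2 - ((n : ℝ) + 1)‖ = 1 := by
      have : (n : ℝ) + 2 - ((n : ℝ) + 1) = 1 := by ring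
      rw [this]; simp
    rw [e1, mul_one, ← mul_assoc] at h
    refine le_trans (le_of_eq ?_) h
    congr 1
    simp only [zt]
    push_cast
    ring
  · intro y hy
    have hy0 : y ≠ 0 := by linarith [hy.1] |> ne_of_gt
    have h3 := hasDerivAt_ofReal_cpow_const (x := y) hy0 (r := 1 - s) (by
        intro h; apply hs1; linear_combination -h)
    have e0 : 1 - s - 1 = -s := by ring
    rw [e0] at h3
    have h4 : HasDerivAt (fun y : ℝ => (1 - s) * (y : ℂ) * (((n : ℝ) + 1 : ℝ) : ℂ) ^ (-s))
        ((1 - s) * (((n : ℝ) + 1 : ℝ) : ℂ) ^ (-s)) y := by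
      have := ((Complex.ofRealCLM.hasDerivAt (x := y)).const_mul (1 - s)).mul_const
        ((((n : ℝ) + 1 : ℝ) : ℂ) ^ (-s))
      simpa using this
    have := (h4.sub h3).hasDerivWithinAt (s := Set.Icc ((n : ℝ) + 1) (n + 2))
    show HasDerivWithinAt _ ((1 - s) * (_ - _)) _ _
    rw [mul_sub]
    exact this
  · intro y hy
    rw [norm_mul]
    gcongr
    exact key y hy

lemma zt_sum (N : ℕ) (s : ℂ) : ∑ n ∈ Finset.range N, zt n s =
    (1 - s) * ∑ n ∈ Finset.range N, ((n : ℂ) + 1) ^ (-s) - (((N : ℂ) + 1) ^ (1 - s) - 1) := by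
  induction N with
  | zero => simp
  | succ k ih =>
    rw [Finset.sum_range_succ, ih, Finset.sum_range_succ, zt]
    push_cast
    have : (k : ℂ) + 1 + 1 = k + 2 := by ring
    rw [this]; ring


lemma zeta_eq_zt {s₀ : ℝ} (hs : 0 < s₀) :
    riemannZeta₁ (s₀ : ℂ) = 1 - ∑' n, zt n (s₀ : ℂ) := by
  set σ := min s₀ 1 / 2 with hσ
  have hσ0 : 0 < σ := by positivity
  have hσ1 : σ < 1 := by have := min_le_right s₀ 1; rw [hσ]; linarith
  have hσ2 : σ < s₀ := by have := min_le_left s₀ 1; rw [hσ]; linarith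
  set U : Set ℂ := {s : ℂ | σ < s.re} ∩ Metric.ball 0 (s₀ + 3) with hU
  have hUo : IsOpen U := (isOpen_lt continuous_const Complex.continuous_re).inter Metric.isOpen_ball
  have hUc : IsPreconnected U :=
    ((convex_halfSpace_re_gt σ).inter (convex_ball 0 (s₀ + 3))).isPreconnected
  have hsum : Summable fun n : ℕ => (s₀ + 4) * (s₀ + 3) * ((n : ℝ) + 1) ^ (-σ - 1) := by
    apply Summable.mul_left
    have : Summable fun n : ℕ => (n : ℝ) ^ (-σ - 1) := Real.summable_nat_rpow.2 (by linarith)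
    have h2 := (summable_nat_add_iff 1).2 this
    simpa using h2
  have hbd : ∀ (n : ℕ) (s : ℂ), s ∈ U → ‖zt n s‖ ≤ (s₀ + 4) * (s₀ + 3) * ((n : ℝ) + 1) ^ (-σ - 1) := by
    intro n s hs'
    have h1 : σ < s.re := hs'.1
    have h2 : ‖s‖ < s₀ + 3 := by simpa using hs'.2
    refine (zt_bound n s (hσ0.trans h1)).trans ?_
    have h3 : ‖1 - s‖ ≤ s₀ + 4 := by
      refine (norm_sub_le _ _).trans ?_
      simp only [norm_one]; linarith
    have h4 : ((n : ℝ) + 1) ^ (-s.re - 1) ≤ ((n : ℝ) + 1) ^ (-σ - 1) :=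
      rpow_le_rpow_of_exponent_le (by linarith [(Nat.cast_nonneg n : (0 : ℝ) ≤ n)]) (by linarith)
    gcongr
  have hd : DifferentiableOn ℂ (fun s => ∑' n, zt n s) U := by
    refine Complex.differentiableOn_tsum_of_summable_norm hsum ?_ hUo hbd
    intro n
    have h1 : ((n : ℂ) + 1) ≠ 0 := by exact_mod_cast Nat.succ_ne_zero n
    have h2 : ((n : ℂ) + 2) ≠ 0 := by exact_mod_cast (by omega : n + 2 ≠ 0)
    unfold zt
    apply Differentiable.differentiableOn
    have e1 : Differentiable ℂ fun s : ℂ => ((n : ℂ) + 1) ^ (-s) :=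
      (differentiable_id.neg).const_cpow (Or.inl h1)
    have e2 : Differentiable ℂ fun s : ℂ => ((n : ℂ) + 2) ^ (1 - s) :=
      ((differentiable_const 1).sub differentiable_id).const_cpow (Or.inl h2)
    have e3 : Differentiable ℂ fun s : ℂ => ((n : ℂ) + 1) ^ (1 - s) :=
      ((differentiable_const 1).sub differentiable_id).const_cpow (Or.inl h1)
    exact (((differentiable_const 1).sub differentiable_id).mul e1).sub (e2.sub e3)
  have hA1 : AnalyticOnNhd ℂ riemannZeta₁ U :=
    differentiable_riemannZeta₁.differentiableOn.analyticOnNhd hUo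
  have hA2 : AnalyticOnNhd ℂ (fun s => 1 - ∑' n, zt n s) U :=
    ((differentiableOn_const 1).sub hd).analyticOnNhd hUo
  have h2U : (2 : ℂ) ∈ U := by
    refine ⟨?_, ?_⟩
    · show σ < (2 : ℂ).re; simp; linarith
    · simp; linarith
  have hev : riemannZeta₁ =ᶠ[nhds (2 : ℂ)] (fun s => 1 - ∑' n, zt n s) := by
    have hV : ({s : ℂ | 1 < s.re} ∩ U) ∈ nhds (2 : ℂ) := by
      apply IsOpen.mem_nhds
      · exact (isOpen_lt continuous_const Complex.continuous_re).inter hUo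
      · exact ⟨by simp, h2U⟩
    filter_upwards [hV] with s hs'
    have hs1 : 1 < s.re := hs'.1
    have hne : s ≠ 1 := by rintro rfl; simp at hs1
    have hz : riemannZeta₁ s = (s - 1) * riemannZeta s := by
      rw [riemannZeta_eq_inv_sub_mul hne, ← mul_assoc, mul_inv_cancel₀ (sub_ne_zero.2 hne), one_mul]
    have hS : HasSum (fun n : ℕ => zt n s) (∑' n, zt n s) :=
      (Summable.of_norm_bounded hsum fun n => hbd n s hs'.2).hasSum
    have t1 := hS.tendsto_sum_nat
    have hzs : Summable fun n : ℕ => ((n : ℂ) + 1) ^ (-s) := by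
      have := (summable_nat_add_iff 1).2 (Complex.summable_one_div_nat_cpow.2 hs1)
      refine this.congr ?_
      intro n
      rw [Complex.cpow_neg]; push_cast; simp
    have t2 : Filter.Tendsto (fun N : ℕ => ∑ n ∈ Finset.range N, zt n s) Filter.atTop
        (nhds ((1 - s) * riemannZeta s - (0 - 1))) := by
      simp_rw [zt_sum]
      have hzz : HasSum (fun n : ℕ => ((n : ℂ) + 1) ^ (-s)) (riemannZeta s) := by
        rw [zeta_eq_tsum_one_div_nat_add_one_cpow hs1]
        convert hzs.hasSum using 1
        apply tsum_congr; intro n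
        rw [Complex.cpow_neg]; simp
      refine (hzz.tendsto_sum_nat.const_mul _).sub (Filter.Tendsto.sub ?_ tendsto_const_nhds)
      rw [tendsto_zero_iff_norm_tendsto_zero]
      have : ∀ N : ℕ, ‖((N : ℂ) + 1) ^ (1 - s)‖ = ((N : ℝ) + 1) ^ (-(s.re - 1)) := by
        intro N
        have : ((N : ℂ) + 1) = (((N : ℝ) + 1 : ℝ) : ℂ) := by push_cast; rfl
        rw [this, Complex.norm_cpow_eq_rpow_re_of_pos (by positivity)]
        simp
      simp_rw [this]
      exact (tendsto_rpow_neg_atTop (by linarith : 0 < s.re - 1)).comp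
        (Filter.tendsto_atTop_add_const_right _ _ tendsto_natCast_atTop_atTop)
    have := tendsto_nhds_unique t1 t2
    rw [hz, this]; ring
  have := hA1.eqOn_of_preconnected_of_eventuallyEq hA2 hUc h2U hev
  apply this
  refine ⟨?_, ?_⟩
  · show σ < ((s₀ : ℂ)).re; simpa using hσ2
  · simp only [Metric.mem_ball, dist_zero_right, Complex.norm_real, Real.norm_eq_abs, abs_of_pos hs]
    linarith

lemma zeta_tendsto {s : ℝ} (hs : 0 < s) (hs1 : s ≠ 1) :
    Filter.Tendsto (fun N : ℕ => ∑ n ∈ Finset.range N, ((n : ℝ) + 1) ^ (-s)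
      - ((N : ℝ) + 1) ^ (1 - s) / (1 - s)) Filter.atTop (nhds (riemannZeta (s : ℂ)).re) := by
  have hne : (s : ℂ) ≠ 1 := by exact_mod_cast hs1
  have hne' : 1 - s ≠ 0 := sub_ne_zero.2 (Ne.symm hs1)
  have hS : Summable fun n : ℕ => zt n (s : ℂ) := by
    have h0 : Summable fun n : ℕ => ‖1 - (s : ℂ)‖ * ‖(s : ℂ)‖ * ((n : ℝ) + 1) ^ (-(s : ℂ).re - 1) := by
      apply Summable.mul_left
      have : Summable fun n : ℕ => (n : ℝ) ^ (-s - 1) := Real.summable_nat_rpow.2 (by linarith)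
      have h2 := (summable_nat_add_iff 1).2 this
      simpa using h2
    exact Summable.of_norm_bounded h0 fun n => zt_bound n s (by simpa using hs)
  have t1 := hS.hasSum.tendsto_sum_nat
  have e1 : ∑' n, zt n (s : ℂ) = 1 + (1 - (s : ℂ)) * riemannZeta (s : ℂ) := by
    have h1 := zeta_eq_zt hs
    rw [riemannZeta_eq_inv_sub_mul hne, h1]
    have : (s : ℂ) - 1 ≠ 0 := sub_ne_zero.2 hne
    field_simp; ring
  rw [e1] at t1
  have t2 := (Complex.continuous_re.tendsto _).comp t1
  have e2 : ∀ N : ℕ, (∑ n ∈ Finset.range N, zt n (s : ℂ)).re =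
      (1 - s) * ∑ n ∈ Finset.range N, ((n : ℝ) + 1) ^ (-s) - (((N : ℝ) + 1) ^ (1 - s) - 1) := by
    intro N
    rw [zt_sum]
    have : (1 - (s : ℂ)) * ∑ n ∈ Finset.range N, ((n : ℂ) + 1) ^ (-(s : ℂ)) - (((N : ℂ) + 1) ^ (1 - (s : ℂ)) - 1)
      = (((1 - s) * ∑ n ∈ Finset.range N, ((n : ℝ) + 1) ^ (-s) - (((N : ℝ) + 1) ^ (1 - s) - 1) : ℝ) : ℂ) := by
      push_cast
      congr 1
      · congr 1
        apply Finset.sum_congr rfl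
        intro n _
        rw [Complex.ofReal_cpow (by positivity)]; push_cast; rfl
      · rw [Complex.ofReal_cpow (by positivity)]; push_cast; rfl
    rw [this, Complex.ofReal_re]
  have t3 := (t2.sub_const 1).div_const (1 - s)
  have e3 : ((1 + (1 - (s : ℂ)) * riemannZeta (s : ℂ)).re - 1) / (1 - s) = (riemannZeta (s : ℂ)).re := by
    simp
    field_simp
  rw [e3] at t3
  refine t3.congr ?_
  intro N
  simp only [Function.comp, e2]
  field_simp
  ring

end MSQ

namespace MSQ

/-- sawtooth -/
noncomputable def saw (u : ℝ) : ℝ := Int.fract u - 1 / 2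

noncomputable def emP (s c : ℝ) (N : ℕ) (y : ℝ) : ℝ :=
  ∑ n ∈ Finset.range N, ((n : ℝ) + 1) ^ (-s) - y ^ (1 - s) / (1 - s) + (y - N - 1 / 2) * y ^ (-s)
    + s / 2 * ((y - N - 1 / 2) ^ 2 - c) * y ^ (-s - 1)

lemma emP_deriv {s : ℝ} (hs1 : s ≠ 1) (c : ℝ) (N : ℕ) {y : ℝ} (hy : 0 < y) :
    HasDerivAt (emP s c N) (-(s * (s + 1) / 2) * ((y - N - 1 / 2) ^ 2 - c) * y ^ (-s - 2)) y := by
  have h1 : 1 - s ≠ 0 := sub_ne_zero.2 (Ne.symm hs1)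
  have d1 := (Real.hasDerivAt_rpow_const (x := y) (p := 1 - s) (Or.inl hy.ne')).div_const (1 - s)
  have d2 := Real.hasDerivAt_rpow_const (x := y) (p := - s) (Or.inl hy.ne')
  have d3 := Real.hasDerivAt_rpow_const (x := y) (p := - s - 1) (Or.inl hy.ne')
  have d4 : HasDerivAt (fun y : ℝ => y - N - 1 / 2) 1 y := ((hasDerivAt_id y).sub_const _).sub_const _
  have d5 := ((d4.pow 2).sub_const c).const_mul (s / 2)
  have := (((hasDerivAt_const y (∑ n ∈ Finset.range N, ((n : ℝ) + 1) ^ (-s))).sub d1).add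
    (d4.mul d2)).add (d5.mul d3)
  have e1 : y ^ (-s) = y ^ (-s - 2) * y ^ 2 := by
    rw [← rpow_natCast, ← rpow_add hy]; congr 1; push_cast; ring
  have e2 : y ^ (-s - 1) = y ^ (-s - 2) * y := by
    nth_rewrite 3 [← rpow_one y]; rw [← rpow_add hy]; congr 1; ring
  refine HasDerivAt.congr_deriv this ?_
  have e3 : (1 : ℝ) - s - 1 = -s := by ring
  have e4 : -s - 1 - 1 = -s - 2 := by ring
  rw [e3, e4, e1, e2]
  simp only [Pi.pow_apply]
  field_simp
  push_cast
  ring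

lemma emP_step (s : ℝ) (c : ℝ) (N : ℕ) : emP s c N (N + 1) = emP s c (N + 1) (N + 1) := by
  unfold emP
  rw [Finset.sum_range_succ]
  push_cast
  ring

lemma emP_tendsto {s : ℝ} (hs : 0 < s) (hs1 : s ≠ 1) (c : ℝ) :
    Filter.Tendsto (fun N : ℕ => emP s c N ((N : ℝ) + 1)) Filter.atTop
      (nhds (riemannZeta (s : ℂ)).re) := by
  have h0 := zeta_tendsto hs hs1
  have hN : Filter.Tendsto (fun N : ℕ => (N : ℝ) + 1) Filter.atTop Filter.atTop :=
    Filter.tendsto_atTop_add_const_right _ _ tendsto_natCast_atTop_atTop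
  have h1 := ((tendsto_rpow_neg_atTop hs).comp hN).const_mul (1 / 2)
  have h2 := ((tendsto_rpow_neg_atTop (by linarith : 0 < s + 1)).comp hN).const_mul (s / 2 * ((1 / 2) ^ 2 - c))
  have := (h0.add h1).add h2
  simp only [mul_zero, add_zero] at this
  refine this.congr ?_
  intro N
  unfold emP
  simp only [Function.comp]
  have : -s - 1 = -(s + 1) := by ring
  rw [this]
  ring

lemma em_bound {s : ℝ} (hs : 0 < s) (hs1 : s ≠ 1) {y : ℝ} (hy : 0 < y) :
    |∑ n ∈ Finset.range ⌊y⌋₊, ((n : ℝ) + 1) ^ (-s) - (riemannZeta (s : ℂ)).re - y ^ (1 - s) / (1 - s)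
      + saw y * y ^ (-s)| ≤ s * y ^ (-s - 1) := by
  set N := ⌊y⌋₊ with hN
  have hNy : (N : ℝ) ≤ y := Nat.floor_le hy.le
  have hyN : y < N + 1 := Nat.lt_floor_add_one y
  have hsaw : saw y = y - N - 1 / 2 := by
    unfold saw
    rw [Int.fract, ← natCast_floor_eq_intCast_floor hy.le]
  have hanti : ∀ M : ℕ, AntitoneOn (emP s 0 M) (Set.Ioi 0) := by
    intro M
    refine antitoneOn_of_deriv_nonpos (convex_Ioi 0) ?_ ?_ ?_
    · intro x hx; exact (emP_deriv hs1 0 M hx).continuousAt.continuousWithinAt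
    · intro x hx; rw [interior_Ioi] at hx
      exact (emP_deriv hs1 0 M hx).differentiableAt.differentiableWithinAt
    · intro x hx; rw [interior_Ioi] at hx
      have hx : 0 < x := hx
      rw [(emP_deriv hs1 0 M hx).deriv]
      have : 0 ≤ (s * (s + 1) / 2) * ((x - M - 1 / 2) ^ 2 - 0) * x ^ (-s - 2) := by
        simp only [sub_zero]; positivity
      linarith
  have hmono : ∀ M : ℕ, MonotoneOn (emP s (1 / 4) M) (Set.Icc (M : ℝ) (M + 1) ∩ Set.Ioi 0) := by
    intro M
    refine monotoneOn_of_deriv_nonneg ((convex_Icc _ _).inter (convex_Ioi 0)) ?_ ?_ ?_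
    · intro x hx; exact (emP_deriv hs1 _ M hx.2).continuousAt.continuousWithinAt
    · intro x hx; have hx := interior_subset hx
      exact (emP_deriv hs1 _ M hx.2).differentiableAt.differentiableWithinAt
    · intro x hx; have hx := interior_subset hx
      rw [(emP_deriv hs1 _ M hx.2).deriv]
      have hx0 : 0 < x := hx.2
      have h1 : 0 ≤ 1 / 4 - (x - M - 1 / 2) ^ 2 := by nlinarith [hx.1.1, hx.1.2]
      have : 0 ≤ (s * (s + 1) / 2) * (1 / 4 - (x - M - 1 / 2) ^ 2) * x ^ (-s - 2) := by
        positivity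
      linarith
  have hA : Antitone (fun M : ℕ => emP s 0 M ((M : ℝ) + 1)) := by
    refine antitone_nat_of_succ_le ?_
    intro M
    rw [emP_step s 0 M]
    push_cast
    refine hanti (M + 1) ?_ ?_ (by linarith)
    · show (0 : ℝ) < M + 1; positivity
    · show (0 : ℝ) < M + 1 + 1; positivity
  have hB : Monotone (fun M : ℕ => emP s (1 / 4) M ((M : ℝ) + 1)) := by
    refine monotone_nat_of_le_succ ?_
    intro M
    rw [emP_step s _ M]
    push_cast
    refine hmono (M + 1) ⟨⟨?_, ?_⟩, ?_⟩ ⟨⟨?_, ?_⟩, ?_⟩ (by linarith)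
    · push_cast; linarith
    · push_cast; linarith
    · show (0 : ℝ) < M + 1; positivity
    · push_cast; linarith
    · push_cast; linarith
    · show (0 : ℝ) < M + 1 + 1; positivity
  have u1 := hA.le_of_tendsto (emP_tendsto hs hs1 0) N
  have u2 := hB.ge_of_tendsto (emP_tendsto hs hs1 (1 / 4)) N
  have hN1 : (0 : ℝ) < N + 1 := by positivity
  have v1 := hanti N (show y ∈ Set.Ioi 0 from hy) (show (N : ℝ) + 1 ∈ Set.Ioi 0 from hN1) hyN.le
  have v2 := hmono N ⟨⟨hNy, hyN.le⟩, hy⟩ ⟨⟨by linarith, le_rfl⟩, hN1⟩ hyN.le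
  have w1 := u1.trans v1
  have w2 := v2.trans u2
  simp only [emP] at w1 w2
  rw [hsaw]
  have hp : 0 < y ^ (-s - 1) := by positivity
  have hsp : 0 < s * y ^ (-s - 1) := by positivity
  have hq : (y - N - 1 / 2) ^ 2 ≤ 1 / 4 := by nlinarith
  have x1 : s / 2 * ((y - ↑N - 1 / 2) ^ 2 - 0) * y ^ (-s - 1) ≤ s * y ^ (-s - 1) := by
    have : s / 2 * ((y - ↑N - 1 / 2) ^ 2 - 0) * y ^ (-s - 1) = (s * y ^ (-s - 1)) * ((y - N - 1 / 2) ^ 2 / 2) := by ring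
    rw [this]; nlinarith
  have x2 : - (s * y ^ (-s - 1)) ≤ s / 2 * ((y - ↑N - 1 / 2) ^ 2 - 1 / 4) * y ^ (-s - 1) := by
    have : s / 2 * ((y - ↑N - 1 / 2) ^ 2 - 1 / 4) * y ^ (-s - 1) = (s * y ^ (-s - 1)) * (((y - N - 1 / 2) ^ 2 - 1 / 4) / 2) := by ring
    rw [this]; nlinarith [sq_nonneg (y - N - 1 / 2)]
  rw [abs_le]
  constructor <;> linarith
end MSQ

namespace MSQ

lemma cnt_floor {X : ℝ} {M : ℕ} (hM : ⌊X⌋₊ ≤ M) (f : ℕ → ℝ) :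
    ∑ n ∈ Finset.range M, (if (n : ℝ) + 1 ≤ X then f n else 0) = ∑ n ∈ Finset.range ⌊X⌋₊, f n := by
  rw [← Finset.sum_filter]
  apply Finset.sum_congr _ (fun _ _ => rfl)
  ext n
  simp only [Finset.mem_filter, Finset.mem_range]
  have : (n : ℝ) + 1 ≤ X ↔ n < ⌊X⌋₊ := by
    rw [← Nat.succ_le_iff, Nat.le_floor_iff' (Nat.succ_ne_zero n)]; push_cast; rfl
  rw [this]; omega

lemma floor_saw {X : ℝ} (hX : 0 ≤ X) : (⌊X⌋₊ : ℝ) = X - 1 / 2 - saw X := by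
  unfold saw
  rw [Int.fract, ← natCast_floor_eq_intCast_floor hX]; ring

noncomputable def Xf (θ t r : ℝ) : ℝ := t ^ (1 + θ) * r ^ (-θ)

lemma Xf_pos {θ t r : ℝ} (ht : 0 < t) (hr : 0 < r) : 0 < Xf θ t r := by unfold Xf; positivity

lemma Xf_le_iff {α β t h r : ℝ} (hα : 0 < α) (ht : 0 < t) (hh : 0 < h) (hr : 0 < r) :
    h ^ α * r ^ β ≤ t ^ (α + β) ↔ h ≤ Xf (β / α) t r := by
  have e : Xf (β / α) t r ^ α = t ^ (α + β) * r ^ (-β) := by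
    unfold Xf
    rw [mul_rpow (by positivity) (by positivity), ← rpow_mul ht.le, ← rpow_mul hr.le]
    congr 2 <;> field_simp
  rw [← rpow_le_rpow_iff hh.le (Xf_pos ht hr).le hα, e, rpow_neg hr.le, ← div_eq_mul_inv,
    le_div_iff₀ (by positivity)]

lemma Xf_le {θ t r : ℝ} (hθ : 0 < θ) (ht : 0 < t) (hr : 1 ≤ r) : Xf θ t r ≤ t ^ (1 + θ) := by
  unfold Xf
  have : r ^ (-θ) ≤ 1 := rpow_le_one_of_one_le_of_nonpos hr (by linarith)
  have h2 : 0 < t ^ (1 + θ) := by positivity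
  nlinarith

lemma lattice_sum {α β t : ℝ} (hα : 0 < α) (hβ : 0 < β) (ht : 0 < t) {M : ℕ}
    (hM1 : t ^ (1 + β / α) ≤ M) (hM2 : t ^ (1 + α / β) ≤ M) :
    latticeCount α β (t ^ (α + β)) = ∑ n ∈ Finset.range M, ∑ k ∈ Finset.range M,
      if ((n : ℝ) + 1) ^ α * ((k : ℝ) + 1) ^ β ≤ t ^ (α + β) then 1 else 0 := by
  classical
  unfold latticeCount
  have hset : {p : ℕ × ℕ | 0 < p.1 ∧ 0 < p.2 ∧ (p.1 : ℝ) ^ α * (p.2 : ℝ) ^ β ≤ t ^ (α + β)} =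
    (((Finset.range M ×ˢ Finset.range M).filter (fun p : ℕ × ℕ => ((p.1 : ℝ) + 1) ^ α * ((p.2 : ℝ) + 1) ^ β ≤ t ^ (α + β))).image
      (fun p : ℕ × ℕ => (p.1 + 1, p.2 + 1)) : Finset (ℕ × ℕ)) := by
    ext ⟨h, r⟩
    simp only [Set.mem_ofPred_eq, Finset.coe_image, Set.mem_image, Finset.mem_coe, Finset.mem_filter,
      Finset.mem_product, Finset.mem_range, Prod.exists, Prod.mk.injEq]
    constructor
    · rintro ⟨h0, r0, hle⟩
      have hh : (1 : ℝ) ≤ h := by exact_mod_cast h0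
      have hr : (1 : ℝ) ≤ r := by exact_mod_cast r0
      have l1 := ((Xf_le_iff hα ht (by linarith) (by linarith)).1 hle).trans
        ((Xf_le (by positivity) ht hr).trans hM1)
      have hle' : (r : ℝ) ^ β * (h : ℝ) ^ α ≤ t ^ (β + α) := by rw [mul_comm, add_comm]; exact hle
      have l2 := ((Xf_le_iff hβ ht (by linarith) (by linarith)).1 hle').trans
        ((Xf_le (by positivity) ht hh).trans hM2)
      have l1 : h ≤ M := by exact_mod_cast l1
      have l2 : r ≤ M := by exact_mod_cast l2
      refine ⟨h - 1, r - 1, ⟨⟨by omega, by omega⟩, ?_⟩, by omega, by omega⟩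
      rw [Nat.cast_sub (by omega), Nat.cast_sub (by omega)]
      simpa using hle
    · rintro ⟨h', r', ⟨⟨_, _⟩, hle⟩, rfl, rfl⟩
      refine ⟨by omega, by omega, ?_⟩
      push_cast; exact hle
  rw [hset, Set.ncard_coe_finset, Finset.card_image_of_injective, Finset.card_filter, Finset.sum_product]
  · push_cast; rfl
  · rintro ⟨a, b⟩ ⟨c, d⟩ h
    simp only [Prod.mk.injEq] at h ⊢; omega

lemma hyperbola {α β t y z : ℝ} (hα : 0 < α) (hβ : 0 < β) (ht : 0 < t) (hy : 0 < y) (hz : 0 < z)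
    (hyz : z ^ α * y ^ β = t ^ (α + β)) :
    latticeCount α β (t ^ (α + β)) = ∑ k ∈ Finset.range ⌊y⌋₊, (⌊Xf (β / α) t (k + 1)⌋₊ : ℝ)
      + ∑ n ∈ Finset.range ⌊z⌋₊, (⌊Xf (α / β) t (n + 1)⌋₊ : ℝ) - (⌊y⌋₊ : ℝ) * ⌊z⌋₊ := by
  obtain ⟨M, hM⟩ := exists_nat_ge (t ^ (1 + β / α) + t ^ (1 + α / β) + y + z)
  have p1 : 0 < t ^ (1 + β / α) := by positivity
  have p2 : 0 < t ^ (1 + α / β) := by positivity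
  have hM1 : t ^ (1 + β / α) ≤ M := by linarith
  have hM2 : t ^ (1 + α / β) ≤ M := by linarith
  have hfl : ∀ X : ℝ, X ≤ M → ⌊X⌋₊ ≤ M := fun X hX => by
    have := Nat.floor_le_floor hX; simpa using this
  rw [lattice_sum hα hβ ht hM1 hM2]
  have hind : ∀ n k : ℕ, (if ((n : ℝ) + 1) ^ α * ((k : ℝ) + 1) ^ β ≤ t ^ (α + β) then (1 : ℝ) else 0)
      = (if (k : ℝ) + 1 ≤ y then (if (n : ℝ) + 1 ≤ Xf (β / α) t (k + 1) then 1 else 0) else 0)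
      + (if (n : ℝ) + 1 ≤ z then (if (k : ℝ) + 1 ≤ Xf (α / β) t (n + 1) then 1 else 0) else 0)
      - (if (k : ℝ) + 1 ≤ y then (if (n : ℝ) + 1 ≤ z then 1 else 0) else 0) := by
    intro n k
    have hn : (0 : ℝ) < n + 1 := by positivity
    have hk : (0 : ℝ) < k + 1 := by positivity
    have i1 := Xf_le_iff (β := β) hα ht hn hk
    have i2 := Xf_le_iff (β := α) hβ ht hk hn
    rw [mul_comm, add_comm β α] at i2
    simp only [← i1, ← i2]
    by_cases c1 : (k : ℝ) + 1 ≤ y <;> by_cases c2 : (n : ℝ) + 1 ≤ z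
    · have : ((n : ℝ) + 1) ^ α * ((k : ℝ) + 1) ^ β ≤ t ^ (α + β) := by
        rw [← hyz]; gcongr
      simp [c1, c2, this]
    · simp [c1, c2]
    · simp [c1, c2]
    · have : ¬ ((n : ℝ) + 1) ^ α * ((k : ℝ) + 1) ^ β ≤ t ^ (α + β) := by
        rw [← hyz, not_le]
        push Not at c1 c2
        gcongr
      simp [c1, c2, this]
  simp_rw [hind, Finset.sum_sub_distrib, Finset.sum_add_distrib]
  congr 1
  · congr 1
    · rw [Finset.sum_comm]
      rw [← cnt_floor (M := M) (hfl y (by linarith))]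
      apply Finset.sum_congr rfl
      intro k _
      split_ifs with h
      · rw [cnt_floor (hfl _ ((Xf_le (by positivity) ht (by linarith [(Nat.cast_nonneg k : (0 : ℝ) ≤ k)])).trans hM1))]
        simp
      · simp
    · rw [← cnt_floor (M := M) (hfl z (by linarith))]
      apply Finset.sum_congr rfl
      intro k _
      split_ifs with h
      · rw [cnt_floor (hfl _ ((Xf_le (by positivity) ht (by linarith [(Nat.cast_nonneg k : (0 : ℝ) ≤ k)])).trans hM2))]
        simp
      · simp
  · rw [Finset.sum_comm]
    have : ∀ k : ℕ, ∑ n ∈ Finset.range M, (if (k : ℝ) + 1 ≤ y then (if (n : ℝ) + 1 ≤ z then (1 : ℝ) else 0) else 0)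
      = if (k : ℝ) + 1 ≤ y then (⌊z⌋₊ : ℝ) else 0 := by
      intro k
      split_ifs with h
      · rw [cnt_floor (hfl z (by linarith))]; simp
      · simp
    simp_rw [this]
    rw [cnt_floor (hfl y (by linarith))]
    simp

lemma floor_sum {θ t y : ℝ} (hθ : 0 < θ) (hθ1 : θ ≠ 1) (ht : 0 < t) (hy : 0 < y) :
    |∑ k ∈ Finset.range ⌊y⌋₊, (⌊Xf θ t (k + 1)⌋₊ : ℝ) - ((riemannZeta (θ : ℂ)).re * t ^ (1 + θ)
      + Xf θ t y * y / (1 - θ) - saw y * Xf θ t y - (⌊y⌋₊ : ℝ) / 2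
      - ∑ k ∈ Finset.range ⌊y⌋₊, saw (Xf θ t (k + 1)))| ≤ θ * (Xf θ t y / y) := by
  have e1 : ∑ k ∈ Finset.range ⌊y⌋₊, (⌊Xf θ t (k + 1)⌋₊ : ℝ) =
      t ^ (1 + θ) * ∑ k ∈ Finset.range ⌊y⌋₊, ((k : ℝ) + 1) ^ (-θ) - (⌊y⌋₊ : ℝ) / 2
       - ∑ k ∈ Finset.range ⌊y⌋₊, saw (Xf θ t (k + 1)) := by
    have : ∀ k : ℕ, (⌊Xf θ t (k + 1)⌋₊ : ℝ) = t ^ (1 + θ) * ((k : ℝ) + 1) ^ (-θ) - 1 / 2 - saw (Xf θ t (k + 1)) := by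
      intro k
      rw [floor_saw (Xf_pos ht (by positivity)).le]; rfl
    simp_rw [this, Finset.sum_sub_distrib, ← Finset.mul_sum]
    simp; ring
  have h := em_bound hθ hθ1 hy
  have hT : 0 < t ^ (1 + θ) := by positivity
  have e2 : y ^ (1 - θ) = y ^ (-θ) * y := by
    nth_rewrite 3 [← rpow_one y]; rw [← rpow_add hy]; congr 1; ring
  have e3 : y ^ (-θ - 1) = y ^ (-θ) / y := by
    nth_rewrite 3 [← rpow_one y]; rw [← rpow_sub hy]
  have h' := mul_le_mul_of_nonneg_left h hT.le
  rw [← abs_of_pos hT, ← abs_mul, abs_of_pos hT] at h'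
  rw [e1]
  refine le_trans (le_of_eq ?_) (h'.trans (le_of_eq ?_))
  · congr 1
    rw [e2]; unfold Xf; ring
  · rw [e3]; unfold Xf; ring

lemma delta_tau {α β t y z : ℝ} (hα : 0 < α) (hβ : 0 < β) (hne : α ≠ β) (ht : 0 < t) (hy : 0 < y) (hz : 0 < z)
    (hyz : z ^ α * y ^ β = t ^ (α + β)) :
    |DeltaErr α β (t ^ (α + β)) + ∑ k ∈ Finset.range ⌊y⌋₊, saw (Xf (β / α) t (k + 1))
      + ∑ n ∈ Finset.range ⌊z⌋₊, saw (Xf (α / β) t (n + 1))| ≤ 1 / 2 + β / α * (z / y) + α / β * (y / z) := by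
  have h1 : β / α ≠ 1 := by rw [Ne, div_eq_one_iff_eq hα.ne']; exact Ne.symm hne
  have h2 : α / β ≠ 1 := by rw [Ne, div_eq_one_iff_eq hβ.ne']; exact hne
  have f1 := floor_sum (by positivity : 0 < β / α) h1 ht hy
  have f2 := floor_sum (by positivity : 0 < α / β) h2 ht hz
  have x1 : Xf (β / α) t y = z := by
    apply le_antisymm
    · have := Xf_le_iff (β := β) hα ht (Xf_pos (θ := β / α) ht hy) hy
      have h3 := this.2 le_rfl
      rw [← hyz] at h3
      have h4 := le_of_mul_le_mul_right h3 (by positivity)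
      exact (rpow_le_rpow_iff (Xf_pos ht hy).le hz.le hα).1 h4
    · exact (Xf_le_iff hα ht hz hy).1 hyz.le
  have x2 : Xf (α / β) t z = y := by
    have hyz' : y ^ β * z ^ α = t ^ (β + α) := by rw [mul_comm, add_comm]; exact hyz
    apply le_antisymm
    · have := Xf_le_iff (β := α) hβ ht (Xf_pos (θ := α / β) ht hz) hz
      have h3 := this.2 le_rfl
      rw [← hyz'] at h3
      have h4 := le_of_mul_le_mul_right h3 (by positivity)
      exact (rpow_le_rpow_iff (Xf_pos ht hz).le hy.le hβ).1 h4
    · exact (Xf_le_iff hβ ht hy hz).1 hyz'.le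
  rw [x1] at f1
  rw [x2] at f2
  have fy := floor_saw hy.le
  have fz := floor_saw hz.le
  have e1 : (t ^ (α + β)) ^ (1 / α) = t ^ (1 + β / α) := by
    rw [← rpow_mul ht.le]; congr 1; field_simp
  have e2 : (t ^ (α + β)) ^ (1 / β) = t ^ (1 + α / β) := by
    rw [← rpow_mul ht.le]; congr 1; field_simp; ring
  have hs : ∀ u, |saw u| ≤ 1 / 2 := by
    intro u; unfold saw; rw [abs_le]; constructor <;> linarith [Int.fract_nonneg u, (Int.fract_lt_one u).le]
  have hss : |saw y * saw z| ≤ 1 / 4 := by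
    rw [abs_mul]; nlinarith [hs y, hs z, abs_nonneg (saw y), abs_nonneg (saw z)]
  unfold DeltaErr
  rw [e1, e2, hyperbola hα hβ ht hy hz hyz]
  have hid : z * y / (1 - β / α) + y * z / (1 - α / β) = y * z := by
    have : α - β ≠ 0 := sub_ne_zero.2 hne
    have h3 : β - α ≠ 0 := sub_ne_zero.2 (Ne.symm hne)
    have e3 : 1 - β / α = (α - β) / α := by field_simp
    have e4 : 1 - α / β = -(α - β) / β := by field_simp; ring
    rw [e3, e4]
    field_simp
    ring
  have hprod : (⌊y⌋₊ : ℝ) * ⌊z⌋₊ = (y - saw y) * (z - saw z) - 1 / 4 - (⌊y⌋₊ : ℝ) / 2 - (⌊z⌋₊ : ℝ) / 2 := by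
    rw [fy, fz]; ring
  rw [abs_le] at f1 f2 hss ⊢
  constructor <;> nlinarith [f1.1, f1.2, f2.1, f2.2, hss.1, hss.2]
end MSQ

namespace MSQ

lemma st_symm (x : ℝ) : Real.smoothTransition (1 - x) = 1 - Real.smoothTransition x := by
  have h := Real.smoothTransition.pos_denom x
  unfold Real.smoothTransition
  have e : 1 - (1 - x) = x := by ring
  rw [e, add_comm (expNegInvGlue (1 - x))]
  field_simp
  ring

noncomputable def wt (κ z : ℝ) : ℝ := Real.smoothTransition (1 / 2 - κ * Real.log z)

noncomputable def SS (θ κ : ℝ) (R : ℕ) (t : ℝ) : ℝ :=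
  ∑ n ∈ Finset.range R, wt κ (((n : ℝ) + 1) / t) * saw (Xf θ t (n + 1))

noncomputable def stS : StieltjesFunction ℝ where
  toFun σ := Real.smoothTransition (1 / 2 + σ)
  mono' := fun x y h => Real.smoothTransition.monotone (by linarith)
  right_continuous' := fun x => by
    apply Continuous.continuousWithinAt
    exact Real.smoothTransition.continuous.comp (continuous_const.add continuous_id)

lemma stS_apply (σ : ℝ) : stS σ = Real.smoothTransition (1 / 2 + σ) := rfl

lemma stS_bot : Filter.Tendsto stS Filter.atBot (nhds 0) := by
  apply tendsto_const_nhds.congr'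
  filter_upwards [Filter.eventually_le_atBot (-1)] with x hx
  rw [stS_apply, Real.smoothTransition.zero_of_nonpos (by linarith)]

lemma stS_top : Filter.Tendsto stS Filter.atTop (nhds 1) := by
  apply tendsto_const_nhds.congr'
  filter_upwards [Filter.eventually_ge_atTop 1] with x hx
  rw [stS_apply, Real.smoothTransition.one_of_one_le (by linarith)]

lemma stS_left (x : ℝ) : Function.leftLim stS x = stS x := by
  apply ContinuousWithinAt.leftLim_eq
  apply Continuous.continuousWithinAt
  exact Real.smoothTransition.continuous.comp (continuous_const.add continuous_id)

lemma stS_Iic (x : ℝ) : stS.measure.real (Set.Iic x) = Real.smoothTransition (1 / 2 + x) := by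
  rw [measureReal_def, StieltjesFunction.measure_Iic _ stS_bot, sub_zero, ENNReal.toReal_ofReal]
  · rfl
  · exact Real.smoothTransition.nonneg _

lemma stS_Ici (x : ℝ) : stS.measure.real (Set.Ici x) = Real.smoothTransition (1 / 2 - x) := by
  have e : Real.smoothTransition (1 / 2 - x) = 1 - stS x := by
    rw [stS_apply, ← st_symm]; congr 1; ring
  rw [measureReal_def, StieltjesFunction.measure_Ici _ stS_top, stS_left, e, ENNReal.toReal_ofReal]
  rw [← e]
  exact Real.smoothTransition.nonneg _

lemma delta_smooth {α β : ℝ} (hα : 0 < α) (hβ : 0 < β) (hne : α ≠ β) :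
    ∃ C > 0, ∀ t : ℝ, 0 < t → ∀ R : ℕ, t * exp (1 / 2) ≤ R → t * exp (β / α / 2) ≤ R →
    |DeltaErr α β (t ^ (α + β)) + SS (β / α) 1 R t + SS (α / β) (α / β) R t| ≤ C := by
  set θ := β / α with hθ
  have hθ0 : 0 < θ := by positivity
  have hinv : α / β = 1 / θ := by rw [hθ]; field_simp
  set C := 1 / 2 + θ * exp ((1 + θ) / 2) + α / β * exp ((1 + θ) / 2) with hC
  refine ⟨C, by positivity, ?_⟩
  intro t ht R hR1 hR2
  have : IsProbabilityMeasure stS.measure := stS.isProbabilityMeasure stS_bot stS_top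
  have hae : ∀ᵐ σ ∂stS.measure, σ ∈ Set.Icc (-(1 / 2) : ℝ) (1 / 2) := by
    have h1 : stS.measure (Set.Iio (-(1 / 2))) = 0 := by
      apply measure_mono_null (Set.Iio_subset_Iic_self)
      rw [StieltjesFunction.measure_Iic _ stS_bot, stS_apply, Real.smoothTransition.zero_of_nonpos (by norm_num)]
      simp
    have h2 : stS.measure (Set.Ioi (1 / 2)) = 0 := by
      apply measure_mono_null (Set.Ioi_subset_Ici_self)
      rw [StieltjesFunction.measure_Ici _ stS_top, stS_left, stS_apply, Real.smoothTransition.one_of_one_le (by norm_num)]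
      simp
    have h3 : ∀ᵐ σ ∂stS.measure, σ ∉ Set.Iio (-(1 / 2)) := measure_eq_zero_iff_ae_notMem.1 h1
    have h4 : ∀ᵐ σ ∂stS.measure, σ ∉ Set.Ioi (1 / 2) := measure_eq_zero_iff_ae_notMem.1 h2
    filter_upwards [h3, h4] with σ h5 h6
    simp only [Set.mem_Iio, Set.mem_Ioi, not_lt] at h5 h6
    exact ⟨h5, h6⟩
  let g : ℝ → ℝ := fun σ => DeltaErr α β (t ^ (α + β))
    + ∑ n ∈ Finset.range R, (Set.Ici (Real.log (((n : ℝ) + 1) / t))).indicator (fun _ => saw (Xf θ t (n + 1))) σ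
    + ∑ n ∈ Finset.range R, (Set.Iic (- (α / β) * Real.log (((n : ℝ) + 1) / t))).indicator (fun _ => saw (Xf (α / β) t (n + 1))) σ
  have hb : ∀ᵐ σ ∂stS.measure, ‖g σ‖ ≤ C := by
    filter_upwards [hae] with σ hσ
    obtain ⟨hσ1, hσ2⟩ := hσ
    have hyz : (t * exp (-θ * σ)) ^ α * (t * exp σ) ^ β = t ^ (α + β) := by
      rw [mul_rpow ht.le (exp_pos _).le, mul_rpow ht.le (exp_pos _).le, ← exp_mul, ← exp_mul, rpow_add ht]
      have : exp (-θ * σ * α) * exp (σ * β) = 1 := by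
        rw [← exp_add, exp_eq_one_iff, hθ]; field_simp; ring
      calc _ = t ^ α * t ^ β * (exp (-θ * σ * α) * exp (σ * β)) := by ring
        _ = _ := by rw [this, mul_one]
    have h := delta_tau hα hβ hne ht (by positivity : 0 < t * exp σ) (by positivity : 0 < t * exp (-θ * σ)) hyz
    rw [Real.norm_eq_abs]
    have e1 : ∑ n ∈ Finset.range R, (Set.Ici (Real.log (((n : ℝ) + 1) / t))).indicator (fun _ => saw (Xf θ t (n + 1))) σ
      = ∑ k ∈ Finset.range ⌊t * exp σ⌋₊, saw (Xf (β / α) t (k + 1)) := by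
      rw [← cnt_floor (M := R)]
      · apply Finset.sum_congr rfl
        intro n _
        rw [Set.indicator_apply]
        have : σ ∈ Set.Ici (Real.log (((n : ℝ) + 1) / t)) ↔ (n : ℝ) + 1 ≤ t * exp σ := by
          rw [Set.mem_Ici, Real.log_le_iff_le_exp (by positivity), div_le_iff₀ ht, mul_comm]
        simp only [this]; rfl
      · have : t * exp σ ≤ R := le_trans (by gcongr) hR1
        simpa using Nat.floor_le_floor this
    have e2 : ∑ n ∈ Finset.range R, (Set.Iic (- (α / β) * Real.log (((n : ℝ) + 1) / t))).indicator (fun _ => saw (Xf (α / β) t (n + 1))) σ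
      = ∑ k ∈ Finset.range ⌊t * exp (-θ * σ)⌋₊, saw (Xf (α / β) t (k + 1)) := by
      rw [← cnt_floor (M := R)]
      · apply Finset.sum_congr rfl
        intro n _
        rw [Set.indicator_apply]
        have : σ ∈ Set.Iic (- (α / β) * Real.log (((n : ℝ) + 1) / t)) ↔ (n : ℝ) + 1 ≤ t * exp (-θ * σ) := by
          rw [Set.mem_Iic, mul_comm t, ← div_le_iff₀ ht, ← Real.log_le_iff_le_exp (by positivity), hinv]
          have : -(1 / θ) * Real.log (((n : ℝ) + 1) / t) = -Real.log (((n : ℝ) + 1) / t) / θ := by ring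
          rw [this, le_div_iff₀ hθ0]
          constructor <;> intro h <;> linarith
        simp only [this]
      · have : t * exp (-θ * σ) ≤ R := by
          refine le_trans ?_ hR2
          gcongr
          nlinarith
        simpa using Nat.floor_le_floor this
    simp only [g]
    rw [e1, e2]
    refine h.trans ?_
    rw [hC]
    have q1 : t * exp (-θ * σ) / (t * exp σ) ≤ exp ((1 + θ) / 2) := by
      rw [mul_div_mul_left _ _ ht.ne', ← exp_sub]
      gcongr; nlinarith
    have q2 : t * exp σ / (t * exp (-θ * σ)) ≤ exp ((1 + θ) / 2) := by
      rw [mul_div_mul_left _ _ ht.ne', ← exp_sub]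
      gcongr; nlinarith
    gcongr
  have hI := norm_integral_le_of_norm_le_const hb
  rw [probReal_univ, mul_one] at hI
  have hi1 : ∀ n : ℕ, Integrable (fun σ => (Set.Ici (Real.log (((n : ℝ) + 1) / t))).indicator (fun _ => saw (Xf θ t (n + 1))) σ) stS.measure :=
    fun n => (integrable_const _).indicator measurableSet_Ici
  have hi2 : ∀ n : ℕ, Integrable (fun σ => (Set.Iic (- (α / β) * Real.log (((n : ℝ) + 1) / t))).indicator (fun _ => saw (Xf (α / β) t (n + 1))) σ) stS.measure :=
    fun n => (integrable_const _).indicator measurableSet_Iic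
  have hs1 : Integrable (fun σ => ∑ n ∈ Finset.range R, (Set.Ici (Real.log (((n : ℝ) + 1) / t))).indicator (fun _ => saw (Xf θ t (n + 1))) σ) stS.measure :=
    integrable_finsetSum _ fun n _ => hi1 n
  have hs2 : Integrable (fun σ => ∑ n ∈ Finset.range R, (Set.Iic (- (α / β) * Real.log (((n : ℝ) + 1) / t))).indicator (fun _ => saw (Xf (α / β) t (n + 1))) σ) stS.measure :=
    integrable_finsetSum _ fun n _ => hi2 n
  have hs0 : Integrable (fun σ : ℝ => DeltaErr α β (t ^ (α + β))) stS.measure := integrable_const _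
  have hg : ∫ σ, g σ ∂stS.measure = DeltaErr α β (t ^ (α + β)) + SS θ 1 R t + SS (α / β) (α / β) R t := by
    have hs01 : Integrable (fun σ => DeltaErr α β (t ^ (α + β)) + ∑ n ∈ Finset.range R, (Set.Ici (Real.log (((n : ℝ) + 1) / t))).indicator (fun _ => saw (Xf θ t (n + 1))) σ) stS.measure := hs0.add hs1
    simp only [g]
    rw [integral_add hs01 hs2, integral_add hs0 hs1, integral_finsetSum _ fun n _ => hi1 n,
      integral_finsetSum _ fun n _ => hi2 n, integral_const, probReal_univ, one_smul]
    congr 1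
    · congr 1
      unfold SS
      apply Finset.sum_congr rfl
      intro n _
      rw [integral_indicator measurableSet_Ici, setIntegral_const, stS_Ici, smul_eq_mul, wt, one_mul]
    · unfold SS
      apply Finset.sum_congr rfl
      intro n _
      rw [integral_indicator measurableSet_Iic, setIntegral_const, stS_Iic, smul_eq_mul, wt]
      congr 2; ring
  rw [hg, Real.norm_eq_abs] at hI
  exact hI
end MSQ

namespace MSQ

noncomputable def sawH (H : ℕ) (u : ℝ) : ℝ :=
  -∑ n ∈ Finset.range H, sin (2 * π * (n + 1) * u) / (π * (n + 1))

lemma int_cos_k (k : ℤ) (hk : k ≠ 0) : ∫ u in (0 : ℝ)..1, cos (2 * π * k * u) = 0 := by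
  have hk' : (k : ℝ) ≠ 0 := by exact_mod_cast hk
  have hp := Real.pi_ne_zero
  rw [intervalIntegral.integral_comp_mul_left (fun x => cos x) (by positivity), integral_cos]
  have : 2 * π * k * 1 = ((2 * k : ℤ) : ℝ) * π := by push_cast; ring
  rw [this, sin_int_mul_pi]; simp

lemma int_sin_sin (n m : ℕ) : ∫ u in (0 : ℝ)..1, sin (2 * π * (n + 1) * u) * sin (2 * π * (m + 1) * u)
    = if n = m then 1 / 2 else 0 := by
  have e : ∀ u : ℝ, sin (2 * π * (n + 1) * u) * sin (2 * π * (m + 1) * u) =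
      1 / 2 * cos (2 * π * ((n - m : ℤ) : ℝ) * u) - 1 / 2 * cos (2 * π * ((n + m + 2 : ℤ) : ℝ) * u) := by
    intro u
    have h1 : 2 * π * ((n - m : ℤ) : ℝ) * u = 2 * π * (n + 1) * u - 2 * π * (m + 1) * u := by push_cast; ring
    have h2 : 2 * π * ((n + m + 2 : ℤ) : ℝ) * u = 2 * π * (n + 1) * u + 2 * π * (m + 1) * u := by push_cast; ring
    rw [h1, h2, cos_sub, cos_add]; ring
  simp_rw [e]
  rw [intervalIntegral.integral_sub, intervalIntegral.integral_const_mul, intervalIntegral.integral_const_mul,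
    int_cos_k (n + m + 2) (by omega)]
  · split_ifs with h
    · subst h; simp
    · rw [int_cos_k (n - m) (by omega)]; simp
  · exact Continuous.intervalIntegrable (by fun_prop) _ _
  · exact Continuous.intervalIntegrable (by fun_prop) _ _

lemma int_saw_congr (f : ℝ → ℝ → ℝ) : ∫ u in (0 : ℝ)..1, f (saw u) u = ∫ u in (0 : ℝ)..1, f (u - 1 / 2) u := by
  apply intervalIntegral.integral_congr_ae
  have : ∀ᵐ u : ℝ, u ≠ 1 := by simp [ae_iff]
  filter_upwards [this] with u hu hm
  rw [Set.uIoc_of_le zero_le_one] at hm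
  have : Int.fract u = u := Int.fract_eq_self.2 ⟨hm.1.le, lt_of_le_of_ne hm.2 hu⟩
  rw [saw, this]

lemma int_saw_sin (n : ℕ) : ∫ u in (0 : ℝ)..1, saw u * sin (2 * π * (n + 1) * u) = -1 / (2 * π * (n + 1)) := by
  rw [int_saw_congr (fun x u => x * sin (2 * π * (n + 1) * u))]
  have hc : (2 * π * ((n : ℝ) + 1)) ≠ 0 := by positivity
  set c := 2 * π * ((n : ℝ) + 1) with hcd
  have d1 : ∀ u ∈ Set.uIcc (0 : ℝ) 1, HasDerivAt (fun u : ℝ => u - 1 / 2) 1 u := fun u _ => (hasDerivAt_id u).sub_const _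
  have d2 : ∀ u ∈ Set.uIcc (0 : ℝ) 1, HasDerivAt (fun u : ℝ => - cos (c * u) / c) (sin (c * u)) u := by
    intro u _
    have := (((hasDerivAt_id u).const_mul c).cos.neg).div_const c
    refine HasDerivAt.congr_deriv this ?_
    simp; field_simp
  rw [intervalIntegral.integral_mul_deriv_eq_deriv_mul d1 d2 (by simp)
    (Continuous.intervalIntegrable (by fun_prop) _ _)]
  have h1 : ∫ u in (0 : ℝ)..1, 1 * (-cos (c * u) / c) = 0 := by
    have h2 := int_cos_k (n + 1) (by omega)
    push_cast at h2
    rw [← hcd] at h2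
    have : ∀ u, 1 * (-cos (c * u) / c) = (-1 / c) * cos (c * u) := fun u => by ring
    simp_rw [this]
    rw [intervalIntegral.integral_const_mul, h2, mul_zero]
  have h3 : cos (c * 1) = 1 := by
    have : c * 1 = ((n + 1 : ℕ) : ℝ) * (2 * π) := by rw [hcd]; push_cast; ring
    rw [this, cos_nat_mul_two_pi]
  rw [h1, h3]
  simp
  field_simp
  ring

lemma saw_measurable : Measurable saw := measurable_fract.sub_const _

lemma saw_abs (u : ℝ) : |saw u| ≤ 1 / 2 := by
  unfold saw; rw [abs_le]; constructor <;> linarith [Int.fract_nonneg u, (Int.fract_lt_one u).le]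

lemma sawH_continuous (H : ℕ) : Continuous (sawH H) := by
  unfold sawH; fun_prop

lemma saw_ii (x y : ℝ) (g : ℝ → ℝ) (hg : Continuous g) : IntervalIntegrable (fun u => saw u * g u) volume x y := by
  apply IntervalIntegrable.mul_continuousOn _ hg.continuousOn
  have : IntervalIntegrable (fun _ : ℝ => (1 / 2 : ℝ)) volume x y := by simp
  refine this.mono_fun saw_measurable.aestronglyMeasurable ?_
  filter_upwards with u
  rw [Real.norm_eq_abs, Real.norm_eq_abs]; refine (saw_abs u).trans (le_abs_self _)

lemma saw_l2_eq (H : ℕ) : ∫ u in (0 : ℝ)..1, (saw u - sawH H u) ^ 2 =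
    1 / 12 - ∑ n ∈ Finset.range H, 1 / (2 * π ^ 2 * ((n : ℝ) + 1) ^ 2) := by
  have e : ∀ u, (saw u - sawH H u) ^ 2 = saw u ^ 2 - 2 * (saw u * sawH H u) + sawH H u ^ 2 := fun u => by ring
  have i1 : IntervalIntegrable (fun u => saw u ^ 2) volume 0 1 := by
    have : IntervalIntegrable (fun _ : ℝ => (1 : ℝ)) volume 0 1 := by simp
    refine this.mono_fun (saw_measurable.pow_const 2).aestronglyMeasurable ?_
    filter_upwards with u
    rw [Real.norm_eq_abs, Real.norm_eq_abs, abs_pow]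
    have := saw_abs u
    have h0 := abs_nonneg (saw u)
    rw [abs_one]; nlinarith
  have i2 : IntervalIntegrable (fun u => 2 * (saw u * sawH H u)) volume 0 1 :=
    (saw_ii 0 1 _ (sawH_continuous H)).const_mul 2
  have i3 : IntervalIntegrable (fun u => sawH H u ^ 2) volume 0 1 :=
    ((sawH_continuous H).pow 2).intervalIntegrable _ _
  simp_rw [e]
  rw [intervalIntegral.integral_add (i1.sub i2) i3, intervalIntegral.integral_sub i1 i2,
    intervalIntegral.integral_const_mul]
  have t1 : ∫ u in (0 : ℝ)..1, saw u ^ 2 = 1 / 12 := by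
    rw [int_saw_congr (fun x _ => x ^ 2)]
    rw [intervalIntegral.integral_comp_sub_right (fun x : ℝ => x ^ 2), integral_pow]
    norm_num
  have t2 : ∫ u in (0 : ℝ)..1, saw u * sawH H u = ∑ n ∈ Finset.range H, 1 / (2 * π ^ 2 * ((n : ℝ) + 1) ^ 2) := by
    have : ∀ u, saw u * sawH H u = ∑ n ∈ Finset.range H, (-1 / (π * ((n : ℝ) + 1))) * (saw u * sin (2 * π * (n + 1) * u)) := by
      intro u
      unfold sawH
      rw [mul_neg, Finset.mul_sum, ← Finset.sum_neg_distrib]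
      apply Finset.sum_congr rfl; intro n _; ring
    simp_rw [this]
    rw [intervalIntegral.integral_finsetSum]
    · apply Finset.sum_congr rfl; intro n _
      rw [intervalIntegral.integral_const_mul, int_saw_sin]
      have := Real.pi_ne_zero
      field_simp
    · intro n _
      exact (saw_ii 0 1 _ (by fun_prop)).const_mul _
  have t3 : ∫ u in (0 : ℝ)..1, sawH H u ^ 2 = ∑ n ∈ Finset.range H, 1 / (2 * π ^ 2 * ((n : ℝ) + 1) ^ 2) := by
    have : ∀ u, sawH H u ^ 2 = ∑ n ∈ Finset.range H, ∑ m ∈ Finset.range H, (1 / (π * ((n : ℝ) + 1)) * (1 / (π * ((m : ℝ) + 1)))) * (sin (2 * π * (n + 1) * u) * sin (2 * π * (m + 1) * u)) := by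
      intro u
      unfold sawH
      rw [neg_sq, sq, Finset.sum_mul_sum]
      apply Finset.sum_congr rfl; intro n _
      apply Finset.sum_congr rfl; intro m _; ring
    simp_rw [this]
    rw [intervalIntegral.integral_finsetSum]
    · apply Finset.sum_congr rfl; intro n hn
      rw [intervalIntegral.integral_finsetSum]
      · simp_rw [intervalIntegral.integral_const_mul, int_sin_sin]
        simp only [mul_ite, mul_zero]
        rw [Finset.sum_ite_eq, if_pos hn]
        have := Real.pi_ne_zero
        field_simp
      · intro m _
        exact Continuous.intervalIntegrable (by fun_prop) _ _
    · intro n _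
      exact Continuous.intervalIntegrable (by fun_prop) _ _
  rw [t1, t2, t3]; ring

lemma saw_l2 {H : ℕ} (hH : 0 < H) : ∫ u in (0 : ℝ)..1, (saw u - sawH H u) ^ 2 ≤ 1 / H := by
  rw [saw_l2_eq]
  have h2 := hasSum_zeta_two
  have h2' : HasSum (fun n : ℕ => 1 / ((n : ℝ) + 1) ^ 2) (π ^ 2 / 6) := by
    have := (hasSum_nat_add_iff' 1).2 h2
    simpa using this
  have h3 : HasSum (fun n : ℕ => 1 / (2 * π ^ 2 * ((n : ℝ) + 1) ^ 2)) (1 / 12) := by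
    have := h2'.mul_left (1 / (2 * π ^ 2))
    have hp := Real.pi_ne_zero
    have ee : (1 / 12 : ℝ) = 1 / (2 * π ^ 2) * (π ^ 2 / 6) := by field_simp; norm_num
    rw [ee]
    refine (funext fun n => ?_ : (fun n : ℕ => 1 / (2 * π ^ 2 * ((n : ℝ) + 1) ^ 2)) = _) ▸ this
    field_simp
  have h4 : ∀ N, H ≤ N → ∑ n ∈ Finset.range N, 1 / (2 * π ^ 2 * ((n : ℝ) + 1) ^ 2) ≤
      ∑ n ∈ Finset.range H, 1 / (2 * π ^ 2 * ((n : ℝ) + 1) ^ 2) + (1 / (H : ℝ) - 1 / (N : ℝ)) := by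
    intro N hN
    induction N, hN using Nat.le_induction with
    | base => simp
    | succ k hk ih =>
      rw [Finset.sum_range_succ]
      have hk0 : (0 : ℝ) < k := by exact_mod_cast lt_of_lt_of_le hH hk
      have : 1 / (2 * π ^ 2 * ((k : ℝ) + 1) ^ 2) ≤ 1 / k - 1 / (k + 1 : ℕ) := by
        push_cast
        have e : 1 / (k : ℝ) - 1 / (k + 1) = 1 / (k * (k + 1)) := by field_simp; ring
        rw [e]
        apply one_div_le_one_div_of_le (by positivity)
        have : 1 ≤ 2 * π ^ 2 := by nlinarith [Real.pi_gt_three]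
        nlinarith [sq_nonneg ((k : ℝ) + 1)]
      linarith
  have h5 := le_of_tendsto h3.tendsto_sum_nat (b := ∑ n ∈ Finset.range H, 1 / (2 * π ^ 2 * ((n : ℝ) + 1) ^ 2) + 1 / (H : ℝ)) (by
    filter_upwards [Filter.eventually_ge_atTop H] with N hN
    refine (h4 N hN).trans ?_
    have : (0 : ℝ) ≤ 1 / N := by positivity
    linarith)
  linarith

lemma saw_periodic : Function.Periodic saw 1 := fun x => by unfold saw; rw [Int.fract_add_one]

lemma sawH_periodic (H : ℕ) : Function.Periodic (sawH H) 1 := fun x => by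
  unfold sawH
  congr 1
  apply Finset.sum_congr rfl; intro n _
  have : 2 * π * ((n : ℝ) + 1) * (x + 1) = 2 * π * (n + 1) * x + ((n + 1 : ℕ) : ℝ) * (2 * π) := by push_cast; ring
  rw [this, sin_add_nat_mul_two_pi]

lemma sawD_ii (H : ℕ) (x y : ℝ) : IntervalIntegrable (fun u => (saw u - sawH H u) ^ 2) volume x y := by
  have e : ∀ u, (saw u - sawH H u) ^ 2 = saw u * saw u + (saw u * (- 2 * sawH H u) + sawH H u ^ 2) := fun u => by ring
  simp_rw [e]
  refine IntervalIntegrable.add ?_ ((saw_ii x y _ ((sawH_continuous H).const_mul _ |>.congr fun _ => rfl)).add (((sawH_continuous H).pow 2).intervalIntegrable _ _))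
  have : IntervalIntegrable (fun _ : ℝ => (1 : ℝ)) volume x y := by simp
  refine this.mono_fun (saw_measurable.mul saw_measurable).aestronglyMeasurable ?_
  filter_upwards with u
  rw [Real.norm_eq_abs, Real.norm_eq_abs, abs_mul]
  have := saw_abs u
  have h0 := abs_nonneg (saw u)
  rw [abs_one]; nlinarith

lemma saw_l2_interval {H : ℕ} (hH : 0 < H) {x y : ℝ} (hxy : x ≤ y) :
    ∫ u in x..y, (saw u - sawH H u) ^ 2 ≤ (y - x + 1) / H := by
  have hper : Function.Periodic (fun u => (saw u - sawH H u) ^ 2) 1 := fun u => by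
    simp only [saw_periodic u, sawH_periodic H u]
  set n := ⌈y - x⌉ with hn
  have hn0 : 0 ≤ n := Int.ceil_nonneg (by linarith)
  have h1 := hper.intervalIntegral_add_zsmul_eq n x (fun _ _ => sawD_ii H _ _)
  have h2 : ∫ u in x..(x + 1), (saw u - sawH H u) ^ 2 = ∫ u in (0 : ℝ)..1, (saw u - sawH H u) ^ 2 := by
    have := hper.intervalIntegral_add_eq x 0
    simpa using this
  have hyn : y ≤ x + n • (1 : ℝ) := by
    have := Int.le_ceil (y - x)
    rw [zsmul_eq_mul, mul_one]; linarith
  have h3 : ∫ u in x..y, (saw u - sawH H u) ^ 2 ≤ ∫ u in x..(x + n • (1 : ℝ)), (saw u - sawH H u) ^ 2 := by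
    apply intervalIntegral.integral_mono_interval le_rfl hxy hyn
    · filter_upwards with u; exact sq_nonneg _
    · exact sawD_ii H _ _
  rw [h1, h2] at h3
  refine h3.trans ?_
  have h4 := saw_l2 hH
  have h5 : (n : ℝ) ≤ y - x + 1 := (Int.ceil_lt_add_one _).le
  rw [zsmul_eq_mul]
  have h6 : (0 : ℝ) ≤ n := by exact_mod_cast hn0
  calc (n : ℝ) * _ ≤ n * (1 / H) := by gcongr
    _ ≤ (y - x + 1) * (1 / H) := by gcongr
    _ = _ := by ring
end MSQ

namespace MSQ

noncomputable def SSH (θ κ : ℝ) (R H : ℕ) (t : ℝ) : ℝ :=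
  ∑ n ∈ Finset.range R, wt κ (((n : ℝ) + 1) / t) * sawH H (Xf θ t (n + 1))

lemma sawH_abs (H : ℕ) (u : ℝ) : |sawH H u| ≤ H := by
  unfold sawH
  rw [abs_neg]
  refine (Finset.abs_sum_le_sum_abs _ _).trans ?_
  calc _ ≤ ∑ n ∈ Finset.range H, (1 : ℝ) := by
        apply Finset.sum_le_sum
        intro n _
        have h0 : 0 < π * ((n : ℝ) + 1) := by positivity
        rw [abs_div, abs_of_pos h0, div_le_one h0]
        have : (0 : ℝ) ≤ n := Nat.cast_nonneg n
        have := Real.abs_sin_le_one (2 * π * (n + 1) * u)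
        nlinarith [Real.pi_gt_three]
    _ = H := by simp

lemma wt_nonneg (κ z : ℝ) : 0 ≤ wt κ z := Real.smoothTransition.nonneg _
lemma wt_le_one (κ z : ℝ) : wt κ z ≤ 1 := Real.smoothTransition.le_one _

lemma Xf_meas (θ r : ℝ) : Measurable (fun t => Xf θ t r) := by unfold Xf; fun_prop

lemma wt_meas (κ r : ℝ) : Measurable (fun t : ℝ => wt κ (r / t)) := by
  unfold wt
  exact Real.smoothTransition.continuous.measurable.comp (by fun_prop)

lemma ii_of_bdd {f : ℝ → ℝ} (hf : Measurable f) {B : ℝ} (hB : ∀ u, |f u| ≤ B) (x y : ℝ) :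
    IntervalIntegrable f volume x y := by
  have : IntervalIntegrable (fun _ : ℝ => B) volume x y := by simp
  refine this.mono_fun hf.aestronglyMeasurable ?_
  filter_upwards with u
  rw [Real.norm_eq_abs, Real.norm_eq_abs]; exact (hB u).trans (le_abs_self _)

lemma sawD_abs (H : ℕ) (u : ℝ) : |(saw u - sawH H u) ^ 2| ≤ (1 / 2 + H) ^ 2 := by
  rw [abs_pow]
  have h1 := saw_abs u
  have h2 := sawH_abs H u
  have := abs_sub (saw u) (sawH H u)
  have h3 := abs_nonneg (saw u - sawH H u)
  gcongr; linarith

lemma sawD_meas (H : ℕ) : Measurable (fun u => (saw u - sawH H u) ^ 2) :=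
  (saw_measurable.sub (sawH_continuous H).measurable).pow_const 2

lemma sawD_cov {θ K0 Q Q' r : ℝ} {H : ℕ} (hθ : 0 < θ) (hK : 0 < K0) (hQ : 1 ≤ Q) (hQQ : Q ≤ Q')
    (hr : 1 ≤ r) (hrK : r ≤ K0 * Q) (hH : 0 < H) :
    ∫ t in Q..Q', (saw (Xf θ t r) - sawH H (Xf θ t r)) ^ 2 ≤ K0 ^ θ * ((Q' ^ (1 + θ) + 1) / H) := by
  set D : ℝ → ℝ := fun u => (saw u - sawH H u) ^ 2 with hD
  have hr0 : 0 < r := by linarith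
  have hder : ∀ t ∈ Set.Icc Q Q', HasDerivWithinAt (fun t => Xf θ t r) ((1 + θ) * t ^ θ * r ^ (-θ)) (Set.Icc Q Q') t := by
    intro t ht
    have ht0 : 0 < t := by linarith [ht.1]
    have := (Real.hasDerivAt_rpow_const (x := t) (p := 1 + θ) (Or.inl ht0.ne')).mul_const (r ^ (-θ))
    have e : 1 + θ - 1 = θ := by ring
    rw [e] at this
    exact this.hasDerivWithinAt
  have hmono : ∀ t ∈ Set.Icc Q Q', ∀ s ∈ Set.Icc Q Q', t < s → Xf θ t r < Xf θ s r := by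
    intro t ht s hs hts
    unfold Xf
    have : 0 < t := by linarith [ht.1]
    gcongr
  have hinj : Set.InjOn (fun t => Xf θ t r) (Set.Icc Q Q') := by
    intro t ht s hs h
    rcases lt_trichotomy t s with h1 | h1 | h1
    · exact absurd h (hmono t ht s hs h1).ne
    · exact h1
    · exact absurd h (hmono s hs t ht h1).ne'
  have hIm := MeasureTheory.integral_image_eq_integral_abs_deriv_smul measurableSet_Icc hder hinj D
  have hsub : (fun t => Xf θ t r) '' Set.Icc Q Q' ⊆ Set.Icc (Xf θ Q r) (Xf θ Q' r) := by
    rintro _ ⟨t, ht, rfl⟩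
    have hmem : Q ∈ Set.Icc Q Q' := ⟨le_rfl, hQQ⟩
    have hmem' : Q' ∈ Set.Icc Q Q' := ⟨hQQ, le_rfl⟩
    constructor
    · rcases ht.1.eq_or_lt with h | h
      · rw [h]
      · exact (hmono _ hmem _ ht h).le
    · rcases ht.2.eq_or_lt with h | h
      · rw [h]
      · exact (hmono _ ht _ hmem' h).le
  have hX : Xf θ Q r ≤ Xf θ Q' r := by
    rcases hQQ.eq_or_lt with h | h
    · rw [h]
    · exact (hmono _ ⟨le_rfl, hQQ⟩ _ ⟨hQQ, le_rfl⟩ h).le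
  have hDi : IntegrableOn D (Set.Icc (Xf θ Q r) (Xf θ Q' r)) := by
    rw [← intervalIntegrable_iff_integrableOn_Icc_of_le hX]
    exact ii_of_bdd (sawD_meas H) (sawD_abs H) _ _
  have h1 : ∫ u in (fun t => Xf θ t r) '' Set.Icc Q Q', D u ≤ (Xf θ Q' r - Xf θ Q r + 1) / H := by
    refine (setIntegral_mono_set hDi ?_ hsub.eventuallyLE).trans ?_
    · filter_upwards with u; exact sq_nonneg _
    · rw [integral_Icc_eq_integral_Ioc, ← intervalIntegral.integral_of_le hX]
      exact saw_l2_interval hH hX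
  have hII : IntegrableOn (fun t => |(1 + θ) * t ^ θ * r ^ (-θ)| • D (Xf θ t r)) (Set.Icc Q Q') :=
    (MeasureTheory.integrableOn_image_iff_integrableOn_abs_deriv_smul measurableSet_Icc hder hinj D).1
      (hDi.mono_set hsub)
  have hc : 0 < K0 ^ θ := by positivity
  have h2 : ∫ t in Q..Q', D (Xf θ t r) ≤ K0 ^ θ * ∫ t in Set.Icc Q Q', |(1 + θ) * t ^ θ * r ^ (-θ)| • D (Xf θ t r) := by
    rw [intervalIntegral.integral_of_le hQQ, ← integral_Icc_eq_integral_Ioc, ← integral_const_mul]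
    apply setIntegral_mono_on _ (hII.const_mul _) measurableSet_Icc
    · intro t ht
      have ht0 : 0 < t := by linarith [ht.1]
      have hDn : 0 ≤ D (Xf θ t r) := sq_nonneg _
      have hp : 0 < (1 + θ) * t ^ θ * r ^ (-θ) := by positivity
      rw [abs_of_pos hp, smul_eq_mul, ← mul_assoc]
      have : 1 ≤ K0 ^ θ * ((1 + θ) * t ^ θ * r ^ (-θ)) := by
        have h3 : r ^ θ ≤ K0 ^ θ * t ^ θ := by
          rw [← mul_rpow hK.le ht0.le]
          gcongr; nlinarith [ht.1]
        rw [rpow_neg hr0.le]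
        have h4 : 0 < r ^ θ := by positivity
        have h5 : 1 ≤ K0 ^ θ * t ^ θ * (r ^ θ)⁻¹ := by
          rw [← div_eq_mul_inv, le_div_iff₀ h4, one_mul]; exact h3
        nlinarith
      nlinarith
    · rw [← intervalIntegrable_iff_integrableOn_Icc_of_le hQQ]
      exact ii_of_bdd ((sawD_meas H).comp (Xf_meas θ r)) (fun u => sawD_abs H _) _ _
  refine h2.trans ?_
  gcongr
  rw [← hIm]
  refine h1.trans ?_
  gcongr
  have := Xf_pos (θ := θ) (by linarith : 0 < Q) hr0
  have h3 := Xf_le hθ (by linarith : 0 < Q') hr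
  linarith

lemma SS_meas (θ κ : ℝ) (R : ℕ) : Measurable (SS θ κ R) := by
  unfold SS
  apply Finset.measurable_fun_sum
  intro n _
  exact (wt_meas κ _).mul (saw_measurable.comp (Xf_meas θ _))

lemma SSH_meas (θ κ : ℝ) (R H : ℕ) : Measurable (SSH θ κ R H) := by
  unfold SSH
  apply Finset.measurable_fun_sum
  intro n _
  exact (wt_meas κ _).mul ((sawH_continuous H).measurable.comp (Xf_meas θ _))

lemma SS_trunc {θ K0 : ℝ} (hθ : 0 < θ) (hK : 0 < K0) : ∃ C > 0, ∀ (κ Q Q' : ℝ) (R H : ℕ), 1 ≤ Q →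
    Q ≤ Q' → Q' ≤ 2 * Q → (R : ℝ) ≤ K0 * Q → Q ^ (3 + θ) ≤ H →
    ∫ t in Q..Q', (SS θ κ R t - SSH θ κ R H t) ^ 2 ≤ C := by
  refine ⟨K0 ^ 2 * (K0 ^ θ * (2 ^ (1 + θ) + 1)), by positivity, ?_⟩
  intro κ Q Q' R H hQ hQQ hQ2 hR hH
  have hQ0 : 0 < Q := by linarith
  have hH0 : (0 : ℝ) < H := lt_of_lt_of_le (by positivity) hH
  have hH1 : 0 < H := by exact_mod_cast hH0
  have hpt : ∀ t, (SS θ κ R t - SSH θ κ R H t) ^ 2 ≤ R * ∑ n ∈ Finset.range R, (saw (Xf θ t (n + 1)) - sawH H (Xf θ t (n + 1))) ^ 2 := by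
    intro t
    unfold SS SSH
    rw [← Finset.sum_sub_distrib]
    have := sq_sum_le_card_mul_sum_sq (s := Finset.range R) (f := fun n : ℕ => wt κ (((n : ℝ) + 1) / t) * saw (Xf θ t (n + 1)) - wt κ (((n : ℝ) + 1) / t) * sawH H (Xf θ t (n + 1)))
    rw [Finset.card_range] at this
    refine this.trans ?_
    apply mul_le_mul_of_nonneg_left _ (Nat.cast_nonneg R)
    apply Finset.sum_le_sum
    intro n _
    rw [← mul_sub, mul_pow]
    have h1 := wt_nonneg κ (((n : ℝ) + 1) / t)
    have h2 := wt_le_one κ (((n : ℝ) + 1) / t)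
    have h3 : wt κ (((n : ℝ) + 1) / t) ^ 2 ≤ 1 := by nlinarith
    have h4 := sq_nonneg (saw (Xf θ t (n + 1)) - sawH H (Xf θ t (n + 1)))
    nlinarith
  have hii : ∀ n : ℕ, IntervalIntegrable (fun t => (saw (Xf θ t (n + 1)) - sawH H (Xf θ t (n + 1))) ^ 2) volume Q Q' :=
    fun n => ii_of_bdd ((sawD_meas H).comp (Xf_meas θ _)) (fun u => sawD_abs H _) _ _
  have hii2 : IntervalIntegrable (fun t => (R : ℝ) * ∑ n ∈ Finset.range R, (saw (Xf θ t (n + 1)) - sawH H (Xf θ t (n + 1))) ^ 2) volume Q Q' := by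
    apply IntervalIntegrable.const_mul
    have := IntervalIntegrable.sum (μ := volume) (a := Q) (b := Q') (Finset.range R)
      (f := fun (n : ℕ) t => (saw (Xf θ t (n + 1)) - sawH H (Xf θ t (n + 1))) ^ 2) (fun n _ => hii n)
    have e : (fun t => ∑ n ∈ Finset.range R, (saw (Xf θ t (n + 1)) - sawH H (Xf θ t (n + 1))) ^ 2) =
      ∑ n ∈ Finset.range R, fun t => (saw (Xf θ t (n + 1)) - sawH H (Xf θ t (n + 1))) ^ 2 := by
      ext t; simp
    rw [e]; exact this
  have h1 : ∫ t in Q..Q', (SS θ κ R t - SSH θ κ R H t) ^ 2 ≤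
      ∫ t in Q..Q', (R : ℝ) * ∑ n ∈ Finset.range R, (saw (Xf θ t (n + 1)) - sawH H (Xf θ t (n + 1))) ^ 2 := by
    apply intervalIntegral.integral_mono_on hQQ _ hii2 (fun t _ => hpt t)
    refine hii2.mono_fun (((SS_meas θ κ R).sub (SSH_meas θ κ R H)).pow_const 2).aestronglyMeasurable ?_
    filter_upwards with t
    rw [Real.norm_eq_abs, Real.norm_eq_abs, abs_of_nonneg (sq_nonneg _)]
    exact (hpt t).trans (le_abs_self _)
  refine h1.trans ?_
  rw [intervalIntegral.integral_const_mul, intervalIntegral.integral_finsetSum (fun n _ => hii n)]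
  have h2 : ∀ n ∈ Finset.range R, ∫ t in Q..Q', (saw (Xf θ t (n + 1)) - sawH H (Xf θ t (n + 1))) ^ 2 ≤ K0 ^ θ * ((2 ^ (1 + θ) + 1) * Q ^ (1 + θ) / H) := by
    intro n hn
    have hn' : (n : ℝ) + 1 ≤ R := by exact_mod_cast Finset.mem_range.1 hn
    refine (sawD_cov hθ hK hQ hQQ (by linarith [(Nat.cast_nonneg n : (0 : ℝ) ≤ n)]) (hn'.trans hR) hH1).trans ?_
    gcongr
    have e1 : Q' ^ (1 + θ) ≤ 2 ^ (1 + θ) * Q ^ (1 + θ) := by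
      rw [← mul_rpow (by norm_num) hQ0.le]
      have : 0 ≤ Q' := by linarith
      gcongr
    have e2 : 1 ≤ Q ^ (1 + θ) := one_le_rpow hQ (by linarith)
    linarith
  have h3 := Finset.sum_le_sum h2
  rw [Finset.sum_const, Finset.card_range, nsmul_eq_mul] at h3
  have h4 : (R : ℝ) ^ 2 ≤ K0 ^ 2 * Q ^ 2 := by rw [← mul_pow]; gcongr
  have h5 : Q ^ 2 * Q ^ (1 + θ) = Q ^ (3 + θ) := by
    rw [← rpow_natCast, ← rpow_add hQ0]; congr 1; push_cast; ring
  calc (R : ℝ) * _ ≤ R * (R * (K0 ^ θ * ((2 ^ (1 + θ) + 1) * Q ^ (1 + θ) / H))) := by gcongr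
    _ = R ^ 2 * (K0 ^ θ * ((2 ^ (1 + θ) + 1) * Q ^ (1 + θ) / H)) := by ring
    _ ≤ K0 ^ 2 * Q ^ 2 * (K0 ^ θ * ((2 ^ (1 + θ) + 1) * Q ^ (1 + θ) / H)) := by gcongr
    _ = K0 ^ 2 * (K0 ^ θ * (2 ^ (1 + θ) + 1)) * ((Q ^ 2 * Q ^ (1 + θ)) / H) := by ring
    _ ≤ K0 ^ 2 * (K0 ^ θ * (2 ^ (1 + θ) + 1)) * 1 := by
        rw [h5]; gcongr; rw [div_le_one hH0]; exact hH
    _ = _ := mul_one _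
end MSQ

namespace MSQ

noncomputable def ee (x : ℝ) : ℂ := Complex.exp ((2 * π * x : ℝ) * Complex.I)

lemma ee_norm (x : ℝ) : ‖ee x‖ = 1 := Complex.norm_exp_ofReal_mul_I _

lemma ee_add (x y : ℝ) : ee (x + y) = ee x * ee y := by
  unfold ee; rw [← Complex.exp_add]; congr 1; push_cast; ring

lemma ee_continuous : Continuous ee := by unfold ee; fun_prop

lemma ee_deriv {P : ℝ → ℝ} {p x : ℝ} (h : HasDerivAt P p x) :
    HasDerivAt (fun x => ee (P x)) ((2 * π * p : ℝ) * Complex.I * ee (P x)) x := by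
  have h1 := ((h.const_mul (2 * π)).ofReal_comp.mul_const Complex.I).cexp
  refine h1.congr_deriv ?_
  unfold ee; ring

lemma bp {G G' : ℝ → ℝ} {E E' : ℝ → ℂ} {a b : ℝ} (hab : a ≤ b)
    (hG : ∀ x ∈ Set.Icc a b, HasDerivAt G (G' x) x) (hE : ∀ x ∈ Set.Icc a b, HasDerivAt E (E' x) x)
    (hG' : IntervalIntegrable G' volume a b) (hE' : IntervalIntegrable E' volume a b)
    (hE1 : ∀ x ∈ Set.Icc a b, ‖E x‖ ≤ 1) {M : ℝ} (hM : ∫ x in a..b, |G' x| ≤ M) :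
    ‖∫ x in a..b, (G x : ℂ) * E' x‖ ≤ |G a| + |G b| + M := by
  have hG2 : ∀ x ∈ Set.uIcc a b, HasDerivAt (fun x => (G x : ℂ)) ((G' x : ℂ)) x := by
    rw [Set.uIcc_of_le hab]; exact fun x hx => (hG x hx).ofReal_comp
  have hG'2 : IntervalIntegrable (fun x => (G' x : ℂ)) volume a b := by
    exact ⟨hG'.1.ofReal, hG'.2.ofReal⟩
  rw [intervalIntegral.integral_mul_deriv_eq_deriv_mul hG2 (by rwa [Set.uIcc_of_le hab]) hG'2 hE']
  have hEa := hE1 a ⟨le_rfl, hab⟩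
  have hEb := hE1 b ⟨hab, le_rfl⟩
  have h1 : ‖(G b : ℂ) * E b‖ ≤ |G b| := by
    rw [norm_mul, Complex.norm_real, Real.norm_eq_abs]
    nlinarith [abs_nonneg (G b)]
  have h2 : ‖(G a : ℂ) * E a‖ ≤ |G a| := by
    rw [norm_mul, Complex.norm_real, Real.norm_eq_abs]
    nlinarith [abs_nonneg (G a)]
  have h3 : ‖∫ x in a..b, (G' x : ℂ) * E x‖ ≤ M := by
    refine le_trans ?_ hM
    apply intervalIntegral.norm_integral_le_of_norm_le hab _ hG'.abs
    filter_upwards with x hx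
    rw [norm_mul, Complex.norm_real, Real.norm_eq_abs]
    nlinarith [abs_nonneg (G' x), hE1 x ⟨hx.1.le, hx.2⟩]
  calc _ ≤ ‖(G b : ℂ) * E b - (G a : ℂ) * E a‖ + ‖∫ x in a..b, (G' x : ℂ) * E x‖ := norm_sub_le _ _
    _ ≤ ‖(G b : ℂ) * E b‖ + ‖(G a : ℂ) * E a‖ + ‖∫ x in a..b, (G' x : ℂ) * E x‖ := by
        gcongr; exact norm_sub_le _ _
    _ ≤ _ := by linarith

lemma int_inv_sq {a b : ℝ} (ha : 0 < a) (hab : a ≤ b) : ∫ x in a..b, 1 / x ^ 2 ≤ 1 / a := by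
  have hd : ∀ x ∈ Set.uIcc a b, HasDerivAt (fun x : ℝ => - x⁻¹) (1 / x ^ 2) x := by
    intro x hx
    rw [Set.uIcc_of_le hab] at hx
    have hx0 : x ≠ 0 := by linarith [hx.1] |> ne_of_gt
    refine (hasDerivAt_inv hx0).neg.congr_deriv ?_
    field_simp
  rw [intervalIntegral.integral_eq_sub_of_hasDerivAt hd]
  · have : 0 < b⁻¹ := by have : 0 < b := by linarith
                         positivity
    rw [one_div]; linarith
  · apply ContinuousOn.intervalIntegrable
    rw [Set.uIcc_of_le hab]
    intro x hx
    have hx0 : x ≠ 0 := by linarith [hx.1] |> ne_of_gt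
    apply ContinuousAt.continuousWithinAt
    fun_prop (disch := positivity)

lemma gauss_tail {b : ℂ} (hb : 0 ≤ b.re) (hb0 : b ≠ 0) {A M : ℝ} (hA : 0 < A) (hAM : A ≤ M) :
    ‖∫ u in A..M, Complex.exp (-b * (u : ℂ) ^ 2)‖ ≤ 3 / (2 * ‖b‖ * A) := by
  have hM : 0 < M := by linarith
  have hnb : 0 < ‖b‖ := norm_pos_iff.2 hb0
  have h := bp (G := fun u => 1 / u) (G' := fun u => - (1 / u ^ 2)) (E := fun u => Complex.exp (-b * (u : ℂ) ^ 2))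
    (E' := fun u => -(2 * b * u) * Complex.exp (-b * (u : ℂ) ^ 2)) hAM (M := 1 / A) ?_ ?_ ?_ ?_ ?_ ?_
  · have e : ∫ u in A..M, (((1 / u : ℝ) : ℂ)) * (-(2 * b * u) * Complex.exp (-b * (u : ℂ) ^ 2)) =
        (-(2 * b)) * ∫ u in A..M, Complex.exp (-b * (u : ℂ) ^ 2) := by
      rw [← intervalIntegral.integral_const_mul]
      apply intervalIntegral.integral_congr
      intro u hu
      rw [Set.uIcc_of_le hAM] at hu
      have hu0 : (u : ℂ) ≠ 0 := by
        have : u ≠ 0 := by linarith [hu.1] |> ne_of_gt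
        exact_mod_cast this
      simp only
      push_cast
      field_simp
    rw [e, norm_mul, norm_neg, norm_mul, Complex.norm_ofNat] at h
    rw [le_div_iff₀ (by positivity)]
    have h1 : |1 / A| = 1 / A := abs_of_pos (by positivity)
    have h2 : |1 / M| ≤ 1 / A := by rw [abs_of_pos (by positivity)]; gcongr
    rw [h1] at h
    calc _ = (2 * ‖b‖ * ‖∫ u in A..M, Complex.exp (-b * (u : ℂ) ^ 2)‖) * A := by ring
      _ ≤ (1 / A + 1 / A + 1 / A) * A := by gcongr; linarith
      _ = 3 := by field_simp; norm_num
  · intro x hx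
    have hx0 : x ≠ 0 := by linarith [hx.1] |> ne_of_gt
    have := hasDerivAt_inv hx0
    simp only [one_div]
    exact this
  · intro x hx
    have h1 : HasDerivAt (fun u : ℝ => -b * (u : ℂ) ^ 2) (-b * (2 * x)) x := by
      have := ((Complex.ofRealCLM.hasDerivAt (x := x)).pow 2).const_mul (-b)
      refine this.congr_deriv ?_
      simp
    refine h1.cexp.congr_deriv ?_
    ring
  · apply ContinuousOn.intervalIntegrable
    rw [Set.uIcc_of_le hAM]
    intro x hx
    have hx0 : x ≠ 0 := by linarith [hx.1] |> ne_of_gt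
    apply ContinuousAt.continuousWithinAt
    fun_prop (disch := positivity)
  · exact Continuous.intervalIntegrable (by fun_prop) _ _
  · intro x hx
    rw [Complex.norm_exp]
    have : (-b * (x : ℂ) ^ 2).re = - b.re * x ^ 2 := by
      rw [← Complex.ofReal_pow, Complex.re_mul_ofReal]; simp
    rw [this, Real.exp_le_one_iff]
    nlinarith [sq_nonneg x]
  · refine le_trans (le_of_eq ?_) (int_inv_sq hA hAM)
    apply intervalIntegral.integral_congr
    intro u _
    simp only [abs_neg]
    exact abs_of_nonneg (by positivity)

lemma gauss_head {b : ℂ} (hb : 0 < b.re) {A : ℝ} (hA : 0 < A) :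
    ‖(∫ u in (0 : ℝ)..A, Complex.exp (-b * (u : ℂ) ^ 2)) - (π / b) ^ (1 / 2 : ℂ) / 2‖ ≤ 3 / (2 * ‖b‖ * A) := by
  have hb0 : b ≠ 0 := by rintro rfl; simp at hb
  have hintg : Integrable (fun u : ℝ => Complex.exp (-b * (u : ℂ) ^ 2)) := integrable_cexp_neg_mul_sq hb
  have t := intervalIntegral_tendsto_integral_Ioi 0 hintg.integrableOn Filter.tendsto_id
  rw [integral_gaussian_complex_Ioi hb] at t
  have t2 := (tendsto_const_nhds (x := ∫ u in (0 : ℝ)..A, Complex.exp (-b * (u : ℂ) ^ 2))).sub t |>.norm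
  refine le_of_tendsto t2 ?_
  filter_upwards [Filter.eventually_ge_atTop A] with M hM
  have hi : ∀ x y : ℝ, IntervalIntegrable (fun u : ℝ => Complex.exp (-b * (u : ℂ) ^ 2)) volume x y :=
    fun x y => Continuous.intervalIntegrable (by fun_prop) _ _
  rw [← norm_neg, neg_sub, id, intervalIntegral.integral_interval_sub_left (hi _ _) (hi _ _)]
  exact gauss_tail hb.le hb0 hA hM

lemma fresnel {Θ A : ℝ} (hΘ : 0 < Θ) (hA : 0 < A) :
    ‖(∫ u in (0 : ℝ)..A, ee (Θ * u ^ 2)) - ee (1 / 8) / (2 * (√(2 * Θ) : ℝ))‖ ≤ 1 / (Θ * A) := by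
  let b : ℝ → ℂ := fun δ => (δ : ℂ) - (2 * π * Θ : ℝ) * Complex.I
  have hb : ∀ δ, (b δ).re = δ := by intro δ; simp [b]
  have hbi : ∀ δ, (b δ).im = -(2 * π * Θ) := by intro δ; simp [b]
  have hbn : ∀ δ, 2 * π * Θ ≤ ‖b δ‖ := by
    intro δ
    refine le_trans ?_ (Complex.abs_im_le_norm (b δ))
    rw [hbi, abs_neg]; exact le_abs_self _
  have hb00 : b 0 ≠ 0 := by
    intro h; have := hbi 0; rw [h] at this; simp at this
    exact hΘ.ne' this
  have hbc : Continuous b := by fun_prop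
  have key : ∀ δ > 0, ‖(∫ u in (0 : ℝ)..A, Complex.exp (-b δ * (u : ℂ) ^ 2)) - (π / b δ) ^ (1 / 2 : ℂ) / 2‖ ≤ 1 / (Θ * A) := by
    intro δ hδ
    refine (gauss_head (by rw [hb]; exact hδ) hA).trans ?_
    have h1 := hbn δ
    have : 0 < Θ * A := by positivity
    rw [div_le_div_iff₀ (by have := Real.pi_pos; have : 0 < ‖b δ‖ := lt_of_lt_of_le (by positivity) h1
                            positivity) this]
    nlinarith [Real.pi_gt_three, mul_pos hΘ hA]
  have hval : ((π : ℂ) / b 0) = ((1 / (2 * Θ) : ℝ) : ℂ) * Complex.I := by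
    have hp : (π : ℂ) ≠ 0 := by exact_mod_cast Real.pi_ne_zero
    have ht : (Θ : ℂ) ≠ 0 := by exact_mod_cast hΘ.ne'
    simp only [b]
    push_cast
    rw [zero_sub]
    have hI := Complex.I_ne_zero
    field_simp
    rw [Complex.I_sq]
  have hsq : ((π : ℂ) / b 0) ^ (1 / 2 : ℂ) / 2 = ee (1 / 8) / (2 * (√(2 * Θ) : ℝ)) := by
    have hx : (0:ℝ) < 1 / (2 * Θ) := by positivity
    have hxc : ((1 / (2 * Θ) : ℝ) : ℂ) ≠ 0 := by exact_mod_cast hx.ne'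
    have hs : √(2 * Θ) = Real.exp (-(Real.log (1 / (2 * Θ)) / 2)) := by
      rw [one_div, Real.log_inv, neg_div, neg_neg, Real.exp_half, Real.exp_log (by positivity)]
    rw [hval, Complex.cpow_def_of_ne_zero (mul_ne_zero hxc Complex.I_ne_zero),
      Complex.log_ofReal_mul hx Complex.I_ne_zero, Complex.log_I, hs]
    unfold ee
    rw [Complex.ofReal_exp, mul_comm (2 : ℂ), ← div_div (Complex.exp _), ← Complex.exp_sub]
    congr 2
    push_cast
    ring
  have hcont1 : Filter.Tendsto (fun δ : ℝ => ((π : ℂ) / b δ) ^ (1 / 2 : ℂ) / 2) (nhds 0) (nhds (((π : ℂ) / b 0) ^ (1 / 2 : ℂ) / 2)) := by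
    apply Filter.Tendsto.div_const
    refine (continuousAt_cpow_const ?_).tendsto.comp (tendsto_const_nhds.div (hbc.tendsto 0) hb00)
    · rw [hval]
      right
      have : 0 < 1 / (2 * Θ) := by positivity
      simp [hΘ.ne']
  have hcont2 : Filter.Tendsto (fun δ : ℝ => ∫ u in (0 : ℝ)..A, Complex.exp (-b δ * (u : ℂ) ^ 2)) (nhds 0) (nhds (∫ u in (0 : ℝ)..A, ee (Θ * u ^ 2))) := by
    have e : ∀ u : ℝ, ee (Θ * u ^ 2) = Complex.exp (-b 0 * (u : ℂ) ^ 2) := by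
      intro u; unfold ee; congr 1; simp only [b]; push_cast; ring
    simp_rw [e]
    exact (intervalIntegral.continuous_parametric_intervalIntegral_of_continuous' (f := fun δ u => Complex.exp (-b δ * (u : ℂ) ^ 2)) (by fun_prop) 0 A).tendsto 0
  have hT := ((hcont2.sub hcont1).norm).mono_left (nhdsWithin_le_nhds (s := Set.Ioi 0))
  rw [hsq] at hT
  refine le_of_tendsto hT ?_
  filter_upwards [self_mem_nhdsWithin] with δ hδ
  exact key δ hδ
end MSQ

namespace MSQ

structure Ph (p p1 p2 p3 : ℝ → ℝ) (K : ℝ) : Prop where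
  hK : 1 ≤ K
  d0 : ∀ x ∈ Set.Icc (0:ℝ) (1/2), HasDerivAt p (p1 x) x
  d1 : ∀ x ∈ Set.Icc (0:ℝ) (1/2), HasDerivAt p1 (p2 x) x
  d2 : ∀ x ∈ Set.Icc (0:ℝ) (1/2), HasDerivAt p2 (p3 x) x
  z0 : p 0 = 0
  z1 : p1 0 = 0
  lo : ∀ x ∈ Set.Icc (0:ℝ) (1/2), 1 / K ≤ p2 x
  hi : ∀ x ∈ Set.Icc (0:ℝ) (1/2), p2 x ≤ K
  b3 : ∀ x ∈ Set.Icc (0:ℝ) (1/2), |p3 x| ≤ K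

/-- comparison of two functions through their derivatives -/
lemma cmp {f g f' g' : ℝ → ℝ} (hf : ∀ x ∈ Set.Icc (0:ℝ) (1/2), HasDerivAt f (f' x) x)
    (hg : ∀ x ∈ Set.Icc (0:ℝ) (1/2), HasDerivAt g (g' x) x) (h0 : f 0 ≤ g 0)
    (h : ∀ x ∈ Set.Icc (0:ℝ) (1/2), f' x ≤ g' x) : ∀ x ∈ Set.Icc (0:ℝ) (1/2), f x ≤ g x := by
  have hd : ∀ x ∈ Set.Icc (0:ℝ) (1/2), HasDerivAt (fun x => g x - f x) (g' x - f' x) x :=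
    fun x hx => (hg x hx).sub (hf x hx)
  have : MonotoneOn (fun x => g x - f x) (Set.Icc (0:ℝ) (1/2)) := by
    apply monotoneOn_of_deriv_nonneg (convex_Icc _ _)
    · exact fun x hx => (hd x hx).continuousAt.continuousWithinAt
    · intro x hx; rw [interior_Icc] at hx
      exact (hd x ⟨hx.1.le, hx.2.le⟩).differentiableAt.differentiableWithinAt
    · intro x hx; rw [interior_Icc] at hx
      have hx' : x ∈ Set.Icc (0:ℝ) (1/2) := ⟨hx.1.le, hx.2.le⟩
      rw [(hd x hx').deriv]; linarith [h x hx']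
  intro x hx
  have := this ⟨le_rfl, by norm_num⟩ hx hx.1
  simp only at this
  linarith

lemma abs_cmp {f f' : ℝ → ℝ} {g g' : ℝ → ℝ} (hf : ∀ x ∈ Set.Icc (0:ℝ) (1/2), HasDerivAt f (f' x) x)
    (hg : ∀ x ∈ Set.Icc (0:ℝ) (1/2), HasDerivAt g (g' x) x) (h0 : f 0 = 0) (h1 : g 0 = 0)
    (h : ∀ x ∈ Set.Icc (0:ℝ) (1/2), |f' x| ≤ g' x) : ∀ x ∈ Set.Icc (0:ℝ) (1/2), |f x| ≤ g x := by
  intro x hx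
  rw [abs_le]
  constructor
  · have := cmp (fun x hx => (hg x hx).neg) hf (by simp [h0, h1]) (fun x hx => by linarith [abs_le.1 (h x hx)]) x hx
    simpa using this
  · exact cmp hf hg (by rw [h0, h1]) (fun x hx => (abs_le.1 (h x hx)).2) x hx

namespace Ph
variable {p p1 p2 p3 : ℝ → ℝ} {K : ℝ}

lemma lin (k x : ℝ) : HasDerivAt (fun x : ℝ => k * x) k x := by
  simpa using (hasDerivAt_id x).const_mul k
lemma quad (k x : ℝ) : HasDerivAt (fun x : ℝ => k * x ^ 2 / 2) (k * x) x := by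
  refine (((hasDerivAt_pow 2 x).const_mul k).div_const 2).congr_deriv ?_
  norm_num; ring
lemma cub (k x : ℝ) : HasDerivAt (fun x : ℝ => k * x ^ 3 / 3) (k * x ^ 2) x := by
  refine (((hasDerivAt_pow 3 x).const_mul k).div_const 3).congr_deriv ?_
  norm_num; ring

lemma p1lo (h : Ph p p1 p2 p3 K) : ∀ x ∈ Set.Icc (0:ℝ) (1/2), 1 / K * x ≤ p1 x :=
  cmp (fun x _ => lin _ x) h.d1 (by simp [h.z1]) h.lo
lemma p1hi (h : Ph p p1 p2 p3 K) : ∀ x ∈ Set.Icc (0:ℝ) (1/2), p1 x ≤ K * x :=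
  cmp h.d1 (fun x _ => lin _ x) (by simp [h.z1]) h.hi
lemma plo (h : Ph p p1 p2 p3 K) : ∀ x ∈ Set.Icc (0:ℝ) (1/2), 1 / K * x ^ 2 / 2 ≤ p x :=
  cmp (fun x _ => quad _ x) h.d0 (by simp [h.z0]) h.p1lo
lemma phi (h : Ph p p1 p2 p3 K) : ∀ x ∈ Set.Icc (0:ℝ) (1/2), p x ≤ K * x ^ 2 / 2 :=
  cmp h.d0 (fun x _ => quad _ x) (by simp [h.z0]) h.p1hi
lemma p2c (h : Ph p p1 p2 p3 K) : ∀ x ∈ Set.Icc (0:ℝ) (1/2), |p2 x - p2 0| ≤ K * x :=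
  abs_cmp (fun x hx => (h.d2 x hx).sub_const _) (fun x _ => lin _ x) (by simp) (by simp) h.b3
lemma Mb (h : Ph p p1 p2 p3 K) : ∀ x ∈ Set.Icc (0:ℝ) (1/2),
    |p1 x ^ 2 - 2 * p2 0 * p x| ≤ (2 * K ^ 2) * x ^ 3 / 3 := by
  have hK := h.hK
  refine abs_cmp (f' := fun x => 2 * p1 x * (p2 x - p2 0)) (fun x hx => ?_) (fun x _ => cub _ x) (by simp [h.z0, h.z1]) (by simp) (fun x hx => ?_)
  · refine (((h.d1 x hx).pow 2).sub ((h.d0 x hx).const_mul (2 * p2 0))).congr_deriv ?_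
    norm_num; ring
  · have hx00 := hx.1
    have h1 := h.p1lo x hx
    have h2 := h.p1hi x hx
    have h3 := h.p2c x hx
    have h4 : 0 ≤ p1 x := le_trans (mul_nonneg (by positivity) hx.1) h1
    rw [abs_mul, abs_mul, abs_of_nonneg h4, abs_two]
    calc 2 * p1 x * |p2 x - p2 0| ≤ 2 * (K * x) * (K * x) := by gcongr
      _ = _ := by ring

lemma ppos (h : Ph p p1 p2 p3 K) : ∀ x ∈ Set.Ioc (0:ℝ) (1/2), 0 < p x ∧ 0 < p1 x := by
  intro x hx
  have hK := h.hK
  have hx' : x ∈ Set.Icc (0:ℝ) (1/2) := ⟨hx.1.le, hx.2⟩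
  have hx0 := hx.1
  exact ⟨lt_of_lt_of_le (by positivity) (h.plo x hx'), lt_of_lt_of_le (by positivity) (h.p1lo x hx')⟩

noncomputable def w (p p2 : ℝ → ℝ) (x : ℝ) : ℝ := √(2 / p2 0) / (2 * √(p x))

lemma cpos (h : Ph p p1 p2 p3 K) : 0 < p2 0 ∧ 1 / K ≤ p2 0 ∧ p2 0 ≤ K := by
  have hK := h.hK
  have h0 : (0:ℝ) ∈ Set.Icc (0:ℝ) (1/2) := ⟨le_rfl, by norm_num⟩
  exact ⟨lt_of_lt_of_le (by positivity) (h.lo 0 h0), h.lo 0 h0, h.hi 0 h0⟩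

lemma v_sq (h : Ph p p1 p2 p3 K) : ∀ x ∈ Set.Ioc (0:ℝ) (1/2), (p1 x * w p p2 x) ^ 2 = p1 x ^ 2 / (2 * p2 0 * p x) := by
  intro x hx
  obtain ⟨hp, hp1⟩ := h.ppos x hx
  obtain ⟨hc, -, -⟩ := h.cpos
  unfold w
  rw [mul_pow, div_pow, mul_pow, Real.sq_sqrt (by positivity), Real.sq_sqrt hp.le]
  field_simp

lemma v_close (h : Ph p p1 p2 p3 K) : ∀ x ∈ Set.Ioc (0:ℝ) (1/2), |p1 x * w p p2 x - 1| ≤ K ^ 4 * x := by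
  intro x hx
  have hx' : x ∈ Set.Icc (0:ℝ) (1/2) := ⟨hx.1.le, hx.2⟩
  have hx0 := hx.1
  have hK := h.hK
  have hK0 : 0 < K := by linarith
  obtain ⟨hp, hp1⟩ := h.ppos x hx
  obtain ⟨hc, hc1, -⟩ := h.cpos
  have hv0 : 0 ≤ p1 x * w p p2 x := by unfold w; positivity
  have hs := h.v_sq x hx
  set v := p1 x * w p p2 x
  have h1 : |v - 1| ≤ |v ^ 2 - 1| := by
    rw [show v ^ 2 - 1 = (v - 1) * (v + 1) by ring, abs_mul]
    have : 1 ≤ |v + 1| := by rw [abs_of_nonneg] <;> linarith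
    nlinarith [abs_nonneg (v - 1)]
  refine h1.trans ?_
  have e : v ^ 2 - 1 = (p1 x ^ 2 - 2 * p2 0 * p x) / (2 * p2 0 * p x) := by
    rw [hs]; field_simp
  rw [e, abs_div, abs_of_pos (by positivity : 0 < 2 * p2 0 * p x), div_le_iff₀ (by positivity)]
  refine (h.Mb x hx').trans ?_
  have h3 : 1 / K * x ^ 2 / K ≤ 2 * p2 0 * p x := by
    have := h.plo x hx'
    calc 1 / K * x ^ 2 / K = 2 * (1 / K) * (1 / K * x ^ 2 / 2) := by ring
      _ ≤ _ := by gcongr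
  calc (2 * K ^ 2) * x ^ 3 / 3 ≤ K ^ 2 * x ^ 3 := by
        have : 0 < K ^ 2 * x ^ 3 := by positivity
        linarith
    _ = K ^ 4 * x * (1 / K * x ^ 2 / K) := by field_simp
    _ ≤ _ := by gcongr

lemma w_deriv (h : Ph p p1 p2 p3 K) : ∀ x ∈ Set.Ioc (0:ℝ) (1/2),
    HasDerivAt (w p p2) (- (w p p2 x * p1 x / (2 * p x))) x := by
  intro x hx
  have hx' : x ∈ Set.Icc (0:ℝ) (1/2) := ⟨hx.1.le, hx.2⟩
  obtain ⟨hp, hp1⟩ := h.ppos x hx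
  have h1 := ((h.d0 x hx').sqrt hp.ne').const_mul 2
  have hs : 0 < √(p x) := by positivity
  have h2 := (hasDerivAt_const x (√(2 / p2 0))).div h1 (by positivity)
  refine h2.congr_deriv ?_
  unfold w
  have : p x = √(p x) ^ 2 := (Real.sq_sqrt hp.le).symm
  rw [this]
  rw [Real.sqrt_sq hs.le]
  field_simp
  ring

/-- key bound for the derivative of the amplitude -/
lemma key (h : Ph p p1 p2 p3 K) : ∀ x ∈ Set.Ioc (0:ℝ) (1/2),
    |p2 x / p1 x ^ 2 - w p p2 x * p1 x / (2 * p x)| ≤ 8 * K ^ 15 / x := by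
  intro x hx
  have hx' : x ∈ Set.Icc (0:ℝ) (1/2) := ⟨hx.1.le, hx.2⟩
  have hx0 := hx.1
  have hK := h.hK
  have hK0 : 0 < K := by linarith
  obtain ⟨hp, hp1⟩ := h.ppos x hx
  obtain ⟨hc, hc1, hc2⟩ := h.cpos
  have hv0 : 0 ≤ p1 x * w p p2 x := by unfold w; positivity
  have hs := h.v_sq x hx
  have hv := h.v_close x hx
  have e : p2 x / p1 x ^ 2 - w p p2 x * p1 x / (2 * p x) =
      ((p2 x - p2 0) + p2 0 * (1 - (p1 x * w p p2 x) ^ 3)) / p1 x ^ 2 := by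
    rw [pow_succ (p1 x * w p p2 x) 2, hs]
    field_simp
    ring
  rw [e, abs_div, abs_of_pos (by positivity : 0 < p1 x ^ 2)]
  set v := p1 x * w p p2 x
  have hv2 : v ≤ 2 * K ^ 4 := by
    have := (abs_le.1 hv).2
    have h1 : K ^ 4 * x ≤ K ^ 4 * (1/2) := by gcongr; exact hx.2
    have h2 : 1 ≤ K ^ 4 := one_le_pow₀ hK
    linarith
  have h3 : |1 - v ^ 3| ≤ K ^ 4 * x * (7 * K ^ 8) := by
    rw [show 1 - v ^ 3 = -(v - 1) * (1 + v + v ^ 2) by ring, abs_mul, abs_neg]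
    rw [abs_of_nonneg (by positivity : 0 ≤ 1 + v + v ^ 2)]
    gcongr
    have h2 : 1 ≤ K ^ 4 := one_le_pow₀ hK
    have h5 : v ^ 2 ≤ (2 * K ^ 4) ^ 2 := by gcongr
    have h6 : K ^ 8 = (K ^ 4) ^ 2 := by ring
    rw [h6]; nlinarith
  have h4 : |(p2 x - p2 0) + p2 0 * (1 - v ^ 3)| ≤ 8 * K ^ 13 * x := by
    calc _ ≤ |p2 x - p2 0| + |p2 0 * (1 - v ^ 3)| := abs_add_le _ _
      _ ≤ K * x + K * (K ^ 4 * x * (7 * K ^ 8)) := by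
          rw [abs_mul, abs_of_pos hc]; gcongr; exact h.p2c x hx'
      _ = (K + 7 * K ^ 13) * x := by ring
      _ ≤ 8 * K ^ 13 * x := by
          gcongr
          have : K ≤ K ^ 13 := le_self_pow₀ hK (by norm_num)
          linarith
  rw [div_le_div_iff₀ (by positivity) hx0]
  have h6 : (x / K) ^ 2 ≤ p1 x ^ 2 := by
    have := h.p1lo x hx'
    have e : 1 / K * x = x / K := by ring
    rw [e] at this
    gcongr
  calc _ ≤ 8 * K ^ 13 * x * x := by gcongr
    _ = 8 * K ^ 15 * (x / K) ^ 2 := by field_simp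
    _ ≤ _ := by gcongr

lemma vint (h : Ph p p1 p2 p3 K) : IntegrableOn (fun x => p1 x * w p p2 x) (Set.Ioc 0 (1/2)) := by
  have hK := h.hK
  refine Integrable.mono' (g := fun _ => 1 + K ^ 4) (integrableOn_const (by simp)) ?_ ?_
  · apply ContinuousOn.aestronglyMeasurable _ measurableSet_Ioc
    intro x hx
    have hx' : x ∈ Set.Icc (0:ℝ) (1/2) := ⟨hx.1.le, hx.2⟩
    exact ((h.d1 x hx').continuousAt.mul (h.w_deriv x hx).continuousAt).continuousWithinAt
  · rw [ae_restrict_iff' measurableSet_Ioc]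
    filter_upwards with x hx
    have h1 := h.v_close x hx
    rw [Real.norm_eq_abs]
    calc |p1 x * w p p2 x| = |(p1 x * w p p2 x - 1) + 1| := by ring_nf
      _ ≤ |p1 x * w p p2 x - 1| + |(1:ℝ)| := abs_add_le _ _
      _ ≤ K ^ 4 * 1 + 1 := by
        rw [abs_one]; gcongr; refine h1.trans ?_; gcongr; linarith [hx.2]
      _ = _ := by ring

lemma pcont (h : Ph p p1 p2 p3 K) : ContinuousOn p (Set.Icc (0:ℝ) (1/2)) :=
  fun x hx => (h.d0 x hx).continuousAt.continuousWithinAt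

lemma vmain (h : Ph p p1 p2 p3 K) (Θ : ℝ) :
    ∫ x in (0:ℝ)..(1/2), ((p1 x * w p p2 x : ℝ) : ℂ) * ee (Θ * p x) =
      (√(2 / p2 0) : ℝ) * ∫ u in (0:ℝ)..√(p (1/2)), ee (Θ * u ^ 2) := by
  have hI : Set.uIcc (0:ℝ) (1/2) = Set.Icc 0 (1/2) := Set.uIcc_of_le (by norm_num)
  have key := intervalIntegral.integral_deriv_smul_comp''' (a := (0:ℝ)) (b := 1/2) (f := fun x => √(p x))
    (f' := fun x => p1 x / (2 * √(p x))) (g := fun u => ee (Θ * u ^ 2)) ?_ ?_ ?_ ?_ ?_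
  · simp only [h.z0, Real.sqrt_zero] at key
    rw [← key, ← intervalIntegral.integral_const_mul]
    apply intervalIntegral.integral_congr
    intro x hx
    rw [hI] at hx
    have : 0 ≤ p x := by
      have := h.plo x hx
      have hK := h.hK
      refine le_trans ?_ this
      positivity
    simp only [w, Function.comp, Real.sq_sqrt this, Complex.real_smul]
    push_cast
    ring
  · rw [hI]; exact h.pcont.sqrt
  · intro x hx
    rw [min_eq_left (by norm_num), max_eq_right (by norm_num)] at hx
    obtain ⟨hp, hp1⟩ := h.ppos x ⟨hx.1, hx.2.le⟩
    exact ((h.d0 x ⟨hx.1.le, hx.2.le⟩).sqrt hp.ne').hasDerivWithinAt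
  · have := ee_continuous
    exact Continuous.continuousOn (by fun_prop)
  · rw [hI]
    have hc : ContinuousOn (fun u => ee (Θ * u ^ 2)) ((fun x => √(p x)) '' Set.Icc 0 (1/2)) := by
      have := ee_continuous
      exact Continuous.continuousOn (by fun_prop)
    exact hc.integrableOn_compact (isCompact_Icc.image_of_continuousOn h.pcont.sqrt)
  · rw [hI, integrableOn_Icc_iff_integrableOn_Ioc]
    have h1 : IntegrableOn (fun x => p1 x / (2 * √(p x))) (Set.Ioc 0 (1/2)) := by
      have := h.vint.const_mul (1 / √(2 / p2 0))
      refine this.congr ?_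
      filter_upwards with x
      have : √(2 / p2 0) ≠ 0 := by have := h.cpos.1; positivity
      unfold w
      field_simp
    have hm : AEStronglyMeasurable (fun x => ee (Θ * (√(p x)) ^ 2)) (volume.restrict (Set.Ioc 0 (1/2))) := by
      apply ContinuousOn.aestronglyMeasurable _ measurableSet_Ioc
      have := ee_continuous
      have h2 := (h.pcont.sqrt).mono (Set.Ioc_subset_Icc_self (a := (0:ℝ)) (b := 1/2))
      exact this.comp_continuousOn (continuousOn_const.mul (h2.pow 2))
    have h3 : IntegrableOn (fun x => ee (Θ * (√(p x)) ^ 2) * ((p1 x / (2 * √(p x)) : ℝ) : ℂ)) (Set.Ioc 0 (1/2)) := by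
      refine Integrable.bdd_mul h1.ofReal hm (c := 1) ?_
      filter_upwards with x
      rw [ee_norm]
    refine h3.congr ?_
    filter_upwards with x
    simp only [Function.comp, Complex.real_smul]
    ring

lemma vfres (h : Ph p p1 p2 p3 K) {Θ : ℝ} (hΘ : 0 < Θ) :
    ‖(∫ x in (0:ℝ)..(1/2), ((p1 x * w p p2 x : ℝ) : ℂ) * ee (Θ * p x)) - ee (1 / 8) / (2 * (√(p2 0 * Θ) : ℝ))‖ ≤ 4 * K / Θ := by
  have hK := h.hK
  have hK0 : 0 < K := by linarith
  obtain ⟨hc, hc1, hc2⟩ := h.cpos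
  obtain ⟨hp, hp1⟩ := h.ppos (1/2) ⟨by norm_num, le_rfl⟩
  rw [h.vmain]
  have e : ee (1 / 8) / (2 * (√(p2 0 * Θ) : ℝ)) = (√(2 / p2 0) : ℝ) * (ee (1 / 8) / (2 * (√(2 * Θ) : ℝ))) := by
    have : √(2 / p2 0) * √(p2 0 * Θ) = √(2 * Θ) := by
      rw [← Real.sqrt_mul (by positivity)]; congr 1; field_simp
    rw [← this]
    have h1 : ((√(2 / p2 0) : ℝ) : ℂ) ≠ 0 := by
      have : √(2 / p2 0) ≠ 0 := by positivity
      exact_mod_cast this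
    push_cast
    field_simp
  rw [e, ← mul_sub, norm_mul, Complex.norm_real, Real.norm_eq_abs, abs_of_nonneg (Real.sqrt_nonneg _)]
  have hA : 0 < √(p (1/2)) := by positivity
  have hf := fresnel hΘ hA
  have h1 : √(2 / p2 0) ≤ √(2 * K) := by
    apply Real.sqrt_le_sqrt
    rw [div_le_iff₀ hc]
    rw [div_le_iff₀ hK0] at hc1
    nlinarith
  have h2 : √(1 / (8 * K)) ≤ √(p (1/2)) := by
    apply Real.sqrt_le_sqrt
    refine le_trans (le_of_eq ?_) (h.plo (1/2) ⟨by norm_num, le_rfl⟩)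
    field_simp; norm_num
  have h3 : √(2 * K) = 4 * K * √(1 / (8 * K)) := by
    rw [Real.sqrt_eq_iff_mul_self_eq (by positivity) (by positivity)]
    have := Real.mul_self_sqrt (by positivity : 0 ≤ 1 / (8 * K))
    symm
    calc _ = 16 * K ^ 2 * (√(1 / (8 * K)) * √(1 / (8 * K))) := by ring
      _ = _ := by rw [this]; field_simp; norm_num
  calc √(2 / p2 0) * _ ≤ √(2 * K) * (1 / (Θ * √(p (1/2)))) := by gcongr
    _ ≤ (4 * K * √(p (1/2))) * (1 / (Θ * √(p (1/2)))) := by rw [h3]; gcongr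
    _ = 4 * K / Θ := by field_simp
end Ph
end MSQ

namespace MSQ
namespace Ph
variable {p p1 p2 p3 : ℝ → ℝ} {K : ℝ}

lemma sp (h : Ph p p1 p2 p3 K) {g g' : ℝ → ℝ} {B Θ : ℝ} (hB : 1 ≤ B) (hΘ : 0 < Θ)
    (hg : ∀ x ∈ Set.Icc (0:ℝ) (1/2), HasDerivAt g (g' x) x)
    (hgc : ContinuousOn g' (Set.Icc (0:ℝ) (1/2)))
    (hg1 : ∀ x ∈ Set.Icc (0:ℝ) (1/2), |g x| ≤ 1) (hgB : ∀ x ∈ Set.Icc (0:ℝ) (1/2), |g' x| ≤ B) :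
    ‖(∫ x in (0:ℝ)..(1/2), (g x : ℂ) * ee (Θ * p x)) - g 0 * (ee (1 / 8) / (2 * (√(p2 0 * Θ) : ℝ)))‖
      ≤ 20 * K ^ 15 * B * (1 + |log Θ|) / Θ := by
  have hK := h.hK
  have hK0 : 0 < K := by linarith
  have h0m : (0:ℝ) ∈ Set.Icc (0:ℝ) (1/2) := ⟨le_rfl, by norm_num⟩
  have hg0 := hg1 0 h0m
  have hgd : ∀ x ∈ Set.Icc (0:ℝ) (1/2), |g x - g 0| ≤ B * x :=
    abs_cmp (fun x hx => (hg x hx).sub_const _) (fun x _ => lin _ x) (by simp) (by simp) hgB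
  set v : ℝ → ℝ := fun x => p1 x * w p p2 x with hv
  have hdiff : ∀ x ∈ Set.Ioc (0:ℝ) (1/2), |g x - g 0 * v x| ≤ 2 * B * K ^ 4 * x := by
    intro x hx
    have hx' : x ∈ Set.Icc (0:ℝ) (1/2) := ⟨hx.1.le, hx.2⟩
    have hx0 := hx.1
    have h1 := hgd x hx'
    have h2 := h.v_close x hx
    have hk4 : 1 ≤ K ^ 4 := one_le_pow₀ hK
    calc |g x - g 0 * v x| = |(g x - g 0) - g 0 * (v x - 1)| := by ring_nf
      _ ≤ |g x - g 0| + |g 0 * (v x - 1)| := abs_sub _ _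
      _ ≤ B * x + 1 * (K ^ 4 * x) := by rw [abs_mul]; gcongr
      _ ≤ B * K ^ 4 * x + B * K ^ 4 * x := by
          have q1 : B * x * 1 ≤ B * x * K ^ 4 := by gcongr
          have q2 : 1 * (K ^ 4 * x) ≤ B * (K ^ 4 * x) := by gcongr
          nlinarith
      _ = _ := by ring
  have hpc := h.pcont
  have hec : ContinuousOn (fun x => ee (Θ * p x)) (Set.Icc (0:ℝ) (1/2)) :=
    ee_continuous.comp_continuousOn (continuousOn_const.mul hpc)
  have hgcont : ContinuousOn g (Set.Icc (0:ℝ) (1/2)) := fun x hx => (hg x hx).continuousAt.continuousWithinAt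
  have hiv : IntervalIntegrable (fun x => ((v x : ℝ) : ℂ) * ee (Θ * p x)) volume 0 (1/2) := by
    rw [intervalIntegrable_iff_integrableOn_Ioc_of_le (by norm_num)]
    refine Integrable.mul_bdd (c := 1) h.vint.ofReal ?_ ?_
    · exact (hec.mono Set.Ioc_subset_Icc_self).aestronglyMeasurable measurableSet_Ioc
    · filter_upwards with x; rw [ee_norm]
  have hig : IntervalIntegrable (fun x => ((g x : ℝ) : ℂ) * ee (Θ * p x)) volume 0 (1/2) := by
    apply ContinuousOn.intervalIntegrable
    rw [Set.uIcc_of_le (by norm_num)]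
    exact (Complex.continuous_ofReal.comp_continuousOn hgcont).mul hec
  set f : ℝ → ℂ := fun x => ((g x - g 0 * v x : ℝ) : ℂ) * ee (Θ * p x) with hf
  have hfe : f = fun x => ((g x : ℝ) : ℂ) * ee (Θ * p x) - (g 0 : ℂ) * (((v x : ℝ) : ℂ) * ee (Θ * p x)) := by
    funext x; simp only [hf]; push_cast; ring
  have hif : IntervalIntegrable f volume 0 (1/2) := by
    rw [hfe]; exact hig.sub (hiv.const_mul _)
  have hfi : ∫ x in (0:ℝ)..(1/2), f x = (∫ x in (0:ℝ)..(1/2), (g x : ℂ) * ee (Θ * p x)) -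
      g 0 * ∫ x in (0:ℝ)..(1/2), ((v x : ℝ) : ℂ) * ee (Θ * p x) := by
    rw [hfe, intervalIntegral.integral_sub hig (hiv.const_mul _), intervalIntegral.integral_const_mul]
  -- splitting point
  set ε : ℝ := min (1/2) (1 / √Θ) with hε
  have hε0 : 0 < ε := by rw [hε]; positivity
  have hε1 : ε ≤ 1/2 := min_le_left _ _
  have hε2 : ε ^ 2 ≤ 1 / Θ := by
    have : ε ≤ 1 / √Θ := min_le_right _ _
    calc ε ^ 2 ≤ (1 / √Θ) ^ 2 := by gcongr
      _ = 1 / Θ := by rw [div_pow, Real.sq_sqrt hΘ.le, one_pow]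
  have hεl : log (1 / 2) - log ε ≤ |log Θ| := by
    rcases le_total (1/2) (1 / √Θ) with hc | hc
    · rw [hε, min_eq_left hc]; simp
    · rw [hε, min_eq_right hc, one_div (√Θ), Real.log_inv, Real.log_sqrt hΘ.le]
      have : log (1/2) ≤ 0 := Real.log_nonpos (by norm_num) (by norm_num)
      have := le_abs_self (log Θ)
      have := abs_nonneg (log Θ)
      linarith
  have hsub1 : IntervalIntegrable f volume 0 ε := hif.mono_set (by
    rw [Set.uIcc_of_le hε0.le, Set.uIcc_of_le (by norm_num)]; exact Set.Icc_subset_Icc le_rfl hε1)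
  have hsub2 : IntervalIntegrable f volume ε (1/2) := hif.mono_set (by
    rw [Set.uIcc_of_le hε1, Set.uIcc_of_le (by norm_num)]; exact Set.Icc_subset_Icc hε0.le le_rfl)
  have hsplit := intervalIntegral.integral_add_adjacent_intervals hsub1 hsub2
  have hA : ‖∫ x in (0:ℝ)..ε, f x‖ ≤ B * K ^ 4 / Θ := by
    have h1 : ‖∫ x in (0:ℝ)..ε, f x‖ ≤ ∫ x in (0:ℝ)..ε, 2 * B * K ^ 4 * x := by
      apply intervalIntegral.norm_integral_le_of_norm_le hε0.le
      · filter_upwards with x hx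
        rw [hf]; simp only
        rw [norm_mul, ee_norm, mul_one, Complex.norm_real, Real.norm_eq_abs]
        exact hdiff x ⟨hx.1, hx.2.trans hε1⟩
      · exact Continuous.intervalIntegrable (by fun_prop) _ _
    refine h1.trans ?_
    rw [intervalIntegral.integral_const_mul, integral_id]
    calc _ = B * K ^ 4 * ε ^ 2 := by ring
      _ ≤ B * K ^ 4 * (1 / Θ) := by gcongr
      _ = _ := by ring
  have hBd : ‖∫ x in ε..(1/2), f x‖ ≤ (4 * B * K ^ 5 + 10 * B * K ^ 15 * |log Θ|) / Θ := by
    set G : ℝ → ℝ := fun x => g x / p1 x - g 0 * w p p2 x with hG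
    set G' : ℝ → ℝ := fun x => (g' x * p1 x - g x * p2 x) / p1 x ^ 2 - g 0 * (-(w p p2 x * p1 x / (2 * p x))) with hG'
    have hm : ∀ x ∈ Set.Icc ε (1/2), x ∈ Set.Ioc (0:ℝ) (1/2) := fun x hx => ⟨lt_of_lt_of_le hε0 hx.1, hx.2⟩
    have hm' : ∀ x ∈ Set.Icc ε (1/2), x ∈ Set.Icc (0:ℝ) (1/2) := fun x hx => ⟨hε0.le.trans hx.1, hx.2⟩
    have hGd : ∀ x ∈ Set.Icc ε (1/2), HasDerivAt G (G' x) x := by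
      intro x hx
      exact ((hg x (hm' x hx)).div (h.d1 x (hm' x hx)) (h.ppos x (hm x hx)).2.ne').sub ((h.w_deriv x (hm x hx)).const_mul _)
    have hG'c : ContinuousOn G' (Set.Icc ε (1/2)) := by
      have c0 := hpc.mono hm'
      have c1 : ContinuousOn p1 (Set.Icc ε (1/2)) := fun x hx => (h.d1 x (hm' x hx)).continuousAt.continuousWithinAt
      have c2 : ContinuousOn p2 (Set.Icc ε (1/2)) := fun x hx => (h.d2 x (hm' x hx)).continuousAt.continuousWithinAt
      have cg := hgcont.mono hm'
      have cg' := hgc.mono hm'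
      have cw : ContinuousOn (w p p2) (Set.Icc ε (1/2)) := fun x hx => (h.w_deriv x (hm x hx)).continuousAt.continuousWithinAt
      refine ContinuousOn.sub (ContinuousOn.div ((cg'.mul c1).sub (cg.mul c2)) (c1.pow 2) ?_) (continuousOn_const.mul (ContinuousOn.neg (ContinuousOn.div (cw.mul c1) (continuousOn_const.mul c0) ?_)))
      · intro x hx; have := (h.ppos x (hm x hx)).2; positivity
      · intro x hx; have := (h.ppos x (hm x hx)).1; positivity
    have hG'i : IntervalIntegrable G' volume ε (1/2) := by
      apply ContinuousOn.intervalIntegrable; rwa [Set.uIcc_of_le hε1]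
    have hGb : ∀ x ∈ Set.Icc ε (1/2), |G x| ≤ 2 * B * K ^ 5 := by
      intro x hx
      obtain ⟨hp, hp1⟩ := h.ppos x (hm x hx)
      have hx0 := (hm x hx).1
      have e : G x = (g x - g 0 * v x) / p1 x := by simp only [hG, hv]; field_simp
      rw [e, abs_div, abs_of_pos hp1, div_le_iff₀ hp1]
      refine (hdiff x (hm x hx)).trans ?_
      have := h.p1lo x (hm' x hx)
      calc 2 * B * K ^ 4 * x = 2 * B * K ^ 5 * (1 / K * x) := by field_simp
        _ ≤ _ := by gcongr
    have hG'b : ∀ x ∈ Set.Icc ε (1/2), |G' x| ≤ 10 * B * K ^ 15 * x⁻¹ := by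
      intro x hx
      obtain ⟨hp, hp1⟩ := h.ppos x (hm x hx)
      have hx0 := (hm x hx).1
      have hkey := h.key x (hm x hx)
      have hlo := h.p1lo x (hm' x hx)
      have e : G' x = g' x / p1 x - (g x - g 0) * (p2 x / p1 x ^ 2) - g 0 * (p2 x / p1 x ^ 2 - w p p2 x * p1 x / (2 * p x)) := by
        simp only [hG']; field_simp; ring
      have t1 : |g' x / p1 x| ≤ B * K ^ 15 * x⁻¹ := by
        rw [abs_div, abs_of_pos hp1, div_le_iff₀ hp1]
        refine (hgB x (hm' x hx)).trans ?_
        have hk : K ≤ K ^ 15 := le_self_pow₀ hK (by norm_num)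
        calc B = B * K * x⁻¹ * (1 / K * x) := by field_simp
          _ ≤ _ := by gcongr
      have t2 : |(g x - g 0) * (p2 x / p1 x ^ 2)| ≤ B * K ^ 15 * x⁻¹ := by
        have hp2 : 0 < p2 x := lt_of_lt_of_le (by positivity) (h.lo x (hm' x hx))
        rw [abs_mul, abs_of_pos (by positivity : 0 < p2 x / p1 x ^ 2), mul_div_assoc', div_le_iff₀ (by positivity)]
        have hk : K ^ 3 ≤ K ^ 15 := pow_le_pow_right₀ hK (by norm_num)
        calc _ ≤ B * x * K := by gcongr; exact hgd x (hm' x hx); exact h.hi x (hm' x hx)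
          _ = B * K ^ 3 * x⁻¹ * (1 / K * x) ^ 2 := by field_simp
          _ ≤ _ := by gcongr
      have t3 : |g 0 * (p2 x / p1 x ^ 2 - w p p2 x * p1 x / (2 * p x))| ≤ 8 * B * K ^ 15 * x⁻¹ := by
        rw [abs_mul]
        calc _ ≤ 1 * (8 * K ^ 15 / x) := by gcongr
          _ = 8 * 1 * K ^ 15 * x⁻¹ := by ring
          _ ≤ _ := by gcongr
      rw [e]
      calc _ ≤ |g' x / p1 x| + |(g x - g 0) * (p2 x / p1 x ^ 2)| + |g 0 * (p2 x / p1 x ^ 2 - w p p2 x * p1 x / (2 * p x))| := by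
            refine (abs_sub _ _).trans ?_
            gcongr
            exact abs_sub _ _
        _ ≤ _ := by linarith
    have hM : ∫ x in ε..(1/2), |G' x| ≤ 10 * B * K ^ 15 * |log Θ| := by
      have hinv : IntervalIntegrable (fun x : ℝ => x⁻¹) volume ε (1/2) := by
        apply ContinuousOn.intervalIntegrable; rw [Set.uIcc_of_le hε1]
        exact ContinuousOn.inv₀ continuousOn_id (fun x hx => (hm x hx).1.ne')
      calc _ ≤ ∫ x in ε..(1/2), 10 * B * K ^ 15 * x⁻¹ :=
            intervalIntegral.integral_mono_on hε1 hG'i.abs (hinv.const_mul _) hG'b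
        _ = 10 * B * K ^ 15 * (log (1/2) - log ε) := by
            rw [intervalIntegral.integral_const_mul, integral_inv_of_pos hε0 (by norm_num), Real.log_div (by norm_num) hε0.ne']
        _ ≤ _ := by gcongr
    have hEd : ∀ x ∈ Set.Icc ε (1/2), HasDerivAt (fun x => ee (Θ * p x)) ((2 * π * (Θ * p1 x) : ℝ) * Complex.I * ee (Θ * p x)) x :=
      fun x hx => ee_deriv ((h.d0 x (hm' x hx)).const_mul Θ)
    have hE'i : IntervalIntegrable (fun x => ((2 * π * (Θ * p1 x) : ℝ) : ℂ) * Complex.I * ee (Θ * p x)) volume ε (1/2) := by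
      apply ContinuousOn.intervalIntegrable; rw [Set.uIcc_of_le hε1]
      have c1 : ContinuousOn p1 (Set.Icc ε (1/2)) := fun x hx => (h.d1 x (hm' x hx)).continuousAt.continuousWithinAt
      exact ((Complex.continuous_ofReal.comp_continuousOn (continuousOn_const.mul (continuousOn_const.mul c1))).mul continuousOn_const).mul (hec.mono hm')
    have hbp := bp hε1 hGd hEd hG'i hE'i (fun x _ => (ee_norm _).le) hM
    have e : ∫ x in ε..(1/2), (G x : ℂ) * ((2 * π * (Θ * p1 x) : ℝ) * Complex.I * ee (Θ * p x)) = ((2 * π * Θ : ℝ) * Complex.I) * ∫ x in ε..(1/2), f x := by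
      rw [← intervalIntegral.integral_const_mul]
      apply intervalIntegral.integral_congr
      intro x hx
      rw [Set.uIcc_of_le hε1] at hx
      obtain ⟨hp, hp1⟩ := h.ppos x (hm x hx)
      have e : g x - g 0 * v x = G x * p1 x := by simp only [hG, hv]; field_simp
      simp only [hf, e]
      push_cast
      ring
    rw [e, norm_mul, norm_mul, Complex.norm_I, mul_one, Complex.norm_real, Real.norm_eq_abs, abs_of_pos (by positivity)] at hbp
    have g1 := hGb ε ⟨le_rfl, hε1⟩
    have g2 := hGb (1/2) ⟨hε1, le_rfl⟩
    rw [le_div_iff₀ hΘ]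
    have hpi : 1 ≤ 2 * π := by linarith [Real.pi_gt_three]
    calc _ ≤ (2 * π) * (‖∫ x in ε..(1/2), f x‖ * Θ) := le_mul_of_one_le_left (by positivity) hpi
      _ = 2 * π * Θ * ‖∫ x in ε..(1/2), f x‖ := by ring
      _ ≤ _ := by linarith
  have hres : (∫ x in (0:ℝ)..(1/2), (g x : ℂ) * ee (Θ * p x)) - g 0 * (ee (1 / 8) / (2 * (√(p2 0 * Θ) : ℝ))) =
      (∫ x in (0:ℝ)..ε, f x) + (∫ x in ε..(1/2), f x) + g 0 * ((∫ x in (0:ℝ)..(1/2), ((v x : ℝ) : ℂ) * ee (Θ * p x)) - (ee (1 / 8) / (2 * (√(p2 0 * Θ) : ℝ)))) := by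
    rw [hsplit, hfi]; ring
  have hlast : ‖(g 0 : ℂ) * ((∫ x in (0:ℝ)..(1/2), ((v x : ℝ) : ℂ) * ee (Θ * p x)) - (ee (1 / 8) / (2 * (√(p2 0 * Θ) : ℝ))))‖ ≤ 1 * (4 * K / Θ) := by
    rw [norm_mul, Complex.norm_real, Real.norm_eq_abs]
    gcongr
    exact h.vfres hΘ
  rw [hres]
  refine (norm_add₃_le).trans ?_
  refine (add_le_add (add_le_add hA hBd) hlast).trans ?_
  rw [one_mul, ← add_div, ← add_div]
  gcongr
  have k1 : K ≤ K ^ 15 := le_self_pow₀ hK (by norm_num)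
  have k4 : K ^ 4 ≤ K ^ 15 := pow_le_pow_right₀ hK (by norm_num)
  have k5 : K ^ 5 ≤ K ^ 15 := pow_le_pow_right₀ hK (by norm_num)
  have l0 := abs_nonneg (log Θ)
  have hk0 : 0 < K ^ 15 := by positivity
  calc _ ≤ B * K ^ 15 + (4 * B * K ^ 15 + 10 * B * K ^ 15 * |log Θ|) + 4 * (B * K ^ 15) := by
        gcongr; nlinarith
    _ ≤ _ := by nlinarith [mul_nonneg (mul_nonneg (by linarith : 0 ≤ B) hk0.le) l0, mul_pos (by linarith : 0 < B) hk0]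
end Ph
end MSQ

namespace MSQ

/-- first derivative test -/
lemma fdt {P P1 P2 W W' : ℝ → ℝ} {α β M : ℝ} (hab : α ≤ β)
    (hP : ∀ x ∈ Set.Icc α β, HasDerivAt P (P1 x) x) (hP1 : ∀ x ∈ Set.Icc α β, HasDerivAt P1 (P2 x) x)
    (hP2 : ContinuousOn P2 (Set.Icc α β)) (hW : ∀ x ∈ Set.Icc α β, HasDerivAt W (W' x) x)
    (hW' : ContinuousOn W' (Set.Icc α β)) (hne : ∀ x ∈ Set.Icc α β, P1 x ≠ 0)
    (hM : ∫ x in α..β, |(W' x * P1 x - W x * P2 x) / P1 x ^ 2| ≤ M) :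
    ‖∫ x in α..β, (W x : ℂ) * ee (P x)‖ ≤ |W α / P1 α| + |W β / P1 β| + M := by
  have cP : ContinuousOn P (Set.Icc α β) := fun x hx => (hP x hx).continuousAt.continuousWithinAt
  have cP1 : ContinuousOn P1 (Set.Icc α β) := fun x hx => (hP1 x hx).continuousAt.continuousWithinAt
  have cW : ContinuousOn W (Set.Icc α β) := fun x hx => (hW x hx).continuousAt.continuousWithinAt
  have hbp := bp (G := fun x => W x / P1 x) (G' := fun x => (W' x * P1 x - W x * P2 x) / P1 x ^ 2)
    (E := fun x => ee (P x)) (E' := fun x => (2 * π * P1 x : ℝ) * Complex.I * ee (P x)) hab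
    (fun x hx => (hW x hx).div (hP1 x hx) (hne x hx)) (fun x hx => ee_deriv (hP x hx)) ?_ ?_
    (fun x _ => (ee_norm _).le) hM
  · have e : ∫ x in α..β, ((W x / P1 x : ℝ) : ℂ) * ((2 * π * P1 x : ℝ) * Complex.I * ee (P x)) =
        ((2 * π : ℝ) * Complex.I) * ∫ x in α..β, (W x : ℂ) * ee (P x) := by
      rw [← intervalIntegral.integral_const_mul]
      apply intervalIntegral.integral_congr
      intro x hx
      rw [Set.uIcc_of_le hab] at hx
      have : (P1 x : ℂ) ≠ 0 := by exact_mod_cast hne x hx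
      simp only
      push_cast
      field_simp
    rw [e, norm_mul, norm_mul, Complex.norm_I, mul_one, Complex.norm_real, Real.norm_eq_abs, abs_of_pos (by positivity)] at hbp
    have hpi : 1 ≤ 2 * π := by linarith [Real.pi_gt_three]
    refine le_trans ?_ hbp
    exact le_mul_of_one_le_left (by positivity) hpi
  · apply ContinuousOn.intervalIntegrable; rw [Set.uIcc_of_le hab]
    exact ((hW'.mul cP1).sub (cW.mul hP2)).div (cP1.pow 2) (fun x hx => pow_ne_zero 2 (hne x hx))
  · apply ContinuousOn.intervalIntegrable; rw [Set.uIcc_of_le hab]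
    exact ((Complex.continuous_ofReal.comp_continuousOn (continuousOn_const.mul cP1)).mul continuousOn_const).mul (ee_continuous.comp_continuousOn cP)

noncomputable def qf (θ s : ℝ) : ℝ := s ^ (-θ) / θ + s
noncomputable def qf1 (θ s : ℝ) : ℝ := 1 - s ^ (-θ - 1)
noncomputable def qf2 (θ s : ℝ) : ℝ := (1 + θ) * s ^ (-θ - 2)
noncomputable def qf3 (θ s : ℝ) : ℝ := -((1 + θ) * (2 + θ) * s ^ (-θ - 3))

lemma qf_d {θ s : ℝ} (hθ : 0 < θ) (hs : 0 < s) : HasDerivAt (qf θ) (qf1 θ s) s := by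
  refine (((Real.hasDerivAt_rpow_const (Or.inl hs.ne')).div_const θ).add (hasDerivAt_id s)).congr_deriv ?_
  unfold qf1; field_simp; ring
lemma qf1_d {θ s : ℝ} (hs : 0 < s) : HasDerivAt (qf1 θ) (qf2 θ s) s := by
  refine ((Real.hasDerivAt_rpow_const (Or.inl hs.ne')).const_sub 1).congr_deriv ?_
  unfold qf2; rw [show -θ - 1 - 1 = -θ - 2 by ring]; ring
lemma qf2_d {θ s : ℝ} (hs : 0 < s) : HasDerivAt (qf2 θ) (qf3 θ s) s := by
  refine ((Real.hasDerivAt_rpow_const (Or.inl hs.ne')).const_mul (1 + θ)).congr_deriv ?_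
  unfold qf3; rw [show -θ - 2 - 1 = -θ - 3 by ring]; ring

noncomputable def KK (θ : ℝ) : ℝ := (1 + θ) * (2 + θ) * 2 ^ (θ + 3)

lemma qf_bounds {θ : ℝ} (hθ : 0 < θ) : 1 ≤ KK θ ∧ ∀ s ∈ Set.Icc (1/2 : ℝ) (3/2),
    1 / KK θ ≤ qf2 θ s ∧ qf2 θ s ≤ KK θ ∧ |qf3 θ s| ≤ KK θ := by
  have h2 : 1 ≤ (2:ℝ) ^ (θ + 3) := Real.one_le_rpow (by norm_num) (by linarith)
  have hK1 : 1 ≤ KK θ := by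
    unfold KK
    have : 1 ≤ (1 + θ) * (2 + θ) := by nlinarith
    nlinarith
  refine ⟨hK1, ?_⟩
  intro s hs
  have hs0 : 0 < s := by linarith [hs.1]
  have hup : ∀ k : ℝ, 0 ≤ k → k ≤ θ + 3 → s ^ (-k) ≤ 2 ^ (θ + 3) := by
    intro k hk hk2
    calc s ^ (-k) ≤ (1/2 : ℝ) ^ (-k) := Real.rpow_le_rpow_of_nonpos (by norm_num) hs.1 (by linarith)
      _ = 2 ^ k := by rw [one_div, Real.inv_rpow (by norm_num), Real.rpow_neg (by norm_num), inv_inv]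
      _ ≤ _ := Real.rpow_le_rpow_of_exponent_le (by norm_num) hk2
  have hlo : (2 ^ (θ + 3))⁻¹ ≤ s ^ (-θ - 2) := by
    calc ((2:ℝ) ^ (θ + 3))⁻¹ = 2 ^ (-θ - 3) := by rw [← Real.rpow_neg (by norm_num)]; ring_nf
      _ ≤ 2 ^ (-θ - 2) := Real.rpow_le_rpow_of_exponent_le (by norm_num) (by linarith)
      _ ≤ _ := Real.rpow_le_rpow_of_nonpos hs0 (by linarith [hs.2]) (by linarith)
  have hp2 : (0:ℝ) < 2 ^ (θ + 3) := by positivity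
  refine ⟨?_, ?_, ?_⟩
  · unfold qf2
    calc 1 / KK θ ≤ 1 / 2 ^ (θ + 3) := by
          apply one_div_le_one_div_of_le hp2
          unfold KK
          have : 1 ≤ (1 + θ) * (2 + θ) := by nlinarith
          nlinarith
      _ ≤ 1 * s ^ (-θ - 2) := by rw [one_div, one_mul]; exact hlo
      _ ≤ _ := by gcongr; linarith
  · unfold qf2 KK
    have := hup (θ + 2) (by linarith) (by linarith)
    rw [show -(θ + 2) = -θ - 2 by ring] at this
    calc _ ≤ (1 + θ) * 2 ^ (θ + 3) := by gcongr
      _ ≤ (1 + θ) * (2 + θ) * 2 ^ (θ + 3) := by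
          gcongr
          nlinarith
  · unfold qf3 KK
    have := hup (θ + 3) (by linarith) (by linarith)
    rw [show -(θ + 3) = -θ - 3 by ring] at this
    rw [abs_neg, abs_of_pos (by positivity)]
    gcongr

lemma ph_right {θ : ℝ} (hθ : 0 < θ) : Ph (fun x => qf θ (1 + x) - qf θ 1) (fun x => qf1 θ (1 + x))
    (fun x => qf2 θ (1 + x)) (fun x => qf3 θ (1 + x)) (KK θ) := by
  obtain ⟨h1, h2⟩ := qf_bounds hθ
  have hm : ∀ x ∈ Set.Icc (0:ℝ) (1/2), 1 + x ∈ Set.Icc (1/2:ℝ) (3/2) := fun x hx => ⟨by linarith [hx.1], by linarith [hx.2]⟩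
  refine ⟨h1, ?_, ?_, ?_, by simp, by simp [qf1], fun x hx => (h2 _ (hm x hx)).1, fun x hx => (h2 _ (hm x hx)).2.1, fun x hx => (h2 _ (hm x hx)).2.2⟩
  · intro x hx
    exact ((qf_d hθ (by linarith [hx.1])).comp_const_add 1 x).sub_const _
  · intro x hx
    exact ((qf1_d (by linarith [hx.1])).comp_const_add 1 x)
  · intro x hx
    exact ((qf2_d (by linarith [hx.1])).comp_const_add 1 x)

lemma ph_left {θ : ℝ} (hθ : 0 < θ) : Ph (fun x => qf θ (1 - x) - qf θ 1) (fun x => -qf1 θ (1 - x))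
    (fun x => qf2 θ (1 - x)) (fun x => -qf3 θ (1 - x)) (KK θ) := by
  obtain ⟨h1, h2⟩ := qf_bounds hθ
  have hm : ∀ x ∈ Set.Icc (0:ℝ) (1/2), 1 - x ∈ Set.Icc (1/2:ℝ) (3/2) := fun x hx => ⟨by linarith [hx.2], by linarith [hx.1]⟩
  refine ⟨h1, ?_, ?_, ?_, by simp, by simp [qf1], fun x hx => (h2 _ (hm x hx)).1, fun x hx => (h2 _ (hm x hx)).2.1, fun x hx => by rw [abs_neg]; exact (h2 _ (hm x hx)).2.2⟩
  · intro x hx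
    exact ((qf_d hθ (by linarith [hx.2])).comp_const_sub 1 x).sub_const _
  · intro x hx
    exact (((qf1_d (by linarith [hx.2])).comp_const_sub 1 x).neg).congr_deriv (by ring)
  · intro x hx
    exact ((qf2_d (by linarith [hx.2])).comp_const_sub 1 x)

structure Amp (g g' : ℝ → ℝ) (B : ℝ) : Prop where
  hB : 1 ≤ B
  d : ∀ s, 0 < s → HasDerivAt g (g' s) s
  c : ContinuousOn g' (Set.Ioi 0)
  b0 : ∀ s, 0 < s → |g s| ≤ 1
  b1 : ∀ s, 0 < s → |g' s| ≤ B / s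

lemma sp_near {θ : ℝ} (hθ : 0 < θ) {g g' : ℝ → ℝ} {B Θ : ℝ} (h : Amp g g' B) (hΘ : 0 < Θ) :
    ‖(∫ s in (1/2:ℝ)..(3/2), (g s : ℂ) * ee (Θ * qf θ s)) - g 1 * (ee (Θ * qf θ 1 + 1 / 8) / (√((1 + θ) * Θ) : ℝ))‖
      ≤ 80 * (KK θ) ^ 15 * B * (1 + |log Θ|) / Θ := by
  have hB := h.hB
  have hR := (ph_right hθ).sp (g := fun x => g (1 + x)) (g' := fun x => g' (1 + x)) (B := 2 * B) (by linarith) hΘ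
    (fun x hx => (h.d _ (by linarith [hx.1])).comp_const_add 1 x)
    (h.c.comp (by fun_prop) (fun x hx => by simp only [Set.mem_Ioi]; linarith [hx.1]))
    (fun x hx => h.b0 _ (by linarith [hx.1]))
    (fun x hx => (h.b1 _ (by linarith [hx.1])).trans (by
      rw [div_le_iff₀ (by linarith [hx.1])]; nlinarith [hx.1]))
  have hL := (ph_left hθ).sp (g := fun x => g (1 - x)) (g' := fun x => -g' (1 - x)) (B := 2 * B) (by linarith) hΘ
    (fun x hx => (h.d _ (by linarith [hx.2])).comp_const_sub 1 x)
    ((h.c.comp (by fun_prop) (fun x hx => by simp only [Set.mem_Ioi]; linarith [hx.2])).neg)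
    (fun x hx => h.b0 _ (by linarith [hx.2]))
    (fun x hx => by rw [abs_neg]; exact (h.b1 _ (by linarith [hx.2])).trans (by
      rw [div_le_iff₀ (by linarith [hx.2])]; nlinarith [hx.2]))
  have hci : ∀ α β : ℝ, 0 < α → 0 < β → IntervalIntegrable (fun s => (g s : ℂ) * ee (Θ * qf θ s)) volume α β := by
    intro α β hα hβ
    apply ContinuousOn.intervalIntegrable
    intro s hs
    have hs0 : 0 < s := lt_of_lt_of_le (lt_min hα hβ) hs.1
    apply ContinuousAt.continuousWithinAt
    exact (Complex.continuous_ofReal.continuousAt.comp (h.d s hs0).continuousAt).mul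
      (ee_continuous.continuousAt.comp (continuousAt_const.mul (qf_d hθ hs0).continuousAt))
  have hsplit := intervalIntegral.integral_add_adjacent_intervals (hci (1/2) 1 (by norm_num) (by norm_num)) (hci 1 (3/2) (by norm_num) (by norm_num))
  have eR : ∫ s in (1:ℝ)..(3/2), (g s : ℂ) * ee (Θ * qf θ s) = ee (Θ * qf θ 1) * ∫ x in (0:ℝ)..(1/2), (g (1 + x) : ℂ) * ee (Θ * (qf θ (1 + x) - qf θ 1)) := by
    have := intervalIntegral.integral_comp_add_left (a := 0) (b := 1/2) (fun s => (g s : ℂ) * ee (Θ * qf θ s)) 1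
    rw [show (1:ℝ) + 0 = 1 by norm_num, show (1:ℝ) + 1/2 = 3/2 by norm_num] at this
    rw [← this, ← intervalIntegral.integral_const_mul]
    congr 1; funext x
    rw [mul_left_comm, ← ee_add]; congr 2; ring
  have eL : ∫ s in (1/2:ℝ)..1, (g s : ℂ) * ee (Θ * qf θ s) = ee (Θ * qf θ 1) * ∫ x in (0:ℝ)..(1/2), (g (1 - x) : ℂ) * ee (Θ * (qf θ (1 - x) - qf θ 1)) := by
    have := intervalIntegral.integral_comp_sub_left (a := 0) (b := 1/2) (fun s => (g s : ℂ) * ee (Θ * qf θ s)) 1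
    rw [show (1:ℝ) - 0 = 1 by norm_num, show (1:ℝ) - 1/2 = 1/2 by norm_num] at this
    rw [← this, ← intervalIntegral.integral_const_mul]
    congr 1; funext x
    rw [mul_left_comm, ← ee_add]; congr 2; ring
  have hq2 : qf2 θ 1 = 1 + θ := by simp [qf2]
  simp only [add_zero, sub_zero, hq2] at hR hL
  rw [← hsplit, eL, eR, ee_add]
  have e2 : ∀ X Y : ℂ, ee (Θ * qf θ 1) * X + ee (Θ * qf θ 1) * Y - g 1 * (ee (Θ * qf θ 1) * ee (1 / 8) / (√((1 + θ) * Θ) : ℝ)) =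
     ee (Θ * qf θ 1) * ((X - g 1 * (ee (1 / 8) / (2 * (√((1 + θ) * Θ) : ℝ)))) + (Y - g 1 * (ee (1 / 8) / (2 * (√((1 + θ) * Θ) : ℝ))))) := by
    intro X Y
    have : ((√((1 + θ) * Θ) : ℝ) : ℂ) ≠ 0 := by
      have : √((1 + θ) * Θ) ≠ 0 := by positivity
      exact_mod_cast this
    field_simp
    ring
  rw [e2, norm_mul, ee_norm, one_mul]
  refine (norm_add_le _ _).trans ((add_le_add hL hR).trans (le_of_eq ?_))
  ring
end MSQ

namespace MSQ

lemma sp_far_left {θ : ℝ} (hθ : 0 < θ) {g g' : ℝ → ℝ} {B Θ s0 : ℝ} (h : Amp g g' B) (hΘ : 0 < Θ) (hs0 : 0 < s0)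
    (hs1 : s0 ≤ 1/2) :
    ‖∫ s in s0..(1/2), (g s : ℂ) * ee (Θ * qf θ s)‖ ≤ (10 + 4 * θ) * B / Θ := by
  have hB := h.hB
  have hpos : ∀ s ∈ Set.Icc s0 (1/2), 0 < s := fun s hs => lt_of_lt_of_le hs0 hs.1
  have hq1 : ∀ s ∈ Set.Icc s0 (1/2), s ^ (-θ - 1) / 2 ≤ -qf1 θ s := by
    intro s hs
    have hs' := hpos s hs
    unfold qf1
    have : 2 ≤ s ^ (-θ - 1) := by
      calc (2:ℝ) = (1/2 : ℝ) ^ (-1 : ℝ) := by rw [Real.rpow_neg_one]; norm_num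
        _ ≤ s ^ (-1 : ℝ) := Real.rpow_le_rpow_of_nonpos hs' hs.2 (by norm_num)
        _ ≤ s ^ (-θ - 1) := Real.rpow_le_rpow_of_exponent_ge hs' (by linarith [hs.2]) (by linarith)
    linarith
  have hne : ∀ s ∈ Set.Icc s0 (1/2), 0 < -qf1 θ s := fun s hs => lt_of_lt_of_le (by have := hpos s hs; positivity) (hq1 s hs)
  have hsm : ∀ s ∈ Set.Icc s0 (1/2), s ^ (θ + 1) ≤ 1/2 ∧ s ^ θ ≤ 1 := by
    intro s hs
    have hs' := hpos s hs
    constructor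
    · calc s ^ (θ + 1) ≤ s ^ (1:ℝ) := Real.rpow_le_rpow_of_exponent_ge hs' (by linarith [hs.2]) (by linarith)
        _ ≤ _ := by rw [Real.rpow_one]; exact hs.2
    · exact Real.rpow_le_one hs'.le (by linarith [hs.2]) hθ.le
  have hinv : ∀ s ∈ Set.Icc s0 (1/2), 1 / (-qf1 θ s) ≤ 2 * s ^ (θ + 1) := by
    intro s hs
    have hs' := hpos s hs
    rw [div_le_iff₀ (hne s hs)]
    calc (1:ℝ) = 2 * s ^ (θ + 1) * (s ^ (-θ - 1) / 2) := by
          rw [show -θ - 1 = -(θ + 1) by ring, Real.rpow_neg hs'.le]; field_simp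
      _ ≤ _ := by have := hq1 s hs; gcongr
  have hGb : ∀ s ∈ Set.Icc s0 (1/2), |g s / (Θ * qf1 θ s)| ≤ 1 / Θ := by
    intro s hs
    have e : g s / (Θ * qf1 θ s) = - (g s * (1 / (-qf1 θ s)) / Θ) := by
      have := (hne s hs).ne'
      have h2 : qf1 θ s ≠ 0 := by simpa using this
      field_simp
    rw [e, abs_neg, abs_div, abs_of_pos hΘ]
    gcongr
    rw [abs_mul, abs_of_pos (one_div_pos.2 (hne s hs))]
    calc _ ≤ 1 * (2 * s ^ (θ + 1)) := by
          gcongr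
          · exact (one_div_pos.2 (hne s hs)).le
          · exact h.b0 s (hpos s hs)
          · exact hinv s hs
      _ ≤ 1 := by linarith [(hsm s hs).1]
  have hG'b : ∀ s ∈ Set.Icc s0 (1/2), |(g' s * (Θ * qf1 θ s) - g s * (Θ * qf2 θ s)) / (Θ * qf1 θ s) ^ 2| ≤ (6 + 4 * θ) * B / Θ := by
    intro s hs
    have hs' := hpos s hs
    have e : (g' s * (Θ * qf1 θ s) - g s * (Θ * qf2 θ s)) / (Θ * qf1 θ s) ^ 2 =
        - ((g' s * (1 / (-qf1 θ s)) + g s * (qf2 θ s * (1 / (-qf1 θ s)) ^ 2)) / Θ) := by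
      have := (hne s hs).ne'
      have h2 : qf1 θ s ≠ 0 := by simpa using this
      field_simp
      ring
    rw [e, abs_neg, abs_div, abs_of_pos hΘ]
    gcongr
    have hi0 := (one_div_pos.2 (hne s hs))
    have hi := hinv s hs
    have t1 : |g' s * (1 / (-qf1 θ s))| ≤ 2 * B := by
      rw [abs_mul, abs_of_pos hi0]
      calc _ ≤ (B / s) * (2 * s ^ (θ + 1)) := by
            have := h.b1 s hs'
            gcongr
        _ = 2 * B * s ^ θ := by rw [Real.rpow_add_one hs'.ne']; field_simp
        _ ≤ 2 * B * 1 := by have := (hsm s hs).2; gcongr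
        _ = _ := by ring
    have t2 : |g s * (qf2 θ s * (1 / (-qf1 θ s)) ^ 2)| ≤ 4 * (1 + θ) := by
      have hq2 : 0 < qf2 θ s := by unfold qf2; positivity
      rw [abs_mul, abs_of_pos (by positivity : 0 < qf2 θ s * (1 / (-qf1 θ s)) ^ 2)]
      calc _ ≤ 1 * (qf2 θ s * (2 * s ^ (θ + 1)) ^ 2) := by
            have := h.b0 s hs'
            gcongr
        _ = 4 * (1 + θ) * s ^ θ := by
            unfold qf2
            have e1 : s ^ (-θ - 2) = (s ^ θ)⁻¹ * (s ^ 2)⁻¹ := by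
              rw [sub_eq_add_neg, Real.rpow_add hs', Real.rpow_neg hs'.le, Real.rpow_neg hs'.le]; norm_num
            rw [Real.rpow_add_one hs'.ne', e1]
            field_simp
            ring
        _ ≤ 4 * (1 + θ) * 1 := by have := (hsm s hs).2; gcongr
        _ = _ := by ring
    calc _ ≤ 2 * B + 4 * (1 + θ) := (abs_add_le _ _).trans (add_le_add t1 t2)
      _ ≤ _ := by nlinarith
  have cq2 : ContinuousOn (fun s => Θ * qf2 θ s) (Set.Icc s0 (1/2)) := fun s hs => ((qf2_d (hpos s hs)).continuousAt.const_mul Θ).continuousWithinAt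
  have cg : ContinuousOn g (Set.Icc s0 (1/2)) := fun s hs => ((h.d s (hpos s hs)).continuousAt).continuousWithinAt
  have cq1 : ContinuousOn (fun s => Θ * qf1 θ s) (Set.Icc s0 (1/2)) := fun s hs => ((qf1_d (hpos s hs)).continuousAt.const_mul Θ).continuousWithinAt
  have cg' := h.c.mono (fun s hs => hpos s hs : Set.Icc s0 (1/2) ⊆ Set.Ioi 0)
  have hne' : ∀ s ∈ Set.Icc s0 (1/2), Θ * qf1 θ s ≠ 0 := fun s hs => mul_ne_zero hΘ.ne' (by have := (hne s hs).ne'; simpa using this)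
  have hintg : IntervalIntegrable (fun s => |(g' s * (Θ * qf1 θ s) - g s * (Θ * qf2 θ s)) / (Θ * qf1 θ s) ^ 2|) volume s0 (1/2) := by
    apply ContinuousOn.intervalIntegrable; rw [Set.uIcc_of_le hs1]
    exact (((cg'.mul cq1).sub (cg.mul cq2)).div (cq1.pow 2) (fun x hx => pow_ne_zero 2 (hne' x hx))).abs
  have hM : ∫ s in s0..(1/2), |(g' s * (Θ * qf1 θ s) - g s * (Θ * qf2 θ s)) / (Θ * qf1 θ s) ^ 2| ≤ (6 + 4 * θ) * B / Θ := by
    refine (intervalIntegral.integral_mono_on hs1 hintg (by simp) hG'b).trans ?_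
    rw [intervalIntegral.integral_const, smul_eq_mul]
    have : 0 ≤ (6 + 4 * θ) * B / Θ := by positivity
    nlinarith
  have := fdt (P := fun s => Θ * qf θ s) (P1 := fun s => Θ * qf1 θ s) (P2 := fun s => Θ * qf2 θ s) hs1
    (fun s hs => (qf_d hθ (hpos s hs)).const_mul Θ) (fun s hs => (qf1_d (hpos s hs)).const_mul Θ)
    cq2 (fun s hs => h.d s (hpos s hs)) cg' hne' hM
  refine this.trans ?_
  have g1 := hGb s0 ⟨le_rfl, hs1⟩
  have g2 := hGb (1/2) ⟨hs1, le_rfl⟩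
  have g3 : 2 * (1 / Θ) + (6 + 4 * θ) * B / Θ ≤ (10 + 4 * θ) * B / Θ := by
    rw [mul_one_div, ← add_div]; gcongr; nlinarith
  linarith

lemma sp_far_right {θ : ℝ} (hθ : 0 < θ) {g g' : ℝ → ℝ} {B Θ S : ℝ} (h : Amp g g' B) (hΘ : 0 < Θ)
    (hS : 3/2 ≤ S) :
    ‖∫ s in (3/2)..S, (g s : ℂ) * ee (Θ * qf θ s)‖ ≤ (12 + 9 * θ) * B * (1 + log S) / Θ := by
  have hB := h.hB
  have hpos : ∀ s ∈ Set.Icc (3/2) S, 0 < s := fun s hs => by linarith [hs.1]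
  have hq1 : ∀ s ∈ Set.Icc (3/2) S, 1/3 ≤ qf1 θ s := by
    intro s hs
    have hs' := hpos s hs
    unfold qf1
    have : s ^ (-θ - 1) ≤ 2/3 := by
      calc s ^ (-θ - 1) ≤ s ^ (-1 : ℝ) := Real.rpow_le_rpow_of_exponent_le (by linarith [hs.1]) (by linarith)
        _ = s⁻¹ := Real.rpow_neg_one _
        _ ≤ (3/2)⁻¹ := inv_anti₀ (by norm_num) hs.1
        _ = 2/3 := by norm_num
    linarith
  have hne : ∀ s ∈ Set.Icc (3/2) S, 0 < qf1 θ s := fun s hs => lt_of_lt_of_le (by norm_num) (hq1 s hs)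
  have hinv : ∀ s ∈ Set.Icc (3/2) S, 1 / (qf1 θ s) ≤ 3 := by
    intro s hs
    rw [div_le_iff₀ (hne s hs)]
    linarith [hq1 s hs]
  have hGb : ∀ s ∈ Set.Icc (3/2) S, |g s / (Θ * qf1 θ s)| ≤ 3 / Θ := by
    intro s hs
    have e : g s / (Θ * qf1 θ s) = (g s * (1 / (qf1 θ s)) / Θ) := by
      have h2 := (hne s hs).ne'
      field_simp
    rw [e, abs_div, abs_of_pos hΘ]
    gcongr
    rw [abs_mul, abs_of_pos (one_div_pos.2 (hne s hs))]
    have q1 := h.b0 s (hpos s hs)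
    have q2 := hinv s hs
    have q3 := (one_div_pos.2 (hne s hs)).le
    calc |g s| * (1 / qf1 θ s) ≤ 1 * 3 := mul_le_mul q1 q2 q3 (by norm_num)
      _ = 3 := by ring
  have hG'b : ∀ s ∈ Set.Icc (3/2) S, |(g' s * (Θ * qf1 θ s) - g s * (Θ * qf2 θ s)) / (Θ * qf1 θ s) ^ 2| ≤ (12 + 9 * θ) * B / Θ * s⁻¹ := by
    intro s hs
    have hs' := hpos s hs
    have e : (g' s * (Θ * qf1 θ s) - g s * (Θ * qf2 θ s)) / (Θ * qf1 θ s) ^ 2 =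
        ((g' s * (1 / (qf1 θ s)) - g s * (qf2 θ s * (1 / (qf1 θ s)) ^ 2)) / Θ) := by
      have h2 := (hne s hs).ne'
      field_simp
    rw [e, abs_div, abs_of_pos hΘ, div_mul_eq_mul_div]
    gcongr
    have hi0 := (one_div_pos.2 (hne s hs))
    have hi := hinv s hs
    have t1 : |g' s * (1 / (qf1 θ s))| ≤ 3 * B * s⁻¹ := by
      rw [abs_mul, abs_of_pos hi0]
      calc _ ≤ (B / s) * 3 := by
            have := h.b1 s hs'
            gcongr
        _ = _ := by ring
    have t2 : |g s * (qf2 θ s * (1 / (qf1 θ s)) ^ 2)| ≤ 9 * (1 + θ) * s⁻¹ := by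
      have hq2 : 0 < qf2 θ s := by unfold qf2; positivity
      rw [abs_mul, abs_of_pos (by positivity : 0 < qf2 θ s * (1 / (qf1 θ s)) ^ 2)]
      have hq3 : qf2 θ s ≤ (1 + θ) * s⁻¹ := by
        unfold qf2
        gcongr
        rw [← Real.rpow_neg_one]
        exact Real.rpow_le_rpow_of_exponent_le (by linarith [hs.1]) (by linarith)
      calc _ ≤ 1 * ((1 + θ) * s⁻¹ * 3 ^ 2) := by
            have := h.b0 s hs'
            gcongr
        _ = _ := by ring
    calc _ ≤ 3 * B * s⁻¹ + 9 * (1 + θ) * s⁻¹ := (abs_sub _ _).trans (add_le_add t1 t2)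
      _ = (3 * B + 9 * (1 + θ)) * s⁻¹ := by ring
      _ ≤ _ := by gcongr; nlinarith
  have cq2 : ContinuousOn (fun s => Θ * qf2 θ s) (Set.Icc (3/2) S) := fun s hs => ((qf2_d (hpos s hs)).continuousAt.const_mul Θ).continuousWithinAt
  have cg : ContinuousOn g (Set.Icc (3/2) S) := fun s hs => ((h.d s (hpos s hs)).continuousAt).continuousWithinAt
  have cq1 : ContinuousOn (fun s => Θ * qf1 θ s) (Set.Icc (3/2) S) := fun s hs => ((qf1_d (hpos s hs)).continuousAt.const_mul Θ).continuousWithinAt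
  have cg' := h.c.mono (fun s hs => hpos s hs : Set.Icc (3/2) S ⊆ Set.Ioi 0)
  have hne' : ∀ s ∈ Set.Icc (3/2) S, Θ * qf1 θ s ≠ 0 := fun s hs => mul_ne_zero hΘ.ne' (hne s hs).ne'
  have hintg : IntervalIntegrable (fun s => |(g' s * (Θ * qf1 θ s) - g s * (Θ * qf2 θ s)) / (Θ * qf1 θ s) ^ 2|) volume (3/2) S := by
    apply ContinuousOn.intervalIntegrable; rw [Set.uIcc_of_le hS]
    exact (((cg'.mul cq1).sub (cg.mul cq2)).div (cq1.pow 2) (fun x hx => pow_ne_zero 2 (hne' x hx))).abs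
  have hinvi : IntervalIntegrable (fun x : ℝ => x⁻¹) volume (3/2) S := by
    apply ContinuousOn.intervalIntegrable; rw [Set.uIcc_of_le hS]
    exact ContinuousOn.inv₀ continuousOn_id (fun x hx => (hpos x hx).ne')
  have hM : ∫ s in (3/2)..S, |(g' s * (Θ * qf1 θ s) - g s * (Θ * qf2 θ s)) / (Θ * qf1 θ s) ^ 2| ≤ (12 + 9 * θ) * B / Θ * log S := by
    refine (intervalIntegral.integral_mono_on hS hintg (hinvi.const_mul _) hG'b).trans ?_
    rw [intervalIntegral.integral_const_mul, integral_inv_of_pos (by norm_num) (by linarith)]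
    gcongr
    rw [div_le_iff₀ (by norm_num)]; linarith
  have := fdt (P := fun s => Θ * qf θ s) (P1 := fun s => Θ * qf1 θ s) (P2 := fun s => Θ * qf2 θ s) hS
    (fun s hs => (qf_d hθ (hpos s hs)).const_mul Θ) (fun s hs => (qf1_d (hpos s hs)).const_mul Θ)
    cq2 (fun s hs => h.d s (hpos s hs)) cg' hne' hM
  refine this.trans ?_
  have g1 := hGb (3/2) ⟨le_rfl, hS⟩
  have g2 := hGb S ⟨hS, le_rfl⟩
  have g3 : 2 * (3 / Θ) + (12 + 9 * θ) * B / Θ * log S ≤ (12 + 9 * θ) * B * (1 + log S) / Θ := by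
    have : 2 * (3 / Θ) ≤ (12 + 9 * θ) * B / Θ := by rw [← mul_div_assoc]; apply div_le_div_of_nonneg_right _ hΘ.le; nlinarith
    calc _ ≤ (12 + 9 * θ) * B / Θ + (12 + 9 * θ) * B / Θ * log S := by linarith
      _ = _ := by ring
  linarith

/-- Stationary phase for the model phase. -/
lemma sp_full {θ : ℝ} (hθ : 0 < θ) : ∃ C > 0, ∀ (g g' : ℝ → ℝ) (B Θ s0 S : ℝ), Amp g g' B → 0 < Θ → 0 < s0 → s0 ≤ 1/2 → 3/2 ≤ S →
    ‖(∫ s in s0..S, (g s : ℂ) * ee (Θ * qf θ s)) - g 1 * (ee (Θ * qf θ 1 + 1 / 8) / (√((1 + θ) * Θ) : ℝ))‖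
      ≤ C * B * (1 + |log Θ| + log S) / Θ := by
  have hK := (qf_bounds hθ).1
  refine ⟨80 * (KK θ) ^ 15 + (10 + 4 * θ) + (12 + 9 * θ), by positivity, ?_⟩
  intro g g' B Θ s0 S h hΘ hs0 hs1 hS
  have hB := h.hB
  have hci : ∀ α β : ℝ, 0 < α → 0 < β → IntervalIntegrable (fun s => (g s : ℂ) * ee (Θ * qf θ s)) volume α β := by
    intro α β hα hβ
    apply ContinuousOn.intervalIntegrable
    intro s hs
    have hs0 : 0 < s := lt_of_lt_of_le (lt_min hα hβ) hs.1
    apply ContinuousAt.continuousWithinAt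
    exact (Complex.continuous_ofReal.continuousAt.comp (h.d s hs0).continuousAt).mul
      (ee_continuous.continuousAt.comp (continuousAt_const.mul (qf_d hθ hs0).continuousAt))
  have h1 := intervalIntegral.integral_add_adjacent_intervals (hci s0 (1/2) hs0 (by norm_num)) (hci (1/2) (3/2) (by norm_num) (by norm_num))
  have h2 := intervalIntegral.integral_add_adjacent_intervals (hci s0 (3/2) hs0 (by norm_num)) (hci (3/2) S (by norm_num) (by linarith))
  rw [← h2, ← h1]
  have e : ∀ X Y Z W : ℂ, X + Y + Z - W = X + (Y - W) + Z := by intros; ring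
  rw [e]
  have hl : 0 ≤ log S := Real.log_nonneg (by linarith)
  have hl2 := abs_nonneg (log Θ)
  refine norm_add₃_le.trans ((add_le_add (add_le_add (sp_far_left hθ h hΘ hs0 hs1) (sp_near hθ h hΘ)) (sp_far_right hθ h hΘ hS)).trans ?_)
  rw [← add_div, ← add_div]
  gcongr
  have h0 : ∀ k, 0 ≤ k → k * B * 1 ≤ k * B * (1 + |log Θ| + log S) := fun k hk =>
    mul_le_mul_of_nonneg_left (by linarith) (by positivity)
  have h1 : ∀ k, 0 ≤ k → k * B * (1 + |log Θ|) ≤ k * B * (1 + |log Θ| + log S) := fun k hk =>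
    mul_le_mul_of_nonneg_left (by linarith) (by positivity)
  have h2 : ∀ k, 0 ≤ k → k * B * (1 + log S) ≤ k * B * (1 + |log Θ| + log S) := fun k hk =>
    mul_le_mul_of_nonneg_left (by linarith) (by positivity)
  have a1 := h0 (10 + 4 * θ) (by positivity)
  have a2 := h1 (80 * KK θ ^ 15) (by positivity)
  have a3 := h2 (12 + 9 * θ) (by positivity)
  rw [mul_one] at a1
  calc _ ≤ (10 + 4 * θ) * B * (1 + |log Θ| + log S) + 80 * KK θ ^ 15 * B * (1 + |log Θ| + log S) + (12 + 9 * θ) * B * (1 + |log Θ| + log S) := add_le_add (add_le_add a1 a2) a3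
    _ = _ := by ring
end MSQ

namespace MSQ

lemma saw_iiC (x y : ℝ) : IntervalIntegrable (fun x => (saw x : ℂ)) volume x y := by
  have : IntervalIntegrable (fun u => saw u * 1) volume x y := saw_ii x y (fun _ => 1) continuous_const
  simp only [mul_one] at this
  exact ⟨this.1.ofReal, this.2.ofReal⟩

lemma em_sum {f f' : ℝ → ℂ} {s0 : ℝ} {R : ℕ} (h0 : 0 < s0) (h1 : s0 < 1) (hR : 1 ≤ R)
    (hd : ∀ x ∈ Set.Icc s0 (R:ℝ), HasDerivAt f (f' x) x) (hc : ContinuousOn f' (Set.Icc s0 (R:ℝ)))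
    (ha : f s0 = 0) (hb : f R = 0) :
    ∑ n ∈ Finset.range R, f ((n:ℝ) + 1) = (∫ x in s0..(R:ℝ), f x) + ∫ x in s0..(R:ℝ), (saw x : ℂ) * f' x := by
  have hR' : (1:ℝ) ≤ R := by exact_mod_cast hR
  have hle : s0 ≤ (R:ℝ) := by linarith
  have hder : ∀ x ∈ Set.Icc s0 (R:ℝ), deriv f x = f' x := fun x hx => (hd x hx).deriv
  have hintg : IntegrableOn (deriv f) (Set.Icc s0 (R:ℝ)) :=
    (hc.congr hder).integrableOn_Icc
  have h := sum_mul_eq_sub_sub_integral_mul (𝕜 := ℂ) (fun _ => 1) h0.le hle (f := f) (fun x hx => (hd x hx).differentiableAt) hintg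
  have hfl : ⌊s0⌋₊ = 0 := Nat.floor_eq_zero.2 h1
  rw [ha, hb, hfl, Nat.floor_natCast] at h
  have e1 : ∑ n ∈ Finset.range R, f ((n:ℝ) + 1) = ∑ k ∈ Finset.Ioc 0 R, f k * 1 := by
    have : Finset.Ioc 0 R = Finset.Ico (0+1) (R+1) := by ext; simp [Nat.succ_le_iff]
    rw [this, ← Finset.sum_Ico_add', ← Finset.range_eq_Ico]
    simp
  rw [e1, h, ← intervalIntegral.integral_of_le hle]
  have ii : IntervalIntegrable f' volume s0 R := (hc.mono (by rw [Set.uIcc_of_le hle])).intervalIntegrable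
  have cf : ContinuousOn f (Set.uIcc s0 (R:ℝ)) := by
    rw [Set.uIcc_of_le hle]; exact fun x hx => (hd x hx).continuousAt.continuousWithinAt
  have iis : IntervalIntegrable (fun x => (saw x : ℂ) * f' x) volume s0 R := by
    have := saw_iiC s0 R
    exact this.mul_continuousOn (hc.mono (by rw [Set.uIcc_of_le hle]))
  have iiu : IntervalIntegrable (fun x : ℝ => ((x + 1/2 : ℝ) : ℂ) * f' x) volume s0 R :=
    ii.continuousOn_mul (by fun_prop)
  have e2 : ∫ x in s0..(R:ℝ), deriv f x * ∑ k ∈ Finset.Icc 0 ⌊x⌋₊, (1:ℂ) =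
      (∫ x in s0..(R:ℝ), ((x + 1/2 : ℝ) : ℂ) * f' x) - ∫ x in s0..(R:ℝ), (saw x : ℂ) * f' x := by
    rw [← intervalIntegral.integral_sub iiu iis]
    apply intervalIntegral.integral_congr
    intro x hx
    rw [Set.uIcc_of_le hle] at hx
    have hx0 : 0 ≤ x := by linarith [hx.1]
    simp only [hder x hx, Finset.sum_const, Nat.card_Icc, nsmul_eq_mul, mul_one, Nat.sub_zero]
    have : ((⌊x⌋₊ : ℕ) : ℝ) = x - Int.fract x := by
      rw [natCast_floor_eq_intCast_floor hx0, Int.self_sub_fract]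
    have h3 : ((⌊x⌋₊ + 1 : ℕ) : ℂ) = ((x - Int.fract x + 1 : ℝ) : ℂ) := by
      rw [← this]; push_cast; rfl
    rw [h3]; unfold saw; push_cast; ring
  have e3 : ∫ x in s0..(R:ℝ), ((x + 1/2 : ℝ) : ℂ) * f' x = - ∫ x in s0..(R:ℝ), f x := by
    have := intervalIntegral.integral_mul_deriv_eq_deriv_mul (a := s0) (b := (R:ℝ)) (u := fun x : ℝ => ((x + 1/2 : ℝ) : ℂ)) (u' := fun _ => (1:ℂ)) (v := f) (v' := f')
      (fun x _ => by simpa using ((hasDerivAt_id x).add_const (1/2:ℝ)).ofReal_comp) (fun x hx => hd x (by rwa [Set.uIcc_of_le hle] at hx)) (by simp) ii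
    rw [this, ha, hb]; simp
  rw [e2, e3]; ring

lemma sawD_l1 {N : ℕ} {x y : ℝ} (hN : 0 < N) (hxy : x ≤ y) : ∫ u in x..y, |saw u - sawH N u| ≤ (y - x + 1) / √N := by
  have hN' : (0:ℝ) < N := by exact_mod_cast hN
  have hs : 0 < √(N:ℝ) := Real.sqrt_pos.2 hN'
  have hss : √(N:ℝ) * √N = N := Real.mul_self_sqrt hN'.le
  have h := saw_l2_interval hN hxy
  have iiD := sawD_ii N x y
  have ii1 : IntervalIntegrable (fun u => |saw u - sawH N u|) volume x y := by
    have : IntervalIntegrable (fun u => saw u * 1) volume x y := saw_ii x y (fun _ => 1) continuous_const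
    simp only [mul_one] at this
    exact (this.sub ((sawH_continuous N).intervalIntegrable _ _)).abs
  have : ∫ u in x..y, |saw u - sawH N u| ≤ ∫ u in x..y, (√N / 2 * (saw u - sawH N u)^2 + 1 / (2 * √N)) := by
    apply intervalIntegral.integral_mono_on hxy ii1 ((iiD.const_mul _).add (by simp))
    intro u hu
    have h1 : 0 ≤ (√N * |saw u - sawH N u| - 1)^2 := sq_nonneg _
    have h2 : (√N * |saw u - sawH N u| - 1)^2 / (2 * √N) = √N / 2 * (saw u - sawH N u)^2 + 1 / (2 * √N) - |saw u - sawH N u| := by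
      rw [← sq_abs (saw u - sawH N u)]; field_simp; ring
    have : 0 ≤ (√N * |saw u - sawH N u| - 1)^2 / (2 * √N) := by positivity
    linarith
  refine this.trans ?_
  rw [intervalIntegral.integral_add (iiD.const_mul _) (by simp), intervalIntegral.integral_const_mul, intervalIntegral.integral_const, smul_eq_mul]
  have h3 : √N / 2 * ∫ u in x..y, (saw u - sawH N u)^2 ≤ √N / 2 * ((y - x + 1) / N) := mul_le_mul_of_nonneg_left h (by positivity)
  have h4 : √N / 2 * ((y - x + 1) / N) = (y - x + 1) / (2 * √N) := by
    have : (N:ℝ) = √N * √N := hss.symm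
    rw [div_mul_div_comm, div_eq_div_iff (by positivity) (by positivity)]
    linear_combination 2 * (y - x + 1) * this * (-1)
  rw [h4] at h3
  have h5 : (y - x + 1) / √N = (y - x + 1) / (2 * √N) + (y - x) * (1 / (2 * √N)) + 1 / (2 * √N) := by field_simp; ring
  have : 0 < 1 / (2 * √N) := by positivity
  linarith

lemma sawH_deriv (N : ℕ) (x : ℝ) : HasDerivAt (fun x => (sawH N x : ℂ)) (-∑ k ∈ Finset.range N, (ee ((k+1) * x) + ee (-((k+1) * x)))) x := by
  have h : HasDerivAt (fun x => (sawH N x)) (-∑ k ∈ Finset.range N, 2 * cos (2 * π * (k+1) * x)) x := by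
    unfold sawH
    refine HasDerivAt.neg (HasDerivAt.fun_sum fun k _ => ?_)
    have : HasDerivAt (fun x : ℝ => 2 * π * (k + 1) * x) (2 * π * (k+1)) x := by
      simpa using (hasDerivAt_id x).const_mul (2 * π * ((k:ℝ)+1))
    refine (this.sin.div_const _).congr_deriv ?_
    have : (k:ℝ) + 1 ≠ 0 := by positivity
    field_simp
  refine h.ofReal_comp.congr_deriv ?_
  push_cast
  congr 1
  apply Finset.sum_congr rfl
  intro k _
  unfold ee
  rw [Complex.two_cos]
  push_cast
  congr 1 <;> congr 1 <;> ring

lemma em_trunc {f f' : ℝ → ℂ} {s0 M1 : ℝ} {R N : ℕ} (h0 : 0 < s0) (h1 : s0 < 1) (hR : 1 ≤ R)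
    (hd : ∀ x ∈ Set.Icc s0 (R:ℝ), HasDerivAt f (f' x) x) (hc : ContinuousOn f' (Set.Icc s0 (R:ℝ)))
    (ha : f s0 = 0) (hb : f R = 0) (hM : ∀ x ∈ Set.Icc s0 (R:ℝ), ‖f' x‖ ≤ M1) (hN : 0 < N) (hN2 : ((R + 1) * M1)^2 ≤ N) :
    ‖∑ n ∈ Finset.range R, f ((n:ℝ) + 1) - (∫ x in s0..(R:ℝ), f x) - ∑ k ∈ Finset.range N, ((∫ x in s0..(R:ℝ), f x * ee ((k+1) * x)) +
      ∫ x in s0..(R:ℝ), f x * ee (-((k+1) * x)))‖ ≤ 1 := by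
  have hR' : (1:ℝ) ≤ R := by exact_mod_cast hR
  have hle : s0 ≤ (R:ℝ) := by linarith
  rw [em_sum h0 h1 hR hd hc ha hb]
  have hc' : ContinuousOn f' (Set.uIcc s0 (R:ℝ)) := hc.mono (by rw [Set.uIcc_of_le hle])
  have ii : IntervalIntegrable f' volume s0 R := hc'.intervalIntegrable
  have cf : ContinuousOn f (Set.uIcc s0 (R:ℝ)) := by
    rw [Set.uIcc_of_le hle]; exact fun x hx => (hd x hx).continuousAt.continuousWithinAt
  have iis : IntervalIntegrable (fun x => (saw x : ℂ) * f' x) volume s0 R := by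
    have := saw_iiC s0 R
    exact this.mul_continuousOn hc'
  have iih : IntervalIntegrable (fun x => (sawH N x : ℂ) * f' x) volume s0 R :=
    ii.continuousOn_mul (Complex.continuous_ofReal.comp (sawH_continuous N)).continuousOn
  have cc : ∀ c : ℝ, Continuous (fun x : ℝ => ee (c * x)) := fun c => ee_continuous.comp (by fun_prop)
  have cc' : ∀ c : ℝ, Continuous (fun x : ℝ => ee (-(c * x))) := fun c => ee_continuous.comp (by fun_prop)
  have e1 : ∫ x in s0..(R:ℝ), (sawH N x : ℂ) * f' x = ∑ k ∈ Finset.range N, ((∫ x in s0..(R:ℝ), f x * ee ((k+1) * x)) +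
      ∫ x in s0..(R:ℝ), f x * ee (-((k+1) * x))) := by
    have := intervalIntegral.integral_mul_deriv_eq_deriv_mul (a := s0) (b := (R:ℝ)) (u := fun x : ℝ => (sawH N x : ℂ)) (v := f) (v' := f')
      (fun x _ => sawH_deriv N x) (fun x hx => hd x (by rwa [Set.uIcc_of_le hle] at hx))
      (Continuous.intervalIntegrable (continuous_finsetSum _ (fun k _ => (cc _).add (cc' _))).neg _ _) ii
    rw [this, ha, hb]
    simp only [mul_zero, sub_zero, zero_sub]
    rw [← intervalIntegral.integral_neg]
    have : ∀ k : ℕ, (∫ x in s0..(R:ℝ), f x * ee ((k+1) * x)) + ∫ x in s0..(R:ℝ), f x * ee (-((k+1) * x)) =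
       ∫ x in s0..(R:ℝ), (f x * ee ((k+1) * x) + f x * ee (-((k+1) * x))) := fun k =>
       (intervalIntegral.integral_add (cf.mul (cc _).continuousOn).intervalIntegrable (cf.mul (cc' _).continuousOn).intervalIntegrable).symm
    simp only [this]
    rw [← intervalIntegral.integral_finsetSum (f := fun (k:ℕ) (x:ℝ) => f x * ee ((k+1) * x) + f x * ee (-((k+1) * x))) (fun k _ => ((cf.mul (cc _).continuousOn).add (cf.mul (cc' _).continuousOn)).intervalIntegrable)]
    apply intervalIntegral.integral_congr
    intro x _
    simp only [neg_mul, neg_neg, Finset.sum_mul]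
    apply Finset.sum_congr rfl; intros; ring
  rw [← e1, add_sub_cancel_left, ← intervalIntegral.integral_sub iis iih]
  have hM0 : 0 ≤ M1 := (norm_nonneg _).trans (hM s0 ⟨le_rfl, hle⟩)
  have ii1 : IntervalIntegrable (fun u => |saw u - sawH N u|) volume s0 R := by
    have : IntervalIntegrable (fun u => saw u * 1) volume s0 R := saw_ii s0 R (fun _ => 1) continuous_const
    simp only [mul_one] at this
    exact (this.sub ((sawH_continuous N).intervalIntegrable _ _)).abs
  calc _ ≤ ∫ x in s0..(R:ℝ), M1 * |saw x - sawH N x| := by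
        apply intervalIntegral.norm_integral_le_of_norm_le hle _ (ii1.const_mul _)
        refine Filter.Eventually.of_forall fun x hx => ?_
        rw [← sub_mul, norm_mul, mul_comm, ← Complex.ofReal_sub, Complex.norm_real, Real.norm_eq_abs]
        exact mul_le_mul_of_nonneg_right (hM x ⟨hx.1.le, hx.2⟩) (abs_nonneg _)
    _ ≤ M1 * ((R - s0 + 1) / √N) := by
        rw [intervalIntegral.integral_const_mul]
        exact mul_le_mul_of_nonneg_left (sawD_l1 hN hle) hM0
    _ ≤ 1 := by
        have hN' : (0:ℝ) < N := by exact_mod_cast hN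
        have hs : 0 < √(N:ℝ) := Real.sqrt_pos.2 hN'
        have : (R + 1) * M1 ≤ √N := Real.le_sqrt_of_sq_le hN2
        rw [mul_div_assoc', div_le_one hs]
        nlinarith

end MSQ

namespace MSQ

noncomputable abbrev st : ℝ → ℝ := Real.smoothTransition

lemma st_d (x : ℝ) : HasDerivAt st (deriv st x) x :=
  ((Real.smoothTransition.contDiff (n := 1)).differentiable (by norm_num)).differentiableAt.hasDerivAt

lemma st_dc : Continuous (deriv st) := (Real.smoothTransition.contDiff (n := 1)).continuous_deriv le_rfl

lemma st_d_bdd : ∃ S : ℝ, 1 ≤ S ∧ ∀ x, |deriv st x| ≤ S := by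
  obtain ⟨S, hS⟩ := (isCompact_Icc (a := (0:ℝ)) (b := 1)).exists_bound_of_continuousOn st_dc.continuousOn
  refine ⟨max S 1, le_max_right _ _, fun x => ?_⟩
  rcases lt_or_ge x 0 with h | h
  · have : st =ᶠ[nhds x] fun _ => 0 := by
      filter_upwards [Iio_mem_nhds h] with y hy using Real.smoothTransition.zero_of_nonpos (le_of_lt hy)
    rw [this.deriv_eq]; simp
  · rcases lt_or_ge 1 x with h1 | h1
    · have : st =ᶠ[nhds x] fun _ => 1 := by
        filter_upwards [Ioi_mem_nhds h1] with y hy using Real.smoothTransition.one_of_one_le (le_of_lt hy)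
      rw [this.deriv_eq]; simp
    · exact (hS x ⟨h, h1⟩).trans (le_max_left _ _)

noncomputable def Wf (κ t y : ℝ) : ℝ := wt κ (y / t) * st (1 + log y)
noncomputable def Wf' (κ t y : ℝ) : ℝ := deriv st (1/2 - κ * log (y/t)) * (-κ / y) * st (1 + log y) +
  wt κ (y / t) * (deriv st (1 + log y) / y)

lemma Wf_amp {κ : ℝ} (hκ : 0 < κ) : ∃ B : ℝ, ∀ t, 0 < t → Amp (Wf κ t) (Wf' κ t) B := by
  obtain ⟨S, hS1, hS⟩ := st_d_bdd
  have n0 := Real.smoothTransition.nonneg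
  have n1 := Real.smoothTransition.le_one
  refine ⟨S * κ + S, fun t ht => ⟨by nlinarith, ?_, ?_, ?_, ?_⟩⟩
  · intro y hy
    have d1 : HasDerivAt (fun y => 1/2 - κ * log (y/t)) (-κ / y) y := by
      refine ((((hasDerivAt_id y).div_const t).log (by simp only [id]; exact (div_pos hy ht).ne')).const_mul κ |>.const_sub (1/2)).congr_deriv ?_
      simp only [id]; field_simp
    have d2 : HasDerivAt (fun y => 1 + log y) (1 / y) y := by
      simpa using (Real.hasDerivAt_log hy.ne').const_add 1
    have e1 := (st_d (1/2 - κ * log (y/t))).comp y d1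
    have e2 := (st_d (1 + log y)).comp y d2
    refine (e1.mul e2).congr_deriv ?_
    simp only [Wf', wt, Function.comp]; ring
  · unfold Wf' wt
    have c1 : ContinuousOn (fun y : ℝ => log y) (Set.Ioi 0) := Real.continuousOn_log.mono (fun x hx => ne_of_gt hx)
    have c2 : ContinuousOn (fun y : ℝ => log (y/t)) (Set.Ioi 0) :=
      ContinuousOn.log (by fun_prop) (fun x hx => (div_pos hx ht).ne')
    have c3 : ContinuousOn (fun y : ℝ => 1/2 - κ * log (y/t)) (Set.Ioi 0) := by fun_prop
    have c4 : ContinuousOn (fun y : ℝ => 1 + log y) (Set.Ioi 0) := by fun_prop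
    have cs : Continuous st := Real.smoothTransition.continuous
    have hne : ∀ x ∈ Set.Ioi (0:ℝ), x ≠ 0 := fun x hx => ne_of_gt hx
    exact (((st_dc.comp_continuousOn c3).mul (continuousOn_const.div continuousOn_id hne)).mul (cs.comp_continuousOn c4)).add
      ((cs.comp_continuousOn c3).mul ((st_dc.comp_continuousOn c4).div continuousOn_id hne))
  · intro y hy
    have h1 := wt_nonneg κ (y/t); have h2 := wt_le_one κ (y/t)
    unfold Wf
    rw [abs_of_nonneg (mul_nonneg h1 (n0 _))]
    exact mul_le_one₀ h2 (n0 _) (n1 _)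
  · intro y hy
    have h1 := wt_nonneg κ (y/t); have h2 := wt_le_one κ (y/t)
    unfold Wf'
    refine (abs_add_le _ _).trans ?_
    rw [abs_mul, abs_mul, abs_mul, abs_div, abs_div, abs_neg, abs_of_pos hκ, abs_of_pos hy, abs_of_nonneg (n0 _), abs_of_nonneg h1, add_div]
    have a1 : |deriv st (1/2 - κ * log (y/t))| * (κ / y) * st (1 + log y) ≤ S * κ / y := by
      have : |deriv st (1/2 - κ * log (y/t))| * (κ / y) ≤ S * (κ / y) := mul_le_mul_of_nonneg_right (hS _) (by positivity)
      have h3 : |deriv st (1/2 - κ * log (y/t))| * (κ / y) * st (1 + log y) ≤ |deriv st (1/2 - κ * log (y/t))| * (κ / y) :=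
        mul_le_of_le_one_right (by positivity) (n1 _)
      rw [mul_div_assoc]; linarith
    have a2 : wt κ (y/t) * (|deriv st (1 + log y)| / y) ≤ S / y := by
      have : |deriv st (1 + log y)| / y ≤ S / y := div_le_div_of_nonneg_right (hS _) hy.le
      have h3 := mul_le_of_le_one_left (by positivity : 0 ≤ |deriv st (1 + log y)| / y) h2
      linarith
    linarith

lemma Amp.scale {g g' : ℝ → ℝ} {B y0 : ℝ} (h : Amp g g' B) (hy : 0 < y0) :
    Amp (fun s => g (y0 * s)) (fun s => y0 * g' (y0 * s)) B := by
  refine ⟨h.hB, ?_, ?_, fun s hs => h.b0 _ (by positivity), ?_⟩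
  · intro s hs
    have := (h.d (y0 * s) (by positivity)).comp s ((hasDerivAt_id s).const_mul y0)
    refine this.congr_deriv ?_
    ring
  · exact continuousOn_const.mul (h.c.comp (by fun_prop) (fun s hs => by simp only [Set.mem_Ioi] at *; positivity))
  · intro s hs
    have := h.b1 (y0 * s) (by positivity)
    rw [abs_mul, abs_of_pos hy]
    calc _ ≤ y0 * (B / (y0 * s)) := mul_le_mul_of_nonneg_left this hy.le
      _ = B / s := by field_simp

lemma Wf_small {κ t y : ℝ} (hy : 0 < y) (h : y ≤ 1/3) : Wf κ t y = 0 := by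
  unfold Wf
  have : log y ≤ -1 := by
    rw [Real.log_le_iff_le_exp hy]
    refine h.trans ?_
    rw [Real.exp_neg, one_div]
    exact inv_anti₀ (Real.exp_pos _) (by linarith [Real.exp_one_lt_d9])
  rw [show st (1 + log y) = 0 from Real.smoothTransition.zero_of_nonpos (by linarith), mul_zero]

lemma Wf_large {κ t y : ℝ} (hκ : 0 < κ) (ht : 0 < t) (h : t * exp (1 / (2 * κ)) ≤ y) : Wf κ t y = 0 := by
  unfold Wf wt
  have hy : exp (1 / (2 * κ)) ≤ y / t := by rw [le_div_iff₀ ht]; linarith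
  have : 1 / (2 * κ) ≤ log (y / t) := by rwa [Real.le_log_iff_exp_le (lt_of_lt_of_le (Real.exp_pos _) hy)]
  have h2 : 1/2 ≤ κ * log (y/t) := by
    calc (1/2:ℝ) = κ * (1 / (2 * κ)) := by field_simp
      _ ≤ _ := mul_le_mul_of_nonneg_left this hκ.le
  rw [Real.smoothTransition.zero_of_nonpos (by linarith), zero_mul]

lemma Wf_nat (κ t : ℝ) (n : ℕ) : Wf κ t (n + 1) = wt κ ((n+1)/t) := by
  unfold Wf
  have : 0 ≤ log ((n:ℝ) + 1) := Real.log_nonneg (by linarith [Nat.cast_nonneg (α := ℝ) n])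
  rw [show st (1 + log ((n:ℝ)+1)) = 1 from Real.smoothTransition.one_of_one_le (by linarith), mul_one]

lemma Xf_d {θ t y : ℝ} (hy : 0 < y) : HasDerivAt (Xf θ t) (-θ * t ^ (1 + θ) * y ^ (-θ - 1)) y := by
  unfold Xf
  refine ((Real.hasDerivAt_rpow_const (Or.inl hy.ne')).const_mul (t ^ (1+θ))).congr_deriv ?_
  ring

end MSQ

namespace MSQ

noncomputable def yst (θ t h ν : ℝ) : ℝ := t * (θ * h / ν) ^ (1 / (1 + θ))

lemma yst_pos {θ t h ν : ℝ} (hθ : 0 < θ) (ht : 0 < t) (hh : 0 < h) (hν : 0 < ν) : 0 < yst θ t h ν := by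
  unfold yst; positivity

lemma yst_eq {θ t h ν : ℝ} (hθ : 0 < θ) (ht : 0 < t) (hh : 0 < h) (hν : 0 < ν) :
    h * t ^ (1 + θ) * (yst θ t h ν) ^ (-θ) = ν * yst θ t h ν / θ := by
  have hp := yst_pos hθ ht hh hν
  have e : (yst θ t h ν) ^ (1 + θ) = t ^ (1 + θ) * (θ * h / ν) := by
    unfold yst
    rw [mul_rpow ht.le (by positivity), ← rpow_mul (by positivity), one_div, inv_mul_cancel₀ (by linarith), rpow_one]
  have e2 : (yst θ t h ν) ^ (-θ) * (yst θ t h ν) ^ (1 + θ) = yst θ t h ν := by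
    rw [← rpow_add hp, show -θ + (1 + θ) = 1 by ring, rpow_one]
  rw [e] at e2
  rw [eq_div_iff hθ.ne']
  nth_rewrite 2 [← e2]
  field_simp

lemma pos_part {θ κ B C0 : ℝ} (hθ : 0 < θ) (hκ : 0 < κ)
    (hC : ∀ (g g' : ℝ → ℝ) (B Θ s0 S : ℝ), Amp g g' B → 0 < Θ → 0 < s0 → s0 ≤ 1/2 → 3/2 ≤ S →
    ‖(∫ s in s0..S, (g s : ℂ) * ee (Θ * qf θ s)) - g 1 * (ee (Θ * qf θ 1 + 1 / 8) / (√((1 + θ) * Θ) : ℝ))‖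
      ≤ C0 * B * (1 + |log Θ| + log S) / Θ) {t h ν : ℝ} {R : ℝ} (hB : Amp (Wf κ t) (Wf' κ t) B)
    (ht : 1 ≤ t) (hh : 1 ≤ h) (hν : 1 ≤ ν) (hR : t * exp (1 / (2 * κ)) ≤ R) :
    ‖(∫ y in (1/4)..R, ((Wf κ t y : ℂ) * ee (h * Xf θ t y)) * ee (ν * y)) -
      (Wf κ t (yst θ t h ν) * √(yst θ t h ν / ((1 + θ) * ν)) : ℝ) * ee (ν * yst θ t h ν * (1 + 1 / θ) + 1/8)‖ ≤
      C0 * B * (1 + |log (ν * yst θ t h ν)| + log (max (R / yst θ t h ν) (3/2))) / ν := by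
  have hy := yst_pos (t := t) (h := h) (ν := ν) hθ (by linarith) (by linarith) (by linarith)
  have hq := yst_eq (t := t) (h := h) (ν := ν) hθ (by linarith) (by linarith) (by linarith)
  set y0 := yst θ t h ν with hy0
  have hR1 : 1 ≤ R := by
    have : 1 ≤ exp (1 / (2 * κ)) := Real.one_le_exp (by positivity)
    nlinarith
  have key := hC _ _ B (ν * y0) (min (1 / (4 * y0)) (1/2)) (max (R / y0) (3/2)) (hB.scale hy) (by positivity) (by positivity) (min_le_right _ _) (le_max_right _ _)
  set s0 := min (1 / (4 * y0)) (1/2) with hs0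
  set S := max (R / y0) (3/2) with hS
  have hs0p : 0 < s0 := by positivity
  have hSp : 0 < S := lt_of_lt_of_le (by norm_num) (le_max_right _ _)
  set F : ℝ → ℂ := fun y => ((Wf κ t y : ℂ) * ee (h * Xf θ t y)) * ee (ν * y) with hF
  have e1 : ∀ s, 0 < s → (Wf κ t (y0 * s) : ℂ) * ee (ν * y0 * qf θ s) = F (y0 * s) := by
    intro s hs
    rw [hF]; simp only
    rw [mul_assoc (Wf κ t (y0 * s) : ℂ), ← ee_add]
    congr 2
    unfold Xf qf
    rw [mul_rpow hy.le hs.le]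
    linear_combination (-s ^ (-θ)) * hq
  have e2 : ∫ s in s0..S, (Wf κ t (y0 * s) : ℂ) * ee (ν * y0 * qf θ s) = ∫ s in s0..S, F (y0 * s) := by
    apply intervalIntegral.integral_congr
    intro s hs
    exact e1 s (lt_of_lt_of_le (lt_min hs0p hSp) hs.1)
  have cF : ∀ y, 0 < y → ContinuousAt F y := by
    intro y hy
    have c1 := (hB.d y hy).continuousAt
    have c2 := (Xf_d (θ := θ) (t := t) hy).continuousAt
    have c4 : ContinuousAt (fun y => (Wf κ t y : ℂ)) y := Complex.continuous_ofReal.continuousAt.comp c1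
    have c5 : ContinuousAt (fun y => ee (h * Xf θ t y)) y := ee_continuous.continuousAt.comp (c2.const_mul h)
    exact (c4.mul c5).mul (ee_continuous.comp (by fun_prop : Continuous (fun y => ν * y))).continuousAt
  have iF : ∀ p q, 0 < p → 0 < q → IntervalIntegrable F volume p q := by
    intro p q hp hq
    exact ContinuousOn.intervalIntegrable (fun x hx => (cF x (lt_of_lt_of_le (lt_min hp hq) hx.1)).continuousWithinAt)
  have z1 : y0 * s0 ≤ 1/4 := by
    calc y0 * s0 ≤ y0 * (1 / (4 * y0)) := mul_le_mul_of_nonneg_left (min_le_left _ _) hy.le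
      _ = 1/4 := by field_simp
  have z2 : R ≤ y0 * S := by
    calc R = y0 * (R / y0) := by field_simp
      _ ≤ _ := mul_le_mul_of_nonneg_left (le_max_left _ _) hy.le
  have hp1 : 0 < y0 * s0 := by positivity
  have hp2 : 0 < y0 * S := by positivity
  have e3 : y0 * ∫ s in s0..S, F (y0 * s) = ∫ y in (1/4)..R, F y := by
    rw [intervalIntegral.integral_comp_mul_left F hy.ne', Complex.real_smul, ← mul_assoc, Complex.ofReal_inv,
      mul_inv_cancel₀ (by exact_mod_cast hy.ne'), one_mul]
    rw [← intervalIntegral.integral_add_adjacent_intervals (iF _ (1/4) hp1 (by norm_num)) (iF (1/4) _ (by norm_num) hp2),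
      ← intervalIntegral.integral_add_adjacent_intervals (iF (1/4) R (by norm_num) (by linarith)) (iF R _ (by linarith) hp2)]
    have k1 : ∫ y in (y0 * s0)..(1/4), F y = 0 := by
      rw [intervalIntegral.integral_congr (g := fun _ => 0)]; · simp
      intro y hyy
      rw [Set.uIcc_of_le z1] at hyy
      simp only [hF]
      rw [Wf_small (by linarith [hyy.1]) (by linarith [hyy.2])]; simp
    have k2 : ∫ y in R..(y0 * S), F y = 0 := by
      rw [intervalIntegral.integral_congr (g := fun _ => 0)]; · simp
      intro y hyy
      rw [Set.uIcc_of_le z2] at hyy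
      simp only [hF]
      rw [Wf_large hκ (by linarith) (by linarith [hyy.1])]; simp
    rw [k1, k2]; ring
  rw [e2, mul_one] at key
  have e4 : (Wf κ t y0 * √(y0 / ((1 + θ) * ν)) : ℝ) * ee (ν * y0 * (1 + 1 / θ) + 1/8) =
      y0 * ((Wf κ t y0 : ℂ) * (ee (ν * y0 * qf θ 1 + 1 / 8) / (√((1 + θ) * (ν * y0)) : ℝ))) := by
    have : √(y0 / ((1 + θ) * ν)) = y0 / √((1 + θ) * (ν * y0)) := by
      rw [eq_div_iff (by positivity), ← Real.sqrt_mul (by positivity), show y0 / ((1 + θ) * ν) * ((1 + θ) * (ν * y0)) = y0 * y0 by field_simp,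
        Real.sqrt_mul_self hy.le]
    rw [this]
    have hqq : qf θ 1 = 1 + 1 / θ := by unfold qf; simp; ring
    rw [hqq]; push_cast; ring
  rw [e4, ← e3, ← mul_sub, norm_mul, Complex.norm_real, Real.norm_eq_abs, abs_of_pos hy]
  calc _ ≤ y0 * (C0 * B * (1 + |log (ν * y0)| + log S) / (ν * y0)) := mul_le_mul_of_nonneg_left key hy.le
    _ = _ := by field_simp

lemma neg_part {θ κ B K0 : ℝ} (hθ : 0 < θ) (hκ : 0 < κ) (hK : 0 < K0)
     {t h k : ℝ} {R : ℝ} (hB : Amp (Wf κ t) (Wf' κ t) B)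
    (ht : 1 ≤ t) (hh : 1 ≤ h) (hk : 0 ≤ k) (hR : t * exp (1 / (2 * κ)) ≤ R) (hR2 : R ≤ K0 * t) :
    ‖∫ y in (1/4)..R, ((Wf κ t y : ℂ) * ee (h * Xf θ t y)) * ee (-(k * y))‖ ≤
      (B + θ + 1) * (log 4 + log R) / (θ * K0 ^ (-θ - 1) + k) := by
  have hR1 : 1 ≤ R := by
    have : 1 ≤ exp (1 / (2 * κ)) := Real.one_le_exp (by positivity)
    nlinarith
  have hB1 := hB.hB
  have h14 : (1/4 : ℝ) ≤ R := by linarith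
  have hpos : ∀ y ∈ Set.Icc (1/4) R, 0 < y := fun y hy => by linarith [hy.1]
  set c := θ * K0 ^ (-θ - 1) + k with hc
  have hcp : 0 < c := by positivity
  set Ph1 : ℝ → ℝ := fun y => -(θ * h * t ^ (1 + θ) * y ^ (-θ - 1) + k) with hPh1
  set Ph2 : ℝ → ℝ := fun y => θ * h * t ^ (1 + θ) * ((θ + 1) * y ^ (-θ - 2)) with hPh2
  have hlow : ∀ y ∈ Set.Icc (1/4) R, c ≤ -Ph1 y := by
    intro y hy
    have hy0 := hpos y hy
    simp only [hPh1, neg_neg, hc]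
    have h1 : K0 ^ (-θ - 1) ≤ t ^ (1 + θ) * y ^ (-θ - 1) := by
      have : y ≤ K0 * t := hy.2.trans hR2
      have h2 : (K0 * t) ^ (-θ - 1) ≤ y ^ (-θ - 1) := rpow_le_rpow_of_nonpos hy0 this (by linarith)
      rw [mul_rpow hK.le (by linarith)] at h2
      have h3 : t ^ (1 + θ) * t ^ (-θ - 1) = 1 := by
        rw [← rpow_add (by linarith), show 1 + θ + (-θ - 1) = 0 by ring, rpow_zero]
      calc K0 ^ (-θ - 1) = t ^ (1+θ) * (K0 ^ (-θ - 1) * t ^ (-θ-1)) := by rw [mul_left_comm, h3, mul_one]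
        _ ≤ _ := mul_le_mul_of_nonneg_left h2 (by positivity)
    have h2 : θ * K0 ^ (-θ - 1) ≤ θ * (t ^ (1 + θ) * y ^ (-θ - 1)) := mul_le_mul_of_nonneg_left h1 hθ.le
    have h3 : 0 ≤ θ * (t ^ (1 + θ) * y ^ (-θ - 1)) := by positivity
    nlinarith
  have hM : ∫ y in (1/4)..R, |(Wf' κ t y * Ph1 y - Wf κ t y * Ph2 y) / Ph1 y ^ 2| ≤ (B + θ + 1) * (log 4 + log R) / c := by
    have hb : ∀ y ∈ Set.Icc (1/4) R, |(Wf' κ t y * Ph1 y - Wf κ t y * Ph2 y) / Ph1 y ^ 2| ≤ (B + θ + 1) / c * (1 / y) := by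
      intro y hy
      have hy0 := hpos y hy
      have hl := hlow y hy
      have habs : |Ph1 y| = -Ph1 y := abs_of_nonpos (by linarith)
      have hP2 : |Ph2 y| ≤ (θ + 1) / y * |Ph1 y| := by
        have e : y ^ (-θ - 2) = y ^ (-θ - 1) / y := by rw [show -θ - 2 = -θ - 1 - 1 by ring, rpow_sub_one hy0.ne']
        have : 0 ≤ Ph2 y := by simp only [hPh2]; positivity
        rw [abs_of_nonneg this, habs]
        simp only [hPh1, hPh2, neg_neg]
        rw [e]
        have : (θ + 1) / y * (θ * h * t ^ (1 + θ) * y ^ (-θ - 1) + k) = θ * h * t ^ (1 + θ) * ((θ + 1) * (y ^ (-θ - 1) / y)) + (θ+1)/y * k := by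
          field_simp
        rw [this]
        have : 0 ≤ (θ+1)/y * k := by positivity
        linarith
      have hp : 0 < |Ph1 y| := by rw [habs]; linarith
      rw [abs_div, abs_pow, div_le_iff₀ (by positivity)]
      have n1 : |Wf' κ t y * Ph1 y - Wf κ t y * Ph2 y| ≤ B / y * |Ph1 y| + 1 * ((θ + 1) / y * |Ph1 y|) := by
        refine (abs_sub _ _).trans ?_
        rw [abs_mul, abs_mul]
        exact add_le_add (mul_le_mul_of_nonneg_right (hB.b1 y hy0) hp.le) (mul_le_mul (hB.b0 y hy0) hP2 (abs_nonneg _) (by norm_num))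
      refine n1.trans ?_
      have n2 : B / y * |Ph1 y| + 1 * ((θ + 1) / y * |Ph1 y|) = (B + θ + 1) / c * (1/y) * (c * |Ph1 y|) := by field_simp; ring
      rw [n2]
      apply mul_le_mul_of_nonneg_left _ (by positivity)
      rw [sq]; exact mul_le_mul_of_nonneg_right (by rw [habs]; exact hl) hp.le
    have ci : IntervalIntegrable (fun y : ℝ => (B + θ + 1) / c * (1 / y)) volume (1/4) R := by
      apply ContinuousOn.intervalIntegrable
      rw [Set.uIcc_of_le h14]
      exact continuousOn_const.mul (continuousOn_const.div continuousOn_id (fun y hy => (hpos y hy).ne'))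
    have cW : ContinuousOn (Wf κ t) (Set.Icc (1/4) R) := fun y hy => (hB.d y (hpos y hy)).continuousAt.continuousWithinAt
    have cW' : ContinuousOn (Wf' κ t) (Set.Icc (1/4) R) := hB.c.mono (fun y hy => hpos y hy)
    have cr : ∀ e : ℝ, ContinuousOn (fun y : ℝ => y ^ e) (Set.Icc (1/4) R) := fun e => continuousOn_id.rpow_const (fun y hy => Or.inl (hpos y hy).ne')
    have c1 : ContinuousOn Ph1 (Set.Icc (1/4) R) := ((continuousOn_const.mul (cr _)).add continuousOn_const).neg
    have c2 : ContinuousOn Ph2 (Set.Icc (1/4) R) := continuousOn_const.mul (continuousOn_const.mul (cr _))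
    have cl : IntervalIntegrable (fun y : ℝ => |(Wf' κ t y * Ph1 y - Wf κ t y * Ph2 y) / Ph1 y ^ 2|) volume (1/4) R := by
      apply ContinuousOn.intervalIntegrable
      rw [Set.uIcc_of_le h14]
      exact (((cW'.mul c1).sub (cW.mul c2)).div (c1.pow 2) (fun y hy => pow_ne_zero _ (by have := hlow y hy; intro h0; rw [h0] at this; linarith))).abs
    refine (intervalIntegral.integral_mono_on h14 cl ci hb).trans ?_
    rw [intervalIntegral.integral_const_mul, integral_one_div_of_pos (by norm_num) (by linarith), Real.log_div (by linarith) (by norm_num)]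
    rw [show (1/4:ℝ) = 4⁻¹ by norm_num, Real.log_inv]
    apply le_of_eq; ring
  have := fdt (P := fun y => h * Xf θ t y - k * y) (P1 := Ph1) (P2 := Ph2) (W := Wf κ t) (W' := Wf' κ t) h14 ?_ ?_ ?_
    (fun y hy => hB.d y (hpos y hy)) (hB.c.mono (fun y hy => hpos y hy)) ?_ hM
  · rw [Wf_small (y := 1/4) (by norm_num) (by norm_num), Wf_large hκ (by linarith) hR] at this
    simp only [zero_div, abs_zero, zero_add] at this
    have e : ∀ y, (Wf κ t y : ℂ) * ee (h * Xf θ t y) * ee (-(k * y)) = (Wf κ t y : ℂ) * ee (h * Xf θ t y - k * y) := by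
      intro y; rw [mul_assoc, ← ee_add, sub_eq_add_neg]
    simp only [e]; exact this
  · intro y hy
    refine (((Xf_d (hpos y hy)).const_mul h).sub ((hasDerivAt_id y).const_mul k)).congr_deriv ?_
    simp only [hPh1]; ring
  · intro y hy
    refine ((((Real.hasDerivAt_rpow_const (Or.inl (hpos y hy).ne')).const_mul (θ * h * t ^ (1 + θ))).add_const k).neg).congr_deriv ?_
    simp only [hPh2]; rw [show -θ - 1 - 1 = -θ - 2 by ring]; ring
  · exact continuousOn_const.mul (continuousOn_const.mul (continuousOn_id.rpow_const (fun y hy => Or.inl (hpos y hy).ne')))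
  · intro y hy h0
    have := hlow y hy; rw [h0] at this; linarith

end MSQ

namespace MSQ

lemma harm (N : ℕ) : ∑ k ∈ Finset.range N, 1 / ((k:ℝ) + 1) ≤ 1 + log N := by
  have := harmonic_le_one_add_log N
  unfold harmonic at this
  push_cast at this
  simpa [one_div] using this

lemma log_yst {θ t h ν N : ℝ} (hθ : 0 < θ) (ht : 1 ≤ t) (hh : 1 ≤ h) (hν : 1 ≤ ν) (hN : t ≤ N) (hN2 : h ≤ N) (hN3 : ν ≤ N) :
    |log (yst θ t h ν)| ≤ |log θ| + 3 * log N := by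
  unfold yst
  have h1 : log t ≤ log N := Real.log_le_log (by linarith) hN
  have h2 : log h ≤ log N := Real.log_le_log (by linarith) hN2
  have h3 : log ν ≤ log N := Real.log_le_log (by linarith) hN3
  have g1 := Real.log_nonneg ht
  have g2 := Real.log_nonneg hh
  have g3 := Real.log_nonneg hν
  rw [Real.log_mul (by positivity) (by positivity), Real.log_rpow (by positivity), Real.log_div (by positivity) (by positivity), Real.log_mul (by positivity) (by positivity)]
  have e1 : (1 / (1 + θ)) ≤ 1 := by rw [div_le_one (by linarith)]; linarith
  have e0 : 0 ≤ 1 / (1 + θ) := by positivity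
  have : |1 / (1 + θ) * (log θ + log h - log ν)| ≤ |log θ| + 2 * log N := by
    rw [abs_mul, abs_of_nonneg e0]
    have a1 : |log θ + log h - log ν| ≤ |log θ| + 2 * log N := by
      rw [abs_le]; constructor <;> linarith [neg_abs_le (log θ), le_abs_self (log θ)]
    exact (mul_le_of_le_one_left (abs_nonneg _) e1).trans a1
  refine (abs_add_le _ _).trans ?_
  rw [abs_of_nonneg g1]; linarith

set_option maxHeartbeats 1600000 in
lemma vdc {θ κ K0 : ℝ} (hθ : 0 < θ) (hκ : 0 < κ) (hK : 0 < K0) : ∃ C > 0, ∀ (t h : ℝ) (R N : ℕ), 1 ≤ t → 1 ≤ h →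
    t * exp (1 / (2 * κ)) ≤ R → (R:ℝ) ≤ K0 * t → C * h ^ 2 * t ^ (4 + 2 * θ) ≤ N →
    ‖∑ n ∈ Finset.range R, (wt κ ((n + 1) / t) : ℂ) * ee (h * Xf θ t (n + 1)) -
      ∑ k ∈ Finset.range N, (Wf κ t (yst θ t h (k + 1)) * √(yst θ t h (k + 1) / ((1 + θ) * ((k:ℝ) + 1))) : ℝ) *
        ee (((k:ℝ) + 1) * yst θ t h (k + 1) * (1 + 1 / θ) + 1/8)‖ ≤ C * (1 + log N) ^ 2 := by
  obtain ⟨B, hB⟩ := Wf_amp hκ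
  obtain ⟨C0, hC0, hsp⟩ := sp_full hθ
  have hB1 : 1 ≤ B := (hB 1 one_pos).hB
  set c := min (θ * K0 ^ (-θ - 1)) 1 with hc
  have hcp : 0 < c := by positivity
  set M := 4 * B + 2 * π * θ * 4 ^ (θ + 1) with hM
  have hMp : 0 < M := by positivity
  set D1 := C0 * B * (3 + 2 * |log θ| + 8) with hD1
  set D2 := (B + θ + 1) * (log 4 + 1) / c with hD2
  have hl4 : 0 < log 4 := Real.log_pos (by norm_num)
  have hD1p : 0 ≤ D1 := by positivity
  have hD2p : 0 ≤ D2 := by positivity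
  refine ⟨((K0 + 1) * M) ^ 2 + K0 + 1 + (1 + D2) + (D1 + D2), by positivity, ?_⟩
  set C := ((K0 + 1) * M) ^ 2 + K0 + 1 + (1 + D2) + (D1 + D2) with hCdef
  intro t h R N ht hh hR1 hR2 hN
  have ht0 : 0 < t := by linarith
  have tp1 : t ≤ t ^ (4 + 2 * θ) := by
    nth_rewrite 1 [← rpow_one t]; exact rpow_le_rpow_of_exponent_le ht (by linarith)
  have hC1 : 1 ≤ C := by have : 0 ≤ ((K0 + 1) * M) ^ 2 := by positivity
                         linarith
  have hCK : K0 ≤ C := by have : 0 ≤ ((K0 + 1) * M) ^ 2 := by positivity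
                          linarith
  have hh2 : h ≤ h ^ 2 := by nlinarith
  have ht2 : 1 ≤ t ^ (4 + 2 * θ) := by linarith
  have hN_t : K0 * t ≤ N := by
    refine le_trans ?_ hN
    calc K0 * t ≤ C * t ^ (4 + 2*θ) := mul_le_mul hCK tp1 ht0.le (by linarith)
      _ ≤ C * h ^ 2 * t ^ (4 + 2 * θ) := mul_le_mul_of_nonneg_right (by nlinarith) (by linarith)
  have hN_t1 : t ≤ N := by
    refine le_trans ?_ hN
    calc t ≤ 1 * t ^ (4 + 2*θ) := by linarith
      _ ≤ C * h ^ 2 * t ^ (4 + 2 * θ) := mul_le_mul_of_nonneg_right (by nlinarith) (by linarith)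
  have hN_h : h ≤ N := by
    refine le_trans ?_ hN
    calc h ≤ C * h ^ 2 := by nlinarith
      _ ≤ C * h ^ 2 * t ^ (4 + 2 * θ) := le_mul_of_one_le_right (by positivity) ht2
  have hN0 : 0 < N := by have : (0:ℝ) < N := by linarith
                         exact_mod_cast this
  have hRr : 1 ≤ (R:ℝ) := by
    have : 1 ≤ exp (1 / (2 * κ)) := Real.one_le_exp (by positivity)
    exact ht.trans ((le_mul_of_one_le_right ht0.le this).trans hR1)
  have hR : 1 ≤ R := by exact_mod_cast hRr
  have hRN : (R:ℝ) ≤ N := hR2.trans hN_t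
  have hA := hB t ht0
  have hlogN : 0 ≤ log N := Real.log_nonneg (by linarith)
  have hlogR : log R ≤ log N := Real.log_le_log (by linarith) hRN
  set L := 1 + log N with hL
  set f : ℝ → ℂ := fun y => (Wf κ t y : ℂ) * ee (h * Xf θ t y) with hf
  set f' : ℝ → ℂ := fun y => (Wf' κ t y : ℂ) * ee (h * Xf θ t y) + (Wf κ t y : ℂ) *
    ((2 * π * (h * (-θ * t ^ (1 + θ) * y ^ (-θ - 1))) : ℝ) * Complex.I * ee (h * Xf θ t y)) with hf'
  have hpos : ∀ y ∈ Set.Icc (1/4) (R:ℝ), 0 < y := fun y hy => by linarith [hy.1]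
  have cX : ContinuousOn (fun y => ee (h * Xf θ t y)) (Set.Icc (1/4) (R:ℝ)) := fun y hy =>
    (ee_deriv ((Xf_d (hpos y hy)).const_mul h)).continuousAt.continuousWithinAt
  have cW : ContinuousOn (fun y => (Wf κ t y : ℂ)) (Set.Icc (1/4) (R:ℝ)) := fun y hy =>
    (hA.d y (hpos y hy)).ofReal_comp.continuousAt.continuousWithinAt
  have cr : ContinuousOn (fun y : ℝ => y ^ (-θ - 1)) (Set.Icc (1/4) (R:ℝ)) := continuousOn_id.rpow_const (fun y hy => Or.inl (hpos y hy).ne')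
  have em := em_trunc (f := f) (f' := f') (s0 := 1/4) (M1 := M * h * t ^ (1 + θ)) (R := R) (N := N) (by norm_num) (by norm_num) hR
    (fun y hy => (hA.d y (hpos y hy)).ofReal_comp.mul (ee_deriv ((Xf_d (hpos y hy)).const_mul h)))
    (by
      refine ((Complex.continuous_ofReal.comp_continuousOn (hA.c.mono fun y hy => hpos y hy)).mul cX).add (cW.mul (ContinuousOn.mul (ContinuousOn.mul ?_ continuousOn_const) cX))
      exact Complex.continuous_ofReal.comp_continuousOn (continuousOn_const.mul (continuousOn_const.mul (continuousOn_const.mul cr))))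
    (by simp only [hf]; rw [Wf_small (by norm_num) (by norm_num)]; simp)
    (by simp only [hf]; rw [Wf_large hκ ht0 hR1]; simp)
    (by
      intro y hy
      have hy0 := hpos y hy
      have t1 : 1 ≤ t ^ (1 + θ) := Real.one_le_rpow ht (by linarith)
      have b1 : |Wf' κ t y| ≤ 4 * B := by
        refine (hA.b1 y hy0).trans ?_
        rw [div_le_iff₀ hy0]; nlinarith [hy.1]
      have b2 : y ^ (-θ - 1) ≤ 4 ^ (θ + 1) := by
        have : y ^ (-θ - 1) ≤ (1/4:ℝ) ^ (-θ - 1) := rpow_le_rpow_of_nonpos (by norm_num) hy.1 (by linarith)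
        rw [show (1/4:ℝ) = 4⁻¹ by norm_num, inv_rpow (by norm_num), ← rpow_neg (by norm_num)] at this
        rwa [show -(-θ - 1) = θ + 1 by ring] at this
      have b3 : 0 ≤ y ^ (-θ - 1) := by positivity
      simp only [hf']
      refine (norm_add_le _ _).trans ?_
      rw [norm_mul, norm_mul, norm_mul, norm_mul, ee_norm, Complex.norm_I, mul_one, mul_one, mul_one, Complex.norm_real, Complex.norm_real, Complex.norm_real,
        Real.norm_eq_abs, Real.norm_eq_abs, Real.norm_eq_abs]
      have b4 : |2 * π * (h * (-θ * t ^ (1 + θ) * y ^ (-θ - 1)))| ≤ 2 * π * θ * 4 ^ (θ+1) * (h * t ^ (1+θ)) := by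
        have : 2 * π * (h * (-θ * t ^ (1 + θ) * y ^ (-θ - 1))) = -(2 * π * θ * y ^ (-θ - 1) * (h * t ^ (1+θ))) := by ring
        rw [this, abs_neg, abs_of_nonneg (by positivity)]
        apply mul_le_mul_of_nonneg_right _ (by positivity)
        exact mul_le_mul_of_nonneg_left b2 (by positivity)
      have b5 : |Wf κ t y| * |2 * π * (h * (-θ * t ^ (1 + θ) * y ^ (-θ - 1)))| ≤ 2 * π * θ * 4 ^ (θ+1) * (h * t ^ (1+θ)) :=
        (mul_le_of_le_one_left (abs_nonneg _) (hA.b0 y hy0)).trans b4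
      have b6 : 4 * B ≤ 4 * B * (h * t ^ (1+θ)) := le_mul_of_one_le_right (by positivity) (by nlinarith)
      have : M * h * t ^ (1 + θ) = 4 * B * (h * t ^ (1+θ)) + 2 * π * θ * 4 ^ (θ+1) * (h * t ^ (1+θ)) := by rw [hM]; ring
      rw [this]; linarith)
    hN0
    (by
      refine le_trans ?_ hN
      have t1 : 0 ≤ t ^ (1 + θ) := by positivity
      have a1 : (R + 1) * (M * h * t ^ (1+θ)) ≤ ((K0 + 1) * t) * (M * h * t ^ (1+θ)) := by
        apply mul_le_mul_of_nonneg_right _ (by positivity); linarith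
      have a2 : ((R + 1) * (M * h * t ^ (1+θ)))^2 ≤ (((K0 + 1) * t) * (M * h * t ^ (1+θ)))^2 := by
        apply pow_le_pow_left₀ (by positivity) a1
      refine a2.trans ?_
      have a3 : (((K0 + 1) * t) * (M * h * t ^ (1+θ)))^2 = ((K0 + 1) * M)^2 * (h^2 * t ^ (4 + 2 * θ)) := by
        have : t ^ (4 + 2 * θ) = t ^ 2 * (t ^ (1+θ)) ^ 2 := by
          rw [← rpow_natCast (t ^ (1+θ)), ← rpow_mul ht0.le, ← rpow_natCast t, ← rpow_add ht0]; congr 1; push_cast; ring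
        rw [this]; ring
      rw [a3, mul_assoc]
      apply mul_le_mul_of_nonneg_right _ (by positivity)
      linarith)
  have e0 : ∑ n ∈ Finset.range R, (wt κ ((n + 1) / t) : ℂ) * ee (h * Xf θ t (n + 1)) = ∑ n ∈ Finset.range R, f ((n:ℝ) + 1) := by
    apply Finset.sum_congr rfl; intro n _
    simp only [hf]; rw [Wf_nat]
  rw [e0]
  set mt : ℕ → ℂ := fun k => (Wf κ t (yst θ t h (k + 1)) * √(yst θ t h (k + 1) / ((1 + θ) * ((k:ℝ) + 1))) : ℝ) *
        ee (((k:ℝ) + 1) * yst θ t h (k + 1) * (1 + 1 / θ) + 1/8) with hmt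
  set I1 : ℕ → ℂ := fun k => ∫ x in (1/4)..(R:ℝ), f x * ee (((k:ℝ)+1) * x) with hI1
  set I2 : ℕ → ℂ := fun k => ∫ x in (1/4)..(R:ℝ), f x * ee (-(((k:ℝ)+1) * x)) with hI2
  have neg : ∀ k : ℝ, 0 ≤ k → ‖∫ y in (1/4)..(R:ℝ), f y * ee (-(k * y))‖ ≤ (B + θ + 1) * (log 4 + log R) / (θ * K0 ^ (-θ - 1) + k) := fun k hk =>
    neg_part hθ hκ hK hA ht hh hk hR1 hR2
  have hnum : (B + θ + 1) * (log 4 + log R) ≤ (B + θ + 1) * (log 4 + 1) * L := by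
    rw [mul_assoc]
    apply mul_le_mul_of_nonneg_left _ (by positivity)
    rw [hL]; nlinarith
  have hlogR0 : 0 ≤ log (R:ℝ) := Real.log_nonneg hRr
  have n0 : ‖∫ y in (1/4)..(R:ℝ), f y‖ ≤ D2 * L := by
    have := neg 0 le_rfl
    simp only [zero_mul, neg_zero, add_zero] at this
    have e : ee 0 = 1 := by simp [ee]
    simp only [e, mul_one] at this
    refine this.trans ?_
    calc _ ≤ (B + θ + 1) * (log 4 + log R) / c := by
            apply div_le_div_of_nonneg_left (by positivity) hcp (min_le_left _ _)
      _ ≤ (B + θ + 1) * (log 4 + 1) * L / c := div_le_div_of_nonneg_right hnum hcp.le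
      _ = _ := by rw [hD2]; ring
  have n2 : ∀ k : ℕ, ‖I2 k‖ ≤ D2 * L * (1 / ((k:ℝ)+1)) := by
    intro k
    refine (neg ((k:ℝ)+1) (by positivity)).trans ?_
    have : c * ((k:ℝ)+1) ≤ θ * K0 ^ (-θ - 1) + ((k:ℝ) + 1) := by
      have : c ≤ 1 := min_le_right _ _
      have : 0 < θ * K0 ^ (-θ - 1) := by positivity
      nlinarith [Nat.cast_nonneg (α := ℝ) k]
    calc _ ≤ (B + θ + 1) * (log 4 + log R) / (c * ((k:ℝ)+1)) := by
            apply div_le_div_of_nonneg_left (by positivity) (by positivity) this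
      _ ≤ (B + θ + 1) * (log 4 + 1) * L / (c * ((k:ℝ)+1)) := div_le_div_of_nonneg_right hnum (by positivity)
      _ = _ := by rw [hD2]; field_simp
  have n1 : ∀ k ∈ Finset.range N, ‖I1 k - mt k‖ ≤ D1 * L * (1 / ((k:ℝ)+1)) := by
    intro k hk
    have hkN : (k:ℝ) + 1 ≤ N := by exact_mod_cast Finset.mem_range.1 hk
    have hk1 : (1:ℝ) ≤ (k:ℝ)+1 := by linarith [Nat.cast_nonneg (α := ℝ) k]
    refine (pos_part (R := (R:ℝ)) hθ hκ hsp hA ht hh hk1 hR1).trans ?_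
    have ly := log_yst hθ ht hh hk1 hN_t1 hN_h hkN
    have hy := yst_pos (t := t) (h := h) (ν := (k:ℝ)+1) hθ (by linarith) (by linarith) (by linarith)
    set y0 := yst θ t h ((k:ℝ)+1)
    have lk : log ((k:ℝ)+1) ≤ log N := Real.log_le_log (by linarith) hkN
    have lk0 : 0 ≤ log ((k:ℝ)+1) := Real.log_nonneg hk1
    have l1 : |log (((k:ℝ)+1) * y0)| ≤ |log θ| + 4 * log N := by
      rw [Real.log_mul (by positivity) hy.ne']
      refine (abs_add_le _ _).trans ?_
      rw [abs_of_nonneg lk0]; linarith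
    have l2 : log (max (R / y0) (3/2)) ≤ 1 + |log θ| + 4 * log N := by
      rcases le_total (R / y0) (3/2) with h1 | h1
      · rw [max_eq_right h1]
        have : log (3/2:ℝ) ≤ 3/2 - 1 := Real.log_le_sub_one_of_pos (by norm_num)
        linarith [abs_nonneg (log θ)]
      · rw [max_eq_left h1, Real.log_div (by linarith) hy.ne']
        linarith [neg_abs_le (log y0)]
    have : 1 + |log (((k:ℝ)+1) * y0)| + log (max (R / y0) (3/2)) ≤ (3 + 2 * |log θ| + 8) * L := by
      rw [hL]; nlinarith [abs_nonneg (log θ), mul_nonneg (abs_nonneg (log θ)) hlogN]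
    rw [mul_one_div]
    apply div_le_div_of_nonneg_right _ (by linarith)
    rw [hD1, mul_assoc (C0 * B)]
    exact mul_le_mul_of_nonneg_left this (by positivity)
  have e1 : ∑ n ∈ Finset.range R, f ((n:ℝ) + 1) - ∑ k ∈ Finset.range N, mt k =
      (∑ n ∈ Finset.range R, f ((n:ℝ) + 1) - (∫ x in (1/4)..(R:ℝ), f x) - ∑ k ∈ Finset.range N, (I1 k + I2 k)) + (∫ x in (1/4)..(R:ℝ), f x) +
        ∑ k ∈ Finset.range N, ((I1 k - mt k) + I2 k) := by
    simp only [Finset.sum_add_distrib, Finset.sum_sub_distrib]; ring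
  rw [e1]
  have hsum : ‖∑ k ∈ Finset.range N, ((I1 k - mt k) + I2 k)‖ ≤ (D1 + D2) * L * L := by
    calc _ ≤ ∑ k ∈ Finset.range N, ((D1 + D2) * L * (1 / ((k:ℝ)+1))) := by
          apply norm_sum_le_of_le
          intro k hk
          refine (norm_add_le _ _).trans ?_
          linarith [n1 k hk, n2 k]
      _ ≤ _ := by
          rw [← Finset.mul_sum]
          exact mul_le_mul_of_nonneg_left (harm N) (by positivity)
  refine (norm_add_le _ _).trans ?_
  have := (norm_add_le (∑ n ∈ Finset.range R, f ((n:ℝ) + 1) - (∫ x in (1/4)..(R:ℝ), f x) - ∑ k ∈ Finset.range N, (I1 k + I2 k)) (∫ x in (1/4)..(R:ℝ), f x))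
  have hL1 : 1 ≤ L := by linarith
  have hLL : L ≤ L ^ 2 := by nlinarith
  have f1 : D2 * L ≤ D2 * L ^ 2 := mul_le_mul_of_nonneg_left hLL hD2p
  have f2 : (1 + D2 + (D1 + D2)) * L ^ 2 ≤ C * L ^ 2 := by
    apply mul_le_mul_of_nonneg_right _ (by positivity)
    have : 0 ≤ ((K0 + 1) * M) ^ 2 := by positivity
    linarith
  have f3 : (D1 + D2) * L * L = (D1 + D2) * L ^ 2 := by ring
  have f4 : (1 + D2 + (D1 + D2)) * L ^ 2 = L ^ 2 + D2 * L ^ 2 + (D1 + D2) * L ^ 2 := by ring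
  linarith

end MSQ

namespace MSQ

lemma ee_im (x : ℝ) : (ee x).im = sin (2 * π * x) := by unfold ee; exact Complex.exp_ofReal_mul_I_im _

lemma sum_Icc1 (f : ℕ → ℝ) (N : ℕ) : ∑ h ∈ Finset.Icc 1 N, f h = ∑ k ∈ Finset.range N, f (k + 1) := by
  have : Finset.Icc 1 N = Finset.Ico (0+1) (N+1) := by ext; simp [Nat.lt_succ_iff]
  rw [this, ← Finset.sum_Ico_add', ← Finset.range_eq_Ico]

lemma SSH_main {θ κ K0 : ℝ} (hθ : 0 < θ) (hκ : 0 < κ) (hK : 0 < K0) : ∃ C > 0, ∀ (t : ℝ) (R H N : ℕ), 1 ≤ t → 1 ≤ H → H ≤ N →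
    t * exp (1 / (2 * κ)) ≤ R → (R:ℝ) ≤ K0 * t → C * H ^ 2 * t ^ (4 + 2 * θ) ≤ N →
    |SSH θ κ R H t + ∑ h ∈ Finset.Icc 1 H, ∑ ν ∈ Finset.Icc 1 N, 1 / (π * h) * (Wf κ t (yst θ t h ν) * √(yst θ t h ν / ((1 + θ) * ν)) *
       sin (2 * π * (ν * yst θ t h ν * (1 + 1 / θ) + 1/8)))| ≤ C * (1 + log N) ^ 3 := by
  obtain ⟨C, hC, hv⟩ := vdc hθ hκ hK
  refine ⟨C, hC, ?_⟩
  intro t R H N ht hH hHN hR1 hR2 hN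
  have e1 : SSH θ κ R H t = -∑ h ∈ Finset.Icc 1 H, 1 / (π * h) * (∑ n ∈ Finset.range R, (wt κ ((n + 1) / t) : ℂ) * ee (h * Xf θ t (n + 1))).im := by
    rw [sum_Icc1 (fun h => 1 / (π * h) * (∑ n ∈ Finset.range R, (wt κ ((n + 1) / t) : ℂ) * ee (h * Xf θ t (n + 1))).im)]
    unfold SSH sawH
    simp only [mul_neg, Finset.sum_neg_distrib, Complex.im_sum, Finset.mul_sum]
    rw [Finset.sum_comm]
    congr 1
    apply Finset.sum_congr rfl; intro k _
    apply Finset.sum_congr rfl; intro n _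
    rw [Complex.im_ofReal_mul, ee_im]
    push_cast
    rw [show 2 * π * (((k:ℝ) + 1) * Xf θ t (n + 1)) = 2 * π * (k + 1) * Xf θ t (n+1) by ring]
    ring
  have e2 : ∀ h : ℕ, ∑ ν ∈ Finset.Icc 1 N, 1 / (π * h) * (Wf κ t (yst θ t h ν) * √(yst θ t h ν / ((1 + θ) * ν)) *
       sin (2 * π * (ν * yst θ t h ν * (1 + 1 / θ) + 1/8))) = 1 / (π * h) * (∑ k ∈ Finset.range N, (Wf κ t (yst θ t h (k + 1)) * √(yst θ t h (k + 1) / ((1 + θ) * ((k:ℝ) + 1))) : ℝ) *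
        ee (((k:ℝ) + 1) * yst θ t h (k + 1) * (1 + 1 / θ) + 1/8)).im := by
    intro h
    rw [← Finset.mul_sum, Complex.im_sum, sum_Icc1 (fun ν => (Wf κ t (yst θ t h ν) * √(yst θ t h ν / ((1 + θ) * ν)) *
       sin (2 * π * (ν * yst θ t h ν * (1 + 1 / θ) + 1/8))))]
    congr 1
    apply Finset.sum_congr rfl; intro k _
    rw [Complex.im_ofReal_mul, ee_im]
    push_cast; rfl
  simp only [e2]
  rw [e1, neg_add_eq_sub, ← Finset.sum_sub_distrib]
  refine (Finset.abs_sum_le_sum_abs _ _).trans ?_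
  have hN1 : 1 ≤ N := hH.trans hHN
  have hl : 0 ≤ log (N:ℝ) := Real.log_nonneg (by exact_mod_cast hN1)
  have hlH : log (H:ℝ) ≤ log N := Real.log_le_log (by exact_mod_cast hH) (by exact_mod_cast hHN)
  have hb : ∀ h ∈ Finset.Icc 1 H, |1 / (π * h) * (∑ k ∈ Finset.range N, (Wf κ t (yst θ t h (k + 1)) * √(yst θ t h (k + 1) / ((1 + θ) * ((k:ℝ) + 1))) : ℝ) *
        ee (((k:ℝ) + 1) * yst θ t h (k + 1) * (1 + 1 / θ) + 1/8)).im - 1 / (π * h) * (∑ n ∈ Finset.range R, (wt κ ((n + 1) / t) : ℂ) * ee (h * Xf θ t (n + 1))).im| ≤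
         C * (1 + log N)^2 * (1 / (h:ℝ)) := by
    intro h hh
    rw [Finset.mem_Icc] at hh
    have h1 : (1:ℝ) ≤ h := by exact_mod_cast hh.1
    have h2 : (h:ℝ) ≤ H := by exact_mod_cast hh.2
    have := hv t h R N ht h1 hR1 hR2 (le_trans (by
      apply mul_le_mul_of_nonneg_right _ (by positivity)
      apply mul_le_mul_of_nonneg_left _ hC.le
      apply pow_le_pow_left₀ (by linarith) h2) hN)
    rw [← mul_sub, ← Complex.sub_im, abs_mul, abs_of_pos (by positivity), mul_comm (C * _)]
    have i1 := (Complex.abs_im_le_norm _).trans ((norm_sub_rev _ _).trans_le this)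
    apply mul_le_mul _ i1 (abs_nonneg _) (by positivity)
    apply one_div_le_one_div_of_le (by linarith)
    nlinarith [Real.pi_gt_three]
  refine (Finset.sum_le_sum hb).trans ?_
  rw [← Finset.mul_sum, sum_Icc1 (fun h => 1 / (h:ℝ)), show (1 + log (N:ℝ))^3 = (1 + log N)^2 * (1 + log N) by ring, ← mul_assoc]
  apply mul_le_mul_of_nonneg_left _ (by positivity)
  have := harm H
  push_cast
  linarith

/-! explicit main term -/
noncomputable def zf (θ : ℝ) (h ν : ℝ) : ℝ := (θ * h / ν) ^ (1 / (1 + θ))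
noncomputable def lam (θ : ℝ) (h ν : ℝ) : ℝ := h ^ (1 / (1 + θ)) * ν ^ (θ / (1 + θ))
noncomputable def muc (θ : ℝ) : ℝ := θ ^ (1 / (1 + θ)) * (1 + θ) / θ
noncomputable def Kc (θ : ℝ) : ℝ := √(θ ^ (1 / (1 + θ)) / (1 + θ))
noncomputable def cc (θ : ℝ) (h ν : ℝ) : ℝ := √(lam θ h ν) / (h * ν)
noncomputable def eta (θ : ℝ) (H h ν : ℕ) (t : ℝ) : ℝ :=
  (if h ≤ H then wt 1 (zf θ h ν) * st (1 + log (t * zf θ h ν)) else 0) +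
  (if ν ≤ H then (1 - wt 1 (zf θ h ν)) * st (1 + log (t * (zf θ h ν) ^ (-θ))) else 0)
noncomputable def Mt (θ : ℝ) (H N : ℕ) (t : ℝ) : ℝ :=
  Kc θ / π * √t * ∑ h ∈ Finset.Icc 1 N, ∑ ν ∈ Finset.Icc 1 N, cc θ h ν * eta θ H h ν t * sin (2 * π * (muc θ * lam θ h ν * t + 1/8))

lemma zf_pos {θ h ν : ℝ} (hθ : 0 < θ) (hh : 0 < h) (hν : 0 < ν) : 0 < zf θ h ν := by unfold zf; positivity

lemma zf_nu {θ h ν : ℝ} (hθ : 0 < θ) (hh : 0 < h) (hν : 0 < ν) : ν * zf θ h ν = θ ^ (1 / (1 + θ)) * lam θ h ν := by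
  unfold zf lam
  rw [div_rpow (by positivity) hν.le, mul_rpow hθ.le hh.le]
  have : ν ^ (θ / (1 + θ)) = ν / ν ^ (1 / (1+θ)) := by
    rw [show θ / (1 + θ) = 1 - 1 / (1 + θ) by field_simp; ring, rpow_sub hν, rpow_one]
  rw [this]; field_simp

lemma term1 {θ t h ν : ℝ} (hθ : 0 < θ) (ht : 0 < t) (hh : 0 < h) (hν : 0 < ν) :
    1 / (π * h) * (Wf 1 t (yst θ t h ν) * √(yst θ t h ν / ((1 + θ) * ν)) *
       sin (2 * π * (ν * yst θ t h ν * (1 + 1 / θ) + 1/8))) =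
    Kc θ / π * √t * (cc θ h ν * (wt 1 (zf θ h ν) * st (1 + log (t * zf θ h ν))) * sin (2 * π * (muc θ * lam θ h ν * t + 1/8))) := by
  have hy : yst θ t h ν = t * zf θ h ν := rfl
  have hz := zf_nu hθ hh hν
  have hzp := zf_pos hθ hh hν
  have hl : 0 < lam θ h ν := by unfold lam; positivity
  rw [hy]
  have e1 : ν * (t * zf θ h ν) * (1 + 1 / θ) = muc θ * lam θ h ν * t := by
    rw [show ν * (t * zf θ h ν) = t * (ν * zf θ h ν) by ring, hz]; unfold muc; field_simp; ring
  have e2 : √(t * zf θ h ν / ((1 + θ) * ν)) = Kc θ * √t * √(lam θ h ν) / ν := by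
    have : t * zf θ h ν / ((1 + θ) * ν) = (θ ^ (1 / (1 + θ)) / (1 + θ)) * t * lam θ h ν / (ν * ν) := by
      rw [eq_div_iff (by positivity), div_mul_eq_mul_div, div_eq_iff (by positivity)]
      have : (θ ^ (1 / (1 + θ)) / (1 + θ)) * t * lam θ h ν * ((1 + θ) * ν) = (θ ^ (1 / (1 + θ)) * lam θ h ν) * (t * ν) := by field_simp
      rw [this, ← hz]; ring
    rw [this, Real.sqrt_div (by positivity), Real.sqrt_mul_self hν.le, Real.sqrt_mul (by positivity), Real.sqrt_mul (by positivity)]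
    rfl
  have e3 : Wf 1 t (t * zf θ h ν) = wt 1 (zf θ h ν) * st (1 + log (t * zf θ h ν)) := by
    unfold Wf; rw [mul_div_cancel_left₀ _ ht.ne']
  rw [e1, e2, e3]; unfold cc; field_simp

lemma zf_inv {θ h ν : ℝ} (hθ : 0 < θ) (hh : 0 < h) (hν : 0 < ν) : zf (1/θ) ν h = (zf θ h ν) ^ (-θ) := by
  unfold zf
  rw [← rpow_mul (by positivity), show 1 / θ * ν / h = (θ * h / ν)⁻¹ by field_simp, inv_rpow (by positivity), ← rpow_neg (by positivity)]
  congr 1; field_simp; ring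

lemma lam_inv {θ h ν : ℝ} (hθ : 0 < θ) : lam (1/θ) ν h = lam θ h ν := by
  unfold lam
  rw [show 1 / (1 + 1 / θ) = θ / (1 + θ) by field_simp; ring, show 1 / θ / (1 + 1/θ) = 1 / (1 + θ) by field_simp; ring, mul_comm]

lemma thp_inv {θ : ℝ} (hθ : 0 < θ) : (1/θ) ^ (1 / (1 + 1/θ)) = θ ^ (1 / (1 + θ)) / θ := by
  rw [show 1 / (1 + 1 / θ) = 1 - 1 / (1 + θ) by field_simp; ring, one_div θ, inv_rpow hθ.le, rpow_sub hθ, rpow_one, inv_div]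

lemma Kc_inv {θ : ℝ} (hθ : 0 < θ) : Kc (1/θ) = Kc θ := by
  unfold Kc; rw [thp_inv hθ]; congr 1; field_simp; ring

lemma muc_inv {θ : ℝ} (hθ : 0 < θ) : muc (1/θ) = muc θ := by
  unfold muc; rw [thp_inv hθ]; field_simp; ring

lemma term2 {θ t h ν : ℝ} (hθ : 0 < θ) (ht : 0 < t) (hh : 0 < h) (hν : 0 < ν) :
    1 / (π * ν) * (Wf (1/θ) t (yst (1/θ) t ν h) * √(yst (1/θ) t ν h / ((1 + 1/θ) * h)) *
       sin (2 * π * (h * yst (1/θ) t ν h * (1 + 1 / (1/θ)) + 1/8))) =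
    Kc θ / π * √t * (cc θ h ν * ((1 - wt 1 (zf θ h ν)) * st (1 + log (t * (zf θ h ν)^(-θ)))) * sin (2 * π * (muc θ * lam θ h ν * t + 1/8))) := by
  have hy : yst (1/θ) t ν h = t * (zf θ h ν)^(-θ) := by rw [← zf_inv hθ hh hν]; rfl
  have hz := zf_nu (θ := 1/θ) (by positivity) hν hh
  rw [zf_inv hθ hh hν, lam_inv hθ] at hz
  have hzp := zf_pos hθ hh hν
  have hl : 0 < lam θ h ν := by unfold lam; positivity
  have hzq : 0 < (zf θ h ν)^(-θ) := by positivity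
  rw [← Kc_inv hθ, ← muc_inv hθ]
  rw [hy]
  have hwt : 1 - wt 1 (zf θ h ν) = wt (1/θ) ((zf θ h ν)^(-θ)) := by
    unfold wt
    rw [← st_symm, Real.log_rpow hzp]; congr 1; field_simp; ring
  rw [hwt]
  set Z := (zf θ h ν)^(-θ)
  have e1 : h * (t * Z) * (1 + 1 / (1/θ)) = muc (1/θ) * lam θ h ν * t := by
    rw [show h * (t * Z) = t * (h * Z) by ring, hz]; unfold muc; field_simp; ring
  have e2 : √(t * Z / ((1 + 1/θ) * h)) = Kc (1/θ) * √t * √(lam θ h ν) / h := by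
    have : t * Z / ((1 + 1/θ) * h) = ((1/θ) ^ (1 / (1 + 1/θ)) / (1 + 1/θ)) * t * lam θ h ν / (h * h) := by
      rw [eq_div_iff (by positivity), div_mul_eq_mul_div, div_eq_iff (by positivity)]
      have : ((1/θ) ^ (1 / (1 + 1/θ)) / (1 + 1/θ)) * t * lam θ h ν * ((1 + 1/θ) * h) = ((1/θ) ^ (1 / (1 + 1/θ)) * lam θ h ν) * (t * h) := by
        have : (1 + 1/θ) ≠ 0 := by positivity
        field_simp
      rw [this, ← hz]; ring
    rw [this, Real.sqrt_div (by positivity), Real.sqrt_mul_self hh.le, Real.sqrt_mul (by positivity), Real.sqrt_mul (by positivity)]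
    rfl
  have e3 : Wf (1/θ) t (t * Z) = wt (1/θ) Z * st (1 + log (t * Z)) := by
    unfold Wf; rw [mul_div_cancel_left₀ _ ht.ne']
  rw [e1, e2, e3]; unfold cc; field_simp

end MSQ

namespace MSQ

lemma Mt_split {θ t : ℝ} {H N : ℕ} (hθ : 0 < θ) (ht : 0 < t) (hHN : H ≤ N) :
    Mt θ H N t = (∑ h ∈ Finset.Icc 1 H, ∑ ν ∈ Finset.Icc 1 N, 1 / (π * h) * (Wf 1 t (yst θ t h ν) * √(yst θ t h ν / ((1 + θ) * ν)) *
       sin (2 * π * (ν * yst θ t h ν * (1 + 1 / θ) + 1/8)))) +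
     ∑ h ∈ Finset.Icc 1 H, ∑ ν ∈ Finset.Icc 1 N, 1 / (π * h) * (Wf (1/θ) t (yst (1/θ) t h ν) * √(yst (1/θ) t h ν / ((1 + 1/θ) * ν)) *
       sin (2 * π * (ν * yst (1/θ) t h ν * (1 + 1 / (1/θ)) + 1/8))) := by
  have key : ∀ f : ℕ → ℝ, ∑ h ∈ Finset.Icc 1 H, f h = ∑ h ∈ Finset.Icc 1 N, if h ≤ H then f h else 0 := by
    intro f
    rw [← Finset.sum_filter]
    apply Finset.sum_congr _ (fun _ _ => rfl)
    ext h; simp; omega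
  rw [key, key (fun h => ∑ ν ∈ Finset.Icc 1 N, 1 / (π * h) * (Wf (1/θ) t (yst (1/θ) t h ν) * √(yst (1/θ) t h ν / ((1 + 1/θ) * ν)) *
       sin (2 * π * (ν * yst (1/θ) t h ν * (1 + 1 / (1/θ)) + 1/8))))]
  have e2 : ∑ h ∈ Finset.Icc 1 N, (if h ≤ H then ∑ ν ∈ Finset.Icc 1 N, 1 / (π * h) * (Wf (1/θ) t (yst (1/θ) t h ν) * √(yst (1/θ) t h ν / ((1 + 1/θ) * ν)) *
       sin (2 * π * (ν * yst (1/θ) t h ν * (1 + 1 / (1/θ)) + 1/8))) else 0) =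
     ∑ h ∈ Finset.Icc 1 N, ∑ ν ∈ Finset.Icc 1 N, if ν ≤ H then 1 / (π * ν) * (Wf (1/θ) t (yst (1/θ) t ν h) * √(yst (1/θ) t ν h / ((1 + 1/θ) * h)) *
       sin (2 * π * (h * yst (1/θ) t ν h * (1 + 1 / (1/θ)) + 1/8))) else 0 := by
    rw [Finset.sum_comm]
    apply Finset.sum_congr rfl; intro h _
    split_ifs
    · rfl
    · simp
  rw [e2, ← Finset.sum_add_distrib]
  unfold Mt
  rw [Finset.mul_sum]
  apply Finset.sum_congr rfl; intro h hh
  have h0 : (0:ℝ) < h := by exact_mod_cast (Finset.mem_Icc.1 hh).1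
  have e3 : (if h ≤ H then ∑ ν ∈ Finset.Icc 1 N, 1 / (π * h) * (Wf 1 t (yst θ t h ν) * √(yst θ t h ν / ((1 + θ) * ν)) *
       sin (2 * π * (ν * yst θ t h ν * (1 + 1 / θ) + 1/8))) else 0) =
      ∑ ν ∈ Finset.Icc 1 N, if h ≤ H then 1 / (π * h) * (Wf 1 t (yst θ t h ν) * √(yst θ t h ν / ((1 + θ) * ν)) *
       sin (2 * π * (ν * yst θ t h ν * (1 + 1 / θ) + 1/8))) else 0 := by
    split_ifs
    · rfl
    · simp
  rw [e3, Finset.mul_sum, ← Finset.sum_add_distrib]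
  apply Finset.sum_congr rfl; intro ν hν
  have ν0 : (0:ℝ) < ν := by exact_mod_cast (Finset.mem_Icc.1 hν).1
  rw [term1 hθ ht h0 ν0, term2 hθ ht h0 ν0]
  unfold eta
  split_ifs <;> ring

lemma ceil_le2 {x : ℝ} (hx : 1 ≤ x) : (⌈x⌉₊ : ℝ) ≤ 2 * x := by
  have := Nat.ceil_lt_add_one (a := x) (by linarith); linarith

set_option maxHeartbeats 1000000 in
lemma sq3 (e x y : ℝ) : (e - x - y)^2 ≤ 3*e^2+3*x^2+3*y^2 := by
  nlinarith [sq_nonneg (e + x), sq_nonneg (e + y), sq_nonneg (x - y)]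

lemma oneadd_le {x E L : ℝ} (h : x ≤ E * L) (hL : 1 ≤ L) : 1 + x ≤ (1 + E) * L := by
  rw [add_mul]; linarith

lemma dSS_abs (θ' κ t : ℝ) (R H : ℕ) : |SS θ' κ R t - SSH θ' κ R H t| ≤ R * (1 / 2 + H) := by
  unfold SS SSH
  rw [← Finset.sum_sub_distrib]
  refine (Finset.abs_sum_le_sum_abs _ _).trans ?_
  refine (Finset.sum_le_card_nsmul _ _ (1 / 2 + (H:ℝ)) ?_).trans (by rw [nsmul_eq_mul]; simp)
  intro n _
  rw [← mul_sub, abs_mul, abs_of_nonneg (wt_nonneg _ _)]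
  refine (mul_le_of_le_one_left (abs_nonneg _) (wt_le_one _ _)).trans ?_
  exact (abs_sub _ _).trans (add_le_add (saw_abs _) (sawH_abs _ _))

lemma dSS_ii (θ' κ Q Q' : ℝ) (R H : ℕ) : IntervalIntegrable (fun t => (SS θ' κ R t - SSH θ' κ R H t)^2) volume Q Q' := by
  refine ii_of_bdd (B := (R * (1 / 2 + H))^2) (((SS_meas θ' κ R).sub (SSH_meas θ' κ R H)).pow_const 2) (fun t => ?_) _ _
  rw [abs_pow]; exact pow_le_pow_left₀ (abs_nonneg _) (dSS_abs _ _ _ _ _) 2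

lemma int3 {f d1 d2 : ℝ → ℝ} {Q Q' c : ℝ} (hQ1 : Q ≤ Q') (h1 : IntervalIntegrable (fun t => d1 t ^ 2) volume Q Q')
    (h2 : IntervalIntegrable (fun t => d2 t ^ 2) volume Q Q')
    (hpt : ∀ t ∈ Set.Icc Q Q', f t ^ 2 ≤ 3 * c + 3 * d1 t ^ 2 + 3 * d2 t ^ 2) :
    ∫ t in Q..Q', f t ^ 2 ≤ (Q' - Q) * (3 * c) + 3 * (∫ t in Q..Q', d1 t ^ 2) + 3 * ∫ t in Q..Q', d2 t ^ 2 := by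
  have di1 := h1.const_mul 3
  have di2 := h2.const_mul 3
  have dic : IntervalIntegrable (fun _ : ℝ => 3 * c) volume Q Q' := by simp
  calc _ ≤ ∫ t in Q..Q', (3 * c + 3 * d1 t ^ 2 + 3 * d2 t ^ 2) := by
        rw [intervalIntegral.integral_of_le hQ1, intervalIntegral.integral_of_le hQ1]
        apply integral_mono_of_nonneg
        · exact Filter.Eventually.of_forall fun t => sq_nonneg _
        · exact ((dic.add di1).add di2).1
        · exact (ae_restrict_iff' measurableSet_Ioc).2 (Filter.Eventually.of_forall fun t ht => hpt t ⟨ht.1.le, ht.2⟩)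
    _ = (Q' - Q) * (3 * c) + 3 * (∫ t in Q..Q', d1 t ^ 2) + 3 * ∫ t in Q..Q', d2 t ^ 2 := by
        rw [intervalIntegral.integral_add (dic.add di1) di2, intervalIntegral.integral_add dic di1, intervalIntegral.integral_const_mul 3 (fun t => d1 t ^ 2),
          intervalIntegral.integral_const_mul 3 (fun t => d2 t ^ 2),
          intervalIntegral.integral_const, smul_eq_mul]

lemma fin3 {C6 L Q Q' C2 C3 E I1 I2 : ℝ} (hL : 1 ≤ L) (hQ : 1 ≤ Q) (hQ2 : Q' ≤ 2 * Q) (hC2 : 0 < C2) (hC3 : 0 < C3) (hE : 0 < E)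
    (i1 : I1 ≤ C2) (i2 : I2 ≤ C3) :
    (Q' - Q) * (3 * (C6 * L ^ 3) ^ 2) + 3 * I1 + 3 * I2 ≤ (E + 3 * (C6 ^ 2 + C2 + C3)) * Q * L ^ 6 := by
  have i3 : (Q' - Q) * (3 * (C6 * L ^ 3) ^ 2) ≤ Q * (3 * (C6 * L ^ 3) ^ 2) := mul_le_mul_of_nonneg_right (by linarith) (by positivity)
  have hQL : 1 ≤ Q * L ^ 6 := one_le_mul_of_one_le_of_one_le hQ (one_le_pow₀ hL)
  have : (E + 3 * (C6 ^ 2 + C2 + C3)) * Q * L ^ 6 = Q * (3 * (C6 * L ^ 3) ^ 2) + 3 * C2 * (Q * L ^ 6) + 3 * C3 * (Q * L ^ 6) + E * (Q * L ^ 6) := by ring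
  rw [this]
  have j1 : 3 * C2 ≤ 3 * C2 * (Q * L ^ 6) := le_mul_of_one_le_right (by positivity) hQL
  have j2 : 3 * C3 ≤ 3 * C3 * (Q * L ^ 6) := le_mul_of_one_le_right (by positivity) hQL
  have j3 : 0 ≤ E * (Q * L ^ 6) := by positivity
  linarith

set_option maxHeartbeats 1000000 in
theorem explicit {α β : ℝ} (hα : 0 < α) (hαβ : α < β) : ∃ C > 0, ∀ Q : ℝ, 1 ≤ Q → ∃ H N : ℕ, 1 ≤ H ∧ H ≤ N ∧
    Q ^ (3 + β / α) ≤ H ∧ log N ≤ C * (1 + log Q) ∧ ∀ Q', Q ≤ Q' → Q' ≤ 2 * Q →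
    ∫ t in Q..Q', (DeltaErr α β (t ^ (α + β)) - Mt (β / α) H N t) ^ 2 ≤ C * Q * (1 + log Q) ^ 6 := by
  have hβ : 0 < β := by linarith
  obtain ⟨C1, hC1, hds⟩ := delta_smooth hα hβ hαβ.ne
  set θ := β / α with hθd
  have hinv : α / β = 1 / θ := by rw [hθd]; field_simp
  have hθ1 : 1 < θ := by rw [hθd, lt_div_iff₀ hα]; linarith
  have hθ : 0 < θ := by linarith
  have hθi : 1 / θ ≤ θ := by rw [div_le_iff₀ hθ]; nlinarith
  have hθi0 : 0 < 1 / θ := by positivity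
  rw [hinv] at hds
  set K0 := 2 * exp (θ / 2) + 1 with hK0
  have hK : 0 < K0 := by positivity
  obtain ⟨C2, hC2, ht1⟩ := SS_trunc hθ hK
  obtain ⟨C3, hC3, ht2⟩ := SS_trunc hθi0 hK
  obtain ⟨C4, hC4, hm1⟩ := SSH_main hθ one_pos hK
  obtain ⟨C5, hC5, hm2⟩ := SSH_main hθi0 hθi0 hK
  set D := (C4 + C5) * 4 * 2 ^ (4 + 2 * θ) + 3 with hD
  have hDp : 3 ≤ D := by have : 0 < (C4 + C5) * 4 * 2 ^ (4 + 2 * θ) := by positivity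
                         linarith
  have hlD : 0 ≤ log D := Real.log_nonneg (by linarith)
  set E := log D + (10 + 4 * θ) with hE
  have hEp : 0 < E := by positivity
  set C6 := C1 + (C4 + C5) * (1 + E) ^ 3 with hC6
  have hC6p : 0 < C6 := by positivity
  refine ⟨E + 3 * (C6 ^ 2 + C2 + C3), by positivity, ?_⟩
  intro Q hQ
  have hQ0 : 0 < Q := by linarith
  have hlQ := Real.log_nonneg hQ
  have hQp : ∀ e : ℝ, 0 ≤ e → 1 ≤ Q ^ e := fun e he => Real.one_le_rpow hQ he
  set R := ⌈2 * Q * exp (θ / 2)⌉₊ with hR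
  set H := ⌈Q ^ (3 + θ)⌉₊ with hH
  set X := (C4 + C5) * H ^ 2 * (2 * Q) ^ (4 + 2 * θ) with hX
  set N := ⌈X⌉₊ + H with hN
  have hH1 : Q ^ (3 + θ) ≤ H := Nat.le_ceil _
  have hH2 : (H:ℝ) ≤ 2 * Q ^ (3 + θ) := ceil_le2 (hQp _ (by linarith))
  have hHr : (1:ℝ) ≤ H := (hQp _ (by linarith)).trans hH1
  have hHn : 1 ≤ H := by exact_mod_cast hHr
  have hHN : H ≤ N := by omega
  have hXp : 0 < X := by positivity
  have hXN : X ≤ N := by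
    have := Nat.le_ceil X
    rw [hN]; push_cast; linarith
  have hNub : (N:ℝ) ≤ D * Q ^ (10 + 4 * θ) := by
    have a1 : (N:ℝ) ≤ X + 1 + H := by
      rw [hN]; push_cast; linarith [Nat.ceil_lt_add_one hXp.le]
    have a2 : (H:ℝ)^2 ≤ 4 * Q ^ (6 + 2 * θ) := by
      have : (H:ℝ)^2 ≤ (2 * Q ^ (3 + θ))^2 := pow_le_pow_left₀ (by linarith) hH2 2
      have e : (2 * Q ^ (3 + θ))^2 = 4 * Q ^ (6 + 2 * θ) := by
        rw [mul_pow, ← rpow_natCast (Q ^ (3+θ)), ← rpow_mul hQ0.le]; norm_num; ring_nf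
      linarith
    have a3 : X ≤ (C4 + C5) * 4 * 2 ^ (4 + 2 * θ) * Q ^ (10 + 4 * θ) := by
      calc X ≤ (C4 + C5) * (4 * Q ^ (6 + 2 * θ)) * (2 * Q) ^ (4 + 2 * θ) := by
            apply mul_le_mul_of_nonneg_right _ (by positivity)
            exact mul_le_mul_of_nonneg_left a2 (by positivity)
        _ = _ := by
            rw [mul_rpow (by norm_num) hQ0.le, show 10 + 4 * θ = (6 + 2 * θ) + (4 + 2 * θ) by ring, rpow_add hQ0 (6 + 2 * θ)]; ring
    have a4 : Q ^ (3 + θ) ≤ Q ^ (10 + 4 * θ) := rpow_le_rpow_of_exponent_le hQ (by linarith)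
    have a5 := hQp (10 + 4 * θ) (by linarith)
    rw [hD, add_mul]; linarith
  have hNpos : (1:ℝ) ≤ N := hHr.trans (by exact_mod_cast hHN)
  have hlN : log N ≤ E * (1 + log Q) := by
    have := Real.log_le_log (lt_of_lt_of_le one_pos hNpos) hNub
    rw [Real.log_mul (by linarith only [hDp]) (by positivity), Real.log_rpow hQ0] at this
    have h5 : E * (1 + log Q) = log D + (10 + 4 * θ) * log Q + (10 + 4 * θ) + log D * log Q := by rw [hE]; ring
    have h6 : 0 ≤ log D * log Q := mul_nonneg hlD hlQ
    linarith only [this, h5, h6, hθ]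
  have hlN0 : 0 ≤ log (N:ℝ) := Real.log_nonneg hNpos
  refine ⟨H, N, hHn, hHN, hH1, ?_, ?_⟩
  · refine hlN.trans (mul_le_mul_of_nonneg_right ?_ (by linarith))
    have : 0 < 3 * (C6 ^ 2 + C2 + C3) := by positivity
    linarith
  intro Q' hQ1 hQ2
  have hRK : (R:ℝ) ≤ K0 * Q := by
    have := Nat.ceil_lt_add_one (a := 2 * Q * exp (θ/2)) (by positivity)
    rw [hK0, add_mul]; linarith only [this, hQ]
  have hRle : 2 * Q * exp (θ/2) ≤ R := Nat.le_ceil _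
  set L := 1 + log Q with hL
  have hL1 : 1 ≤ L := by linarith
  have hXN' : (C4 + C5) * H ^ 2 * (2 * Q) ^ (4 + 2 * θ) ≤ N := hXN
  clear hD hE hN hX hR hH hNub hXp
  clear_value K0 D E R X N H
  set d1 : ℝ → ℝ := fun t => SS θ 1 R t - SSH θ 1 R H t with hd1
  set d2 : ℝ → ℝ := fun t => SS (1/θ) (1/θ) R t - SSH (1/θ) (1/θ) R H t with hd2
  have hpt : ∀ t ∈ Set.Icc Q Q', (DeltaErr α β (t ^ (α + β)) - Mt θ H N t) ^ 2 ≤ 3 * (C6 * L ^ 3) ^ 2 + 3 * d1 t ^ 2 + 3 * d2 t ^ 2 := by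
    intro t ht
    have ht1' : 1 ≤ t := by linarith [ht.1]
    have ht0 : 0 < t := by linarith
    have ht2Q : t ≤ 2 * Q := by linarith [ht.2]
    have hx1 : t * exp (θ / 2) ≤ R := le_trans (mul_le_mul_of_nonneg_right ht2Q (Real.exp_pos _).le) hRle
    have hx2 : t * exp (1 / 2) ≤ R := le_trans (mul_le_mul_of_nonneg_left (Real.exp_le_exp.2 (by linarith)) ht0.le) hx1
    have hRt : (R:ℝ) ≤ K0 * t := hRK.trans (mul_le_mul_of_nonneg_left ht.1 hK.le)
    have b0 := hds t ht0 R hx2 hx1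
    have hp1 : t ^ (4 + 2 * θ) ≤ (2 * Q) ^ (4 + 2 * θ) := rpow_le_rpow ht0.le ht2Q (by linarith)
    have hp2 : t ^ (4 + 2 * (1/θ)) ≤ (2 * Q) ^ (4 + 2 * θ) := (rpow_le_rpow_of_exponent_le ht1' (by linarith)).trans hp1
    have b1 := hm1 t R H N ht1' hHn hHN (by rw [mul_one]; exact hx2) hRt
      ((mul_le_mul (mul_le_mul_of_nonneg_right (by linarith) (by positivity)) hp1 (by positivity) (by positivity)).trans hXN')
    have b2 := hm2 t R H N ht1' hHn hHN (by rw [show 1 / (2 * (1/θ)) = θ / 2 by field_simp]; exact hx1) hRt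
      ((mul_le_mul (mul_le_mul_of_nonneg_right (by linarith) (by positivity)) hp2 (by positivity) (by positivity)).trans hXN')
    rw [Mt_split hθ ht0 hHN]
    set S1 := ∑ h ∈ Finset.Icc 1 H, ∑ ν ∈ Finset.Icc 1 N, 1 / (π * h) * (Wf 1 t (yst θ t h ν) * √(yst θ t h ν / ((1 + θ) * ν)) *
       sin (2 * π * (ν * yst θ t h ν * (1 + 1 / θ) + 1/8)))
    set S2 := ∑ h ∈ Finset.Icc 1 H, ∑ ν ∈ Finset.Icc 1 N, 1 / (π * h) * (Wf (1/θ) t (yst (1/θ) t h ν) * √(yst (1/θ) t h ν / ((1 + 1/θ) * ν)) *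
       sin (2 * π * (ν * yst (1/θ) t h ν * (1 + 1 / (1/θ)) + 1/8)))
    have hLN : (1 + log N) ^ 3 ≤ (1 + E) ^ 3 * L ^ 3 := by
      rw [← mul_pow]
      exact pow_le_pow_left₀ (by linarith) (oneadd_le hlN hL1) 3
    have b1' : C4 * (1 + log N) ^ 3 ≤ C4 * ((1 + E) ^ 3 * L ^ 3) := mul_le_mul_of_nonneg_left hLN hC4.le
    have b2' : C5 * (1 + log N) ^ 3 ≤ C5 * ((1 + E) ^ 3 * L ^ 3) := mul_le_mul_of_nonneg_left hLN hC5.le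
    have hL3 : 1 ≤ L ^ 3 := one_le_pow₀ hL1
    have b0' : C1 ≤ C1 * L ^ 3 := le_mul_of_one_le_right hC1.le hL3
    set e := DeltaErr α β (t ^ (α + β)) - (S1 + S2) + d1 t + d2 t with he
    have hee : |e| ≤ C6 * L ^ 3 := by
      have : e = (DeltaErr α β (t ^ (α + β)) + SS θ 1 R t + SS (1/θ) (1/θ) R t) - (SSH θ 1 R H t + S1) - (SSH (1/θ) (1/θ) R H t + S2) := by
        rw [he, hd1, hd2]; ring
      rw [this]
      refine (abs_sub _ _).trans ?_
      have := abs_sub (DeltaErr α β (t ^ (α + β)) + SS θ 1 R t + SS (1/θ) (1/θ) R t) (SSH θ 1 R H t + S1)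
      have e6 : C6 * L ^ 3 = C1 * L ^ 3 + C4 * ((1 + E) ^ 3 * L ^ 3) + C5 * ((1 + E) ^ 3 * L ^ 3) := by rw [hC6]; ring
      rw [e6]; linarith only [this, b0, b1, b2, b0', b1', b2']
    have he2 : e ^ 2 ≤ (C6 * L ^ 3) ^ 2 := by rw [← sq_abs]; exact pow_le_pow_left₀ (abs_nonneg _) hee 2
    have : DeltaErr α β (t ^ (α + β)) - (S1 + S2) = e - d1 t - d2 t := by rw [he]; ring
    rw [this]
    exact (sq3 e (d1 t) (d2 t)).trans (add_le_add (add_le_add (mul_le_mul_of_nonneg_left he2 (by norm_num)) le_rfl) le_rfl)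
  have i1 := ht1 1 Q Q' R H hQ hQ1 hQ2 hRK hH1
  have i2 := ht2 (1/θ) Q Q' R H hQ hQ1 hQ2 hRK ((rpow_le_rpow_of_exponent_le hQ (add_le_add_right hθi 3)).trans hH1)
  exact (int3 hQ1 (dSS_ii θ 1 Q Q' R H) (dSS_ii (1/θ) (1/θ) Q Q' R H) hpt).trans (fin3 hL1 hQ hQ2 hC2 hC3 hEp i1 i2)

end MSQ

namespace MSQ

/-- Nonnegative nondecreasing continuously differentiable amplitude. -/
structure MonoAmp (Q Q' : ℝ) (Φ Φ' : ℝ → ℝ) : Prop where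
  d : ∀ x ∈ Set.Icc Q Q', HasDerivAt Φ (Φ' x) x
  nn : ∀ x ∈ Set.Icc Q Q', 0 ≤ Φ x
  dnn : ∀ x ∈ Set.Icc Q Q', 0 ≤ Φ' x
  dc : ContinuousOn Φ' (Set.Icc Q Q')

lemma MonoAmp.mul {Q Q' : ℝ} {f f' g g' : ℝ → ℝ} (hf : MonoAmp Q Q' f f') (hg : MonoAmp Q Q' g g') :
    MonoAmp Q Q' (fun x => f x * g x) (fun x => f' x * g x + f x * g' x) where
  d x hx := (hf.d x hx).mul (hg.d x hx)
  nn x hx := mul_nonneg (hf.nn x hx) (hg.nn x hx)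
  dnn x hx := add_nonneg (mul_nonneg (hf.dnn x hx) (hg.nn x hx)) (mul_nonneg (hf.nn x hx) (hg.dnn x hx))
  dc := (hf.dc.mul (fun x hx => (hg.d x hx).continuousAt.continuousWithinAt)).add
    (ContinuousOn.mul (fun x hx => (hf.d x hx).continuousAt.continuousWithinAt) hg.dc)

lemma MonoAmp.cont {Q Q' : ℝ} {f f' : ℝ → ℝ} (hf : MonoAmp Q Q' f f') : ContinuousOn f (Set.Icc Q Q') :=
  fun x hx => (hf.d x hx).continuousAt.continuousWithinAt

lemma MonoAmp.ii {Q Q' : ℝ} {f f' : ℝ → ℝ} (hf : MonoAmp Q Q' f f') (h : Q ≤ Q') {g : ℝ → ℝ} (hg : Continuous g) :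
    IntervalIntegrable (fun x => f x * g x) volume Q Q' := by
  apply ContinuousOn.intervalIntegrable
  rw [Set.uIcc_of_le h]
  exact hf.cont.mul hg.continuousOn

lemma MonoAmp.ii' {Q Q' : ℝ} {f f' : ℝ → ℝ} (hf : MonoAmp Q Q' f f') (h : Q ≤ Q') :
    IntervalIntegrable f' volume Q Q' := by
  apply ContinuousOn.intervalIntegrable
  rw [Set.uIcc_of_le h]
  exact hf.dc

lemma MonoAmp.ftc {Q Q' : ℝ} {f f' : ℝ → ℝ} (hf : MonoAmp Q Q' f f') (h : Q ≤ Q') :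
    ∫ x in Q..Q', f' x = f Q' - f Q :=
  intervalIntegral.integral_eq_sub_of_hasDerivAt (by rw [Set.uIcc_of_le h]; exact hf.d) (hf.ii' h)

lemma MonoAmp.le_end {Q Q' : ℝ} {f f' : ℝ → ℝ} (hf : MonoAmp Q Q' f f') {x : ℝ} (hx : x ∈ Set.Icc Q Q') : f x ≤ f Q' := by
  have hm : MonotoneOn f (Set.Icc Q Q') := by
    apply monotoneOn_of_deriv_nonneg (convex_Icc _ _) hf.cont
    · intro y hy; exact (hf.d y (interior_subset hy)).differentiableAt.differentiableWithinAt
    · intro y hy; rw [(hf.d y (interior_subset hy)).deriv]; exact hf.dnn y (interior_subset hy)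
  exact hm hx ⟨hx.1.trans hx.2, le_rfl⟩ hx.2

lemma osc1 {Q Q' : ℝ} {f f' : ℝ → ℝ} (hf : MonoAmp Q Q' f f') (h : Q ≤ Q') {ω φ : ℝ} (hω : ω ≠ 0) :
    |∫ x in Q..Q', f x * cos (ω * x + φ)| ≤ 2 * f Q' / |ω| := by
  have hv : ∀ x : ℝ, HasDerivAt (fun x => sin (ω * x + φ) / ω) (cos (ω * x + φ)) x := by
    intro x
    have h1 : HasDerivAt (fun x : ℝ => ω * x + φ) ω x := by
      simpa using ((hasDerivAt_id x).const_mul ω).add_const φ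
    refine (h1.sin.div_const ω).congr_deriv ?_
    field_simp
  have hcc : Continuous fun x : ℝ => cos (ω * x + φ) := by fun_prop
  rw [intervalIntegral.integral_mul_deriv_eq_deriv_mul (u := f) (v := fun x => sin (ω * x + φ) / ω) (u' := f')
    (by rw [Set.uIcc_of_le h]; exact hf.d) (fun x _ => hv x) (hf.ii' h) (hcc.intervalIntegrable _ _)]
  have sb : ∀ x : ℝ, |sin (ω * x + φ) / ω| ≤ 1 / |ω| := by
    intro x; rw [abs_div]; exact div_le_div_of_nonneg_right (abs_sin_le_one _) (abs_nonneg _)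
  have n0 := hf.nn Q ⟨le_rfl, h⟩
  have n1 := hf.nn Q' ⟨h, le_rfl⟩
  have b1 : |f Q' * (sin (ω * Q' + φ) / ω)| ≤ f Q' * (1 / |ω|) := by
    rw [abs_mul, abs_of_nonneg n1]; exact mul_le_mul_of_nonneg_left (sb _) n1
  have b2 : |f Q * (sin (ω * Q + φ) / ω)| ≤ f Q * (1 / |ω|) := by
    rw [abs_mul, abs_of_nonneg n0]; exact mul_le_mul_of_nonneg_left (sb _) n0
  have b3 : |∫ x in Q..Q', f' x * (sin (ω * x + φ) / ω)| ≤ (f Q' - f Q) * (1 / |ω|) := by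
    rw [← hf.ftc h, ← intervalIntegral.integral_mul_const]
    rw [← Real.norm_eq_abs]
    apply intervalIntegral.norm_integral_le_of_norm_le h
    · refine Filter.Eventually.of_forall fun x hx => ?_
      have := hf.dnn x ⟨hx.1.le, hx.2⟩
      rw [Real.norm_eq_abs, abs_mul, abs_of_nonneg this]
      exact mul_le_mul_of_nonneg_left (sb _) this
    · exact (hf.ii' h).mul_const _
  have e : 2 * f Q' / |ω| = f Q' * (1 / |ω|) + f Q * (1 / |ω|) + (f Q' - f Q) * (1 / |ω|) := by ring
  rw [e]
  refine (abs_sub _ _).trans (add_le_add ((abs_sub _ _).trans (add_le_add b1 b2)) b3)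

lemma osc2 {Q Q' : ℝ} {f f' : ℝ → ℝ} (hf : MonoAmp Q Q' f f') (h : Q ≤ Q') {ω φ : ℝ} :
    |∫ x in Q..Q', f x * cos (ω * x + φ)| ≤ f Q' * (Q' - Q) := by
  rw [← Real.norm_eq_abs]
  refine (intervalIntegral.norm_integral_le_of_norm_le_const (C := f Q') ?_).trans (by rw [abs_of_nonneg (by linarith)])
  intro x hx
  rw [Set.uIoc_of_le h] at hx
  have hx' : x ∈ Set.Icc Q Q' := ⟨hx.1.le, hx.2⟩
  rw [Real.norm_eq_abs, abs_mul, abs_of_nonneg (hf.nn x hx')]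
  exact (mul_le_of_le_one_right (hf.nn x hx') (abs_cos_le_one _)).trans (hf.le_end hx')

theorem meansq {ι : Type*} (S : Finset ι) (c l : ι → ℝ) (η η' : ι → ℝ → ℝ) {Q Q' μ : ℝ} (k : ℕ)
    (hQ : 0 ≤ Q) (h : Q ≤ Q') (hQ2 : Q' ≤ 2 * Q) (hμ : 0 < μ) (hc : ∀ i ∈ S, 0 ≤ c i) (hl : ∀ i ∈ S, 0 < l i)
    (hη : ∀ i ∈ S, MonoAmp Q Q' (η i) (η' i)) (hη1 : ∀ i ∈ S, η i Q' ≤ 1) :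
    |(∫ t in Q..Q', t ^ k * (∑ i ∈ S, c i * η i t * sin (2 * π * (μ * l i * t + 1 / 8))) ^ 2) -
      1 / 2 * ∑ i ∈ S, ∑ j ∈ S, if l i = l j then c i * c j * ∫ t in Q..Q', η i t * η j t * t ^ k else 0| ≤
    (1 + 1 / μ) * Q' ^ k * ((∑ i ∈ S, ∑ j ∈ S, c i * c j * (1 / (l i + l j))) +
      ∑ i ∈ S, ∑ j ∈ S, if l i = l j then 0 else c i * c j * min Q (1 / |l i - l j|)) := by
  have hpow : MonoAmp Q Q' (fun t => t ^ k) (fun t => k * t ^ (k - 1)) := by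
    refine ⟨fun x _ => hasDerivAt_pow k x, fun x hx => ?_, fun x hx => ?_, by fun_prop⟩
    · exact pow_nonneg (hQ.trans hx.1) _
    · exact mul_nonneg (Nat.cast_nonneg _) (pow_nonneg (hQ.trans hx.1) _)
  have hQ'0 : 0 ≤ Q' := hQ.trans h
  set F : ι → ι → ℝ → ℝ := fun i j t => η i t * η j t * t ^ k with hF
  have hFA : ∀ i ∈ S, ∀ j ∈ S, ∃ F', MonoAmp Q Q' (F i j) F' := fun i hi j hj => ⟨_, ((hη i hi).mul (hη j hj)).mul hpow⟩
  have hF1 : ∀ i ∈ S, ∀ j ∈ S, F i j Q' ≤ Q' ^ k := by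
    intro i hi j hj
    have e : Q' ∈ Set.Icc Q Q' := ⟨h, le_rfl⟩
    exact mul_le_of_le_one_left (pow_nonneg hQ'0 k) (mul_le_one₀ (hη1 i hi) ((hη j hj).nn _ e) (hη1 j hj))
  have key : ∀ t, t ^ k * (∑ i ∈ S, c i * η i t * sin (2 * π * (μ * l i * t + 1 / 8))) ^ 2 =
      ∑ i ∈ S, ∑ j ∈ S, (c i * c j / 2) * (F i j t * cos (2 * π * μ * (l i - l j) * t + 0) -
        F i j t * cos (2 * π * μ * (l i + l j) * t + π / 2)) := by
    intro t
    rw [sq, Finset.sum_mul_sum, Finset.mul_sum]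
    refine Finset.sum_congr rfl fun i _ => ?_
    rw [Finset.mul_sum]
    refine Finset.sum_congr rfl fun j _ => ?_
    have e1 : cos (2 * π * μ * (l i - l j) * t + 0) = cos (2 * π * (μ * l i * t + 1 / 8) - 2 * π * (μ * l j * t + 1 / 8)) := by
      congr 1; ring
    have e2 : cos (2 * π * μ * (l i + l j) * t + π / 2) = cos (2 * π * (μ * l i * t + 1 / 8) + 2 * π * (μ * l j * t + 1 / 8)) := by
      congr 1; ring
    rw [e1, e2, cos_sub, cos_add, hF]; ring
  have hiA : ∀ i ∈ S, ∀ j ∈ S, ∀ ω φ : ℝ, IntervalIntegrable (fun t => F i j t * cos (ω * t + φ)) volume Q Q' := by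
    intro i hi j hj ω φ
    obtain ⟨F', hF'⟩ := hFA i hi j hj
    exact hF'.ii h (by fun_prop)
  have hintg : (∫ t in Q..Q', t ^ k * (∑ i ∈ S, c i * η i t * sin (2 * π * (μ * l i * t + 1 / 8))) ^ 2) =
      ∑ i ∈ S, ∑ j ∈ S, (c i * c j / 2) * ((∫ t in Q..Q', F i j t * cos (2 * π * μ * (l i - l j) * t + 0)) -
        ∫ t in Q..Q', F i j t * cos (2 * π * μ * (l i + l j) * t + π / 2)) := by
    simp_rw [key]
    rw [intervalIntegral.integral_finsetSum]
    · refine Finset.sum_congr rfl fun i hi => ?_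
      rw [intervalIntegral.integral_finsetSum]
      · refine Finset.sum_congr rfl fun j hj => ?_
        rw [intervalIntegral.integral_const_mul, intervalIntegral.integral_sub (hiA i hi j hj _ _) (hiA i hi j hj _ _)]
      · intro j hj
        exact ((hiA i hi j hj _ _).sub (hiA i hi j hj _ _)).const_mul _
    · intro i hi
      have := IntervalIntegrable.sum (μ := volume) (a := Q) (b := Q') S (f := fun j t => (c i * c j / 2) * (F i j t * cos (2 * π * μ * (l i - l j) * t + 0) -
        F i j t * cos (2 * π * μ * (l i + l j) * t + π / 2))) (fun j hj => ((hiA i hi j hj _ _).sub (hiA i hi j hj _ _)).const_mul _)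
      have e : (fun t => ∑ j ∈ S, (c i * c j / 2) * (F i j t * cos (2 * π * μ * (l i - l j) * t + 0) -
        F i j t * cos (2 * π * μ * (l i + l j) * t + π / 2))) = ∑ j ∈ S, (fun t => (c i * c j / 2) * (F i j t * cos (2 * π * μ * (l i - l j) * t + 0) -
        F i j t * cos (2 * π * μ * (l i + l j) * t + π / 2))) := by
        ext t; simp
      rw [e]; exact this
  rw [hintg, Finset.mul_sum, ← Finset.sum_sub_distrib, ← Finset.sum_add_distrib, Finset.mul_sum]
  refine (Finset.abs_sum_le_sum_abs _ _).trans (Finset.sum_le_sum fun i hi => ?_)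
  rw [Finset.mul_sum, ← Finset.sum_sub_distrib, ← Finset.sum_add_distrib, Finset.mul_sum]
  refine (Finset.abs_sum_le_sum_abs _ _).trans (Finset.sum_le_sum fun j hj => ?_)
  obtain ⟨F', hF'⟩ := hFA i hi j hj
  have hcij : 0 ≤ c i * c j := mul_nonneg (hc i hi) (hc j hj)
  have hli := hl i hi
  have hlj := hl j hj
  have hpi := Real.pi_gt_three
  have hQk : 0 ≤ Q' ^ k := pow_nonneg hQ'0 k
  have hFQ0 : 0 ≤ F i j Q' := hF'.nn _ ⟨h, le_rfl⟩
  have o2 : |∫ t in Q..Q', F i j t * cos (2 * π * μ * (l i + l j) * t + π / 2)| ≤ (1 + 1 / μ) * Q' ^ k * (1 / (l i + l j)) := by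
    refine (osc1 hF' h (by positivity)).trans ?_
    rw [abs_of_pos (by positivity)]
    have e : 2 * F i j Q' / (2 * π * μ * (l i + l j)) = (1 / π) * (1 / μ) * (F i j Q') * (1 / (l i + l j)) := by field_simp
    rw [e]
    apply mul_le_mul_of_nonneg_right _ (by positivity)
    apply mul_le_mul _ (hF1 i hi j hj) hFQ0 (by positivity)
    have : 1 / π ≤ 1 := by rw [div_le_one (by positivity)]; linarith
    have h2 : 0 < 1 / μ := by positivity
    calc 1 / π * (1 / μ) ≤ 1 * (1 / μ) := mul_le_mul_of_nonneg_right this h2.le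
      _ ≤ _ := by linarith
  by_cases hlij : l i = l j
  · rw [if_pos hlij, if_pos hlij, add_zero]
    have e : (∫ t in Q..Q', F i j t * cos (2 * π * μ * (l i - l j) * t + 0)) = ∫ t in Q..Q', η i t * η j t * t ^ k := by
      congr 1; ext t; rw [hlij]; simp [hF]
    rw [e]
    have e2 : ∀ I J : ℝ, c i * c j / 2 * (I - J) - 1 / 2 * (c i * c j * I) = - (c i * c j * (1 / 2)) * J := by intros; ring
    rw [e2, abs_mul, abs_neg, abs_of_nonneg (by positivity)]
    calc c i * c j * (1 / 2) * _ ≤ c i * c j * (1 / 2) * _ := mul_le_mul_of_nonneg_left o2 (by positivity)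
      _ ≤ (c i * c j) * ((1 + 1 / μ) * Q' ^ k * (1 / (l i + l j))) := by
        apply mul_le_mul_of_nonneg_right _ (by positivity); linarith
      _ = _ := by ring
  · rw [if_neg hlij, if_neg hlij, mul_zero, sub_zero, abs_mul, abs_of_nonneg (by positivity)]
    have hne : l i - l j ≠ 0 := sub_ne_zero.2 hlij
    have hla : 0 < |l i - l j| := abs_pos.2 hne
    have o1 : |∫ t in Q..Q', F i j t * cos (2 * π * μ * (l i - l j) * t + 0)| ≤ (1 + 1 / μ) * Q' ^ k * min Q (1 / |l i - l j|) := by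
      rw [mul_min_of_nonneg _ _ (by positivity)]
      apply le_min
      · refine (osc2 hF' h).trans ?_
        apply mul_le_mul _ (by linarith) (by linarith) (by positivity)
        refine (hF1 i hi j hj).trans (le_mul_of_one_le_left hQk ?_)
        have : 0 < 1 / μ := by positivity
        linarith
      · refine (osc1 hF' h (mul_ne_zero (by positivity) hne)).trans ?_
        rw [abs_mul, abs_of_pos (a := 2 * π * μ) (by positivity)]
        have e : 2 * F i j Q' / (2 * π * μ * |l i - l j|) = (1 / π) * (1 / μ) * (F i j Q') * (1 / |l i - l j|) := by field_simp
        rw [e]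
        apply mul_le_mul_of_nonneg_right _ (by positivity)
        apply mul_le_mul _ (hF1 i hi j hj) hFQ0 (by positivity)
        have : 1 / π ≤ 1 := by rw [div_le_one (by positivity)]; linarith
        have h2 : 0 < 1 / μ := by positivity
        calc 1 / π * (1 / μ) ≤ 1 * (1 / μ) := mul_le_mul_of_nonneg_right this h2.le
          _ ≤ _ := by linarith
    calc _ ≤ c i * c j / 2 * ((1 + 1 / μ) * Q' ^ k * min Q (1 / |l i - l j|) + (1 + 1 / μ) * Q' ^ k * (1 / (l i + l j))) :=
          mul_le_mul_of_nonneg_left ((abs_sub _ _).trans (add_le_add o1 o2)) (by positivity)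
      _ ≤ c i * c j * ((1 + 1 / μ) * Q' ^ k * min Q (1 / |l i - l j|) + (1 + 1 / μ) * Q' ^ k * (1 / (l i + l j))) := by
          apply mul_le_mul_of_nonneg_right (by linarith)
          have : 0 ≤ min Q (1 / |l i - l j|) := le_min hQ (by positivity)
          positivity
      _ = _ := by ring

end MSQ

namespace MSQ

lemma st_dnn (x : ℝ) : 0 ≤ deriv st x := Real.smoothTransition.monotone.deriv_nonneg

lemma amp_st {Q Q' z w : ℝ} (hQ : 0 < Q) (hz : 0 < z) (hw : 0 ≤ w) :
    MonoAmp Q Q' (fun t => w * st (1 + log (t * z))) (fun t => w * (deriv st (1 + log (t * z)) * (z / (t * z)))) where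
  d x hx := by
    have hx0 : 0 < x := lt_of_lt_of_le hQ hx.1
    have h1 : HasDerivAt (fun t => 1 + log (t * z)) (z / (x * z)) x := by
      have : HasDerivAt (fun t : ℝ => t * z) z x := by simpa using (hasDerivAt_id x).mul_const z
      exact (this.log (by positivity)).const_add 1
    exact ((st_d _).comp x h1).const_mul w
  nn x hx := mul_nonneg hw (Real.smoothTransition.nonneg _)
  dnn x hx := by
    have hx0 : 0 < x := lt_of_lt_of_le hQ hx.1
    exact mul_nonneg hw (mul_nonneg (st_dnn _) (by positivity))
  dc := by
    have h0 : ∀ x ∈ Set.Icc Q Q', x * z ≠ 0 := fun x hx => by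
      have hx0 : 0 < x := lt_of_lt_of_le hQ hx.1
      positivity
    refine ContinuousOn.mul continuousOn_const (ContinuousOn.mul ?_ ?_)
    · refine st_dc.comp_continuousOn ?_
      exact continuousOn_const.add ((continuousOn_id.mul continuousOn_const).log h0)
    · exact continuousOn_const.div (continuousOn_id.mul continuousOn_const) h0

lemma amp_zero {Q Q' : ℝ} : MonoAmp Q Q' (fun _ => 0) (fun _ => 0) :=
  ⟨fun x _ => hasDerivAt_const x 0, fun _ _ => le_rfl, fun _ _ => le_rfl, continuousOn_const⟩

lemma MonoAmp.add {Q Q' : ℝ} {f f' g g' : ℝ → ℝ} (hf : MonoAmp Q Q' f f') (hg : MonoAmp Q Q' g g') :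
    MonoAmp Q Q' (fun x => f x + g x) (fun x => f' x + g' x) where
  d x hx := (hf.d x hx).add (hg.d x hx)
  nn x hx := add_nonneg (hf.nn x hx) (hg.nn x hx)
  dnn x hx := add_nonneg (hf.dnn x hx) (hg.dnn x hx)
  dc := hf.dc.add hg.dc

lemma eta_amp {θ Q Q' : ℝ} {H h ν : ℕ} (hθ : 0 < θ) (hQ : 0 < Q) (hh : 1 ≤ h) (hν : 1 ≤ ν) :
    ∃ η', MonoAmp Q Q' (eta θ H h ν) η' := by
  have hz : 0 < zf θ h ν := zf_pos hθ (by exact_mod_cast hh) (by exact_mod_cast hν)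
  have h1 : ∃ g, MonoAmp Q Q' (fun t => if h ≤ H then wt 1 (zf θ h ν) * st (1 + log (t * zf θ h ν)) else 0) g := by
    split_ifs
    · exact ⟨_, amp_st hQ hz (wt_nonneg _ _)⟩
    · exact ⟨_, amp_zero⟩
  have h2 : ∃ g, MonoAmp Q Q' (fun t => if ν ≤ H then (1 - wt 1 (zf θ h ν)) * st (1 + log (t * (zf θ h ν) ^ (-θ))) else 0) g := by
    split_ifs
    · exact ⟨_, amp_st hQ (by positivity) (by linarith [wt_le_one 1 (zf θ h ν)])⟩
    · exact ⟨_, amp_zero⟩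
  obtain ⟨g1, h1⟩ := h1
  obtain ⟨g2, h2⟩ := h2
  exact ⟨_, h1.add h2⟩

lemma eta_le_one (θ : ℝ) (H h ν : ℕ) (t : ℝ) : eta θ H h ν t ≤ 1 := by
  unfold eta
  have a1 := wt_nonneg 1 (zf θ h ν)
  have a2 := wt_le_one 1 (zf θ h ν)
  have h1 : (if h ≤ H then wt 1 (zf θ h ν) * st (1 + log (t * zf θ h ν)) else 0) ≤ wt 1 (zf θ h ν) := by
    split_ifs
    · exact mul_le_of_le_one_right a1 (Real.smoothTransition.le_one _)
    · exact a1
  have h2 : (if ν ≤ H then (1 - wt 1 (zf θ h ν)) * st (1 + log (t * (zf θ h ν) ^ (-θ))) else 0) ≤ 1 - wt 1 (zf θ h ν) := by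
    split_ifs
    · exact mul_le_of_le_one_right (by linarith) (Real.smoothTransition.le_one _)
    · linarith
  linarith

lemma eta_nonneg (θ : ℝ) (H h ν : ℕ) (t : ℝ) : 0 ≤ eta θ H h ν t := by
  unfold eta
  have a1 := wt_nonneg 1 (zf θ h ν)
  have a2 := wt_le_one 1 (zf θ h ν)
  apply add_nonneg
  · split_ifs
    · exact mul_nonneg a1 (Real.smoothTransition.nonneg _)
    · exact le_rfl
  · split_ifs
    · exact mul_nonneg (by linarith) (Real.smoothTransition.nonneg _)
    · exact le_rfl

lemma eta_eq_one {θ t : ℝ} {H h ν : ℕ} (hθ : 1 < θ) (ht : 1 ≤ t) (hh : 1 ≤ h) (hν : 1 ≤ ν) (hhH : h ≤ H) (hνH : ν ≤ H)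
    (h1 : (ν:ℝ) ≤ t ^ (1 + θ)) (h2 : (h:ℝ) ≤ t ^ (1 + 1 / θ) / θ) : eta θ H h ν t = 1 := by
  have hh' : (1:ℝ) ≤ h := by exact_mod_cast hh
  have hν' : (1:ℝ) ≤ ν := by exact_mod_cast hν
  have hθ0 : 0 < θ := by linarith
  have ht0 : 0 < t := by linarith
  have hz : 0 < zf θ h ν := zf_pos hθ0 (by linarith) (by linarith)
  have e1 : 1 ≤ t * zf θ h ν := by
    have : t⁻¹ ≤ zf θ h ν := by
      unfold zf
      have e : t⁻¹ = ((t ^ (1 + θ))⁻¹) ^ (1 / (1 + θ)) := by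
        rw [inv_rpow (by positivity), ← rpow_mul ht0.le, mul_one_div_cancel (by positivity), rpow_one]
      rw [e]
      apply rpow_le_rpow (by positivity) _ (by positivity)
      rw [inv_eq_one_div, div_le_div_iff₀ (by positivity) (by positivity), one_mul]
      calc (ν:ℝ) ≤ t ^ (1 + θ) := h1
        _ ≤ θ * h * t ^ (1 + θ) := le_mul_of_one_le_left (by positivity) (one_le_mul_of_one_le_of_one_le hθ.le hh')
    calc 1 = t * t⁻¹ := by field_simp
      _ ≤ _ := mul_le_mul_of_nonneg_left this ht0.le
  have e2 : 1 ≤ t * (zf θ h ν) ^ (-θ) := by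
    have : zf θ h ν ≤ t ^ (1 / θ) := by
      unfold zf
      have e : t ^ (1 / θ) = (t ^ (1 + 1 / θ)) ^ (1 / (1 + θ)) := by
        rw [← rpow_mul ht0.le]; congr 1; field_simp; ring
      rw [e]
      apply rpow_le_rpow (by positivity) _ (by positivity)
      rw [le_div_iff₀ hθ0] at h2
      rw [div_le_iff₀ (by positivity)]
      calc θ * h = h * θ := by ring
        _ ≤ t ^ (1 + 1 / θ) := h2
        _ ≤ _ := le_mul_of_one_le_right (by positivity) hν'
    have h3 : (zf θ h ν) ^ θ ≤ t := by
      calc (zf θ h ν) ^ θ ≤ (t ^ (1 / θ)) ^ θ := rpow_le_rpow hz.le this hθ0.le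
        _ = t := by rw [← rpow_mul ht0.le, one_div_mul_cancel hθ0.ne', rpow_one]
    rw [rpow_neg hz.le, ← div_eq_mul_inv, one_le_div (by positivity)]
    exact h3
  unfold eta
  rw [if_pos hhH, if_pos hνH]
  have s1 : st (1 + log (t * zf θ h ν)) = 1 := Real.smoothTransition.one_of_one_le (by linarith [Real.log_nonneg e1])
  have s2 : st (1 + log (t * (zf θ h ν) ^ (-θ))) = 1 := Real.smoothTransition.one_of_one_le (by linarith [Real.log_nonneg e2])
  rw [s1, s2]; ring

end MSQ

namespace MSQ

lemma sep {ι : Type*} (S : Finset ι) (u f : ι → ℝ) {v σ M : ℝ} (K : ℕ) (hσ : 0 < σ) (hM : 0 ≤ M)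
    (hsep : ∀ x ∈ S, ∀ y ∈ S, x ≠ y → σ ≤ |u x - u y|) (hK : ∀ x ∈ S, |u x - v| ≤ σ * K)
    (hfM : ∀ x ∈ S, f x ≤ M) (hf : ∀ x ∈ S, f x * |u x - v| ≤ 1) :
    ∑ x ∈ S, f x ≤ 2 * M + 2 / σ * (1 + log K) := by
  classical
  set g : ℕ → ℝ := fun j => if j = 0 then M else 1 / (σ * j) with hg
  have hg0 : ∀ j, 0 ≤ g j := by intro j; simp only [hg]; split_ifs; exacts [hM, by positivity]
  set φ : ι → Bool × ℕ := fun x => (decide (v ≤ u x), ⌊|u x - v| / σ⌋₊) with hφ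
  have h1 : ∀ x ∈ S, f x ≤ g (φ x).2 := by
    intro x hx
    simp only [hg, hφ]
    split_ifs with h0
    · exact hfM x hx
    · have hj : 0 < (⌊|u x - v| / σ⌋₊ : ℝ) := by exact_mod_cast Nat.pos_of_ne_zero h0
      have hfl : (⌊|u x - v| / σ⌋₊ : ℝ) ≤ |u x - v| / σ := Nat.floor_le (by positivity)
      have hle : σ * ⌊|u x - v| / σ⌋₊ ≤ |u x - v| := by
        rw [le_div_iff₀ hσ] at hfl; linarith
      rw [le_div_iff₀ (by positivity)]
      by_cases hfx : 0 ≤ f x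
      · exact (mul_le_mul_of_nonneg_left hle hfx).trans (hf x hx)
      · push Not at hfx
        have : f x * (σ * ⌊|u x - v| / σ⌋₊) ≤ 0 := mul_nonpos_of_nonpos_of_nonneg hfx.le (by positivity)
        linarith
  have hinj : Set.InjOn φ S := by
    intro x hx y hy hxy
    by_contra hne
    have hs := hsep x hx y hy hne
    simp only [hφ, Prod.mk.injEq, decide_eq_decide] at hxy
    obtain ⟨hb, hj⟩ := hxy
    have hd : |(|u x - v| - |u y - v|)| = |u x - u y| := by
      by_cases hvx : v ≤ u x
      · have hvy := hb.1 hvx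
        rw [abs_of_nonneg (sub_nonneg.2 hvx), abs_of_nonneg (sub_nonneg.2 hvy)]; congr 1; ring
      · have hvy : ¬ v ≤ u y := fun h => hvx (hb.2 h)
        push Not at hvx hvy
        rw [abs_of_neg (sub_neg.2 hvx), abs_of_neg (sub_neg.2 hvy), ← abs_neg]; congr 1; ring
    have a1 := Nat.floor_le (a := |u x - v| / σ) (by positivity)
    have a2 := Nat.lt_floor_add_one (|u x - v| / σ)
    have b1 := Nat.floor_le (a := |u y - v| / σ) (by positivity)
    have b2 := Nat.lt_floor_add_one (|u y - v| / σ)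
    rw [hj] at a1 a2
    have : |(|u x - v| / σ - |u y - v| / σ)| < 1 := by rw [abs_lt]; constructor <;> linarith
    rw [← sub_div, abs_div, hd, abs_of_pos hσ, div_lt_one hσ] at this
    linarith
  have hmem : ∀ x ∈ S, φ x ∈ (Finset.univ : Finset Bool) ×ˢ Finset.range (K + 1) := by
    intro x hx
    simp only [hφ, Finset.mem_product, Finset.mem_univ, true_and, Finset.mem_range]
    have : ⌊|u x - v| / σ⌋₊ ≤ K := by
      apply Nat.floor_le_of_le
      rw [div_le_iff₀ hσ]; linarith [hK x hx]
    omega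
  calc ∑ x ∈ S, f x ≤ ∑ x ∈ S, g (φ x).2 := Finset.sum_le_sum h1
    _ = ∑ p ∈ S.image φ, g p.2 := by rw [Finset.sum_image hinj]
    _ ≤ ∑ p ∈ (Finset.univ : Finset Bool) ×ˢ Finset.range (K + 1), g p.2 := by
        apply Finset.sum_le_sum_of_subset_of_nonneg
        · intro p hp
          obtain ⟨x, hx, rfl⟩ := Finset.mem_image.1 hp
          exact hmem x hx
        · intro p _ _; exact hg0 _
    _ = 2 * ∑ j ∈ Finset.range (K + 1), g j := by
        rw [Finset.sum_product]; simp
    _ ≤ _ := by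
        rw [Finset.sum_range_succ']
        have e : ∑ k ∈ Finset.range K, g (k + 1) = 1 / σ * ∑ k ∈ Finset.range K, 1 / ((k:ℝ) + 1) := by
          rw [Finset.mul_sum]
          refine Finset.sum_congr rfl fun k _ => ?_
          simp only [hg]; rw [if_neg (by omega)]; push_cast; field_simp
        rw [e]
        have h0 : g 0 = M := by simp [hg]
        have := mul_le_mul_of_nonneg_left (harm K) (show 0 ≤ 1 / σ by positivity)
        have e2 : 2 / σ * (1 + log K) = 2 * (1 / σ * (1 + log K)) := by ring
        rw [h0, e2]; linarith

/-- Distinct positive integers have well separated logarithms. -/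
lemma log_sep {m n : ℕ} (hm : 1 ≤ m) (hn : 1 ≤ n) (hne : m ≠ n) : 1 / (2 * √((m:ℝ) * n)) ≤ |log m - log n| := by
  wlog h : n < m generalizing m n
  · have := this hn hm hne.symm (by omega)
    rwa [abs_sub_comm, mul_comm (n:ℝ)] at this
  have hn' : (1:ℝ) ≤ n := by exact_mod_cast hn
  have hm' : (n:ℝ) + 1 ≤ m := by exact_mod_cast h
  rw [← Real.log_div (by positivity) (by positivity)]
  have h1 : 1 - ((m:ℝ) / n)⁻¹ ≤ log (m / n) := Real.one_sub_inv_le_log_of_pos (by positivity)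
  have h2 : 1 / (2 * √((m:ℝ) * n)) ≤ 1 - ((m:ℝ) / n)⁻¹ := by
    have e : 1 - ((m:ℝ) / n)⁻¹ = ((m:ℝ) - n) / m := by field_simp
    rw [e]
    have hsq : √((m:ℝ) * n) = √m * √n := Real.sqrt_mul (by positivity) _
    have hsn : 1 ≤ √(n:ℝ) := Real.one_le_sqrt.2 hn'
    have hsm0 : 0 < √(m:ℝ) := Real.sqrt_pos.2 (by positivity)
    have hmm : √(m:ℝ) * √m = m := Real.mul_self_sqrt (by positivity)
    have hnn : √(n:ℝ) * √n = n := Real.mul_self_sqrt (by positivity)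
    have hsnm : √(n:ℝ) ≤ √m := Real.sqrt_le_sqrt (by linarith)
    rw [hsq, div_le_div_iff₀ (by positivity) (by positivity)]
    -- m ≤ (m-n) * 2 √m √n
    have hdiff : (m:ℝ) - n = (√m - √n) * (√m + √n) := by rw [sub_mul, mul_add, mul_add, hmm, hnn]; ring
    have h3 : (1:ℝ) ≤ (m:ℝ) - n := by linarith
    by_cases hc : √(m:ℝ) ≤ 2 * √n
    · have : (m:ℝ) ≤ 2 * (√m * √n) := by
        calc (m:ℝ) = √m * √m := hmm.symm
          _ ≤ √m * (2 * √n) := mul_le_mul_of_nonneg_left hc hsm0.le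
          _ = _ := by ring
      calc 1 * (m:ℝ) ≤ 1 * (2 * (√m * √n)) := by linarith
        _ ≤ _ := mul_le_mul_of_nonneg_right h3 (by positivity)
    · push Not at hc
      have h4 : (n:ℝ) ≤ m / 4 := by
        rw [← hmm, ← hnn]
        have : 2 * √(n:ℝ) * (2 * √n) ≤ √m * √m := mul_le_mul hc.le hc.le (by positivity) hsm0.le
        linarith
      have h5 : (1:ℝ) ≤ √m * √n := one_le_mul_of_one_le_of_one_le (hsn.trans hsnm) hsn
      calc 1 * (m:ℝ) ≤ (m - n) * 2 := by linarith
        _ ≤ (m - n) * (2 * (√m * √n)) := mul_le_mul_of_nonneg_left (by linarith) (by linarith)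
  exact (h2.trans h1).trans (le_abs_self _)

/-- geometric mean is at most logarithmic mean -/
lemma geo_log {x y : ℝ} (hx : 0 < x) (hy : 0 < y) : √(x * y) * |log x - log y| ≤ |x - y| := by
  wlog h : y ≤ x generalizing x y
  · have := this hy hx (by linarith)
    rwa [abs_sub_comm, abs_sub_comm y, mul_comm y] at this
  rw [abs_of_nonneg (sub_nonneg.2 (Real.log_le_log hy h)), abs_of_nonneg (sub_nonneg.2 h)]
  have hs : 0 ≤ (log x - log y) / 2 := by linarith [Real.log_le_log hy h]
  have h1 : (log x - log y) / 2 ≤ Real.sinh ((log x - log y) / 2) := Real.self_le_sinh_iff.2 hs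
  have hsx : √x = exp (log x / 2) := by
    rw [Real.sqrt_eq_rpow, Real.rpow_def_of_pos hx]; ring_nf
  have hsy : √y = exp (log y / 2) := by
    rw [Real.sqrt_eq_rpow, Real.rpow_def_of_pos hy]; ring_nf
  rw [Real.sqrt_mul hx.le]
  calc √x * √y * (log x - log y) = 2 * (√x * √y * ((log x - log y) / 2)) := by ring
    _ ≤ 2 * (√x * √y * Real.sinh ((log x - log y) / 2)) := by
        apply mul_le_mul_of_nonneg_left _ (by norm_num)
        exact mul_le_mul_of_nonneg_left h1 (by positivity)
    _ = x - y := by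
        rw [Real.sinh_eq, hsx, hsy]
        have e1 : exp (log x / 2) * exp (log y / 2) * exp ((log x - log y) / 2) = x := by
          rw [← exp_add, ← exp_add]; rw [show log x / 2 + log y / 2 + (log x - log y) / 2 = log x by ring, exp_log hx]
        have e2 : exp (log x / 2) * exp (log y / 2) * exp (-((log x - log y) / 2)) = y := by
          rw [← exp_add, ← exp_add]; rw [show log x / 2 + log y / 2 + -((log x - log y) / 2) = log y by ring, exp_log hy]
        linear_combination e1 - e2

end MSQ

namespace MSQ

def PN (N : ℕ) : Finset (ℕ × ℕ) := (Finset.Icc 1 N ×ˢ Finset.Icc 1 N).filter fun x => Nat.Coprime x.1 x.2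
def PC (N i : ℕ) : Finset (ℕ × ℕ) := (PN N).filter fun x => Nat.log 2 (x.1 * x.2) = i
noncomputable def uu (x : ℕ × ℕ) : ℝ := log x.1 - log x.2

lemma PN_mem {N : ℕ} {x : ℕ × ℕ} (h : x ∈ PN N) : 1 ≤ x.1 ∧ x.1 ≤ N ∧ 1 ≤ x.2 ∧ x.2 ≤ N ∧ Nat.Coprime x.1 x.2 := by
  simp only [PN, Finset.mem_filter, Finset.mem_product, Finset.mem_Icc] at h
  tauto

lemma PC_mem {N i : ℕ} {x : ℕ × ℕ} (h : x ∈ PC N i) : x ∈ PN N ∧ 2 ^ i ≤ x.1 * x.2 ∧ x.1 * x.2 < 2 ^ (i + 1) := by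
  simp only [PC, Finset.mem_filter] at h
  obtain ⟨h1, rfl⟩ := h
  have := PN_mem h1
  refine ⟨h1, Nat.pow_log_le_self 2 (Nat.mul_pos this.1 this.2.2.1).ne', Nat.lt_pow_succ_log_self (by norm_num) _⟩

lemma uu_abs {N : ℕ} {x : ℕ × ℕ} (h : x ∈ PN N) : |uu x| ≤ log N := by
  obtain ⟨h1, h2, h3, h4, -⟩ := PN_mem h
  have a1 : (1:ℝ) ≤ x.1 := by exact_mod_cast h1
  have a2 : (x.1:ℝ) ≤ N := by exact_mod_cast h2
  have a3 : (1:ℝ) ≤ x.2 := by exact_mod_cast h3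
  have a4 : (x.2:ℝ) ≤ N := by exact_mod_cast h4
  have b1 := Real.log_nonneg a1
  have b2 := Real.log_nonneg a3
  have b3 := Real.log_le_log (by linarith) a2
  have b4 := Real.log_le_log (by linarith) a4
  unfold uu
  rw [abs_le]; constructor <;> linarith

lemma uu_sep {N i : ℕ} {x y : ℕ × ℕ} (hx : x ∈ PC N i) (hy : y ∈ PC N i) (hne : x ≠ y) : 1 / 2 ^ (i + 2) ≤ |uu x - uu y| := by
  obtain ⟨hx0, hx1, hx2⟩ := PC_mem hx
  obtain ⟨hy0, hy1, hy2⟩ := PC_mem hy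
  obtain ⟨p1, -, q1, -, c1⟩ := PN_mem hx0
  obtain ⟨p2, -, q2, -, c2⟩ := PN_mem hy0
  have hneq : x.1 * y.2 ≠ y.1 * x.2 := by
    intro h
    apply hne
    have d1 : x.1 ∣ y.1 := c1.dvd_of_dvd_mul_right (Dvd.intro _ h)
    have d2 : y.1 ∣ x.1 := c2.dvd_of_dvd_mul_right (Dvd.intro _ h.symm)
    have e1 : x.1 = y.1 := Nat.dvd_antisymm d1 d2
    have e2 : x.2 = y.2 := by
      rw [e1] at h; exact (Nat.eq_of_mul_eq_mul_left p2 h).symm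
    exact Prod.ext e1 e2
  have hl := log_sep (Nat.mul_pos p1 q2) (Nat.mul_pos p2 q1) hneq
  have z1 : (x.1:ℝ) ≠ 0 := by positivity
  have z2 : (x.2:ℝ) ≠ 0 := by positivity
  have z3 : (y.1:ℝ) ≠ 0 := by positivity
  have z4 : (y.2:ℝ) ≠ 0 := by positivity
  have e : uu x - uu y = log ((x.1 * y.2 : ℕ):ℝ) - log ((y.1 * x.2 : ℕ):ℝ) := by
    push_cast
    rw [Real.log_mul z1 z4, Real.log_mul z3 z2]; unfold uu; ring
  rw [e]
  refine le_trans ?_ hl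
  have hs : √(((x.1 * y.2 : ℕ):ℝ) * ((y.1 * x.2 : ℕ):ℝ)) ≤ 2 ^ (i + 1) := by
    apply Real.sqrt_le_iff.2 ⟨by positivity, ?_⟩
    have a1 : ((x.1 * x.2 : ℕ):ℝ) ≤ 2 ^ (i + 1) := by exact_mod_cast hx2.le
    have a2 : ((y.1 * y.2 : ℕ):ℝ) ≤ 2 ^ (i + 1) := by exact_mod_cast hy2.le
    calc (((x.1 * y.2 : ℕ):ℝ) * ((y.1 * x.2 : ℕ):ℝ)) = ((x.1 * x.2 : ℕ):ℝ) * ((y.1 * y.2 : ℕ):ℝ) := by push_cast; ring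
      _ ≤ 2 ^ (i + 1) * 2 ^ (i + 1) := mul_le_mul a1 a2 (by positivity) (by positivity)
      _ = _ := by ring
  have hpos : 0 < √(((x.1 * y.2 : ℕ):ℝ) * ((y.1 * x.2 : ℕ):ℝ)) := Real.sqrt_pos.2 (by push_cast; positivity)
  apply one_div_le_one_div_of_le (by positivity)
  calc 2 * √(((x.1 * y.2 : ℕ):ℝ) * ((y.1 * x.2 : ℕ):ℝ)) ≤ 2 * 2 ^ (i + 1) := by linarith
    _ = _ := by ring

lemma PC_card (N j : ℕ) : ((PC N j).card : ℝ) ≤ 2 ^ (j + 1) * (1 + log N) := by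
  have hsub : PC N j ⊆ (Finset.Icc 1 N).biUnion fun p => (Finset.Icc 1 (2 ^ (j + 1) / p)).image fun q => (p, q) := by
    intro x hx
    obtain ⟨hx0, hx1, hx2⟩ := PC_mem hx
    obtain ⟨p1, p2, q1, -, c1⟩ := PN_mem hx0
    simp only [Finset.mem_biUnion, Finset.mem_Icc, Finset.mem_image]
    refine ⟨x.1, ⟨p1, p2⟩, x.2, ⟨q1, ?_⟩, rfl⟩
    rw [Nat.le_div_iff_mul_le (by omega), mul_comm]; exact hx2.le
  have h1 := (Finset.card_le_card hsub).trans Finset.card_biUnion_le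
  have h2 : ((PC N j).card : ℝ) ≤ ∑ p ∈ Finset.Icc 1 N, (((Finset.Icc 1 (2 ^ (j + 1) / p)).image fun q => (p, q)).card : ℝ) := by
    exact_mod_cast h1
  refine h2.trans ?_
  calc _ ≤ ∑ p ∈ Finset.Icc 1 N, 2 ^ (j + 1) * (1 / (p:ℝ)) := by
        apply Finset.sum_le_sum
        intro p hp
        have : ((Finset.Icc 1 (2 ^ (j + 1) / p)).image fun q => (p, q)).card ≤ 2 ^ (j + 1) / p := by
          refine Finset.card_image_le.trans (by simp)
        calc _ ≤ ((2 ^ (j + 1) / p : ℕ) : ℝ) := by exact_mod_cast this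
          _ ≤ ((2 ^ (j + 1) : ℕ) : ℝ) / p := Nat.cast_div_le
          _ = _ := by push_cast; ring
    _ = 2 ^ (j + 1) * ∑ p ∈ Finset.Icc 1 N, 1 / (p:ℝ) := by rw [Finset.mul_sum]
    _ ≤ _ := by
        apply mul_le_mul_of_nonneg_left _ (by positivity)
        rw [sum_Icc1 (fun p => 1 / (p:ℝ))]
        have := harm N
        push_cast; exact this

lemma block {N i j : ℕ} {A B M : ℝ} (K : ℕ) (F : ℕ × ℕ → ℕ × ℕ → ℝ) (hA : 0 < A) (hM : 0 ≤ M)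
    (hK : ∀ x ∈ PC N i, ∀ y ∈ PC N j, |A * uu x + B * uu y| ≤ A * (1 / 2 ^ (i + 2)) * K)
    (hF1 : ∀ x ∈ PC N i, ∀ y ∈ PC N j, F x y ≤ M)
    (hF2 : ∀ x ∈ PC N i, ∀ y ∈ PC N j, F x y * |A * uu x + B * uu y| ≤ 1) :
    ∑ y ∈ PC N j, ∑ x ∈ PC N i, F x y ≤ 2 ^ (j + 1) * (1 + log N) * (2 * M + 2 ^ (i + 3) / A * (1 + log K)) := by
  have hlk : 0 ≤ log (K:ℝ) := Real.log_natCast_nonneg K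
  have e : 2 / (A * (1 / 2 ^ (i + 2))) = 2 ^ (i + 3) / A := by field_simp; ring
  have h1 : ∀ y ∈ PC N j, ∑ x ∈ PC N i, F x y ≤ 2 * M + 2 ^ (i + 3) / A * (1 + log K) := by
    intro y hy
    rw [← e]
    have e2 : ∀ x, A * uu x - (-(B * uu y)) = A * uu x + B * uu y := by intro x; ring
    apply sep (PC N i) (fun x => A * uu x) (fun x => F x y) (v := -(B * uu y)) K (by positivity) hM
    · intro x hx x' hx' hne
      rw [← mul_sub, abs_mul, abs_of_pos hA]
      exact mul_le_mul_of_nonneg_left (uu_sep hx hx' hne) hA.le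
    · intro x hx; rw [e2]; exact hK x hx y hy
    · intro x hx; exact hF1 x hx y hy
    · intro x hx; rw [e2]; exact hF2 x hx y hy
  refine (Finset.sum_le_card_nsmul _ _ _ h1).trans ?_
  rw [nsmul_eq_mul]
  exact mul_le_mul_of_nonneg_right (PC_card N j) (by positivity)

end MSQ

namespace MSQ

noncomputable def Lm (a b : ℕ) (x y : ℕ × ℕ) : ℝ :=
  ((x.1:ℝ) * x.2) ^ ((a:ℝ) / (2 * (a + b))) * ((y.1:ℝ) * y.2) ^ ((b:ℝ) / (2 * (a + b)))
noncomputable def Ld (a b : ℕ) (x y : ℕ × ℕ) : ℝ := |(a:ℝ) / (a + b) * uu x + (b:ℝ) / (a + b) * uu y|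
noncomputable def FF (a b : ℕ) (Q : ℝ) (x y : ℕ × ℕ) : ℝ :=
  if x.1 ^ a * y.1 ^ b = x.2 ^ a * y.2 ^ b then 0 else min (Q * Lm a b x y) (1 / Ld a b x y)

lemma min_geo {X Y d : ℝ} (hX : 0 < X) (hY : 0 < Y) (hd0 : 0 ≤ d) (hd1 : d ≤ 1) : min X Y ≤ X ^ (1 - d) * Y ^ d := by
  have hm : 0 < min X Y := lt_min hX hY
  calc min X Y = (min X Y) ^ (1 - d) * (min X Y) ^ d := by rw [← rpow_add hm]; simp
    _ ≤ _ := mul_le_mul (rpow_le_rpow hm.le (min_le_left _ _) (by linarith)) (rpow_le_rpow hm.le (min_le_right _ _) hd0)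
      (by positivity) (by positivity)

lemma Ld_lower {a b N : ℕ} (ha : 1 ≤ a) {x y : ℕ × ℕ} (hx : x ∈ PN N) (hy : y ∈ PN N)
    (hne : x.1 ^ a * y.1 ^ b ≠ x.2 ^ a * y.2 ^ b) : 1 / (2 * ((a:ℝ) + b) * (Lm a b x y) ^ ((a:ℝ) + b)) ≤ Ld a b x y := by
  obtain ⟨p1, -, q1, -, c1⟩ := PN_mem hx
  obtain ⟨p2, -, q2, -, c2⟩ := PN_mem hy
  have hl := log_sep (Nat.mul_pos (pow_pos p1 a) (pow_pos p2 b)) (Nat.mul_pos (pow_pos q1 a) (pow_pos q2 b)) hne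
  have z1 : (0:ℝ) < x.1 := by exact_mod_cast p1
  have z2 : (0:ℝ) < x.2 := by exact_mod_cast q1
  have z3 : (0:ℝ) < y.1 := by exact_mod_cast p2
  have z4 : (0:ℝ) < y.2 := by exact_mod_cast q2
  have ha' : (1:ℝ) ≤ a := by exact_mod_cast ha
  have hb' : (0:ℝ) ≤ b := by positivity
  have hm : (0:ℝ) < (a:ℝ) + b := by linarith
  have e1 : Ld a b x y = 1 / ((a:ℝ) + b) * |log ((x.1 ^ a * y.1 ^ b : ℕ):ℝ) - log ((x.2 ^ a * y.2 ^ b : ℕ):ℝ)| := by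
    unfold Ld
    rw [← abs_of_pos (show 0 < 1 / ((a:ℝ) + b) by positivity), ← abs_mul]
    push_cast
    rw [Real.log_mul (by positivity) (by positivity), Real.log_mul (by positivity) (by positivity), Real.log_pow, Real.log_pow, Real.log_pow, Real.log_pow]
    unfold uu
    congr 1; ring
  have e2 : √(((x.1 ^ a * y.1 ^ b : ℕ):ℝ) * ((x.2 ^ a * y.2 ^ b : ℕ):ℝ)) = (Lm a b x y) ^ ((a:ℝ) + b) := by
    unfold Lm
    rw [mul_rpow (by positivity) (by positivity), ← rpow_mul (by positivity), ← rpow_mul (by positivity)]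
    have : ((x.1 ^ a * y.1 ^ b : ℕ):ℝ) * ((x.2 ^ a * y.2 ^ b : ℕ):ℝ) = ((x.1:ℝ) * x.2) ^ (a:ℝ) * ((y.1:ℝ) * y.2) ^ (b:ℝ) := by
      rw [rpow_natCast, rpow_natCast]; push_cast; ring
    rw [this, Real.sqrt_eq_rpow, mul_rpow (by positivity) (by positivity), ← rpow_mul (by positivity), ← rpow_mul (by positivity)]
    congr 2 <;> field_simp
  rw [e1, ← e2]
  calc _ = 1 / ((a:ℝ) + b) * (1 / (2 * √(((x.1 ^ a * y.1 ^ b : ℕ):ℝ) * ((x.2 ^ a * y.2 ^ b : ℕ):ℝ)))) := by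
        rw [div_mul_div_comm]; ring_nf
    _ ≤ _ := mul_le_mul_of_nonneg_left hl (by positivity)

lemma FF_bound {a b N : ℕ} (ha : 1 ≤ a) (hab : a < b) {x y : ℕ × ℕ} (hx : x ∈ PN N) (hy : y ∈ PN N) {Q : ℝ} (hQ : 1 ≤ Q) :
    FF a b Q x y ≤ 2 * ((a:ℝ) + b) * Q ^ (1 - (a:ℝ) / (b * (a + b - 1))) *
      (((x.1:ℝ) * x.2) ^ ((a:ℝ) / (2 * b)) * ((y.1:ℝ) * y.2) ^ ((1:ℝ) / 2)) := by
  obtain ⟨p1, -, q1, -, c1⟩ := PN_mem hx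
  obtain ⟨p2, -, q2, -, c2⟩ := PN_mem hy
  have z1 : (1:ℝ) ≤ x.1 := by exact_mod_cast p1
  have z2 : (1:ℝ) ≤ x.2 := by exact_mod_cast q1
  have z3 : (1:ℝ) ≤ y.1 := by exact_mod_cast p2
  have z4 : (1:ℝ) ≤ y.2 := by exact_mod_cast q2
  have ha' : (1:ℝ) ≤ a := by exact_mod_cast ha
  have hb' : (a:ℝ) + 1 ≤ b := by exact_mod_cast hab
  have hQ0 : 0 < Q := by linarith
  unfold FF
  split_ifs with hne
  · positivity
  have hL : 0 < Lm a b x y := by unfold Lm; positivity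
  have hlow := Ld_lower ha hx hy hne
  have hd : 0 < Ld a b x y := lt_of_lt_of_le (by positivity) hlow
  set m := (a:ℝ) + b with hm
  have hm3 : 3 ≤ m := by linarith
  set d := (a:ℝ) / (b * (m - 1)) with hdd
  have hd0 : 0 ≤ d := div_nonneg (by linarith) (mul_nonneg (by linarith) (by linarith))
  have hd1 : d ≤ 1 := by
    rw [hdd, div_le_one (mul_pos (by linarith) (by linarith))]
    calc (a:ℝ) ≤ b * 1 := by linarith
      _ ≤ b * (m - 1) := mul_le_mul_of_nonneg_left (by linarith) (by linarith)
  have h1 : 1 / Ld a b x y ≤ 2 * m * (Lm a b x y) ^ m := by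
    rw [div_le_iff₀ hd]
    rw [div_le_iff₀ (by positivity)] at hlow
    linarith
  calc min (Q * Lm a b x y) (1 / Ld a b x y) ≤ min (Q * Lm a b x y) (2 * m * (Lm a b x y) ^ m) := min_le_min_left _ h1
    _ ≤ (Q * Lm a b x y) ^ (1 - d) * (2 * m * (Lm a b x y) ^ m) ^ d := min_geo (by positivity) (by positivity) hd0 hd1
    _ = (2 * m) ^ d * Q ^ (1 - d) * (Lm a b x y) ^ (m / b) := by
        rw [mul_rpow hQ0.le hL.le, mul_rpow (by positivity) (by positivity), ← rpow_mul hL.le]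
        have : m / b = (1 - d) + m * d := by
          have h3 : m - 1 ≠ 0 := by linarith
          have h4 : (b:ℝ) ≠ 0 := by linarith
          rw [hdd]; field_simp; rw [hm]; ring
        rw [this, rpow_add hL]; ring
    _ ≤ (2 * m) * Q ^ (1 - d) * (Lm a b x y) ^ (m / b) := by
        apply mul_le_mul_of_nonneg_right _ (by positivity)
        apply mul_le_mul_of_nonneg_right _ (by positivity)
        calc (2 * m) ^ d ≤ (2 * m) ^ (1:ℝ) := rpow_le_rpow_of_exponent_le (by linarith) hd1
          _ = _ := rpow_one _
    _ = _ := by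
        congr 1
        unfold Lm
        rw [mul_rpow (by positivity) (by positivity), ← rpow_mul (by positivity), ← rpow_mul (by positivity), ← hm]
        have h4 : (b:ℝ) ≠ 0 := by linarith
        have h5 : m ≠ 0 := by linarith
        congr 2 <;> field_simp

lemma FF_nonneg {a b : ℕ} {Q : ℝ} (hQ : 0 ≤ Q) (x y : ℕ × ℕ) : 0 ≤ FF a b Q x y := by
  unfold FF
  split_ifs
  · exact le_rfl
  · apply le_min
    · unfold Lm; positivity
    · unfold Ld; positivity

lemma FF_mul {a b : ℕ} {Q : ℝ} (x y : ℕ × ℕ) : FF a b Q x y * Ld a b x y ≤ 1 := by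
  have h0 : 0 ≤ Ld a b x y := abs_nonneg _
  unfold FF
  split_ifs
  · simp
  · rcases h0.eq_or_lt with h | h
    · rw [← h]; simp
    · calc _ ≤ 1 / Ld a b x y * Ld a b x y := mul_le_mul_of_nonneg_right (min_le_right _ _) h0
        _ = 1 := by field_simp

lemma blk_arith {L M κ m A U V S : ℝ} (hL : 0 ≤ L) (hκ : 0 ≤ κ) (hA : 1 / A ≤ m) (hU : 0 < U) (hV : 0 < V)
    (h : S ≤ 2 * V * L * (2 * M + 8 * U / A * κ)) : 1 / (U * V) * S ≤ 4 * L * M * (1 / U) + 16 * m * L * κ := by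
  calc 1 / (U * V) * S ≤ 1 / (U * V) * (2 * V * L * (2 * M + 8 * U / A * κ)) := mul_le_mul_of_nonneg_left h (by positivity)
    _ = 4 * L * M * (1 / U) + 16 * (L * κ) * (1 / A) := by
        have : 8 * U / A * κ = 8 * U * κ * (1 / A) := by ring
        rw [this]
        generalize 1 / A = A'
        field_simp; ring
    _ ≤ 4 * L * M * (1 / U) + 16 * (L * κ) * m := by
        have := mul_le_mul_of_nonneg_left hA (show 0 ≤ 16 * (L * κ) by positivity)
        linarith
    _ = _ := by ring

end MSQ

namespace MSQ

lemma kap_bound {a b N i j : ℕ} (ha : 1 ≤ a) {A B : ℝ} (hA : 1 / ((a:ℝ) + b) ≤ A) (hB : 0 ≤ B) (hAB : A + B = 1) {x y : ℕ × ℕ} (hx : x ∈ PC N i) (hy : y ∈ PC N j) :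
    |A * uu x + B * uu y| ≤ A * (1 / 2 ^ (i + 2)) * (4 * (a + b) * N ^ 3 : ℕ) := by
  obtain ⟨hx0, hx1, hx2⟩ := PC_mem hx
  obtain ⟨hy0, -, -⟩ := PC_mem hy
  obtain ⟨p1, p2, q1, q2, -⟩ := PN_mem hx0
  have ha' : (1:ℝ) ≤ a := by exact_mod_cast ha
  have hm : (0:ℝ) < (a:ℝ) + b := by positivity
  have hA0 : 0 < A := lt_of_lt_of_le (by positivity) hA
  have h1 := uu_abs hx0
  have h2 := uu_abs hy0
  have hN1 : (1:ℝ) ≤ N := by exact_mod_cast p1.trans p2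
  have hln : log (N:ℝ) ≤ N := (Real.log_le_sub_one_of_pos (by linarith)).trans (by linarith)
  have hw : (2:ℝ) ^ i ≤ N ^ 2 := by
    have : x.1 * x.2 ≤ N * N := Nat.mul_le_mul p2 q2
    have h3 : 2 ^ i ≤ N ^ 2 := by rw [sq]; exact hx1.trans this
    exact_mod_cast h3
  calc |A * uu x + B * uu y| ≤ A * |uu x| + B * |uu y| := by
        refine (abs_add_le _ _).trans (by rw [abs_mul, abs_mul, abs_of_pos hA0, abs_of_nonneg hB])
    _ ≤ A * log N + B * log N := add_le_add (mul_le_mul_of_nonneg_left h1 hA0.le) (mul_le_mul_of_nonneg_left h2 hB)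
    _ = log N := by rw [← add_mul, hAB, one_mul]
    _ ≤ N := hln
    _ ≤ 1 / ((a:ℝ) + b) * (1 / 2 ^ (i + 2)) * (4 * (a + b) * N ^ 3 : ℕ) := by
        push_cast
        have e : 1 / ((a:ℝ) + b) * (1 / 2 ^ (i + 2)) * (4 * (a + b) * N ^ 3) = N ^ 3 / 2 ^ i := by
          rw [pow_add]; field_simp; norm_num
        rw [e, le_div_iff₀ (by positivity)]
        calc (N:ℝ) * 2 ^ i ≤ N * N ^ 2 := mul_le_mul_of_nonneg_left hw (by linarith)
          _ = _ := by ring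
    _ ≤ _ := by
        apply mul_le_mul_of_nonneg_right _ (Nat.cast_nonneg _)
        exact mul_le_mul_of_nonneg_right hA (by positivity)

lemma E_block {a b N i j : ℕ} (ha : 1 ≤ a) (hab : a < b) {Q : ℝ} (hQ : 1 ≤ Q) (hN : 1 ≤ N) :
    ∑ x ∈ PC N i, ∑ y ∈ PC N j, 1 / (((x.1:ℝ) * x.2) * ((y.1:ℝ) * y.2)) * FF a b Q x y ≤
      16 * ((a:ℝ) + b) * (1 + log N) * Q ^ (1 - (a:ℝ) / (b * (a + b - 1))) * ((2:ℝ) ^ (-((1 - (a:ℝ) / b) / 2))) ^ i +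
      16 * ((a:ℝ) + b) * (1 + log N) * (1 + log (4 * (a + b) * N ^ 3 : ℕ)) := by
  have ha' : (1:ℝ) ≤ a := by exact_mod_cast ha
  have hb' : (a:ℝ) + 1 ≤ b := by exact_mod_cast hab
  have hN' : (1:ℝ) ≤ N := by exact_mod_cast hN
  have hQ0 : 0 < Q := by linarith
  have ha0 : (0:ℝ) < a := by linarith
  have hb0 : (0:ℝ) < b := by linarith
  set m := (a:ℝ) + b with hm
  have hm0 : 0 < m := by linarith
  have hL0 : 0 ≤ 1 + log (N:ℝ) := by linarith [Real.log_nonneg hN']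
  set K := 4 * (a + b) * N ^ 3 with hK
  have hκ : 0 ≤ 1 + log (K:ℝ) := by linarith [Real.log_natCast_nonneg K]
  set U : ℝ := 2 ^ i with hU
  set V : ℝ := 2 ^ j with hV
  have hU0 : 0 < U := by positivity
  have hV0 : 0 < V := by positivity
  set R := Q ^ (1 - (a:ℝ) / (b * (m - 1))) with hR
  have hR0 : 0 < R := by positivity
  set M := 4 * m * R * (U ^ ((a:ℝ) / (2 * b)) * V ^ ((1:ℝ) / 2)) with hM
  have hM0 : 0 ≤ M := by positivity
  have hFM : ∀ x ∈ PC N i, ∀ y ∈ PC N j, FF a b Q x y ≤ M := by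
    intro x hx y hy
    obtain ⟨hx0, hx1, hx2⟩ := PC_mem hx
    obtain ⟨hy0, hy1, hy2⟩ := PC_mem hy
    refine (FF_bound ha hab hx0 hy0 hQ).trans ?_
    have w1 : (x.1:ℝ) * x.2 ≤ 2 * U := by
      rw [hU]; calc (x.1:ℝ) * x.2 ≤ 2 ^ (i + 1) := by exact_mod_cast hx2.le
        _ = _ := by ring
    have w2 : (y.1:ℝ) * y.2 ≤ 2 * V := by
      rw [hV]; calc (y.1:ℝ) * y.2 ≤ 2 ^ (j + 1) := by exact_mod_cast hy2.le
        _ = _ := by ring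
    have hab2 : (a:ℝ) / (2 * b) ≤ 1 / 2 := by
      rw [div_le_div_iff₀ (by linarith) (by norm_num)]; linarith
    have p1 : ((x.1:ℝ) * x.2) ^ ((a:ℝ) / (2 * b)) ≤ 2 ^ ((1:ℝ) / 2) * U ^ ((a:ℝ) / (2 * b)) := by
      calc _ ≤ (2 * U) ^ ((a:ℝ) / (2 * b)) := rpow_le_rpow (by positivity) w1 (by positivity)
        _ = 2 ^ ((a:ℝ) / (2 * b)) * U ^ ((a:ℝ) / (2 * b)) := mul_rpow (by norm_num) hU0.le
        _ ≤ _ := mul_le_mul_of_nonneg_right (rpow_le_rpow_of_exponent_le (by norm_num) hab2) (by positivity)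
    have p2 : ((y.1:ℝ) * y.2) ^ ((1:ℝ) / 2) ≤ 2 ^ ((1:ℝ) / 2) * V ^ ((1:ℝ) / 2) := by
      calc _ ≤ (2 * V) ^ ((1:ℝ) / 2) := rpow_le_rpow (by positivity) w2 (by positivity)
        _ = _ := mul_rpow (by norm_num) hV0.le
    calc _ ≤ 2 * m * R * ((2 ^ ((1:ℝ) / 2) * U ^ ((a:ℝ) / (2 * b))) * (2 ^ ((1:ℝ) / 2) * V ^ ((1:ℝ) / 2))) := by
          apply mul_le_mul_of_nonneg_left _ (by positivity)
          exact mul_le_mul p1 p2 (by positivity) (by positivity)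
      _ = M := by
          have : (2:ℝ) ^ ((1:ℝ) / 2) * 2 ^ ((1:ℝ) / 2) = 2 := by rw [← rpow_add (by norm_num)]; norm_num
          rw [hM]
          linear_combination (2 * m * R * (U ^ ((a:ℝ) / (2 * b)) * V ^ ((1:ℝ) / 2))) * this
  have hABs : (a:ℝ) / m + (b:ℝ) / m = 1 := by rw [← add_div, ← hm, div_self hm0.ne']
  have hA1 : 1 / m ≤ (a:ℝ) / m := div_le_div_of_nonneg_right ha' hm0.le
  have hB1 : 1 / m ≤ (b:ℝ) / m := div_le_div_of_nonneg_right (by linarith) hm0.le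
  have iA : 1 / ((a:ℝ) / m) ≤ m := by rw [one_div_div]; exact div_le_self hm0.le ha'
  have iB : 1 / ((b:ℝ) / m) ≤ m := by rw [one_div_div]; exact div_le_self hm0.le (by linarith)
  have v1 := block (N := N) (i := i) (j := j) (A := (a:ℝ) / m) (B := (b:ℝ) / m) K (fun x y => FF a b Q x y) (by positivity) hM0
    (fun x hx y hy => kap_bound ha hA1 (by positivity) hABs hx hy) hFM (fun x hx y hy => FF_mul x y)
  have v2 := block (N := N) (i := j) (j := i) (A := (b:ℝ) / m) (B := (a:ℝ) / m) K (fun y x => FF a b Q x y) (by positivity) hM0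
    (fun x hx y hy => kap_bound ha hB1 (by positivity) (by rw [add_comm]; exact hABs) hx hy) (fun y hy x hx => hFM x hx y hy)
    (fun y hy x hx => by rw [add_comm]; exact FF_mul x y)
  rw [Finset.sum_comm] at v1
  set S := ∑ x ∈ PC N i, ∑ y ∈ PC N j, FF a b Q x y with hS
  have hLHS : ∑ x ∈ PC N i, ∑ y ∈ PC N j, 1 / (((x.1:ℝ) * x.2) * ((y.1:ℝ) * y.2)) * FF a b Q x y ≤ 1 / (U * V) * S := by
    rw [hS, Finset.mul_sum]
    refine Finset.sum_le_sum fun x hx => ?_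
    rw [Finset.mul_sum]
    refine Finset.sum_le_sum fun y hy => ?_
    obtain ⟨hx0, hx1, hx2⟩ := PC_mem hx
    obtain ⟨hy0, hy1, hy2⟩ := PC_mem hy
    have w1 : U ≤ (x.1:ℝ) * x.2 := by rw [hU]; exact_mod_cast hx1
    have w2 : V ≤ (y.1:ℝ) * y.2 := by rw [hV]; exact_mod_cast hy1
    apply mul_le_mul_of_nonneg_right _ (FF_nonneg hQ0.le x y)
    exact one_div_le_one_div_of_le (by positivity) (mul_le_mul w1 w2 hV0.le (by positivity))
  have e1 := blk_arith (U := U) (V := V) (S := S) (M := M) hL0 hκ iA hU0 hV0 (by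
    refine v1.trans (le_of_eq ?_)
    rw [hU, hV]; ring)
  have e2 := blk_arith (U := V) (V := U) (S := S) (M := M) hL0 hκ iB hV0 hU0 (by
    refine v2.trans (le_of_eq ?_)
    rw [hU, hV]; ring)
  rw [mul_comm V U] at e2
  have hgeo : min (1 / U) (1 / V) ≤ U ^ (-(1:ℝ) / 2) * V ^ (-(1:ℝ) / 2) := by
    refine (min_geo (d := 1 / 2) (by positivity) (by positivity) (by norm_num) (by norm_num)).trans (le_of_eq ?_)
    rw [show 1 / U = U ^ (-1:ℝ) from by rw [rpow_neg_one, one_div], show 1 / V = V ^ (-1:ℝ) from by rw [rpow_neg_one, one_div], ← rpow_mul hU0.le, ← rpow_mul hV0.le]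
    norm_num
  have hfin : 4 * (1 + log (N:ℝ)) * M * min (1 / U) (1 / V) ≤ 16 * m * (1 + log N) * R * ((2:ℝ) ^ (-((1 - (a:ℝ) / b) / 2))) ^ i := by
    calc _ ≤ 4 * (1 + log (N:ℝ)) * M * (U ^ (-(1:ℝ) / 2) * V ^ (-(1:ℝ) / 2)) := mul_le_mul_of_nonneg_left hgeo (by positivity)
      _ = 16 * m * (1 + log N) * R * ((U ^ ((a:ℝ) / (2 * b)) * U ^ (-(1:ℝ) / 2)) * (V ^ ((1:ℝ) / 2) * V ^ (-(1:ℝ) / 2))) := by rw [hM]; ring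
      _ = _ := by
        rw [← rpow_add hU0, ← rpow_add hV0]
        have : (1:ℝ) / 2 + -1 / 2 = 0 := by norm_num
        rw [this, rpow_zero, mul_one, hU, ← rpow_natCast, ← rpow_mul (by norm_num), ← rpow_natCast, ← rpow_mul (by norm_num)]
        congr 2; ring
  have : 1 / (U * V) * S ≤ 4 * (1 + log (N:ℝ)) * M * min (1 / U) (1 / V) + 16 * m * (1 + log N) * (1 + log K) := by
    rw [mul_min_of_nonneg _ _ (by positivity), ← min_add_add_right]
    exact le_min e1 e2
  exact hLHS.trans (this.trans (add_le_add hfin le_rfl))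

theorem offcop {a b : ℕ} (ha : 1 ≤ a) (hab : a < b) : ∃ C > 0, ∀ (Q : ℝ) (N : ℕ), 1 ≤ Q → 1 ≤ N →
    ∑ x ∈ PN N, ∑ y ∈ PN N, 1 / (((x.1:ℝ) * x.2) * ((y.1:ℝ) * y.2)) * FF a b Q x y ≤
      C * Q ^ (1 - (a:ℝ) / (b * (a + b - 1))) * (1 + log N) ^ 4 := by
  have ha' : (1:ℝ) ≤ a := by exact_mod_cast ha
  have hb' : (a:ℝ) + 1 ≤ b := by exact_mod_cast hab
  set ρ := (2:ℝ) ^ (-((1 - (a:ℝ) / b) / 2)) with hρ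
  have hρ0 : 0 < ρ := by positivity
  have hρ1 : ρ < 1 := by
    apply rpow_lt_one_of_one_lt_of_neg (by norm_num)
    have : (a:ℝ) / b < 1 := by rw [div_lt_one (by linarith)]; linarith
    linarith
  have hlog4 : 0 ≤ log (4 * ((a:ℝ) + b)) := Real.log_nonneg (by linarith)
  have h1ρ : 0 < 1 - ρ := by linarith
  refine ⟨64 * (a + b) * (1 / (1 - ρ)) + 256 * (a + b) * (4 + log (4 * ((a:ℝ) + b))), by positivity, ?_⟩
  intro Q N hQ hN
  have hN' : (1:ℝ) ≤ N := by exact_mod_cast hN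
  have hlN := Real.log_nonneg hN'
  set L := 1 + log (N:ℝ) with hL
  have hL1 : 1 ≤ L := by linarith
  set J := Nat.log 2 (N ^ 2) + 1 with hJ
  set R := Q ^ (1 - (a:ℝ) / (b * (a + b - 1))) with hR
  have hd1 : (a:ℝ) / (b * (a + b - 1)) ≤ 1 := by
    rw [div_le_one (mul_pos (by linarith) (by linarith))]
    calc (a:ℝ) ≤ b * 1 := by linarith
      _ ≤ b * (a + b - 1) := mul_le_mul_of_nonneg_left (by linarith) (by linarith)
  have hR1 : 1 ≤ R := Real.one_le_rpow hQ (by linarith)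
  have hJL : (J:ℝ) ≤ 4 * L := by
    have h1 : (Nat.log 2 (N ^ 2) : ℝ) ≤ Real.logb 2 ((N ^ 2 : ℕ):ℝ) := Real.natLog_le_logb (N ^ 2) 2
    have h2 : Real.logb 2 ((N ^ 2 : ℕ):ℝ) ≤ 4 * log N := by
      unfold Real.logb
      push_cast
      rw [Real.log_pow, div_le_iff₀ (Real.log_pos (by norm_num))]
      have : (0.6931471803 : ℝ) < log 2 := Real.log_two_gt_d9
      push_cast
      have h3 : 4 * log (N:ℝ) * (1 / 2) ≤ 4 * log N * log 2 := mul_le_mul_of_nonneg_left (by linarith) (by linarith)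
      linarith
    rw [hJ]; push_cast; linarith
  have hκ : 1 + log ((4 * (a + b) * N ^ 3 : ℕ):ℝ) ≤ (4 + log (4 * ((a:ℝ) + b))) * L := by
    push_cast
    rw [Real.log_mul (by positivity) (by positivity), Real.log_pow]
    have : log (4 * ((a:ℝ) + b)) ≤ log (4 * ((a:ℝ) + b)) * L := le_mul_of_one_le_right hlog4 hL1
    push_cast
    rw [add_mul]; linarith
  have hdec : ∀ f : ℕ × ℕ → ℝ, ∑ x ∈ PN N, f x = ∑ i ∈ Finset.range J, ∑ x ∈ PC N i, f x := by
    intro f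
    have hmt : ∀ x ∈ PN N, (fun x : ℕ × ℕ => Nat.log 2 (x.1 * x.2)) x ∈ Finset.range J := by
      intro x hx
      obtain ⟨-, p2, -, q2, -⟩ := PN_mem hx
      simp only [Finset.mem_range, hJ]
      have : Nat.log 2 (x.1 * x.2) ≤ Nat.log 2 (N ^ 2) := Nat.log_mono_right (by rw [sq]; exact Nat.mul_le_mul p2 q2)
      omega
    exact (Finset.sum_fiberwise_of_maps_to hmt f).symm
  have hdd : ∑ x ∈ PN N, ∑ y ∈ PN N, 1 / (((x.1:ℝ) * x.2) * ((y.1:ℝ) * y.2)) * FF a b Q x y =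
      ∑ i ∈ Finset.range J, ∑ j ∈ Finset.range J, ∑ x ∈ PC N i, ∑ y ∈ PC N j, 1 / (((x.1:ℝ) * x.2) * ((y.1:ℝ) * y.2)) * FF a b Q x y := by
    rw [hdec (fun x => ∑ y ∈ PN N, 1 / (((x.1:ℝ) * x.2) * ((y.1:ℝ) * y.2)) * FF a b Q x y)]
    have key : ∀ i ∈ Finset.range J, ∑ x ∈ PC N i, ∑ y ∈ PN N, 1 / (((x.1:ℝ) * x.2) * ((y.1:ℝ) * y.2)) * FF a b Q x y =
        ∑ j ∈ Finset.range J, ∑ x ∈ PC N i, ∑ y ∈ PC N j, 1 / (((x.1:ℝ) * x.2) * ((y.1:ℝ) * y.2)) * FF a b Q x y := by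
      intro i _
      rw [Finset.sum_comm (s := Finset.range J) (t := PC N i)]
      have key2 : ∀ x ∈ PC N i, ∑ y ∈ PN N, 1 / (((x.1:ℝ) * x.2) * ((y.1:ℝ) * y.2)) * FF a b Q x y =
          ∑ j ∈ Finset.range J, ∑ y ∈ PC N j, 1 / (((x.1:ℝ) * x.2) * ((y.1:ℝ) * y.2)) * FF a b Q x y :=
        fun x _ => hdec (fun y => 1 / (((x.1:ℝ) * x.2) * ((y.1:ℝ) * y.2)) * FF a b Q x y)
      exact Finset.sum_congr rfl key2
    exact Finset.sum_congr rfl key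
  rw [hdd]
  set c1 := 16 * ((a:ℝ) + b) * L with hc1
  have hc10 : 0 ≤ c1 := by positivity
  calc _ ≤ ∑ i ∈ Finset.range J, ∑ j ∈ Finset.range J, (c1 * R * ρ ^ i + c1 * ((4 + log (4 * ((a:ℝ) + b))) * L)) := by
        refine Finset.sum_le_sum fun i _ => Finset.sum_le_sum fun j _ => ?_
        exact (E_block ha hab hQ hN).trans (add_le_add le_rfl (mul_le_mul_of_nonneg_left hκ hc10))
    _ = J * (c1 * R * ∑ i ∈ Finset.range J, ρ ^ i) + J * (J * (c1 * ((4 + log (4 * ((a:ℝ) + b))) * L))) := by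
        simp only [Finset.sum_const, Finset.card_range, nsmul_eq_mul, Finset.mul_sum, Finset.sum_add_distrib, mul_add]
    _ ≤ (4 * L) * (c1 * R * (1 / (1 - ρ))) + (4 * L) * ((4 * L) * (c1 * ((4 + log (4 * ((a:ℝ) + b))) * L))) := by
        have hg : ∑ i ∈ Finset.range J, ρ ^ i ≤ 1 / (1 - ρ) := by
          rw [geom_sum_eq hρ1.ne, ← neg_div_neg_eq, neg_sub, neg_sub]
          exact div_le_div_of_nonneg_right (by linarith [pow_nonneg hρ0.le J]) h1ρ.le
        have hg0 : 0 ≤ ∑ i ∈ Finset.range J, ρ ^ i := Finset.sum_nonneg fun i _ => by positivity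
        apply add_le_add
        · apply mul_le_mul hJL _ (by positivity) (by positivity)
          exact mul_le_mul_of_nonneg_left hg (by positivity)
        · apply mul_le_mul hJL _ (by positivity) (by positivity)
          exact mul_le_mul_of_nonneg_right hJL (by positivity)
    _ = 64 * (a + b) * (1 / (1 - ρ)) * (R * L ^ 2) + 256 * (a + b) * (4 + log (4 * ((a:ℝ) + b))) * L ^ 4 := by rw [hc1]; ring
    _ ≤ 64 * (a + b) * (1 / (1 - ρ)) * (R * L ^ 4) + 256 * (a + b) * (4 + log (4 * ((a:ℝ) + b))) * (R * L ^ 4) := by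
        apply add_le_add
        · apply mul_le_mul_of_nonneg_left _ (by positivity)
          exact mul_le_mul_of_nonneg_left (pow_le_pow_right₀ hL1 (by norm_num)) (by linarith)
        · apply mul_le_mul_of_nonneg_left _ (by positivity)
          exact le_mul_of_one_le_left (by positivity) hR1
    _ = _ := by ring

end MSQ

namespace MSQ

lemma lam_ab {a b : ℕ} (ha : 1 ≤ a) (h ν : ℝ) :
    lam ((b:ℝ) / a) h ν = h ^ ((a:ℝ) / (a + b)) * ν ^ ((b:ℝ) / (a + b)) := by
  have ha0 : (0:ℝ) < a := by exact_mod_cast ha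
  have hb0 : (0:ℝ) ≤ b := by positivity
  unfold lam
  have e1 : 1 / (1 + (b:ℝ) / a) = (a:ℝ) / (a + b) := by field_simp
  have e2 : (b:ℝ) / a / (1 + (b:ℝ) / a) = (b:ℝ) / (a + b) := by field_simp
  rw [e1, e2]

lemma lam_pos' {a b : ℕ} (ha : 1 ≤ a) {h ν : ℝ} (hh : 0 < h) (hν : 0 < ν) : 0 < lam ((b:ℝ) / a) h ν := by
  rw [lam_ab ha]; positivity

lemma lam_pow {a b : ℕ} (ha : 1 ≤ a) {h ν : ℝ} (hh : 0 ≤ h) (hν : 0 ≤ ν) : (lam ((b:ℝ) / a) h ν) ^ (a + b) = h ^ a * ν ^ b := by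
  have ha0 : (0:ℝ) < a := by exact_mod_cast ha
  have hm : ((a:ℝ) + b) ≠ 0 := by positivity
  rw [lam_ab ha, mul_pow, ← rpow_natCast, ← rpow_natCast, ← rpow_mul hh, ← rpow_mul hν]
  push_cast
  rw [div_mul_cancel₀ _ hm, div_mul_cancel₀ _ hm, rpow_natCast, rpow_natCast]

lemma lam_eq_iff {a b : ℕ} (ha : 1 ≤ a) {h₁ h₂ ν₁ ν₂ : ℕ} :
    lam ((b:ℝ) / a) h₁ ν₁ = lam ((b:ℝ) / a) h₂ ν₂ ↔ h₁ ^ a * ν₁ ^ b = h₂ ^ a * ν₂ ^ b := by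
  have n1 : 0 ≤ lam ((b:ℝ) / a) h₁ ν₁ := by rw [lam_ab ha]; positivity
  have n2 : 0 ≤ lam ((b:ℝ) / a) h₂ ν₂ := by rw [lam_ab ha]; positivity
  have := pow_left_inj₀ n1 n2 (n := a + b) (by omega)
  rw [← this, lam_pow ha (by positivity) (by positivity), lam_pow ha (by positivity) (by positivity)]
  exact_mod_cast Iff.rfl

lemma cc_mul {θ x1 y1 x2 y2 : ℝ} (h : 0 ≤ lam θ x1 y1) :
    cc θ x1 y1 * cc θ x2 y2 = √(lam θ x1 y1 * lam θ x2 y2) / ((x1 * x2) * (y1 * y2)) := by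
  unfold cc
  rw [div_mul_div_comm, Real.sqrt_mul h]
  congr 1; ring

lemma off_term {a b : ℕ} (ha : 1 ≤ a) {Q : ℝ} (hQ : 1 ≤ Q) {g k p q r s : ℕ} (hg : 1 ≤ g) (hk : 1 ≤ k) (hp : 1 ≤ p)
    (hq : 1 ≤ q) (hr : 1 ≤ r) (hs : 1 ≤ s) :
    (if lam ((b:ℝ) / a) (g * p : ℕ) (k * r : ℕ) = lam ((b:ℝ) / a) (g * q : ℕ) (k * s : ℕ) then 0 else
      cc ((b:ℝ) / a) (g * p : ℕ) (k * r : ℕ) * cc ((b:ℝ) / a) (g * q : ℕ) (k * s : ℕ) *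
        min Q (1 / |lam ((b:ℝ) / a) (g * p : ℕ) (k * r : ℕ) - lam ((b:ℝ) / a) (g * q : ℕ) (k * s : ℕ)|)) ≤
      (g:ℝ) ^ ((a:ℝ) / (a + b) - 2) * ((k:ℝ) ^ ((b:ℝ) / (a + b) - 2) *
        (1 / (((p:ℝ) * q) * ((r:ℝ) * s)) * FF a b Q (p, q) (r, s))) := by
  have ha0 : (0:ℝ) < a := by exact_mod_cast ha
  have hg0 : (0:ℝ) < g := by exact_mod_cast hg
  have hk0 : (0:ℝ) < k := by exact_mod_cast hk
  have hp0 : (0:ℝ) < p := by exact_mod_cast hp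
  have hq0 : (0:ℝ) < q := by exact_mod_cast hq
  have hr0 : (0:ℝ) < r := by exact_mod_cast hr
  have hs0 : (0:ℝ) < s := by exact_mod_cast hs
  have hF := FF_nonneg (a := a) (b := b) (zero_le_one.trans hQ) (p, q) (r, s)
  split_ifs with he
  · positivity
  have hne : p ^ a * r ^ b ≠ q ^ a * s ^ b := by
    intro h; apply he; rw [lam_eq_iff ha]
    calc (g * p) ^ a * (k * r) ^ b = g ^ a * k ^ b * (p ^ a * r ^ b) := by ring
      _ = _ := by rw [h]; ring
  set A := (a:ℝ) / (a + b) with hA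
  set B := (b:ℝ) / (a + b) with hB
  have hl1 : lam ((b:ℝ) / a) (g * p : ℕ) (k * r : ℕ) = g ^ A * k ^ B * (p ^ A * r ^ B) := by
    rw [lam_ab ha]; push_cast; rw [mul_rpow hg0.le hp0.le, mul_rpow hk0.le hr0.le]; ring
  have hl2 : lam ((b:ℝ) / a) (g * q : ℕ) (k * s : ℕ) = g ^ A * k ^ B * (q ^ A * s ^ B) := by
    rw [lam_ab ha]; push_cast; rw [mul_rpow hg0.le hq0.le, mul_rpow hk0.le hs0.le]; ring
  set l1 := lam ((b:ℝ) / a) (g * p : ℕ) (k * r : ℕ) with hl1'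
  set l2 := lam ((b:ℝ) / a) (g * q : ℕ) (k * s : ℕ) with hl2'
  have hl10 : 0 < l1 := by rw [hl1]; positivity
  have hl20 : 0 < l2 := by rw [hl2]; positivity
  have hΛ : √(l1 * l2) = g ^ A * k ^ B * Lm a b (p, q) (r, s) := by
    rw [Real.sqrt_eq_iff_mul_self_eq (by positivity) (by unfold Lm; positivity)]
    have e : Lm a b (p, q) (r, s) * Lm a b (p, q) (r, s) = (p ^ A * r ^ B) * (q ^ A * s ^ B) := by
      unfold Lm
      simp only
      have e1 : ∀ x : ℝ, 0 < x → x ^ ((a:ℝ) / (2 * (a + b))) * x ^ ((a:ℝ) / (2 * (a + b))) = x ^ A := by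
        intro x hx; rw [← rpow_add hx, hA]; congr 1; field_simp; norm_num
      have e2 : ∀ x : ℝ, 0 < x → x ^ ((b:ℝ) / (2 * (a + b))) * x ^ ((b:ℝ) / (2 * (a + b))) = x ^ B := by
        intro x hx; rw [← rpow_add hx, hB]; congr 1; field_simp; norm_num
      rw [mul_mul_mul_comm, e1 _ (by positivity), e2 _ (by positivity), mul_rpow hp0.le hq0.le, mul_rpow hr0.le hs0.le]
      ring
    rw [hl1, hl2]
    linear_combination (-(g ^ A * k ^ B * (g ^ A * k ^ B))) * e
  have hℓ : |log l1 - log l2| = Ld a b (p, q) (r, s) := by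
    rw [hl1, hl2, Real.log_mul (by positivity) (by positivity), Real.log_mul (x := (g:ℝ) ^ A * k ^ B) (y := (q:ℝ) ^ A * s ^ B) (by positivity) (by positivity),
      Real.log_mul (x := (p:ℝ) ^ A) (by positivity) (by positivity), Real.log_mul (x := (q:ℝ) ^ A) (by positivity) (by positivity),
      log_rpow hp0, log_rpow hq0, log_rpow hr0, log_rpow hs0]
    unfold Ld uu
    congr 1
    simp only [hA, hB]; ring
  have hgeo := geo_log hl10 hl20
  rw [hℓ] at hgeo
  have hd : 0 < |l1 - l2| := abs_pos.mpr (sub_ne_zero.mpr he)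
  have hLd : 0 < Ld a b (p, q) (r, s) := by
    rw [← hℓ]; apply abs_pos.mpr; apply sub_ne_zero.mpr
    exact fun h => he (Real.log_injOn_pos hl10 hl20 h)
  have hLm : 0 ≤ Lm a b (p, q) (r, s) := by unfold Lm; positivity
  have hA0 : 0 ≤ A := by positivity
  have hB0 : 0 ≤ B := by positivity
  have hK1 : (1:ℝ) ≤ g ^ A * k ^ B := one_le_mul_of_one_le_of_one_le (one_le_rpow (by exact_mod_cast hg) hA0) (one_le_rpow (by exact_mod_cast hk) hB0)
  have hmin : √(l1 * l2) * min Q (1 / |l1 - l2|) ≤ g ^ A * k ^ B * FF a b Q (p, q) (r, s) := by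
    have hFF : FF a b Q (p, q) (r, s) = min (Q * Lm a b (p, q) (r, s)) (1 / Ld a b (p, q) (r, s)) := by
      unfold FF; rw [if_neg hne]
    rw [hFF, mul_min_of_nonneg _ _ (by positivity), mul_min_of_nonneg _ _ (by positivity)]
    apply min_le_min
    · rw [hΛ]; apply le_of_eq; ring
    · have : √(l1 * l2) * (1 / |l1 - l2|) ≤ 1 / Ld a b (p, q) (r, s) := by
        rw [mul_one_div, div_le_div_iff₀ hd hLd]; linarith
      exact this.trans (le_mul_of_one_le_left (by positivity) hK1)
  rw [cc_mul hl10.le, ← hl1', ← hl2']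
  clear_value l1 l2
  push_cast
  have eg : (g:ℝ) ^ (A - 2) = g ^ A / g ^ 2 := by rw [rpow_sub hg0]; norm_num
  have ek : (k:ℝ) ^ (B - 2) = k ^ B / k ^ 2 := by rw [rpow_sub hk0]; norm_num
  calc √(l1 * l2) / ((g:ℝ) * p * (g * q) * (k * r * (k * s))) * min Q (1 / |l1 - l2|)
      = (√(l1 * l2) * min Q (1 / |l1 - l2|)) * (1 / ((g:ℝ) * p * (g * q) * (k * r * (k * s)))) := by ring
    _ ≤ (g ^ A * k ^ B * FF a b Q (p, q) (r, s)) * (1 / ((g:ℝ) * p * (g * q) * (k * r * (k * s)))) :=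
        mul_le_mul_of_nonneg_right hmin (by positivity)
    _ = _ := by
        rw [eg, ek]; field_simp

lemma gcd_sum {N : ℕ} (f : ℕ × ℕ → ℝ) (w : ℕ → ℝ) (G : ℕ × ℕ → ℝ) (hw : ∀ g, 0 ≤ w g) (hG : ∀ x, 0 ≤ G x)
    (h : ∀ g p q, 1 ≤ g → 1 ≤ p → 1 ≤ q → f (g * p, g * q) ≤ w g * G (p, q)) :
    ∑ z ∈ Finset.Icc 1 N ×ˢ Finset.Icc 1 N, f z ≤ (∑ g ∈ Finset.Icc 1 N, w g) * ∑ x ∈ PN N, G x := by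
  classical
  let φ : ℕ × ℕ → ℕ × (ℕ × ℕ) := fun z => (Nat.gcd z.1 z.2, (z.1 / Nat.gcd z.1 z.2, z.2 / Nat.gcd z.1 z.2))
  have hinv : ∀ z : ℕ × ℕ, ((φ z).1 * (φ z).2.1, (φ z).1 * (φ z).2.2) = z := by
    intro z
    simp only [φ]
    rw [Nat.mul_div_cancel' (Nat.gcd_dvd_left _ _), Nat.mul_div_cancel' (Nat.gcd_dvd_right _ _)]
  have hinj : Set.InjOn φ (Finset.Icc 1 N ×ˢ Finset.Icc 1 N : Finset (ℕ × ℕ)) := by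
    intro z _ z' _ hzz
    rw [← hinv z, ← hinv z', hzz]
  have hpos : ∀ z ∈ Finset.Icc 1 N ×ˢ Finset.Icc 1 N, 1 ≤ (φ z).1 ∧ 1 ≤ (φ z).2.1 ∧ 1 ≤ (φ z).2.2 := by
    intro z hz
    simp only [Finset.mem_product, Finset.mem_Icc] at hz
    obtain ⟨⟨h1, h2⟩, h3, h4⟩ := hz
    have e := hinv z
    have e1 : (φ z).1 * (φ z).2.1 = z.1 := congrArg Prod.fst e
    have e2 : (φ z).1 * (φ z).2.2 = z.2 := congrArg Prod.snd e
    refine ⟨?_, ?_, ?_⟩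
    · by_contra hc; have : (φ z).1 = 0 := by omega
      rw [this] at e1; omega
    · by_contra hc; have : (φ z).2.1 = 0 := by omega
      rw [this] at e1; omega
    · by_contra hc; have : (φ z).2.2 = 0 := by omega
      rw [this] at e2; omega
  calc ∑ z ∈ Finset.Icc 1 N ×ˢ Finset.Icc 1 N, f z
      ≤ ∑ z ∈ Finset.Icc 1 N ×ˢ Finset.Icc 1 N, w (φ z).1 * G (φ z).2 := by
        refine Finset.sum_le_sum fun z hz => ?_
        obtain ⟨h1, h2, h3⟩ := hpos z hz
        have := h _ _ _ h1 h2 h3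
        rw [hinv z] at this
        exact this
    _ = ∑ y ∈ (Finset.Icc 1 N ×ˢ Finset.Icc 1 N).image φ, w y.1 * G y.2 := (Finset.sum_image (f := fun y => w y.1 * G y.2) hinj).symm
    _ ≤ ∑ y ∈ Finset.Icc 1 N ×ˢ PN N, w y.1 * G y.2 := by
        apply Finset.sum_le_sum_of_subset_of_nonneg
        · intro y hy
          obtain ⟨z, hz, rfl⟩ := Finset.mem_image.mp hy
          obtain ⟨h1, h2, h3⟩ := hpos z hz
          simp only [Finset.mem_product, Finset.mem_Icc] at hz
          obtain ⟨⟨k1, k2⟩, k3, k4⟩ := hz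
          simp only [Finset.mem_product, Finset.mem_Icc, PN, Finset.mem_filter]
          refine ⟨⟨h1, (Nat.gcd_le_left _ (by omega)).trans k2⟩, ⟨⟨h2, (Nat.div_le_self _ _).trans k2⟩, h3, (Nat.div_le_self _ _).trans k4⟩, ?_⟩
          exact Nat.coprime_div_gcd_div_gcd h1
        · intro y _ _; exact mul_nonneg (hw _) (hG _)
    _ = _ := by rw [Finset.sum_product, Finset.sum_mul_sum]

lemma rpow_sum_le {e : ℝ} (he : e < -1) (N : ℕ) : ∑ g ∈ Finset.Icc 1 N, (g:ℝ) ^ e ≤ ∑' g : ℕ, (g:ℝ) ^ e :=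
  (Real.summable_nat_rpow.mpr he).sum_le_tsum _ fun g _ => by positivity

theorem offdiag {a b : ℕ} (ha : 1 ≤ a) (hab : a < b) : ∃ C > 0, ∀ (Q : ℝ) (N : ℕ), 1 ≤ Q → 1 ≤ N →
    ∑ i ∈ Finset.Icc 1 N ×ˢ Finset.Icc 1 N, ∑ j ∈ Finset.Icc 1 N ×ˢ Finset.Icc 1 N,
      (if lam ((b:ℝ) / a) i.1 i.2 = lam ((b:ℝ) / a) j.1 j.2 then 0 else
        cc ((b:ℝ) / a) i.1 i.2 * cc ((b:ℝ) / a) j.1 j.2 *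
          min Q (1 / |lam ((b:ℝ) / a) i.1 i.2 - lam ((b:ℝ) / a) j.1 j.2|)) ≤
      C * Q ^ (1 - (a:ℝ) / (b * (a + b - 1))) * (1 + log N) ^ 4 := by
  obtain ⟨C, hC, hoff⟩ := offcop ha hab
  have ha' : (1:ℝ) ≤ a := by exact_mod_cast ha
  have hb' : (a:ℝ) + 1 ≤ b := by exact_mod_cast hab
  have hA : (a:ℝ) / (a + b) - 2 < -1 := by
    have : (a:ℝ) / (a + b) < 1 := by rw [div_lt_one (by linarith)]; linarith
    linarith
  have hB : (b:ℝ) / (a + b) - 2 < -1 := by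
    have : (b:ℝ) / (a + b) < 1 := by rw [div_lt_one (by linarith)]; linarith
    linarith
  set W1 := ∑' g : ℕ, (g:ℝ) ^ ((a:ℝ) / (a + b) - 2) with hW1
  set W2 := ∑' g : ℕ, (g:ℝ) ^ ((b:ℝ) / (a + b) - 2) with hW2
  have hW10 : 0 ≤ W1 := tsum_nonneg fun g => by positivity
  have hW20 : 0 ≤ W2 := tsum_nonneg fun g => by positivity
  refine ⟨(W1 + 1) * (W2 + 1) * C, by positivity, ?_⟩
  intro Q N hQ hN
  set tm : ℕ → ℕ → ℕ → ℕ → ℝ := fun h₁ h₂ ν₁ ν₂ => (if lam ((b:ℝ) / a) h₁ ν₁ = lam ((b:ℝ) / a) h₂ ν₂ then 0 else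
        cc ((b:ℝ) / a) h₁ ν₁ * cc ((b:ℝ) / a) h₂ ν₂ *
          min Q (1 / |lam ((b:ℝ) / a) h₁ ν₁ - lam ((b:ℝ) / a) h₂ ν₂|)) with htm
  set I := Finset.Icc 1 N with hI
  have hre : ∑ i ∈ I ×ˢ I, ∑ j ∈ I ×ˢ I, tm i.1 j.1 i.2 j.2 = ∑ x ∈ I ×ˢ I, ∑ y ∈ I ×ˢ I, tm x.1 x.2 y.1 y.2 := by
    simp only [Finset.sum_product]
    refine Finset.sum_congr rfl fun i _ => ?_
    rw [Finset.sum_comm]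
  have hF := fun x y => FF_nonneg (a := a) (b := b) (zero_le_one.trans hQ) x y
  set E := ∑ x ∈ PN N, ∑ y ∈ PN N, 1 / (((x.1:ℝ) * x.2) * ((y.1:ℝ) * y.2)) * FF a b Q x y with hE
  have hE0 : 0 ≤ E := Finset.sum_nonneg fun x _ => Finset.sum_nonneg fun y _ => mul_nonneg (by positivity) (hF _ _)
  set G : ℕ × ℕ → ℝ := fun x => (∑ k ∈ I, (k:ℝ) ^ ((b:ℝ) / (a + b) - 2)) * ∑ y ∈ PN N, 1 / (((x.1:ℝ) * x.2) * ((y.1:ℝ) * y.2)) * FF a b Q x y with hG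
  have hG0 : ∀ x, 0 ≤ G x := fun x => mul_nonneg (Finset.sum_nonneg fun g _ => by positivity)
    (Finset.sum_nonneg fun y _ => mul_nonneg (by positivity) (hF _ _))
  have hout := gcd_sum (N := N) (fun x => ∑ y ∈ I ×ˢ I, tm x.1 x.2 y.1 y.2) (fun g => (g:ℝ) ^ ((a:ℝ) / (a + b) - 2)) G
    (fun g => by positivity) hG0 (by
      intro g p q hg hp hq
      have hg0 : (0:ℝ) < g := by exact_mod_cast hg
      have hin := gcd_sum (N := N) (fun y => ((g:ℝ) ^ ((a:ℝ) / (a + b) - 2))⁻¹ * tm (g * p) (g * q) y.1 y.2) (fun k => (k:ℝ) ^ ((b:ℝ) / (a + b) - 2))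
        (fun y => 1 / (((p:ℝ) * q) * ((y.1:ℝ) * y.2)) * FF a b Q (p, q) y) (fun g => by positivity)
        (fun y => mul_nonneg (by positivity) (hF _ _)) (by
          intro k r s hk hr hs
          rw [inv_mul_le_iff₀ (by positivity)]
          exact off_term ha hQ hg hk hp hq hr hs)
      rw [← Finset.mul_sum, inv_mul_le_iff₀ (by positivity)] at hin
      exact hin)
  have hgoal : ∑ i ∈ I ×ˢ I, ∑ j ∈ I ×ˢ I, tm i.1 j.1 i.2 j.2 ≤ (W1 + 1) * (W2 + 1) * C * Q ^ (1 - (a:ℝ) / (b * (a + b - 1))) * (1 + log N) ^ 4 := by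
    rw [hre]
    refine hout.trans ?_
    have h1 : ∑ g ∈ I, (g:ℝ) ^ ((a:ℝ) / (a + b) - 2) ≤ W1 + 1 := (rpow_sum_le hA N).trans (by linarith)
    have h2 : ∑ g ∈ I, (g:ℝ) ^ ((b:ℝ) / (a + b) - 2) ≤ W2 + 1 := (rpow_sum_le hB N).trans (by linarith)
    have h3 : ∑ x ∈ PN N, G x = (∑ k ∈ I, (k:ℝ) ^ ((b:ℝ) / (a + b) - 2)) * E := by
      simp only [hG]; rw [← Finset.mul_sum]
    rw [h3]
    calc _ ≤ (W1 + 1) * ((W2 + 1) * E) := by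
          apply mul_le_mul h1 (mul_le_mul_of_nonneg_right h2 hE0) (mul_nonneg (Finset.sum_nonneg fun g _ => by positivity) hE0) (by positivity)
      _ ≤ (W1 + 1) * ((W2 + 1) * (C * Q ^ (1 - (a:ℝ) / (b * (a + b - 1))) * (1 + log N) ^ 4)) := by
          apply mul_le_mul_of_nonneg_left _ (by positivity)
          exact mul_le_mul_of_nonneg_left (hoff Q N hQ hN) (by positivity)
      _ = _ := by ring
  exact hgoal

lemma sumdiag {a b : ℕ} (ha : 1 ≤ a) (N : ℕ) :
    ∑ i ∈ Finset.Icc 1 N ×ˢ Finset.Icc 1 N, ∑ j ∈ Finset.Icc 1 N ×ˢ Finset.Icc 1 N,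
      cc ((b:ℝ) / a) i.1 i.2 * cc ((b:ℝ) / a) j.1 j.2 * (1 / (lam ((b:ℝ) / a) i.1 i.2 + lam ((b:ℝ) / a) j.1 j.2)) ≤ (1 + log N) ^ 4 := by
  set I := Finset.Icc 1 N with hI
  have hterm : ∀ i ∈ I ×ˢ I, ∀ j ∈ I ×ˢ I, cc ((b:ℝ) / a) i.1 i.2 * cc ((b:ℝ) / a) j.1 j.2 * (1 / (lam ((b:ℝ) / a) i.1 i.2 + lam ((b:ℝ) / a) j.1 j.2))
      ≤ (1 / (i.1:ℝ) * (1 / (i.2:ℝ))) * (1 / (j.1:ℝ) * (1 / (j.2:ℝ))) := by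
    intro i hi j hj
    simp only [hI, Finset.mem_product, Finset.mem_Icc] at hi hj
    have i1 : (0:ℝ) < i.1 := by exact_mod_cast hi.1.1
    have i2 : (0:ℝ) < i.2 := by exact_mod_cast hi.2.1
    have j1 : (0:ℝ) < j.1 := by exact_mod_cast hj.1.1
    have j2 : (0:ℝ) < j.2 := by exact_mod_cast hj.2.1
    have l1 := lam_pos' (b := b) ha i1 i2
    have l2 := lam_pos' (b := b) ha j1 j2
    rw [cc_mul l1.le]
    have : √(lam ((b:ℝ) / a) i.1 i.2 * lam ((b:ℝ) / a) j.1 j.2) * (1 / (lam ((b:ℝ) / a) i.1 i.2 + lam ((b:ℝ) / a) j.1 j.2)) ≤ 1 := by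
      rw [mul_one_div, div_le_one (by positivity)]
      apply Real.sqrt_le_iff.mpr ⟨by positivity, ?_⟩
      nlinarith
    calc _ = (√(lam ((b:ℝ) / a) i.1 i.2 * lam ((b:ℝ) / a) j.1 j.2) * (1 / (lam ((b:ℝ) / a) i.1 i.2 + lam ((b:ℝ) / a) j.1 j.2))) *
          ((1 / (i.1:ℝ) * (1 / (i.2:ℝ))) * (1 / (j.1:ℝ) * (1 / (j.2:ℝ)))) := by field_simp
      _ ≤ _ := mul_le_of_le_one_left (by positivity) this
  have hh : ∑ h ∈ I, 1 / (h:ℝ) ≤ 1 + log N := by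
    rw [hI, sum_Icc1 (fun h => 1 / (h:ℝ)) N]
    exact_mod_cast harm N
  have hh0 : 0 ≤ ∑ h ∈ I, 1 / (h:ℝ) := Finset.sum_nonneg fun g _ => by positivity
  calc _ ≤ ∑ i ∈ I ×ˢ I, ∑ j ∈ I ×ˢ I, (1 / (i.1:ℝ) * (1 / (i.2:ℝ))) * (1 / (j.1:ℝ) * (1 / (j.2:ℝ))) :=
        Finset.sum_le_sum fun i hi => Finset.sum_le_sum fun j hj => hterm i hi j hj
    _ = (∑ h ∈ I, 1 / (h:ℝ)) ^ 4 := by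
        rw [← Finset.sum_mul_sum]
        have : ∑ i ∈ I ×ˢ I, (1 / (i.1:ℝ) * (1 / (i.2:ℝ))) = (∑ h ∈ I, 1 / (h:ℝ)) * ∑ h ∈ I, 1 / (h:ℝ) := by
          rw [Finset.sum_product, Finset.sum_mul_sum]
        rw [this]; ring
    _ ≤ _ := pow_le_pow_left₀ hh0 hh 4

end MSQ

namespace MSQ

lemma pow_eq_pow_cop {a b p w : ℕ} (ha : 1 ≤ a) (hb : 1 < b) (hcop : Nat.gcd a b = 1) (hp : 1 ≤ p) (h : p ^ a = w ^ b) :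
    ∃ s, p = s ^ b ∧ w = s ^ a := by
  obtain ⟨x, -, hx⟩ := Nat.exists_mul_mod_eq_one_of_coprime (show Nat.Coprime a b from hcop) hb
  have hxy : a * x = b * (a * x / b) + 1 := by
    have := Nat.div_add_mod (a * x) b
    rw [hx] at this; exact this.symm
  set y := a * x / b with hy
  have h1 : p * (p ^ y) ^ b = (w ^ x) ^ b := by
    calc p * (p ^ y) ^ b = p ^ (b * y + 1) := by rw [← pow_mul, pow_succ, mul_comm y b]; ring
      _ = (p ^ a) ^ x := by rw [← hxy, pow_mul]
      _ = (w ^ x) ^ b := by rw [h, ← pow_mul, ← pow_mul, mul_comm]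
  have hdv : p ^ y ∣ w ^ x := by
    rw [← Nat.pow_dvd_pow_iff (show b ≠ 0 by omega), ← h1]
    exact Dvd.intro_left _ rfl
  obtain ⟨s, hs⟩ := hdv
  have hps : p = s ^ b := by
    rw [hs, mul_pow, mul_comm] at h1
    exact Nat.eq_of_mul_eq_mul_left (by positivity) h1
  refine ⟨s, hps, ?_⟩
  rw [hps, ← pow_mul, mul_comm, pow_mul] at h
  exact (Nat.pow_left_injective (show b ≠ 0 by omega) h).symm

lemma diag_param {a b h₁ h₂ ν₁ ν₂ : ℕ} (ha : 1 ≤ a) (hb : 1 < b) (hcop : Nat.gcd a b = 1) (p1 : 1 ≤ h₁) (p2 : 1 ≤ h₂) (p3 : 1 ≤ ν₁)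
    (_p4 : 1 ≤ ν₂) (h : h₁ ^ a * ν₁ ^ b = h₂ ^ a * ν₂ ^ b) :
    ∃ y : (ℕ × ℕ) × (ℕ × ℕ), h₁ = y.1.1 * y.2.1 ^ b ∧ h₂ = y.1.1 * y.2.2 ^ b ∧ ν₁ = y.1.2 * y.2.2 ^ a ∧ ν₂ = y.1.2 * y.2.1 ^ a := by
  obtain ⟨g, p, q, hg, hpq, e1, e2⟩ := Nat.exists_coprime' (m := h₁) (n := h₂) (Nat.gcd_pos_of_pos_left _ p1)
  obtain ⟨k, r, w, hk, hrw, e3, e4⟩ := Nat.exists_coprime' (m := ν₁) (n := ν₂) (Nat.gcd_pos_of_pos_left _ p3)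
  have hp : 1 ≤ p := by
    by_contra hc; have : p = 0 := by omega
    rw [this] at e1; omega
  have hq : 1 ≤ q := by
    by_contra hc; have : q = 0 := by omega
    rw [this] at e2; omega
  have h' : p ^ a * r ^ b = q ^ a * w ^ b := by
    have : (g ^ a * k ^ b) * (p ^ a * r ^ b) = (g ^ a * k ^ b) * (q ^ a * w ^ b) := by
      rw [e1, e2, e3, e4] at h
      calc _ = (p * g) ^ a * (r * k) ^ b := by ring
        _ = _ := h
        _ = _ := by ring
    exact Nat.eq_of_mul_eq_mul_left (by positivity) this
  have c1 : Nat.Coprime (p ^ a) (q ^ a) := Nat.Coprime.pow _ _ hpq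
  have c2 : Nat.Coprime (r ^ b) (w ^ b) := Nat.Coprime.pow _ _ hrw
  have t1 : p ^ a = w ^ b := Nat.dvd_antisymm (c1.dvd_of_dvd_mul_left (h' ▸ Dvd.intro _ rfl))
    (c2.symm.dvd_of_dvd_mul_right (h'.symm ▸ Dvd.intro_left _ rfl))
  have t2 : q ^ a = r ^ b := Nat.dvd_antisymm (c1.symm.dvd_of_dvd_mul_left (h'.symm ▸ Dvd.intro _ rfl))
    (c2.dvd_of_dvd_mul_right (h' ▸ Dvd.intro_left _ rfl))
  obtain ⟨s, rfl, rfl⟩ := pow_eq_pow_cop ha hb hcop hp t1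
  obtain ⟨u, rfl, rfl⟩ := pow_eq_pow_cop ha hb hcop hq t2
  refine ⟨((g, k), (s, u)), ?_, ?_, ?_, ?_⟩
  · simp only; rw [e1, mul_comm]
  · simp only; rw [e2, mul_comm]
  · simp only; rw [e3, mul_comm]
  · simp only; rw [e4, mul_comm]

def DD (a b : ℕ) : Set ((ℕ × ℕ) × (ℕ × ℕ)) := {z | (1 ≤ z.1.1 ∧ 1 ≤ z.1.2 ∧ 1 ≤ z.2.1 ∧ 1 ≤ z.2.2) ∧ z.1.1 ^ a * z.1.2 ^ b = z.2.1 ^ a * z.2.2 ^ b}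

noncomputable def fd (p q : ℝ) (z : (ℕ × ℕ) × (ℕ × ℕ)) : ℝ := ((z.1.1:ℝ) * z.2.1) ^ (-p) * ((z.1.2:ℝ) * z.2.2) ^ (-q)

lemma fd_nonneg (p q : ℝ) (z : (ℕ × ℕ) × (ℕ × ℕ)) : 0 ≤ fd p q z := by unfold fd; positivity

lemma fd_summable {a b : ℕ} (ha : 1 ≤ a) (hb : 1 < b) (hcop : Nat.gcd a b = 1) {p q : ℝ} (hp : 1 < 2 * p) (hq : 1 < 2 * q) (hk : 1 < b * p + a * q) :
    Summable ((DD a b).indicator (fd p q)) := by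
  rw [← summable_subtype_iff_indicator]
  have hex : ∀ z : DD a b, ∃ y : (ℕ × ℕ) × (ℕ × ℕ), z.1.1.1 = y.1.1 * y.2.1 ^ b ∧ z.1.2.1 = y.1.1 * y.2.2 ^ b ∧ z.1.1.2 = y.1.2 * y.2.2 ^ a ∧ z.1.2.2 = y.1.2 * y.2.1 ^ a := by
    rintro ⟨z, ⟨h1, h2, h3, h4⟩, h5⟩
    exact diag_param ha hb hcop h1 h3 h2 h4 h5
  choose ψ hψ using hex
  have hinj : Function.Injective ψ := by
    intro z z' h
    obtain ⟨e1, e2, e3, e4⟩ := hψ z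
    obtain ⟨f1, f2, f3, f4⟩ := hψ z'
    rw [h] at e1 e2 e3 e4
    apply Subtype.ext
    exact Prod.ext (Prod.ext (e1.trans f1.symm) (e3.trans f3.symm)) (Prod.ext (e2.trans f2.symm) (e4.trans f4.symm))
  set κ := b * p + a * q with hκ
  have s1 : Summable fun n : ℕ => (n:ℝ) ^ (-(2 * p)) := Real.summable_nat_rpow.mpr (by linarith)
  have s2 : Summable fun n : ℕ => (n:ℝ) ^ (-(2 * q)) := Real.summable_nat_rpow.mpr (by linarith)
  have s3 : Summable fun n : ℕ => (n:ℝ) ^ (-κ) := Real.summable_nat_rpow.mpr (by linarith)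
  have s12 := s1.mul_of_nonneg s2 (fun n => by positivity) (fun n => by positivity)
  have s33 := s3.mul_of_nonneg s3 (fun n => by positivity) (fun n => by positivity)
  have s := s12.mul_of_nonneg s33 (fun n => by positivity) (fun n => by positivity)
  have := s.comp_injective hinj
  refine this.congr fun z => ?_
  obtain ⟨e1, e2, e3, e4⟩ := hψ z
  simp only [Function.comp, fd]
  rw [e1, e2, e3, e4]
  push_cast
  set y := ψ z
  have key : ∀ g k s u : ℝ, 0 ≤ g → 0 ≤ k → 0 ≤ s → 0 ≤ u → g ^ (-(2 * p)) * k ^ (-(2 * q)) * (s ^ (-κ) * u ^ (-κ)) =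
      (g * s ^ b * (g * u ^ b)) ^ (-p) * (k * u ^ a * (k * s ^ a)) ^ (-q) := by
    intro g k s u hg hk' hs hu
    have w1 : g * s ^ b * (g * u ^ b) = g ^ 2 * (s * u) ^ b := by ring
    have w2 : k * u ^ a * (k * s ^ a) = k ^ 2 * (s * u) ^ a := by ring
    have hsu : 0 ≤ s * u := by positivity
    rw [w1, w2, mul_rpow (by positivity) (by positivity), mul_rpow (by positivity) (by positivity), ← mul_rpow hs hu]
    rw [← rpow_natCast, ← rpow_natCast, ← rpow_natCast, ← rpow_natCast, ← rpow_mul hg, ← rpow_mul hk', ← rpow_mul hsu, ← rpow_mul hsu]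
    have : (s * u) ^ (-κ) = (s * u) ^ ((b:ℝ) * -p) * (s * u) ^ ((a:ℝ) * -q) := by
      rw [← rpow_add' hsu (by intro h; linarith)]
      congr 1; rw [hκ]; ring
    rw [this]; push_cast; rw [mul_neg, mul_neg]; ring
  exact key y.1.1 y.1.2 y.2.1 y.2.2 (by positivity) (by positivity) (by positivity) (by positivity)

lemma Gab_eq (a b : ℕ) : Gab a b = ∑' z, (DD a b).indicator (fd (((a:ℝ) + 2 * b) / (2 * (a + b))) ((2 * (a:ℝ) + b) / (2 * (a + b)))) z := by
  let φ : ℕ+ × ℕ+ × ℕ+ × ℕ+ → (ℕ × ℕ) × (ℕ × ℕ) := fun q => ((q.1, q.2.2.1), (q.2.1, q.2.2.2))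
  have hφ : Function.Injective φ := by
    rintro ⟨q1, q2, q3, q4⟩ ⟨r1, r2, r3, r4⟩ h
    simp only [φ, Prod.mk.injEq, PNat.coe_inj] at h
    obtain ⟨⟨h1, h2⟩, h3, h4⟩ := h
    rw [h1, h2, h3, h4]
  rw [← hφ.tsum_eq]
  · unfold Gab
    refine tsum_congr fun q => ?_
    have hmem : φ q ∈ DD a b ↔ ((q.1:ℕ):ℝ) ^ (a:ℝ) * ((q.2.2.1:ℕ):ℝ) ^ (b:ℝ) = ((q.2.1:ℕ):ℝ) ^ (a:ℝ) * ((q.2.2.2:ℕ):ℝ) ^ (b:ℝ) := by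
      simp only [rpow_natCast, DD, φ, Set.mem_ofPred_eq]
      constructor
      · rintro ⟨-, h⟩; exact_mod_cast h
      · intro h; exact ⟨⟨q.1.2, q.2.2.1.2, q.2.1.2, q.2.2.2.2⟩, by exact_mod_cast h⟩
    by_cases h : φ q ∈ DD a b
    · rw [if_pos (hmem.mp h), Set.indicator_of_mem h]
      simp only [fd, φ]
      rw [neg_div, neg_div]
    · rw [if_neg (fun h' => h (hmem.mpr h')), Set.indicator_of_notMem h]
  · intro z hz
    have : z ∈ DD a b := Set.mem_of_indicator_ne_zero hz
    obtain ⟨⟨h1, h2, h3, h4⟩, -⟩ := this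
    exact ⟨(⟨z.1.1, h1⟩, ⟨z.2.1, h3⟩, ⟨z.1.2, h2⟩, ⟨z.2.2, h4⟩), rfl⟩

lemma cc_fd {a b : ℕ} (ha : 1 ≤ a) {z : (ℕ × ℕ) × (ℕ × ℕ)} (h1 : 1 ≤ z.1.1) (h2 : 1 ≤ z.1.2) (h3 : 1 ≤ z.2.1) (h4 : 1 ≤ z.2.2) :
    cc ((b:ℝ) / a) z.1.1 z.1.2 * cc ((b:ℝ) / a) z.2.1 z.2.2 = fd (((a:ℝ) + 2 * b) / (2 * (a + b))) ((2 * (a:ℝ) + b) / (2 * (a + b))) z := by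
  have p1 : (0:ℝ) < z.1.1 := by exact_mod_cast h1
  have p2 : (0:ℝ) < z.1.2 := by exact_mod_cast h2
  have p3 : (0:ℝ) < z.2.1 := by exact_mod_cast h3
  have p4 : (0:ℝ) < z.2.2 := by exact_mod_cast h4
  have ha0 : (0:ℝ) < a := by exact_mod_cast ha
  rw [cc_mul (lam_pos' ha p1 p2).le, lam_ab ha, lam_ab ha]
  unfold fd
  generalize (z.1.1:ℝ) = x at *
  generalize (z.1.2:ℝ) = y at *
  generalize (z.2.1:ℝ) = x' at *
  generalize (z.2.2:ℝ) = y' at *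
  have e : x ^ ((a:ℝ) / (a + b)) * y ^ ((b:ℝ) / (a + b)) * (x' ^ ((a:ℝ) / (a + b)) * y' ^ ((b:ℝ) / (a + b))) =
      (x * x') ^ ((a:ℝ) / (a + b)) * (y * y') ^ ((b:ℝ) / (a + b)) := by
    rw [mul_rpow p1.le p3.le, mul_rpow p2.le p4.le]; ring
  rw [e, Real.sqrt_eq_rpow, mul_rpow (by positivity) (by positivity), ← rpow_mul (by positivity), ← rpow_mul (by positivity), mul_div_mul_comm]
  have d1 : -(((a:ℝ) + 2 * b) / (2 * (a + b))) = (a:ℝ) / (a + b) * (1 / 2) - 1 := by field_simp; ring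
  have d2 : -((2 * (a:ℝ) + b) / (2 * (a + b))) = (b:ℝ) / (a + b) * (1 / 2) - 1 := by field_simp; ring
  rw [d1, d2, rpow_sub_one (by positivity), rpow_sub_one (by positivity)]

end MSQ

namespace MSQ

lemma rpow_shift {X Y p ε : ℝ} (hY : 0 < Y) (hXY : Y ≤ X) (hε : 0 ≤ ε) : X ^ (-p) ≤ Y ^ (-ε) * X ^ (-(p - ε)) := by
  have hX : 0 < X := lt_of_lt_of_le hY hXY
  have e : X ^ (-p) = X ^ (-ε) * X ^ (-(p - ε)) := by rw [← rpow_add hX]; congr 1; ring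
  rw [e]
  exact mul_le_mul_of_nonneg_right (rpow_le_rpow_of_nonpos hY hXY (by linarith)) (by positivity)

lemma fd_shift {p q ε₁ ε₂ K : ℝ} (h1 : 0 ≤ ε₁) (h2 : 0 ≤ ε₂) {z : (ℕ × ℕ) × (ℕ × ℕ)} {Y1 Y2 : ℝ} (hY1 : 0 < Y1) (hY2 : 0 < Y2)
    (g1 : Y1 ≤ (z.1.1:ℝ) * z.2.1) (g2 : Y2 ≤ (z.1.2:ℝ) * z.2.2) (hK : Y1 ^ (-ε₁) * Y2 ^ (-ε₂) ≤ K) :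
    fd p q z ≤ K * fd (p - ε₁) (q - ε₂) z := by
  unfold fd
  calc _ ≤ (Y1 ^ (-ε₁) * ((z.1.1:ℝ) * z.2.1) ^ (-(p - ε₁))) * (Y2 ^ (-ε₂) * ((z.1.2:ℝ) * z.2.2) ^ (-(q - ε₂))) :=
        mul_le_mul (rpow_shift hY1 g1 h1) (rpow_shift hY2 g2 h2) (by positivity) (by positivity)
    _ = (Y1 ^ (-ε₁) * Y2 ^ (-ε₂)) * (((z.1.1:ℝ) * z.2.1) ^ (-(p - ε₁)) * ((z.1.2:ℝ) * z.2.2) ^ (-(q - ε₂))) := by ring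
    _ ≤ _ := mul_le_mul_of_nonneg_right hK (by positivity)

/-- tail bound for points outside the good range -/
lemma fd_tail {p q ε₁ ε₂ θ δ Q : ℝ} (h1 : 0 < ε₁) (h2 : 0 < ε₂) (hθ : 1 < θ) (hQ : 1 ≤ Q)
    (hd1 : ε₁ * (1 + 1 / θ) = δ) (hd2 : ε₂ * (1 + θ) = δ)
    {z : (ℕ × ℕ) × (ℕ × ℕ)} (k1 : 1 ≤ z.1.1) (k2 : 1 ≤ z.1.2) (k3 : 1 ≤ z.2.1) (k4 : 1 ≤ z.2.2)
    (hbad : ¬ (((z.1.1:ℝ) ≤ Q ^ (1 + 1 / θ) / θ ∧ (z.1.2:ℝ) ≤ Q ^ (1 + θ)) ∧ ((z.2.1:ℝ) ≤ Q ^ (1 + 1 / θ) / θ ∧ (z.2.2:ℝ) ≤ Q ^ (1 + θ)))) :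
    fd p q z ≤ θ ^ ε₁ * Q ^ (-δ) * fd (p - ε₁) (q - ε₂) z := by
  have p1 : (1:ℝ) ≤ z.1.1 := by exact_mod_cast k1
  have p2 : (1:ℝ) ≤ z.1.2 := by exact_mod_cast k2
  have p3 : (1:ℝ) ≤ z.2.1 := by exact_mod_cast k3
  have p4 : (1:ℝ) ≤ z.2.2 := by exact_mod_cast k4
  have hQ0 : 0 < Q := by linarith
  have hθ0 : 0 < θ := by linarith
  have hθ1 : 1 ≤ θ ^ ε₁ := one_le_rpow hθ.le h1.le
  have x1 : (Q ^ (1 + 1 / θ) / θ) ^ (-ε₁) * 1 ^ (-ε₂) ≤ θ ^ ε₁ * Q ^ (-δ) := by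
    rw [one_rpow, mul_one, div_rpow (by positivity) hθ0.le, ← rpow_mul hQ0.le, rpow_neg hθ0.le, div_inv_eq_mul, mul_comm]
    apply le_of_eq; congr 2; rw [← hd1]; ring
  have x2 : 1 ^ (-ε₁) * (Q ^ (1 + θ)) ^ (-ε₂) ≤ θ ^ ε₁ * Q ^ (-δ) := by
    rw [one_rpow, one_mul, ← rpow_mul hQ0.le]
    have : (1 + θ) * -ε₂ = -δ := by rw [← hd2]; ring
    rw [this]
    exact le_mul_of_one_le_left (by positivity) hθ1
  have m1 : (1:ℝ) ≤ (z.1.1:ℝ) * z.2.1 := one_le_mul_of_one_le_of_one_le p1 p3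
  have m2 : (1:ℝ) ≤ (z.1.2:ℝ) * z.2.2 := one_le_mul_of_one_le_of_one_le p2 p4
  have hY : 0 < Q ^ (1 + 1 / θ) / θ := by positivity
  have hZ : 0 < Q ^ (1 + θ) := by positivity
  by_cases c1 : (z.1.1:ℝ) ≤ Q ^ (1 + 1 / θ) / θ
  · by_cases c2 : (z.1.2:ℝ) ≤ Q ^ (1 + θ)
    · by_cases c3 : (z.2.1:ℝ) ≤ Q ^ (1 + 1 / θ) / θ
      · have c4 : ¬ (z.2.2:ℝ) ≤ Q ^ (1 + θ) := fun h => hbad ⟨⟨c1, c2⟩, c3, h⟩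
        push Not at c4
        exact fd_shift h1.le h2.le one_pos hZ m1 (c4.le.trans (le_mul_of_one_le_left (by linarith) p2)) x2
      · push Not at c3
        exact fd_shift h1.le h2.le hY one_pos (c3.le.trans (le_mul_of_one_le_left (by linarith) p1)) m2 x1
    · push Not at c2
      exact fd_shift h1.le h2.le one_pos hZ m1 (c2.le.trans (le_mul_of_one_le_right (by linarith) p4)) x2
  · push Not at c1
    exact fd_shift h1.le h2.le hY one_pos (c1.le.trans (le_mul_of_one_le_right (by linarith) p3)) m2 x1

lemma box_tsum {α : Type*} (D : Set α) (f f' : α → ℝ) (X : Finset α) (J : α → ℝ) {J0 K : ℝ} (hf : ∀ z, 0 ≤ f z) (hf' : ∀ z, 0 ≤ f' z)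
    (hs : Summable (D.indicator f)) (hs' : Summable (D.indicator f')) (hJ0 : 0 ≤ J0) (hK : 0 ≤ K)
    (hJn : ∀ z ∈ X, 0 ≤ J z) (hJ : ∀ z ∈ X, J z ≤ J0)
    (hgood : ∀ z ∈ D, (z ∈ X ∧ J z = J0) ∨ f z ≤ K * f' z) :
    |∑ z ∈ X, D.indicator f z * J z - (∑' z, D.indicator f z) * J0| ≤ K * (∑' z, D.indicator f' z) * J0 := by
  classical
  set g : α → ℝ := fun z => if z ∈ X then D.indicator f z * J z else 0 with hg
  have hgs : Summable g := summable_of_ne_finset_zero (s := X) (fun z hz => by simp [hg, hz])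
  have e1 : ∑ z ∈ X, D.indicator f z * J z = ∑' z, g z := by
    rw [tsum_eq_sum (s := X) (fun z hz => by simp [hg, hz])]
    exact Finset.sum_congr rfl fun z hz => by simp [hg, hz]
  rw [e1, ← tsum_mul_right, ← hgs.tsum_sub (hs.mul_right J0)]
  have hsub : Summable fun z => g z - D.indicator f z * J0 := hgs.sub (hs.mul_right J0)
  have hbd : ∀ z, |g z - D.indicator f z * J0| ≤ K * D.indicator f' z * J0 := by
    intro z
    by_cases hD : z ∈ D
    · have hfz := hf z
      have hfz' := hf' z
      simp only [hg, Set.indicator_of_mem hD]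
      rcases hgood z hD with ⟨hX, hJe⟩ | hle
      · rw [if_pos hX, hJe, sub_self, abs_zero]; positivity
      · have : |(if z ∈ X then f z * J z else 0) - f z * J0| ≤ f z * J0 := by
          split_ifs with hX
          · have := hJn z hX
            have h2 := mul_le_mul_of_nonneg_left (hJ z hX) hfz
            rw [abs_le]
            constructor
            · have := mul_nonneg hfz this; linarith
            · have := mul_nonneg hfz hJ0; linarith
          · rw [zero_sub, abs_neg, abs_of_nonneg (mul_nonneg hfz hJ0)]
        exact this.trans (mul_le_mul_of_nonneg_right hle hJ0)
    · simp [hg, Set.indicator_of_notMem hD]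
  have hsr : Summable fun z => K * D.indicator f' z * J0 := (hs'.mul_left K).mul_right J0
  calc |∑' z, (g z - D.indicator f z * J0)| ≤ ∑' z, K * D.indicator f' z * J0 := by
        have := tsum_of_norm_bounded hsr.hasSum (f := fun z => g z - D.indicator f z * J0) (fun z => hbd z)
        exact this
    _ = _ := by rw [tsum_mul_right, tsum_mul_left]

lemma eps_ineq {a b : ℝ} (ha : 1 ≤ a) (hb : a + 1 ≤ b) : 2 * a < b * (a + b - 1) := by nlinarith

lemma exp_facts {a b : ℝ} (ha : 1 ≤ a) (hb : a + 1 ≤ b) :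
    1 < 2 * ((a + 2 * b) / (2 * (a + b)) - a / ((a + b) * (a + b - 1))) ∧
    1 < 2 * ((2 * a + b) / (2 * (a + b)) - a ^ 2 / (b * (a + b) * (a + b - 1))) ∧
    (a / ((a + b) * (a + b - 1))) * (1 + 1 / (b / a)) = a / (b * (a + b - 1)) ∧
    (a ^ 2 / (b * (a + b) * (a + b - 1))) * (1 + b / a) = a / (b * (a + b - 1)) := by
  have h := eps_ineq ha hb
  have h1 : 0 < a + b - 1 := by linarith
  have ha0 : 0 < a := by linarith
  have hb0 : 0 < b := by linarith
  have hm : 0 < a + b := by linarith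
  refine ⟨?_, ?_, ?_, ?_⟩
  · have e : 2 * ((a + 2 * b) / (2 * (a + b)) - a / ((a + b) * (a + b - 1))) - 1 = (b * (a + b - 1) - 2 * a) / ((a + b) * (a + b - 1)) := by
      field_simp; ring
    have : 0 < (b * (a + b - 1) - 2 * a) / ((a + b) * (a + b - 1)) := div_pos (by linarith) (by positivity)
    linarith
  · have e : 2 * ((2 * a + b) / (2 * (a + b)) - a ^ 2 / (b * (a + b) * (a + b - 1))) - 1 = a * (b * (a + b - 1) - 2 * a) / (b * (a + b) * (a + b - 1)) := by
      field_simp; ring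
    have : 0 < a * (b * (a + b - 1) - 2 * a) / (b * (a + b) * (a + b - 1)) := div_pos (mul_pos ha0 (by linarith)) (by positivity)
    linarith
  · field_simp; ring
  · field_simp

theorem diag {a b : ℕ} (ha : 1 ≤ a) (hab : a < b) (hcop : Nat.gcd a b = 1) : ∃ C > 0, ∀ (Q Q' : ℝ) (H N k : ℕ), 1 ≤ Q → Q ≤ Q' → 1 ≤ H → H ≤ N →
    Q ^ (3 + (b:ℝ) / a) ≤ H →
    |∑ i ∈ Finset.Icc 1 N ×ˢ Finset.Icc 1 N, ∑ j ∈ Finset.Icc 1 N ×ˢ Finset.Icc 1 N,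
      (if lam ((b:ℝ) / a) i.1 i.2 = lam ((b:ℝ) / a) j.1 j.2 then
        cc ((b:ℝ) / a) i.1 i.2 * cc ((b:ℝ) / a) j.1 j.2 *
          ∫ t in Q..Q', eta ((b:ℝ) / a) H i.1 i.2 t * eta ((b:ℝ) / a) H j.1 j.2 t * t ^ k else 0) - Gab a b * ∫ t in Q..Q', t ^ k| ≤
      C * Q ^ (-((a:ℝ) / (b * (a + b - 1)))) * ∫ t in Q..Q', t ^ k := by
  have ha' : (1:ℝ) ≤ a := by exact_mod_cast ha
  have hb' : (a:ℝ) + 1 ≤ b := by exact_mod_cast hab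
  have hb1 : 1 < b := by omega
  have ha0 : (0:ℝ) < a := by linarith
  have hb0 : (0:ℝ) < b := by linarith
  have hm1 : (0:ℝ) < a + b - 1 := by linarith
  obtain ⟨f1, f2, f3, f4⟩ := exp_facts ha' hb'
  set θ := (b:ℝ) / a with hθ
  have hθ1 : 1 < θ := by rw [hθ, one_lt_div ha0]; linarith
  have hθ0 : 0 < θ := by linarith
  set δ := (a:ℝ) / (b * (a + b - 1)) with hδ
  set ε₁ := (a:ℝ) / ((a + b) * (a + b - 1)) with hε₁
  set ε₂ := (a:ℝ) ^ 2 / (b * (a + b) * (a + b - 1)) with hε₂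
  set p := ((a:ℝ) + 2 * b) / (2 * (a + b)) with hp
  set q := (2 * (a:ℝ) + b) / (2 * (a + b)) with hq
  have e10 : 0 < ε₁ := by positivity
  have e20 : 0 < ε₂ := by positivity
  have kap : ∀ u v : ℝ, 1 < 2 * u → 1 < 2 * v → 1 < b * u + a * v := by
    intro u v hu hv
    have h1 : (b:ℝ) * (1 / 2) ≤ b * u := mul_le_mul_of_nonneg_left (by linarith) hb0.le
    have h2 : (a:ℝ) * (1 / 2) ≤ a * v := mul_le_mul_of_nonneg_left (by linarith) ha0.le
    linarith
  have s0 := fd_summable ha hb1 hcop (p := p) (q := q) (by linarith) (by linarith) (kap _ _ (by linarith) (by linarith))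
  have s1 := fd_summable ha hb1 hcop f1 f2 (kap _ _ f1 f2)
  set W := ∑' z, (DD a b).indicator (fd (p - ε₁) (q - ε₂)) z with hW
  have hW0 : 0 ≤ W := tsum_nonneg fun z => Set.indicator_nonneg (fun z _ => fd_nonneg _ _ z) z
  refine ⟨θ ^ ε₁ * (W + 1), by positivity, ?_⟩
  intro Q Q' H N k hQ hQQ hH hHN hQH
  have hQ0 : 0 < Q := by linarith
  set J0 := ∫ t in Q..Q', t ^ k with hJ0
  have hJ00 : 0 ≤ J0 := intervalIntegral.integral_nonneg hQQ fun t ht => pow_nonneg (by linarith [ht.1]) k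
  set J : (ℕ × ℕ) × (ℕ × ℕ) → ℝ := fun z => ∫ t in Q..Q', eta θ H z.1.1 z.1.2 t * eta θ H z.2.1 z.2.2 t * t ^ k with hJ
  set S := Finset.Icc 1 N ×ˢ Finset.Icc 1 N with hS
  have hsum : ∑ i ∈ S, ∑ j ∈ S, (if lam θ i.1 i.2 = lam θ j.1 j.2 then
        cc θ i.1 i.2 * cc θ j.1 j.2 * ∫ t in Q..Q', eta θ H i.1 i.2 t * eta θ H j.1 j.2 t * t ^ k else 0) =
      ∑ z ∈ S ×ˢ S, (DD a b).indicator (fd p q) z * J z := by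
    rw [Finset.sum_product S S]
    apply Finset.sum_congr rfl
    intro i hi
    apply Finset.sum_congr rfl
    intro j hj
    simp only [hS, Finset.mem_product, Finset.mem_Icc] at hi hj
    have hmem : (i, j) ∈ DD a b ↔ lam θ i.1 i.2 = lam θ j.1 j.2 := by
      rw [hθ, lam_eq_iff ha]
      simp only [DD, Set.mem_ofPred_eq]
      exact ⟨fun h => h.2, fun h => ⟨⟨hi.1.1, hi.2.1, hj.1.1, hj.2.1⟩, h⟩⟩
    by_cases h : lam θ i.1 i.2 = lam θ j.1 j.2
    · rw [if_pos h, Set.indicator_of_mem (hmem.mpr h)]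
      have := cc_fd (b := b) ha (z := (i, j)) hi.1.1 hi.2.1 hj.1.1 hj.2.1
      rw [← hθ] at this
      rw [← this]
    · rw [if_neg h, Set.indicator_of_notMem (fun h' => h (hmem.mp h')), zero_mul]
  rw [hsum, Gab_eq]
  have hbox := box_tsum (DD a b) (fd p q) (fd (p - ε₁) (q - ε₂)) (S ×ˢ S) J (J0 := J0) (K := θ ^ ε₁ * Q ^ (-δ))
    (fd_nonneg _ _) (fd_nonneg _ _) s0 s1 hJ00 (by positivity)
    (fun z _ => intervalIntegral.integral_nonneg hQQ fun t ht => mul_nonneg (mul_nonneg (eta_nonneg _ _ _ _ _) (eta_nonneg _ _ _ _ _)) (pow_nonneg (by linarith [ht.1]) k))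
    (by
      intro z _
      simp only [hJ]
      rw [hJ0, intervalIntegral.integral_of_le hQQ, intervalIntegral.integral_of_le hQQ]
      apply integral_mono_of_nonneg
      · filter_upwards [ae_restrict_mem measurableSet_Ioc] with t ht
        exact mul_nonneg (mul_nonneg (eta_nonneg _ _ _ _ _) (eta_nonneg _ _ _ _ _)) (pow_nonneg (by linarith [ht.1]) k)
      · exact ((continuous_pow k).intervalIntegrable Q Q').1
      · filter_upwards [ae_restrict_mem measurableSet_Ioc] with t ht
        apply mul_le_of_le_one_left (pow_nonneg (by linarith [ht.1]) k)
        exact mul_le_one₀ (eta_le_one _ _ _ _ _) (eta_nonneg _ _ _ _ _) (eta_le_one _ _ _ _ _))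
    (by
      rintro z ⟨⟨k1, k2, k3, k4⟩, -⟩
      by_cases hg : (((z.1.1:ℝ) ≤ Q ^ (1 + 1 / θ) / θ ∧ (z.1.2:ℝ) ≤ Q ^ (1 + θ)) ∧ ((z.2.1:ℝ) ≤ Q ^ (1 + 1 / θ) / θ ∧ (z.2.2:ℝ) ≤ Q ^ (1 + θ)))
      · left
        have hB : Q ^ (1 + θ) ≤ H := (rpow_le_rpow_of_exponent_le hQ (by linarith)).trans hQH
        have hA : Q ^ (1 + 1 / θ) / θ ≤ H := by
          refine (div_le_self (by positivity) hθ1.le).trans ((rpow_le_rpow_of_exponent_le hQ ?_).trans hQH)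
          have : 1 / θ ≤ 1 := by rw [div_le_one hθ0]; exact hθ1.le
          linarith
        obtain ⟨⟨g1, g2⟩, g3, g4⟩ := hg
        have b1 : z.1.1 ≤ H := by exact_mod_cast g1.trans hA
        have b2 : z.1.2 ≤ H := by exact_mod_cast g2.trans hB
        have b3 : z.2.1 ≤ H := by exact_mod_cast g3.trans hA
        have b4 : z.2.2 ≤ H := by exact_mod_cast g4.trans hB
        constructor
        · simp only [hS, Finset.mem_product, Finset.mem_Icc]
          exact ⟨⟨⟨k1, b1.trans hHN⟩, k2, b2.trans hHN⟩, ⟨k3, b3.trans hHN⟩, k4, b4.trans hHN⟩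
        · simp only [hJ, hJ0]
          apply intervalIntegral.integral_congr
          intro t ht
          rw [Set.uIcc_of_le hQQ] at ht
          have ht1 : 1 ≤ t := hQ.trans ht.1
          have m1 : Q ^ (1 + θ) ≤ t ^ (1 + θ) := rpow_le_rpow hQ0.le ht.1 (by linarith)
          have m2 : Q ^ (1 + 1 / θ) / θ ≤ t ^ (1 + 1 / θ) / θ := div_le_div_of_nonneg_right (rpow_le_rpow hQ0.le ht.1 (by positivity)) hθ0.le
          simp only
          rw [eta_eq_one hθ1 ht1 k1 k2 b1 b2 (g2.trans m1) (g1.trans m2), eta_eq_one hθ1 ht1 k3 k4 b3 b4 (g4.trans m1) (g3.trans m2)]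
          ring
      · right
        exact fd_tail e10 e20 hθ1 hQ f3 f4 k1 k2 k3 k4 hg)
  refine hbox.trans ?_
  apply mul_le_mul_of_nonneg_right _ hJ00
  calc θ ^ ε₁ * Q ^ (-δ) * W ≤ θ ^ ε₁ * Q ^ (-δ) * (W + 1) := mul_le_mul_of_nonneg_left (by linarith) (by positivity)
    _ = _ := by ring

end MSQ

namespace MSQ

lemma muc_pos {θ : ℝ} (hθ : 0 < θ) : 0 < muc θ := by unfold muc; positivity

/-- the trigonometric sum in `Mt`. -/
noncomputable def Sg (θ : ℝ) (H N : ℕ) (t : ℝ) : ℝ :=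
  ∑ i ∈ Finset.Icc 1 N ×ˢ Finset.Icc 1 N, cc θ i.1 i.2 * eta θ H i.1 i.2 t * sin (2 * π * (muc θ * lam θ i.1 i.2 * t + 1 / 8))

lemma Mt_eq (θ : ℝ) (H N : ℕ) (t : ℝ) : Mt θ H N t = Kc θ / π * √t * Sg θ H N t := by
  unfold Mt Sg
  rw [Finset.sum_product]

theorem Sg_sq {a b : ℕ} (ha : 1 ≤ a) (hab : a < b) (hcop : Nat.gcd a b = 1) (k : ℕ) :
    ∃ C > 0, ∀ (Q Q' : ℝ) (H N : ℕ), 1 ≤ Q → Q ≤ Q' → Q' ≤ 2 * Q → 1 ≤ H → H ≤ N → Q ^ (3 + (b:ℝ) / a) ≤ H →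
    |(∫ t in Q..Q', t ^ k * (Sg ((b:ℝ) / a) H N t) ^ 2) - 1 / 2 * (Gab a b * ∫ t in Q..Q', t ^ k)| ≤
      C * (Q ^ k * Q ^ (1 - (a:ℝ) / (b * (a + b - 1))) * (1 + log N) ^ 4) := by
  have ha' : (1:ℝ) ≤ a := by exact_mod_cast ha
  have hb' : (a:ℝ) + 1 ≤ b := by exact_mod_cast hab
  have ha0 : (0:ℝ) < a := by linarith
  have hb0 : (0:ℝ) < b := by linarith
  have hm1 : (0:ℝ) < a + b - 1 := by linarith
  obtain ⟨C1, hC1, hoff⟩ := offdiag ha hab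
  obtain ⟨C2, hC2, hdiag⟩ := diag ha hab hcop
  set θ := (b:ℝ) / a with hθ
  have hθ0 : 0 < θ := by positivity
  have hμ := muc_pos hθ0
  set δ := (a:ℝ) / (b * (a + b - 1)) with hδ
  have hδ1 : δ < 1 := by
    rw [hδ, div_lt_one (by positivity)]
    have := eps_ineq ha' hb'; linarith
  refine ⟨(1 + 1 / muc θ) * 2 ^ k * (1 + C1) + C2 * 2 ^ k, by positivity, ?_⟩
  intro Q Q' H N hQ hQQ hQ2 hH hHN hQH
  have hQ0 : 0 < Q := by linarith
  have hN : 1 ≤ N := hH.trans hHN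
  have hN' : (1:ℝ) ≤ N := by exact_mod_cast hN
  have hlN := Real.log_nonneg hN'
  set L := (1 + log (N:ℝ)) ^ 4 with hL
  have hL1 : 1 ≤ L := one_le_pow₀ (by linarith)
  have hR1 : 1 ≤ Q ^ (1 - δ) := one_le_rpow hQ (by linarith)
  have hex : ∀ i : ℕ × ℕ, ∃ η', (i ∈ Finset.Icc 1 N ×ˢ Finset.Icc 1 N → MonoAmp Q Q' (eta θ H i.1 i.2) η') := by
    intro i
    by_cases hi : i ∈ Finset.Icc 1 N ×ˢ Finset.Icc 1 N
    · simp only [Finset.mem_product, Finset.mem_Icc] at hi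
      obtain ⟨η', h⟩ := eta_amp (Q' := Q') (H := H) hθ0 hQ0 hi.1.1 hi.2.1
      exact ⟨η', fun _ => h⟩
    · exact ⟨fun _ => 0, fun h => absurd h hi⟩
  choose η' hη' using hex
  have hms := meansq (Finset.Icc 1 N ×ˢ Finset.Icc 1 N) (fun i => cc θ i.1 i.2) (fun i => lam θ i.1 i.2) (fun i => eta θ H i.1 i.2) η'
    (Q := Q) (Q' := Q') (μ := muc θ) k hQ0.le hQQ hQ2 hμ
    (by
      intro i hi
      unfold cc; positivity)
    (by
      intro i hi
      simp only [Finset.mem_product, Finset.mem_Icc] at hi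
      exact lam_pos' ha (by exact_mod_cast hi.1.1) (by exact_mod_cast hi.2.1))
    (fun i hi => hη' i hi) (fun i _ => eta_le_one _ _ _ _ _)
  have hd := hdiag Q Q' H N k hQ hQQ hH hHN hQH
  have ho := hoff Q N hQ hN
  have hsd := sumdiag (b := b) ha N
  rw [← hθ] at hsd
  rw [← hL] at ho hsd
  have hJ0 : ∫ t in Q..Q', t ^ k ≤ 2 ^ k * Q ^ k * Q := by
    have h1 : ∫ t in Q..Q', t ^ k ≤ ∫ t in Q..Q', (Q' ^ k : ℝ) := by
      apply intervalIntegral.integral_mono_on hQQ ((continuous_pow k).intervalIntegrable _ _) (by simp)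
      intro t ht
      exact pow_le_pow_left₀ (by linarith [ht.1]) ht.2 k
    refine h1.trans ?_
    rw [intervalIntegral.integral_const, smul_eq_mul, ← mul_pow, mul_comm]
    exact mul_le_mul (pow_le_pow_left₀ (by linarith) hQ2 k) (by linarith) (by linarith) (by positivity)
  set X := ∫ t in Q..Q', t ^ k * (Sg θ H N t) ^ 2 with hX
  set J0 := ∫ t in Q..Q', t ^ k with hJ0'
  set S1 := ∑ i ∈ Finset.Icc 1 N ×ˢ Finset.Icc 1 N, ∑ j ∈ Finset.Icc 1 N ×ˢ Finset.Icc 1 N, cc θ i.1 i.2 * cc θ j.1 j.2 * (1 / (lam θ i.1 i.2 + lam θ j.1 j.2)) with hS1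
  set S2 := ∑ i ∈ Finset.Icc 1 N ×ˢ Finset.Icc 1 N, ∑ j ∈ Finset.Icc 1 N ×ˢ Finset.Icc 1 N, (if lam θ i.1 i.2 = lam θ j.1 j.2 then 0 else
        cc θ i.1 i.2 * cc θ j.1 j.2 * min Q (1 / |lam θ i.1 i.2 - lam θ j.1 j.2|)) with hS2
  set Y := ∑ i ∈ Finset.Icc 1 N ×ˢ Finset.Icc 1 N, ∑ j ∈ Finset.Icc 1 N ×ˢ Finset.Icc 1 N, (if lam θ i.1 i.2 = lam θ j.1 j.2 then
        cc θ i.1 i.2 * cc θ j.1 j.2 * ∫ t in Q..Q', eta θ H i.1 i.2 t * eta θ H j.1 j.2 t * t ^ k else 0) with hY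
  have hms' : |X - 1 / 2 * Y| ≤ (1 + 1 / muc θ) * Q' ^ k * (S1 + S2) := hms
  clear hms
  clear_value X J0 S1 S2 Y L
  have hQk : Q' ^ k ≤ 2 ^ k * Q ^ k := by rw [← mul_pow]; exact pow_le_pow_left₀ (by linarith) hQ2 k
  have e1 : |X - 1 / 2 * Y| ≤ (1 + 1 / muc θ) * 2 ^ k * (1 + C1) * (Q ^ k * Q ^ (1 - δ) * L) := by
    refine hms'.trans ?_
    have h12 : S1 + S2 ≤ (1 + C1) * (Q ^ (1 - δ) * L) := by
      have : L ≤ Q ^ (1 - δ) * L := le_mul_of_one_le_left (by linarith) hR1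
      calc S1 + S2 ≤ L + C1 * Q ^ (1 - δ) * L := add_le_add hsd ho
        _ ≤ Q ^ (1 - δ) * L + C1 * Q ^ (1 - δ) * L := add_le_add this le_rfl
        _ = _ := by ring
    calc _ ≤ (1 + 1 / muc θ) * Q' ^ k * ((1 + C1) * (Q ^ (1 - δ) * L)) := mul_le_mul_of_nonneg_left h12 (mul_nonneg (by positivity) (pow_nonneg (by linarith) k))
      _ ≤ (1 + 1 / muc θ) * (2 ^ k * Q ^ k) * ((1 + C1) * (Q ^ (1 - δ) * L)) := by
          apply mul_le_mul_of_nonneg_right _ (by positivity)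
          exact mul_le_mul_of_nonneg_left hQk (by positivity)
      _ = _ := by ring
  have e2 : |Y - Gab a b * J0| ≤ C2 * 2 ^ k * (Q ^ k * Q ^ (1 - δ) * L) := by
    refine hd.trans ?_
    calc C2 * Q ^ (-δ) * J0 ≤ C2 * Q ^ (-δ) * (2 ^ k * Q ^ k * Q) := mul_le_mul_of_nonneg_left hJ0 (by positivity)
      _ = C2 * 2 ^ k * (Q ^ k * (Q ^ (-δ) * Q) * 1) := by ring
      _ = C2 * 2 ^ k * (Q ^ k * Q ^ (1 - δ) * 1) := by
          congr 4
          rw [← rpow_add_one hQ0.ne']; congr 1; ring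
      _ ≤ _ := by
          apply mul_le_mul_of_nonneg_left _ (by positivity)
          exact mul_le_mul_of_nonneg_left hL1 (by positivity)
  have e3 : X - 1 / 2 * (Gab a b * J0) = (X - 1 / 2 * Y) + 1 / 2 * (Y - Gab a b * J0) := by ring
  rw [e3]
  refine (abs_add_le _ _).trans ?_
  rw [abs_mul, abs_of_pos (show (0:ℝ) < 1 / 2 by norm_num), add_mul]
  apply add_le_add e1
  refine le_trans ?_ e2
  have := abs_nonneg (Y - Gab a b * J0)
  linarith

/-- bounded measurable functions on an interval -/
def Good (Q Q' : ℝ) (f : ℝ → ℝ) : Prop :=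
  AEStronglyMeasurable f (volume.restrict (Set.Ioc Q Q')) ∧ ∃ B, ∀ t ∈ Set.Ioc Q Q', |f t| ≤ B

lemma Good.mul {Q Q' : ℝ} {f g : ℝ → ℝ} (hf : Good Q Q' f) (hg : Good Q Q' g) : Good Q Q' (fun t => f t * g t) := by
  obtain ⟨h1, B, hB⟩ := hf
  obtain ⟨h2, D, hD⟩ := hg
  refine ⟨h1.mul h2, B * D, fun t ht => ?_⟩
  rw [abs_mul]
  exact mul_le_mul (hB t ht) (hD t ht) (abs_nonneg _) ((abs_nonneg _).trans (hB t ht))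

lemma Good.sub {Q Q' : ℝ} {f g : ℝ → ℝ} (hf : Good Q Q' f) (hg : Good Q Q' g) : Good Q Q' (fun t => f t - g t) := by
  obtain ⟨h1, B, hB⟩ := hf
  obtain ⟨h2, D, hD⟩ := hg
  refine ⟨h1.sub h2, B + D, fun t ht => ?_⟩
  exact (abs_sub _ _).trans (add_le_add (hB t ht) (hD t ht))

lemma Good.sq {Q Q' : ℝ} {f : ℝ → ℝ} (hf : Good Q Q' f) : Good Q Q' (fun t => f t ^ 2) := by
  have := hf.mul hf
  simpa only [pow_two] using this

lemma Good.ii {Q Q' : ℝ} (hQ : Q ≤ Q') {f : ℝ → ℝ} (hf : Good Q Q' f) : IntervalIntegrable f volume Q Q' := by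
  obtain ⟨h1, B, hB⟩ := hf
  rw [intervalIntegrable_iff_integrableOn_Ioc_of_le hQ]
  have hfin : IsFiniteMeasure (volume.restrict (Set.Ioc Q Q')) := ⟨by simp⟩
  refine Integrable.mono' (integrable_const B) h1 ?_
  filter_upwards [ae_restrict_mem measurableSet_Ioc] with t ht
  exact hB t ht

lemma Good.of_cont {Q Q' : ℝ} {f : ℝ → ℝ} (hf : ContinuousOn f (Set.Icc Q Q')) : Good Q Q' f := by
  refine ⟨(hf.mono Set.Ioc_subset_Icc_self).aestronglyMeasurable measurableSet_Ioc, ?_⟩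
  obtain ⟨B, hB⟩ := isCompact_Icc.exists_bound_of_continuousOn hf
  exact ⟨B, fun t ht => hB t (Set.Ioc_subset_Icc_self ht)⟩

lemma Good.of_mono {Q Q' : ℝ} {f : ℝ → ℝ} (hf : Monotone f) : Good Q Q' f := by
  refine ⟨hf.measurable.aestronglyMeasurable, max |f Q| |f Q'|, fun t ht => ?_⟩
  exact abs_le_max_abs_abs (hf ht.1.le) (hf ht.2)

lemma pert {Q Q' l : ℝ} (hQ : Q ≤ Q') (hl : 0 < l) {V M w : ℝ → ℝ} (hV : Good Q Q' V) (hM : Good Q Q' M) (hw : Good Q Q' w)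
    (hw0 : ∀ t ∈ Set.Icc Q Q', 0 ≤ w t) :
    |(∫ t in Q..Q', w t * V t ^ 2) - ∫ t in Q..Q', w t * M t ^ 2| ≤ l * (∫ t in Q..Q', w t * M t ^ 2) + (1 + 1 / l) * ∫ t in Q..Q', w t * (V t - M t) ^ 2 := by
  have i1 := (hw.mul hV.sq).ii hQ
  have i2 := (hw.mul hM.sq).ii hQ
  have i3 := (hw.mul (hV.sub hM).sq).ii hQ
  rw [← intervalIntegral.integral_sub i1 i2, ← intervalIntegral.integral_const_mul, ← intervalIntegral.integral_const_mul,
    ← intervalIntegral.integral_add (i2.const_mul l) (i3.const_mul _)]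
  refine (intervalIntegral.abs_integral_le_integral_abs hQ).trans ?_
  apply intervalIntegral.integral_mono_on hQ (i1.sub i2).abs ((i2.const_mul l).add (i3.const_mul _))
  intro t ht
  have hwt := hw0 t ht
  have key : |V t ^ 2 - M t ^ 2| ≤ l * M t ^ 2 + (1 + 1 / l) * (V t - M t) ^ 2 := by
    set r := V t - M t with hr
    have e : V t ^ 2 - M t ^ 2 = 2 * M t * r + r ^ 2 := by rw [hr]; ring
    rw [e]
    have h1 : 0 ≤ (l * M t - r) ^ 2 / l := by positivity
    have h2 : 0 ≤ (l * M t + r) ^ 2 / l := by positivity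
    have f1 : (l * M t - r) ^ 2 / l = l * M t ^ 2 - 2 * M t * r + 1 / l * r ^ 2 := by field_simp; ring
    have f2 : (l * M t + r) ^ 2 / l = l * M t ^ 2 + 2 * M t * r + 1 / l * r ^ 2 := by field_simp; ring
    have h3 := sq_nonneg r
    rw [abs_le]
    constructor <;> linarith
  calc |w t * V t ^ 2 - w t * M t ^ 2| = w t * |V t ^ 2 - M t ^ 2| := by rw [← mul_sub, abs_mul, abs_of_nonneg hwt]
    _ ≤ w t * (l * M t ^ 2 + (1 + 1 / l) * (V t - M t) ^ 2) := mul_le_mul_of_nonneg_left key hwt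
    _ = _ := by ring

end MSQ

namespace MSQ

lemma Good.congr {Q Q' : ℝ} {f g : ℝ → ℝ} (hf : Good Q Q' f) (h : ∀ t ∈ Set.Ioc Q Q', f t = g t) : Good Q Q' g := by
  obtain ⟨h1, B, hB⟩ := hf
  refine ⟨h1.congr ?_, B, fun t ht => by rw [← h t ht]; exact hB t ht⟩
  filter_upwards [ae_restrict_mem measurableSet_Ioc] with t ht
  exact h t ht

lemma lattice_mono {a b : ℕ} (ha : 1 ≤ a) (hab : a < b) : Monotone (fun x => latticeCount a b x) := by
  intro x y hxy
  simp only [latticeCount]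
  have : Set.ncard {p : ℕ × ℕ | 0 < p.1 ∧ 0 < p.2 ∧ (p.1 : ℝ) ^ (a:ℝ) * (p.2 : ℝ) ^ (b:ℝ) ≤ x} ≤
      Set.ncard {p : ℕ × ℕ | 0 < p.1 ∧ 0 < p.2 ∧ (p.1 : ℝ) ^ (a:ℝ) * (p.2 : ℝ) ^ (b:ℝ) ≤ y} := by
    apply Set.ncard_le_ncard
    · rintro p ⟨h1, h2, h3⟩
      exact ⟨h1, h2, h3.trans hxy⟩
    · apply Set.Finite.subset ((Set.finite_Iic ⌊y⌋₊).prod (Set.finite_Iic ⌊y⌋₊))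
      rintro ⟨h, r⟩ ⟨h1, h2, h3⟩
      simp only [rpow_natCast] at h1 h2 h3
      have e1 : (1:ℝ) ≤ h := by exact_mod_cast h1
      have e2 : (1:ℝ) ≤ r := by exact_mod_cast h2
      have f1 : (h:ℝ) ≤ (h:ℝ) ^ a := le_self_pow₀ e1 (by omega)
      have f2 : (r:ℝ) ≤ (r:ℝ) ^ b := le_self_pow₀ e2 (by omega)
      have g1 : (1:ℝ) ≤ (h:ℝ) ^ a := e1.trans f1
      have g2 : (1:ℝ) ≤ (r:ℝ) ^ b := e2.trans f2
      constructor
      · exact Nat.le_floor ((f1.trans (le_mul_of_one_le_right (by linarith) g2)).trans h3)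
      · exact Nat.le_floor ((f2.trans (le_mul_of_one_le_left (by linarith) g1)).trans h3)
  exact_mod_cast this

lemma V_good {a b : ℕ} (ha : 1 ≤ a) (hab : a < b) {Q Q' : ℝ} (hQ : 0 < Q) :
    Good Q Q' (fun t => DeltaErr a b (t ^ (a + b))) := by
  have hpos : ∀ t ∈ Set.Icc Q Q', t ^ (a + b) ≠ 0 := fun t ht => (pow_pos (hQ.trans_le ht.1) _).ne'
  have c1 : ∀ c e : ℝ, Good Q Q' (fun t => c * (t ^ (a + b)) ^ e) := fun c e =>
    Good.of_cont (continuousOn_const.mul (ContinuousOn.rpow_const (by fun_prop) (fun t ht => Or.inl (hpos t ht))))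
  have c0 : Good Q Q' (fun t => latticeCount a b (t ^ (a + b))) := by
    have hm : Monotone (fun t : ℝ => latticeCount a b ((max t 0) ^ (a + b))) := by
      intro s t hst
      exact lattice_mono ha hab (pow_le_pow_left₀ (le_max_right _ _) (max_le_max_right _ hst) _)
    refine (Good.of_mono hm).congr fun t ht => ?_
    rw [max_eq_left (hQ.trans ht.1).le]
  exact (c0.sub (c1 _ _)).sub (c1 _ _)

lemma M_good {θ Q Q' : ℝ} (hθ : 0 < θ) (hQ : 0 < Q) (H N : ℕ) : Good Q Q' (Mt θ H N) := by
  apply Good.of_cont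
  have e : Mt θ H N = fun t => Kc θ / π * √t * Sg θ H N t := funext (Mt_eq θ H N)
  rw [e]
  apply ContinuousOn.mul
  · exact (continuous_const.mul Real.continuous_sqrt).continuousOn
  · unfold Sg
    apply continuousOn_finsetSum
    intro i hi
    simp only [Finset.mem_product, Finset.mem_Icc] at hi
    obtain ⟨η', hη⟩ := eta_amp (Q' := Q') (H := H) hθ hQ hi.1.1 hi.2.1
    apply ContinuousOn.mul
    · exact continuousOn_const.mul hη.cont
    · apply Continuous.continuousOn; fun_prop

lemma subst_pow {m : ℕ} (hm : 1 ≤ m) {Q Q' : ℝ} (hQ : 0 < Q) (hQQ : Q ≤ Q') (g : ℝ → ℝ) :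
    ∫ x in Q ^ m..Q' ^ m, g x = ∫ t in Q..Q', (m * t ^ (m - 1)) * g (t ^ m) := by
  have hmono : StrictMonoOn (fun t : ℝ => t ^ m) (Set.Icc Q Q') := fun s hs t ht hst =>
    pow_lt_pow_left₀ hst (hQ.le.trans hs.1) (by omega)
  have him : (fun t : ℝ => t ^ m) '' (Set.Ioc Q Q') = Set.Ioc (Q ^ m) (Q' ^ m) := by
    ext x
    constructor
    · rintro ⟨t, ht, rfl⟩
      exact ⟨pow_lt_pow_left₀ ht.1 hQ.le (by omega), pow_le_pow_left₀ (hQ.trans ht.1).le ht.2 _⟩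
    · rintro ⟨h1, h2⟩
      have hx : 0 < x := (pow_pos hQ m).trans h1
      have e : (x ^ ((m:ℝ)⁻¹)) ^ m = x := Real.rpow_inv_natCast_pow hx.le (by omega)
      refine ⟨x ^ ((m:ℝ)⁻¹), ⟨?_, ?_⟩, e⟩
      · apply lt_of_pow_lt_pow_left₀ m (by positivity); rw [e]; exact h1
      · apply le_of_pow_le_pow_left₀ (n := m) (by omega) (hQ.le.trans hQQ); rw [e]; exact h2
  rw [intervalIntegral.integral_of_le (pow_le_pow_left₀ hQ.le hQQ _), intervalIntegral.integral_of_le hQQ, ← him,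
    integral_image_eq_integral_abs_deriv_smul (f' := fun t => m * t ^ (m - 1)) measurableSet_Ioc
      (fun t _ => (hasDerivAt_pow m t).hasDerivWithinAt) (hmono.injOn.mono Set.Ioc_subset_Icc_self)]
  apply setIntegral_congr_fun measurableSet_Ioc
  intro t ht
  have : 0 < t := hQ.trans ht.1
  simp only [smul_eq_mul]
  rw [abs_of_nonneg (by positivity)]

lemma Kc_sq {a b : ℝ} (ha : 0 < a) (hb : 0 < b) :
    Kc (b / a) ^ 2 = a ^ (b / (a + b)) * b ^ (a / (a + b)) / (a + b) := by
  unfold Kc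
  rw [Real.sq_sqrt (by positivity)]
  have e1 : 1 / (1 + b / a) = a / (a + b) := by field_simp
  have e2 : b / (a + b) = 1 - a / (a + b) := by field_simp; ring
  rw [e1, e2, div_rpow hb.le ha.le, rpow_sub ha, rpow_one]
  field_simp

end MSQ

namespace MSQ

lemma log_absorb {ε : ℝ} (hε : 0 < ε) : ∃ C > 0, ∀ Q : ℝ, 1 ≤ Q → (1 + log Q) ^ 2 ≤ C * Q ^ ε := by
  refine ⟨(1 + 1 / (ε / 2)) ^ 2, by positivity, fun Q hQ => ?_⟩
  have h1 := Real.log_le_rpow_div (x := Q) (by linarith) (half_pos hε)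
  have h2 : 1 ≤ Q ^ (ε / 2) := one_le_rpow hQ (by positivity)
  have h3 : 1 + log Q ≤ (1 + 1 / (ε / 2)) * Q ^ (ε / 2) := by
    have : (1 + 1 / (ε / 2)) * Q ^ (ε / 2) = Q ^ (ε / 2) + Q ^ (ε / 2) / (ε / 2) := by ring
    rw [this]; linarith only [h1, h2]
  have h4 : Q ^ ε = (Q ^ (ε / 2)) ^ 2 := by
    rw [← rpow_natCast, ← rpow_mul (by linarith)]; congr 1; push_cast; ring
  have := log_nonneg hQ
  rw [h4, ← mul_pow]
  exact pow_le_pow_left₀ (by linarith) h3 2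

/-- purely numerical assembly -/
lemma assemble {κ C1 C2 C3 G m2 Qm Q Qh Qd L LN X J P I W l : ℝ} (hκ : 0 ≤ κ) (hC1 : 0 ≤ C1) (hC2 : 0 ≤ C2)
    (hm2 : 0 ≤ m2) (hQm : 0 ≤ Qm) (hL : 1 ≤ L) (hLN0 : 0 ≤ LN) (hQh : 1 ≤ Qh) (hQd : 0 ≤ Qd) (hQd1 : Qd ≤ Q)
    (hlQ : l * Q = Qh) (hl : 0 ≤ l) (hl1 : 1 / l = Qh) (hJ0 : 0 ≤ J) 
    (habs : Qh * L ^ 2 ≤ C3 * Qd)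
    (hLN : LN ≤ (1 + C1) * L)
    (hX : |X - 1 / 2 * (G * J)| ≤ C2 * (Qm * Qd * LN ^ 4))
    (hJ : J ≤ m2 * Qm * Q)
    (hP : P ≤ W * (Qm * L ^ 6)) (hW : 0 ≤ W)
    (hI : |I - κ * X| ≤ l * (κ * X) + (1 + 1 / l) * P) :
    |I - κ / 2 * G * J| ≤ (κ * C2 * (1 + C1) ^ 4 + κ * (|G| * m2 + C2) * (1 + C1) ^ 4 * C3 + 2 * W * C3) * (Qm * Qd * L ^ 4) := by
  have hL0 : 0 ≤ L := by linarith
  have hQ0 : 0 ≤ Q := hQd.trans hQd1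
  have hLN4 : LN ^ 4 ≤ (1 + C1) ^ 4 * L ^ 4 := by rw [← mul_pow]; exact pow_le_pow_left₀ hLN0 hLN 4
  have h1 : C2 * (Qm * Qd * LN ^ 4) ≤ C2 * (1 + C1) ^ 4 * (Qm * Qd * L ^ 4) := by
    calc C2 * (Qm * Qd * LN ^ 4) ≤ C2 * (Qm * Qd * ((1 + C1) ^ 4 * L ^ 4)) :=
          mul_le_mul_of_nonneg_left (mul_le_mul_of_nonneg_left hLN4 (by positivity)) hC2
      _ = _ := by ring
  have hL4 : 1 ≤ L ^ 4 := one_le_pow₀ hL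
  have hC14 : 1 ≤ (1 + C1) ^ 4 := one_le_pow₀ (by linarith)
  have hX2 : X ≤ (|G| * m2 + C2) * (1 + C1) ^ 4 * (Qm * Q * L ^ 4) := by
    have a1 : X ≤ 1 / 2 * (G * J) + C2 * (Qm * Qd * LN ^ 4) := by linarith only [(abs_le.1 hX).2]
    have a2 : 1 / 2 * (G * J) ≤ |G| * m2 * (Qm * Q) := by
      calc 1 / 2 * (G * J) ≤ 1 / 2 * (|G| * J) := by
            apply mul_le_mul_of_nonneg_left _ (by norm_num)
            exact mul_le_mul_of_nonneg_right (le_abs_self G) hJ0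
        _ ≤ |G| * J := by have : 0 ≤ |G| * J := by positivity
                          linarith
        _ ≤ |G| * (m2 * Qm * Q) := mul_le_mul_of_nonneg_left hJ (abs_nonneg _)
        _ = _ := by ring
    have a3 : |G| * m2 * (Qm * Q) ≤ |G| * m2 * ((1 + C1) ^ 4 * (Qm * Q * L ^ 4)) := by
      apply mul_le_mul_of_nonneg_left _ (by positivity)
      calc Qm * Q = 1 * (Qm * Q * 1) := by ring
        _ ≤ _ := mul_le_mul hC14 (mul_le_mul_of_nonneg_left hL4 (by positivity)) (by positivity) (by positivity)
    have a4 : C2 * (1 + C1) ^ 4 * (Qm * Qd * L ^ 4) ≤ C2 * (1 + C1) ^ 4 * (Qm * Q * L ^ 4) := by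
      apply mul_le_mul_of_nonneg_left _ (by positivity)
      exact mul_le_mul_of_nonneg_right (mul_le_mul_of_nonneg_left hQd1 hQm) (by positivity)
    calc X ≤ |G| * m2 * ((1 + C1) ^ 4 * (Qm * Q * L ^ 4)) + C2 * (1 + C1) ^ 4 * (Qm * Q * L ^ 4) := by
          linarith only [a1, a2, a3, a4, h1]
      _ = _ := by ring
  have hL2 : 1 ≤ L ^ 2 := one_le_pow₀ hL
  have hh : Qh ≤ C3 * Qd := (le_mul_of_one_le_right (by linarith) hL2).trans habs
  have b1 : l * (κ * X) ≤ κ * (|G| * m2 + C2) * (1 + C1) ^ 4 * C3 * (Qm * Qd * L ^ 4) := by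
    calc l * (κ * X) ≤ l * (κ * ((|G| * m2 + C2) * (1 + C1) ^ 4 * (Qm * Q * L ^ 4))) :=
          mul_le_mul_of_nonneg_left (mul_le_mul_of_nonneg_left hX2 hκ) hl
      _ = κ * (|G| * m2 + C2) * (1 + C1) ^ 4 * (Qm * L ^ 4) * (l * Q) := by ring
      _ ≤ κ * (|G| * m2 + C2) * (1 + C1) ^ 4 * (Qm * L ^ 4) * (C3 * Qd) := by
          rw [hlQ]; exact mul_le_mul_of_nonneg_left hh (by positivity)
      _ = _ := by ring
  have b2 : (1 + 1 / l) * P ≤ 2 * W * C3 * (Qm * Qd * L ^ 4) := by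
    calc (1 + 1 / l) * P ≤ (1 + 1 / l) * (W * (Qm * L ^ 6)) := mul_le_mul_of_nonneg_left hP (by rw [hl1]; linarith)
      _ ≤ (2 * Qh) * (W * (Qm * L ^ 6)) := by
          apply mul_le_mul_of_nonneg_right _ (by positivity)
          rw [hl1]; linarith
      _ = 2 * W * (Qm * L ^ 4) * (Qh * L ^ 2) := by ring
      _ ≤ 2 * W * (Qm * L ^ 4) * (C3 * Qd) := mul_le_mul_of_nonneg_left habs (by positivity)
      _ = _ := by ring
  have e : I - κ / 2 * G * J = (I - κ * X) + κ * (X - 1 / 2 * (G * J)) := by ring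
  rw [e]
  refine (abs_add_le _ _).trans ?_
  rw [abs_mul, abs_of_nonneg hκ]
  have b3 : κ * |X - 1 / 2 * (G * J)| ≤ κ * (C2 * (1 + C1) ^ 4 * (Qm * Qd * L ^ 4)) :=
    mul_le_mul_of_nonneg_left (hX.trans h1) hκ
  calc _ ≤ κ * (|G| * m2 + C2) * (1 + C1) ^ 4 * C3 * (Qm * Qd * L ^ 4) + 2 * W * C3 * (Qm * Qd * L ^ 4) +
        κ * (C2 * (1 + C1) ^ 4 * (Qm * Qd * L ^ 4)) := by linarith only [hI, b1, b2, b3]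
    _ = _ := by ring

theorem core {a b : ℕ} (ha : 1 ≤ a) (hab : a < b) (hcop : Nat.gcd a b = 1) :
    ∃ C > 0, ∀ Q Q' : ℝ, 1 ≤ Q → Q ≤ Q' → Q' ≤ 2 * Q →
      |(∫ t in Q..Q', (((a + b : ℕ) : ℝ) * t ^ (a + b - 1)) * (DeltaErr a b (t ^ (a + b))) ^ 2) -
        (Kc ((b:ℝ) / a) ^ 2 / π ^ 2 * ((a + b : ℕ) : ℝ)) / 2 * Gab a b * ∫ t in Q..Q', t ^ (a + b)| ≤
      C * (Q ^ (a + b) * Q ^ (1 - (a:ℝ) / (b * (a + b - 1))) * (1 + log Q) ^ 4) := by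
  have ha' : (1:ℝ) ≤ a := by exact_mod_cast ha
  have hb' : (a:ℝ) + 1 ≤ b := by exact_mod_cast hab
  have ha0 : (0:ℝ) < a := by linarith
  have hb0 : (0:ℝ) < b := by linarith
  have hm1 : (0:ℝ) < a + b - 1 := by linarith
  obtain ⟨C1, hC1, hex⟩ := explicit (α := a) (β := b) ha0 (by linarith)
  obtain ⟨C2, hC2, hS⟩ := Sg_sq ha hab hcop (a + b)
  set δ := (a:ℝ) / (b * (a + b - 1)) with hδ
  have hδ0 : 0 < δ := by positivity
  have hδ1 : δ < 1 / 2 := by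
    rw [hδ, div_lt_iff₀ (by positivity)]
    have := eps_ineq ha' hb'; linarith
  obtain ⟨C3, hC3, habs⟩ := log_absorb (ε := 1 / 2 - δ) (by linarith)
  set κ := Kc ((b:ℝ) / a) ^ 2 / π ^ 2 * ((a + b : ℕ) : ℝ) with hκ
  have hκ0 : 0 ≤ κ := by positivity
  have hθ0 : 0 < (b:ℝ) / a := by positivity
  set W := ((a + b : ℕ) : ℝ) * 2 ^ (a + b) * C1 with hW
  have hW0 : 0 < W := by
    have : (0:ℝ) < ((a + b : ℕ) : ℝ) := by push_cast; positivity
    positivity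
  refine ⟨κ * C2 * (1 + C1) ^ 4 + κ * (|Gab a b| * 2 ^ (a + b) + C2) * (1 + C1) ^ 4 * C3 + 2 * W * C3, by positivity, ?_⟩
  intro Q Q' hQ hQQ hQ2
  have hQ0 : 0 < Q := by linarith
  obtain ⟨H, N, hH, hHN, hQH, hlN, hR⟩ := hex Q hQ
  have hR' := hR Q' hQQ hQ2
  have hS' := hS Q Q' H N hQ hQQ hQ2 hH hHN hQH
  have hN' : (1:ℝ) ≤ N := by exact_mod_cast hH.trans hHN
  have hlN0 := Real.log_nonneg hN'
  have hlQ0 := Real.log_nonneg hQ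
  have hV := V_good ha hab (Q' := Q') hQ0
  have hM := M_good (Q' := Q') hθ0 hQ0 H N
  have hw : Good Q Q' (fun t => ((a + b : ℕ) : ℝ) * t ^ (a + b - 1)) := Good.of_cont (by fun_prop)
  have hp := pert (l := Q ^ (-(1/2) : ℝ)) hQQ (by positivity) hV hM hw (fun t ht => by
    have : 0 < t := hQ0.trans_le ht.1
    positivity)
  have eM : (∫ t in Q..Q', ((a + b : ℕ) : ℝ) * t ^ (a + b - 1) * Mt ((b:ℝ) / a) H N t ^ 2) =
      κ * ∫ t in Q..Q', t ^ (a + b) * (Sg ((b:ℝ) / a) H N t) ^ 2 := by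
    rw [← intervalIntegral.integral_const_mul]
    apply intervalIntegral.integral_congr
    intro t ht
    rw [Set.uIcc_of_le hQQ] at ht
    have ht0 : 0 < t := hQ0.trans_le ht.1
    have hs : √t ^ 2 = t := Real.sq_sqrt ht0.le
    have ht2 : t ^ (a + b) = t ^ (a + b - 1) * t := by rw [← pow_succ]; congr 1; omega
    simp only [Mt_eq]
    rw [mul_pow, mul_pow, hs, ht2, hκ, div_pow]
    ring
  have hJ0 : 0 ≤ ∫ t in Q..Q', t ^ (a + b) := intervalIntegral.integral_nonneg hQQ (fun t ht => by
    have : 0 < t := hQ0.trans_le ht.1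
    positivity)
  have hJ : (∫ t in Q..Q', t ^ (a + b)) ≤ 2 ^ (a + b) * Q ^ (a + b) * Q := by
    have h1 : (∫ t in Q..Q', t ^ (a + b)) ≤ ∫ t in Q..Q', (2 * Q) ^ (a + b) := by
      apply intervalIntegral.integral_mono_on hQQ (by apply Continuous.intervalIntegrable; fun_prop) (by simp)
      intro t ht
      exact pow_le_pow_left₀ (hQ0.le.trans ht.1) (ht.2.trans hQ2) _
    refine h1.trans ?_
    rw [intervalIntegral.integral_const, smul_eq_mul, mul_pow, mul_comm]
    exact mul_le_mul_of_nonneg_left (by linarith) (by positivity)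
  have hP : (∫ t in Q..Q', ((a + b : ℕ) : ℝ) * t ^ (a + b - 1) * (DeltaErr a b (t ^ (a + b)) - Mt ((b:ℝ) / a) H N t) ^ 2) ≤
      W * (Q ^ (a + b) * (1 + log Q) ^ 6) := by
    have hD := (hV.sub hM).sq
    have h1 : (∫ t in Q..Q', ((a + b : ℕ) : ℝ) * t ^ (a + b - 1) * (DeltaErr a b (t ^ (a + b)) - Mt ((b:ℝ) / a) H N t) ^ 2) ≤
        ∫ t in Q..Q', ((a + b : ℕ) : ℝ) * (2 * Q) ^ (a + b - 1) * (DeltaErr a b (t ^ (a + b)) - Mt ((b:ℝ) / a) H N t) ^ 2 := by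
      apply intervalIntegral.integral_mono_on hQQ ((hw.mul hD).ii hQQ) ((hD.ii hQQ).const_mul _)
      intro t ht
      apply mul_le_mul_of_nonneg_right _ (sq_nonneg _)
      apply mul_le_mul_of_nonneg_left _ (by positivity)
      exact pow_le_pow_left₀ (hQ0.le.trans ht.1) (ht.2.trans hQ2) _
    refine h1.trans ?_
    rw [intervalIntegral.integral_const_mul]
    have h2 : (∫ t in Q..Q', (DeltaErr a b (t ^ (a + b)) - Mt ((b:ℝ) / a) H N t) ^ 2) ≤ C1 * Q * (1 + log Q) ^ 6 := by
      have e : ∀ t : ℝ, t ^ ((a:ℝ) + (b:ℝ)) = t ^ (a + b) := fun t => by rw [← rpow_natCast]; push_cast; rfl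
      simp only [e] at hR'
      exact hR'
    have h3 : (2 * Q) ^ (a + b - 1) * Q ≤ 2 ^ (a + b) * Q ^ (a + b) := by
      have e : 2 ^ (a + b) * Q ^ (a + b) = 2 * ((2 * Q) ^ (a + b - 1) * Q) := by
        rw [← mul_pow]
        obtain ⟨k, hk⟩ : ∃ k, a + b = k + 1 := ⟨a + b - 1, by omega⟩
        rw [hk, Nat.add_sub_cancel, pow_succ]; ring
      rw [e]
      have : 0 ≤ (2 * Q) ^ (a + b - 1) * Q := by positivity
      linarith
    calc _ ≤ ((a + b : ℕ) : ℝ) * (2 * Q) ^ (a + b - 1) * (C1 * Q * (1 + log Q) ^ 6) :=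
          mul_le_mul_of_nonneg_left h2 (by positivity)
      _ = ((a + b : ℕ) : ℝ) * C1 * (1 + log Q) ^ 6 * ((2 * Q) ^ (a + b - 1) * Q) := by ring
      _ ≤ ((a + b : ℕ) : ℝ) * C1 * (1 + log Q) ^ 6 * (2 ^ (a + b) * Q ^ (a + b)) :=
          mul_le_mul_of_nonneg_left h3 (by positivity)
      _ = _ := by rw [hW]; ring
  rw [eM] at hp
  have hlQ : Q ^ (-(1/2) : ℝ) * Q = Q ^ ((1/2) : ℝ) := by
    rw [← rpow_add_one hQ0.ne']; norm_num
  have hl1 : 1 / Q ^ (-(1/2) : ℝ) = Q ^ ((1/2) : ℝ) := by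
    rw [rpow_neg hQ0.le]; simp
  have hQd1 : Q ^ (1 - δ) ≤ Q := by
    calc Q ^ (1 - δ) ≤ Q ^ (1:ℝ) := rpow_le_rpow_of_exponent_le hQ (by linarith)
      _ = Q := rpow_one Q
  have hab2 : Q ^ ((1/2) : ℝ) * (1 + log Q) ^ 2 ≤ C3 * Q ^ (1 - δ) := by
    calc _ ≤ Q ^ ((1/2) : ℝ) * (C3 * Q ^ (1 / 2 - δ)) := mul_le_mul_of_nonneg_left (habs Q hQ) (by positivity)
      _ = C3 * (Q ^ ((1/2) : ℝ) * Q ^ (1 / 2 - δ)) := by ring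
      _ = _ := by rw [← rpow_add hQ0]; congr 2; ring
  have hLN : 1 + log (N:ℝ) ≤ (1 + C1) * (1 + log Q) := by
    have : (1 + C1) * (1 + log Q) = (1 + log Q) + C1 * (1 + log Q) := by ring
    rw [this]; linarith only [hlN, hlQ0]
  exact assemble hκ0 hC1.le hC2.le (by positivity) (by positivity) (by linarith only [hlQ0]) (by linarith only [hlN0])
    (one_le_rpow hQ (by norm_num)) (by positivity) hQd1 hlQ (by positivity) hl1 hJ0 hab2 hLN hS' hJ hP hW0.le hp

end MSQ

theorem mean_square_coprime_integers (a b : ℕ) (ha : 1 ≤ a) (hab : a < b)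
    (hcop : Nat.gcd a b = 1) :
    ∃ C > (0 : ℝ), ∀ T T₀ : ℝ, 10 < T → 0 < T₀ → T₀ ≤ T →
      |(∫ x in T..(T + T₀), (DeltaErr a b x) ^ 2) -
          (a : ℝ) ^ ((b : ℝ) / (a + b)) * (b : ℝ) ^ ((a : ℝ) / (a + b)) /
              (2 * π ^ 2 * ((a : ℝ) + b)) * Gab a b *
            ∫ x in T..(T + T₀), x ^ (1 / ((a : ℝ) + b))| ≤
        C * T ^ (1 + 1 / ((a : ℝ) + b) -
            (a : ℝ) / (b * ((a : ℝ) + b) * ((a : ℝ) + b - 1))) *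
          (Real.log T) ^ 4 := by
  have ha' : (1:ℝ) ≤ a := by exact_mod_cast ha
  have hb' : (a:ℝ) + 1 ≤ b := by exact_mod_cast hab
  have ha0 : (0:ℝ) < a := by linarith
  have hb0 : (0:ℝ) < b := by linarith
  have hm1 : (0:ℝ) < a + b - 1 := by linarith
  have hm0 : (0:ℝ) < a + b := by linarith
  obtain ⟨C, hC, hcore⟩ := MSQ.core ha hab hcop
  refine ⟨C * 2 ^ 4, by positivity, ?_⟩
  intro T T₀ hT hT0 hTT
  have hTpos : 0 < T := by linarith
  have hmn : a + b ≠ 0 := by omega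
  have hcast : ((a + b : ℕ) : ℝ) = (a:ℝ) + b := by push_cast; rfl
  set Q := T ^ (((a + b : ℕ) : ℝ)⁻¹) with hQ
  set Q' := (T + T₀) ^ (((a + b : ℕ) : ℝ)⁻¹) with hQ'
  have eQ : Q ^ (a + b) = T := Real.rpow_inv_natCast_pow hTpos.le hmn
  have eQ' : Q' ^ (a + b) = T + T₀ := Real.rpow_inv_natCast_pow (by linarith) hmn
  have hinv : 0 < (((a + b : ℕ) : ℝ)⁻¹) := by rw [hcast]; positivity
  have hQ1 : 1 ≤ Q := one_le_rpow (by linarith) hinv.le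
  have hQ0 : 0 < Q := by linarith
  have hQQ : Q ≤ Q' := rpow_le_rpow hTpos.le (by linarith) hinv.le
  have hQ2 : Q' ≤ 2 * Q := by
    apply le_of_pow_le_pow_left₀ (n := a + b) hmn (by positivity)
    rw [mul_pow, eQ, eQ']
    have : (2:ℝ) ≤ 2 ^ (a + b) := le_self_pow₀ (by norm_num) hmn
    calc T + T₀ ≤ 2 * T := by linarith
      _ ≤ _ := mul_le_mul_of_nonneg_right this hTpos.le
  have h := hcore Q Q' hQ1 hQQ hQ2
  have s1 := MSQ.subst_pow (m := a + b) (by omega) hQ0 hQQ (fun x => (DeltaErr a b x) ^ 2)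
  have s2 := MSQ.subst_pow (m := a + b) (by omega) hQ0 hQQ (fun x => x ^ (1 / ((a : ℝ) + b)))
  rw [eQ, eQ'] at s1 s2
  have s3 : (∫ t in Q..Q', (((a + b : ℕ) : ℝ) * t ^ (a + b - 1)) * (t ^ (a + b)) ^ (1 / ((a : ℝ) + b))) =
      ((a + b : ℕ) : ℝ) * ∫ t in Q..Q', t ^ (a + b) := by
    rw [← intervalIntegral.integral_const_mul]
    apply intervalIntegral.integral_congr
    intro t ht
    rw [Set.uIcc_of_le hQQ] at ht
    have ht0 : 0 < t := hQ0.trans_le ht.1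
    have e : (t ^ (a + b)) ^ (1 / ((a : ℝ) + b)) = t := by
      rw [one_div, ← hcast]; exact Real.pow_rpow_inv_natCast ht0.le hmn
    have ht2 : t ^ (a + b) = t ^ (a + b - 1) * t := by rw [← pow_succ]; congr 1; omega
    show ((a + b : ℕ) : ℝ) * t ^ (a + b - 1) * (t ^ (a + b)) ^ (1 / ((a : ℝ) + b)) = ((a + b : ℕ) : ℝ) * t ^ (a + b)
    rw [e, ht2]; ring
  rw [s1, s2, s3]
  have hK := MSQ.Kc_sq ha0 hb0
  have ec : (a : ℝ) ^ ((b : ℝ) / (a + b)) * (b : ℝ) ^ ((a : ℝ) / (a + b)) / (2 * π ^ 2 * ((a : ℝ) + b)) * Gab a b *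
      (((a + b : ℕ) : ℝ) * ∫ t in Q..Q', t ^ (a + b)) =
      (MSQ.Kc ((b:ℝ) / a) ^ 2 / π ^ 2 * ((a + b : ℕ) : ℝ)) / 2 * Gab a b * ∫ t in Q..Q', t ^ (a + b) := by
    rw [hK]
    have := Real.pi_pos
    field_simp
  rw [ec]
  refine h.trans ?_
  have hlogT : 1 ≤ log T := by
    rw [Real.le_log_iff_exp_le hTpos]
    linarith [Real.exp_one_lt_d9]
  have hL : 1 + log Q ≤ 2 * log T := by
    rw [hQ, Real.log_rpow hTpos]
    have : (((a + b : ℕ) : ℝ)⁻¹) ≤ 1 := by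
      rw [hcast]; exact inv_le_one_of_one_le₀ (by linarith)
    have := mul_le_mul_of_nonneg_right this (by linarith : 0 ≤ log T)
    linarith
  have hL0 : 0 ≤ 1 + log Q := by have := Real.log_nonneg hQ1; linarith
  have eP : Q ^ (a + b) * Q ^ (1 - (a:ℝ) / (b * (a + b - 1))) =
      T ^ (1 + 1 / ((a : ℝ) + b) - (a : ℝ) / (b * ((a : ℝ) + b) * ((a : ℝ) + b - 1))) := by
    rw [eQ, hQ, ← rpow_mul hTpos.le, hcast]
    nth_rewrite 1 [← rpow_one T]
    rw [← rpow_add hTpos]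
    congr 1
    field_simp
    ring
  rw [eP]
  have hp : (1 + log Q) ^ 4 ≤ 2 ^ 4 * log T ^ 4 := by
    rw [← mul_pow]; exact pow_le_pow_left₀ hL0 hL 4
  have hTp : 0 ≤ T ^ (1 + 1 / ((a : ℝ) + b) - (a : ℝ) / (b * ((a : ℝ) + b) * ((a : ℝ) + b - 1))) := (rpow_pos_of_pos hTpos _).le
  calc _ ≤ C * (T ^ (1 + 1 / ((a : ℝ) + b) - (a : ℝ) / (b * ((a : ℝ) + b) * ((a : ℝ) + b - 1))) * (2 ^ 4 * log T ^ 4)) :=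
        mul_le_mul_of_nonneg_left (mul_le_mul_of_nonneg_left hp hTp) hC.le
    _ = _ := by ring
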